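/- Let d ∈ {43, 67, 163}, let K = ℚ(√−d) be the imaginary quadratic field obtained by adjoining to ℚ a root of X² + d, and let 𝓞_K be its ring of integers. Then for every even n ≥ 2, the rational group cohomology in the virtual cohomological dimension is nonzero: H^{n² − n}(SL_n(𝓞_K); ℚ) ≠ 0. (Miller–Patzt–Wilson–Yasaki) -/

import Mathlib

open Polynomial

set_option linter.unusedSectionVars false

/-! ### The augmented complex of finite lists -/

namespace ListCx

variable {X Y Z : Type*}

/-- Real chains on finite lists of points of `X`. -/
abbrev Ch (X : Type*) := List X →₀ ℝ

/-- The cone over a chain with apex `a`. -/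
noncomputable def cone (a : X) : Ch X →ₗ[ℝ] Ch X := Finsupp.lmapDomain ℝ ℝ (List.cons a)

/-- The boundary of a list. -/
noncomputable def bdL : List X → Ch X
  | [] => 0
  | a :: l => Finsupp.single l 1 - cone a (bdL l)

/-- The boundary operator. -/
noncomputable def bd : Ch X →ₗ[ℝ] Ch X := Finsupp.linearCombination ℝ bdL

/-- Evaluation of a cochain on chains. -/
noncomputable def ev (f : List X → ℝ) : Ch X →ₗ[ℝ] ℝ := Finsupp.linearCombination ℝ f

/-- The coboundary of a cochain. -/
noncomputable def cod (f : List X → ℝ) : List X → ℝ := fun l => ev f (bdL l)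

/-- The map on chains induced by a map of points. -/
noncomputable def mp (φ : X → Y) : Ch X →ₗ[ℝ] Ch Y := Finsupp.lmapDomain ℝ ℝ (List.map φ)

@[simp] theorem cone_single (a : X) (l : List X) (r : ℝ) :
    cone a (Finsupp.single l r) = Finsupp.single (a :: l) r := by
  simp [cone]

@[simp] theorem mp_single (φ : X → Y) (l : List X) (r : ℝ) :
    mp φ (Finsupp.single l r) = Finsupp.single (l.map φ) r := by
  simp [mp]

@[simp] theorem ev_single (f : List X → ℝ) (l : List X) (r : ℝ) :
    ev f (Finsupp.single l r) = r * f l := by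
  simp [ev]

@[simp] theorem bd_single (l : List X) (r : ℝ) :
    bd (Finsupp.single l r) = r • bdL l := by
  simp [bd]

@[simp] theorem bdL_nil : bdL ([] : List X) = 0 := rfl

theorem bdL_cons (a : X) (l : List X) : bdL (a :: l) = Finsupp.single l 1 - cone a (bdL l) := rfl

/-- Two linear maps on chains agree if they agree on lists. -/
theorem ch_ext {M : Type*} [AddCommMonoid M] [Module ℝ M] {F G : Ch X →ₗ[ℝ] M}
    (h : ∀ l, F (Finsupp.single l 1) = G (Finsupp.single l 1)) : F = G :=
  Finsupp.lhom_ext' fun l => LinearMap.ext_ring (h l)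

theorem bd_cone (a : X) (x : Ch X) : bd (cone a x) = x - cone a (bd x) := by
  have : bd ∘ₗ cone a = LinearMap.id - cone a ∘ₗ bd := ch_ext fun l => by simp [bdL_cons]
  exact LinearMap.congr_fun this x

theorem bd_bdL (l : List X) : bd (bdL l) = 0 := by
  induction l with
  | nil => simp
  | cons a l ih => simp [bdL_cons, bd_cone, ih]

@[simp] theorem bd_bd (x : Ch X) : bd (bd x) = 0 := by
  have : (bd ∘ₗ bd : Ch X →ₗ[ℝ] Ch X) = 0 := ch_ext fun l => by simp [bd_bdL]
  exact LinearMap.congr_fun this x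

theorem mp_cone (φ : X → Y) (a : X) (x : Ch X) : mp φ (cone a x) = cone (φ a) (mp φ x) := by
  have : mp φ ∘ₗ cone a = cone (φ a) ∘ₗ mp φ := ch_ext fun l => by simp
  exact LinearMap.congr_fun this x

theorem mp_bdL (φ : X → Y) (l : List X) : mp φ (bdL l) = bdL (l.map φ) := by
  induction l with
  | nil => simp
  | cons a l ih => simp [bdL_cons, mp_cone, ih]

theorem bd_mp (φ : X → Y) (x : Ch X) : bd (mp φ x) = mp φ (bd x) := by
  have : bd ∘ₗ mp φ = mp φ ∘ₗ bd := ch_ext fun l => by simp [mp_bdL]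
  exact LinearMap.congr_fun this x

theorem mp_mp (ψ : Y → Z) (φ : X → Y) (x : Ch X) : mp ψ (mp φ x) = mp (ψ ∘ φ) x := by
  have : mp ψ ∘ₗ mp φ = mp (ψ ∘ φ) := ch_ext fun l => by simp
  exact LinearMap.congr_fun this x

theorem mp_id (x : Ch X) : mp (fun a => a) x = x := by
  have : mp (fun a : X => a) = LinearMap.id := ch_ext fun l => by simp
  exact LinearMap.congr_fun this x

theorem ev_mp (f : List Y → ℝ) (φ : X → Y) (x : Ch X) :
    ev f (mp φ x) = ev (fun l => f (l.map φ)) x := by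
  have : ev f ∘ₗ mp φ = ev (fun l => f (l.map φ)) := ch_ext fun l => by simp
  exact LinearMap.congr_fun this x

theorem ev_cone (f : List X → ℝ) (a : X) (x : Ch X) :
    ev f (cone a x) = ev (fun l => f (a :: l)) x := by
  have : ev f ∘ₗ cone a = ev (fun l => f (a :: l)) := ch_ext fun l => by simp
  exact LinearMap.congr_fun this x

theorem ev_bd (f : List X → ℝ) (x : Ch X) : ev f (bd x) = ev (cod f) x := by
  have : ev f ∘ₗ bd = ev (cod f) := ch_ext fun l => by simp [cod]
  exact LinearMap.congr_fun this x

theorem ev_congr {f g : List X → ℝ} {x : Ch X} (h : ∀ l ∈ x.support, f l = g l) :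
    ev f x = ev g x := by
  simp only [ev, Finsupp.linearCombination_apply]
  exact Finsupp.sum_congr fun l hl => by rw [h l hl]

theorem ev_add (f g : List X → ℝ) (x : Ch X) : ev (f + g) x = ev f x + ev g x := by
  have : ev (f + g) = ev f + ev g := ch_ext fun l => by simp
  exact LinearMap.congr_fun this x

theorem ev_sub (f g : List X → ℝ) (x : Ch X) : ev (f - g) x = ev f x - ev g x := by
  have : ev (f - g) = ev f - ev g := ch_ext fun l => by simp
  exact LinearMap.congr_fun this x

theorem ev_smul (r : ℝ) (f : List X → ℝ) (x : Ch X) : ev (r • f) x = r * ev f x := by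
  have : ev (r • f) = r • ev f := ch_ext fun l => by simp
  exact LinearMap.congr_fun this x

@[simp] theorem ev_zero (x : Ch X) : ev (0 : List X → ℝ) x = 0 := by
  have : ev (0 : List X → ℝ) = 0 := ch_ext fun l => by simp
  exact LinearMap.congr_fun this x

@[simp] theorem cod_nil (f : List X → ℝ) : cod f [] = 0 := by simp [cod]

theorem cod_cons (f : List X → ℝ) (a : X) (l : List X) :
    cod f (a :: l) = f l - cod (fun m => f (a :: m)) l := by
  simp [cod, bdL_cons, ev_cone]

theorem cod_sub (f g : List X → ℝ) : cod (f - g) = cod f - cod g := by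
  ext l; simp [cod, ev_sub]

theorem cod_smul (r : ℝ) (f : List X → ℝ) : cod (r • f) = r • cod f := by
  ext l; simp [cod, ev_smul]

@[simp] theorem cod_zero : cod (0 : List X → ℝ) = 0 := by
  ext l; simp [cod]

@[simp] theorem cod_cod (f : List X → ℝ) : cod (cod f) = 0 := by
  ext l
  change ev (cod f) (bdL l) = 0
  rw [← ev_bd, bd_bdL, map_zero]

theorem cod_comp_map (f : List Y → ℝ) (φ : X → Y) :
    cod (fun l => f (l.map φ)) = fun l => cod f (l.map φ) := by
  ext l
  simp [cod, ← ev_mp, mp_bdL]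

/-! ### Degrees -/

/-- A cochain supported on lists of length `m`. -/
def Homog (m : ℕ) (f : List X → ℝ) : Prop := ∀ l, l.length ≠ m → f l = 0

theorem bdL_support {l m : List X} (hm : m ∈ (bdL l).support) :
    m.length + 1 = l.length ∧ m ⊆ l := by
  induction l generalizing m with
  | nil => simp at hm
  | cons a l ih =>
    classical
    rw [bdL_cons] at hm
    rcases Finset.mem_union.1 (Finsupp.support_sub hm) with h | h
    · have := Finsupp.support_single_subset h
      simp only [Finset.mem_singleton] at this
      subst this
      exact ⟨by simp, by simp⟩
    · have := Finsupp.mapDomain_support h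
      obtain ⟨m', hm', rfl⟩ := Finset.mem_image.1 this
      obtain ⟨h1, h2⟩ := ih hm'
      exact ⟨by simp [h1], List.cons_subset_cons _ h2⟩

theorem Homog.cod {m : ℕ} {f : List X → ℝ} (hf : Homog m f) : Homog (m + 1) (cod f) := by
  intro l hl
  have : ev f (bdL l) = ev 0 (bdL l) := ev_congr fun k hk => by
    have := (bdL_support hk).1
    simpa using hf k (by omega)
  simpa [ListCx.cod] using this

/-! ### Cup products -/

/-- The cup product of a cochain of degree `p` with another cochain. -/
def cup (p : ℕ) (α β : List X → ℝ) : List X → ℝ := fun l => α (l.take (p + 1)) * β (l.drop p)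

theorem cod_cup (p : ℕ) {α β : List X → ℝ} (hα : Homog (p + 1) α) (hβ : β [] = 0) :
    cod (cup p α β) = cup (p + 1) (cod α) β + (-1 : ℝ) ^ p • cup p α (cod β) := by
  ext l
  induction p generalizing α l with
  | zero =>
    cases l with
    | nil => simp [cup]
    | cons a l =>
      have h1 : (fun m => cup 0 α β (a :: m)) = α [a] • fun m => β (a :: m) := by
        ext m; simp [cup]
      rw [cod_cons, h1, cod_smul]
      have h2 := cod_cons β a l
      cases l with
      | nil =>
        simp [cup, cod_cons, hβ]
      | cons b l =>
        simp only [cup, cod_cons, Pi.add_apply, Pi.smul_apply, smul_eq_mul] at h2 ⊢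
        simp [cod_cons]
        ring
  | succ p ih =>
    cases l with
    | nil => simp [cup, hα [] (by simp)]
    | cons a l =>
      have ha : Homog (p + 1) fun m => α (a :: m) := fun m hm => hα _ (by simpa using hm)
      have h1 : (fun m => cup (p + 1) α β (a :: m)) = cup p (fun m => α (a :: m)) β := by
        ext m; simp [cup]
      rw [cod_cons, h1, ih ha]
      simp only [cup, Pi.add_apply, Pi.smul_apply, smul_eq_mul, List.take_succ_cons,
        List.drop_succ_cons, cod_cons]
      ring

theorem cup_assoc (p q : ℕ) (α β γ : List X → ℝ) :
    cup (p + q) (cup p α β) γ = cup p α (cup q β γ) := by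
  ext l
  simp only [cup, List.take_take, List.drop_drop, List.drop_take]
  rw [show min (p + 1) (p + q + 1) = p + 1 by omega, show p + q + 1 - p = q + 1 by omega]
  ring

theorem Homog.cup {p m : ℕ} {α β : List X → ℝ} (hβ : Homog (m + 1) β) :
    Homog (p + m + 1) (cup p α β) := by
  intro l hl
  simp [ListCx.cup, hβ (l.drop p) (by simp; omega)]

theorem cup_sub_right (p : ℕ) (α β β' : List X → ℝ) :
    cup p α (β - β') = cup p α β - cup p α β' := by
  ext l; simp [cup, mul_sub]

theorem cup_comp_map (p : ℕ) (α β : List Y → ℝ) (φ : X → Y) (l : List X) :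
    cup p α β (l.map φ) = cup p (fun m => α (m.map φ)) (fun m => β (m.map φ)) l := by
  simp [cup, List.map_take, List.map_drop]

/-! ### The prism operator -/

/-- The prism between the maps induced by `φ` and `ψ`. -/
noncomputable def prismL (φ ψ : X → Y) : List X → Ch Y
  | [] => 0
  | a :: l => Finsupp.single (φ a :: (a :: l).map ψ) 1 - cone (φ a) (prismL φ ψ l)

/-- The prism operator on chains. -/
noncomputable def prism (φ ψ : X → Y) : Ch X →ₗ[ℝ] Ch Y :=
  Finsupp.linearCombination ℝ (prismL φ ψ)

@[simp] theorem prism_single (φ ψ : X → Y) (l : List X) (r : ℝ) :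
    prism φ ψ (Finsupp.single l r) = r • prismL φ ψ l := by
  simp [prism]

theorem prism_cone (φ ψ : X → Y) (a : X) (x : Ch X) :
    prism φ ψ (cone a x) = cone (φ a) (cone (ψ a) (mp ψ x)) - cone (φ a) (prism φ ψ x) := by
  have : prism φ ψ ∘ₗ cone a =
      cone (φ a) ∘ₗ cone (ψ a) ∘ₗ mp ψ - cone (φ a) ∘ₗ prism φ ψ :=
    ch_ext fun l => by simp [prismL]
  exact LinearMap.congr_fun this x

theorem bd_prismL (φ ψ : X → Y) (l : List X) :
    bd (prismL φ ψ l) + prism φ ψ (bdL l) =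
      Finsupp.single (l.map ψ) 1 - Finsupp.single (l.map φ) 1 := by
  induction l with
  | nil => simp [prismL]
  | cons a l ih =>
    rw [← eq_sub_iff_add_eq] at ih
    simp only [prismL, map_sub, bd_cone, bdL_cons, bd_single, prism_single, one_smul,
      prism_cone, ih, List.map_cons, cone_single, mp_bdL]
    abel

theorem bd_prism (φ ψ : X → Y) (x : Ch X) :
    bd (prism φ ψ x) + prism φ ψ (bd x) = mp ψ x - mp φ x := by
  have : bd ∘ₗ prism φ ψ + prism φ ψ ∘ₗ bd = mp ψ - mp φ :=
    ch_ext fun l => by simpa using bd_prismL φ ψ l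
  exact LinearMap.congr_fun this x

theorem prismL_support (φ ψ : X → Y) {l : List X} {m : List Y}
    (hm : m ∈ (prismL φ ψ l).support) :
    m.length = l.length + 1 ∧ ∀ y ∈ m, ∃ x ∈ l, y = φ x ∨ y = ψ x := by
  classical
  induction l generalizing m with
  | nil => simp [prismL] at hm
  | cons a l ih =>
    rw [prismL] at hm
    rcases Finset.mem_union.1 (Finsupp.support_sub hm) with h | h
    · have := Finsupp.support_single_subset h
      simp only [Finset.mem_singleton] at this
      subst this
      refine ⟨by simp, fun y hy => ?_⟩
      simp only [List.mem_cons, List.mem_map] at hy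
      rcases hy with rfl | ⟨x, hx, rfl⟩
      · exact ⟨a, by simp, Or.inl rfl⟩
      · exact ⟨x, by simpa using hx, Or.inr rfl⟩
    · have := Finsupp.mapDomain_support h
      obtain ⟨m', hm', rfl⟩ := Finset.mem_image.1 this
      obtain ⟨h1, h2⟩ := ih hm'
      refine ⟨by simp [h1], fun y hy => ?_⟩
      rcases List.mem_cons.1 hy with rfl | hy
      · exact ⟨a, by simp, Or.inl rfl⟩
      · obtain ⟨x, hx, h⟩ := h2 y hy
        exact ⟨x, by simp [hx], h⟩

theorem prism_mp_comm {X' Y' : Type*} (φ ψ : X → Y) (φ' ψ' : X' → Y') (r : X → X') (s : Y → Y')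
    (h1 : ∀ x, s (φ x) = φ' (r x)) (h2 : ∀ x, s (ψ x) = ψ' (r x)) (x : Ch X) :
    mp s (prism φ ψ x) = prism φ' ψ' (mp r x) := by
  have key : ∀ l, mp s (prismL φ ψ l) = prismL φ' ψ' (l.map r) := by
    intro l
    induction l with
    | nil => simp [prismL]
    | cons a l ih =>
      have h3 : s ∘ ψ = ψ' ∘ r := funext h2
      simp [prismL, mp_cone, ih, h1, h2, h3]
  have : mp s ∘ₗ prism φ ψ = prism φ' ψ' ∘ₗ mp r := ch_ext fun l => by simp [key]
  exact LinearMap.congr_fun this x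

end ListCx

namespace ListCx

/-! ### Graded pieces -/

variable {X Y : Type*}

/-- Chains supported on lists of length `m`. -/
def chn (X : Type*) (m : ℕ) : Submodule ℝ (Ch X) := Finsupp.supported ℝ ℝ {l | l.length = m}

theorem single_mem_chn {l : List X} {m : ℕ} (h : l.length = m) (r : ℝ) :
    Finsupp.single l r ∈ chn X m := by
  exact Finsupp.single_mem_supported ℝ r h

theorem chn_eq_span (m : ℕ) :
    chn X m = Submodule.span ℝ ((fun l => Finsupp.single l (1 : ℝ)) '' {l | l.length = m}) :=
  Finsupp.supported_eq_span_single ℝ _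

theorem map_chn_of_single {Z : Type*} {m : ℕ} (F : Ch X →ₗ[ℝ] Z →₀ ℝ)
    (S : Submodule ℝ (Z →₀ ℝ)) (h : ∀ l : List X, l.length = m → F (Finsupp.single l 1) ∈ S)
    {x : Ch X} (hx : x ∈ chn X m) : F x ∈ S := by
  rw [chn_eq_span] at hx
  have : Submodule.span ℝ ((fun l : List X => Finsupp.single l (1 : ℝ)) '' {l | l.length = m}) ≤
      S.comap F := by
    rw [Submodule.span_le]
    rintro _ ⟨l, hl, rfl⟩
    exact h l hl
  exact this hx

/-- Two linear maps agree on chains of length `m` if they agree on lists of length `m`. -/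
theorem eq_on_chn {M : Type*} [AddCommGroup M] [Module ℝ M] {m : ℕ} (F G : Ch X →ₗ[ℝ] M)
    (h : ∀ l : List X, l.length = m → F (Finsupp.single l 1) = G (Finsupp.single l 1))
    {x : Ch X} (hx : x ∈ chn X m) : F x = G x := by
  rw [chn_eq_span] at hx
  have : Submodule.span ℝ ((fun l : List X => Finsupp.single l (1 : ℝ)) '' {l | l.length = m}) ≤
      LinearMap.eqLocus F G := by
    rw [Submodule.span_le]
    rintro _ ⟨l, hl, rfl⟩
    exact h l hl
  exact this hx

theorem cone_mem_chn (a : X) {m : ℕ} {x : Ch X} (hx : x ∈ chn X m) :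
    cone a x ∈ chn X (m + 1) :=
  map_chn_of_single (cone a) _
    (fun l hl => by rw [cone_single]; exact single_mem_chn (by simp [hl]) _) hx

theorem mp_mem_chn (φ : X → Y) {m : ℕ} {x : Ch X} (hx : x ∈ chn X m) :
    mp φ x ∈ chn Y m :=
  map_chn_of_single (mp φ) _
    (fun l hl => by rw [mp_single]; exact single_mem_chn (by simp [hl]) _) hx

theorem bdL_mem_chn {l : List X} {m : ℕ} (h : l.length = m + 1) : bdL l ∈ chn X m := by
  intro k hk
  have := (bdL_support (Finset.mem_coe.1 hk)).1
  simp only [Set.mem_ofPred_eq]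
  omega

theorem bd_mem_chn {m : ℕ} {x : Ch X} (hx : x ∈ chn X (m + 1)) : bd x ∈ chn X m :=
  map_chn_of_single bd _ (fun l hl => by simpa using bdL_mem_chn hl) hx

/-- The projection onto chains of length `m`. -/
noncomputable def pr (m : ℕ) : Ch X →ₗ[ℝ] Ch X :=
  Finsupp.linearCombination ℝ fun l => if l.length = m then Finsupp.single l 1 else 0

theorem pr_single (m : ℕ) (l : List X) :
    pr m (Finsupp.single l 1) = if l.length = m then Finsupp.single l 1 else 0 := by
  simp [pr]

theorem pr_mem_chn (m : ℕ) (x : Ch X) : pr m x ∈ chn X m := by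
  induction x using Finsupp.induction_linear with
  | zero => simp
  | add f g hf hg => rw [map_add]; exact add_mem hf hg
  | single l r =>
    rw [← mul_one r, ← smul_eq_mul, ← Finsupp.smul_single, map_smul, pr_single]
    refine Submodule.smul_mem _ _ ?_
    split_ifs with h
    · exact single_mem_chn h 1
    · exact zero_mem _

theorem pr_of_mem {m : ℕ} {x : Ch X} (hx : x ∈ chn X m) : pr m x = x :=
  eq_on_chn (pr m) LinearMap.id (fun l hl => by simp [pr_single, hl]) hx

theorem pr_mp (m : ℕ) (φ : X → Y) (x : Ch X) : pr m (mp φ x) = mp φ (pr m x) := by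
  have : pr m ∘ₗ mp φ = mp φ ∘ₗ pr m := ch_ext fun l => by
    simp only [LinearMap.comp_apply, mp_single, pr_single, List.length_map]
    split_ifs <;> simp
  exact LinearMap.congr_fun this x

/-! ### Coinvariants -/

variable {Γ Γ' : Type*} [Group Γ] [Group Γ']

/-- Left translation of chains. -/
noncomputable def lsm (g : Γ) : Ch Γ →ₗ[ℝ] Ch Γ := mp (g * ·)

/-- The span of the differences of translates by `H`. -/
noncomputable def coin (H : Subgroup Γ) : Submodule ℝ (Ch Γ) :=
  Submodule.span ℝ {y | ∃ h ∈ H, ∃ x, y = lsm h x - x}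

theorem lsm_sub_mem_coin {H : Subgroup Γ} {h : Γ} (hh : h ∈ H) (x : Ch Γ) :
    lsm h x - x ∈ coin H := Submodule.subset_span ⟨h, hh, x, rfl⟩

@[simp] theorem lsm_single (g : Γ) (l : List Γ) (r : ℝ) :
    lsm g (Finsupp.single l r) = Finsupp.single (l.map (g * ·)) r := mp_single _ _ _

theorem lsm_mem_chn (g : Γ) {m : ℕ} {x : Ch Γ} (hx : x ∈ chn Γ m) : lsm g x ∈ chn Γ m :=
  mp_mem_chn _ hx

theorem lsm_mul (g h : Γ) (x : Ch Γ) : lsm (g * h) x = lsm g (lsm h x) := by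
  rw [lsm, lsm, lsm, mp_mp]
  congr 2
  ext a
  simp [mul_assoc]

@[simp] theorem lsm_one (x : Ch Γ) : lsm 1 x = x := by
  simpa [lsm] using mp_id x

theorem bd_lsm (g : Γ) (x : Ch Γ) : bd (lsm g x) = lsm g (bd x) := bd_mp _ _

theorem coin_mono {H K : Subgroup Γ} (h : H ≤ K) : coin H ≤ coin K :=
  Submodule.span_mono fun _ ⟨g, hg, x, hx⟩ => ⟨g, h hg, x, hx⟩

theorem coin_map_of {Z : Type*} {H : Subgroup Γ} (F : Ch Γ →ₗ[ℝ] Ch Z) (S : Submodule ℝ (Ch Z))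
    (h : ∀ g ∈ H, ∀ x, F (lsm g x) - F x ∈ S) {x : Ch Γ} (hx : x ∈ coin H) : F x ∈ S := by
  have : coin H ≤ S.comap F := by
    rw [coin, Submodule.span_le]
    rintro _ ⟨g, hg, x, rfl⟩
    simpa using h g hg x
  exact this hx

theorem bd_mem_coin {H : Subgroup Γ} {x : Ch Γ} (hx : x ∈ coin H) : bd x ∈ coin H :=
  coin_map_of bd _ (fun g hg x => by rw [bd_lsm]; exact lsm_sub_mem_coin hg _) hx

theorem pr_mem_coin {H : Subgroup Γ} (m : ℕ) {x : Ch Γ} (hx : x ∈ coin H) : pr m x ∈ coin H :=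
  coin_map_of (pr m) _ (fun g hg x => by
    rw [lsm, pr_mp]; exact lsm_sub_mem_coin hg _) hx

theorem mp_mem_coin {H : Subgroup Γ} {H' : Subgroup Γ'} (φ : Γ →* Γ')
    (h : ∀ g ∈ H, φ g ∈ H') {x : Ch Γ} (hx : x ∈ coin H) : mp φ x ∈ coin H' :=
  coin_map_of (mp φ) _ (fun g hg x => by
    have : mp φ (lsm g x) = lsm (φ g) (mp φ x) := by
      rw [lsm, lsm, mp_mp, mp_mp]; congr 2; ext a; simp
    rw [this]
    exact lsm_sub_mem_coin (h g hg) _) hx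

theorem lsm_mem_coin {H : Subgroup Γ} (g : Γ) (hg : ∀ h ∈ H, g * h * g⁻¹ ∈ H) {x : Ch Γ}
    (hx : x ∈ coin H) : lsm g x ∈ coin H :=
  coin_map_of (lsm g) _ (fun h hh x => by
    have : lsm g (lsm h x) = lsm (g * h * g⁻¹) (lsm g x) := by
      rw [← lsm_mul, ← lsm_mul]; congr 1; group
    rw [this]
    exact lsm_sub_mem_coin (hg h hh) _) hx

theorem ev_lsm (f : List Γ → ℝ) (g : Γ) (x : Ch Γ) :
    ev f (lsm g x) = ev (fun l => f (l.map (g * ·))) x := ev_mp _ _ _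

theorem ev_coin {H : Subgroup Γ} {f : List Γ → ℝ} (hf : ∀ h ∈ H, ∀ l, f (l.map (h * ·)) = f l)
    {x : Ch Γ} (hx : x ∈ coin H) : ev f x = 0 := by
  have : coin H ≤ LinearMap.ker (ev f) := by
    rw [coin, Submodule.span_le]
    rintro _ ⟨g, hg, x, rfl⟩
    simp only [SetLike.mem_coe, LinearMap.mem_ker, map_sub, ev_lsm, sub_eq_zero]
    exact ev_congr fun l _ => hf g hg l
  exact this hx

@[simp] theorem coin_bot : coin (⊥ : Subgroup Γ) = ⊥ := by
  rw [eq_bot_iff, coin, Submodule.span_le]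
  rintro _ ⟨g, hg, x, rfl⟩
  rw [Subgroup.mem_bot.1 hg]
  simp

/-- The orbit relation of `H` on lists. -/
def orb (H : Subgroup Γ) : Setoid (List Γ) where
  r l m := ∃ h ∈ H, m = l.map (h * ·)
  iseqv := {
    refl := fun l => ⟨1, H.one_mem, by simp⟩
    symm := by
      rintro l _ ⟨h, hh, rfl⟩
      exact ⟨h⁻¹, H.inv_mem hh, by simp [Function.comp_def]⟩
    trans := by
      rintro l _ _ ⟨h, hh, rfl⟩ ⟨k, hk, rfl⟩
      exact ⟨k * h, H.mul_mem hk hh, by simp [Function.comp_def, mul_assoc]⟩ }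

/-- The projection of chains onto coinvariants. -/
noncomputable def orbMap (H : Subgroup Γ) : Ch Γ →ₗ[ℝ] (Quotient (orb H) →₀ ℝ) :=
  Finsupp.lmapDomain ℝ ℝ (Quotient.mk (orb H))

theorem orbMap_single (H : Subgroup Γ) (l : List Γ) (r : ℝ) :
    orbMap H (Finsupp.single l r) = Finsupp.single (Quotient.mk (orb H) l) r := by
  simp [orbMap]

theorem orbMap_eq_zero {H : Subgroup Γ} {x : Ch Γ} : orbMap H x = 0 ↔ x ∈ coin H := by
  constructor
  · intro h
    let s : (Quotient (orb H) →₀ ℝ) →ₗ[ℝ] Ch Γ := Finsupp.lmapDomain ℝ ℝ Quotient.out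
    have key : ∀ x : Ch Γ, x - s (orbMap H x) ∈ coin H := by
      intro x
      induction x using Finsupp.induction_linear with
      | zero => simp
      | add f g hf hg =>
        have := add_mem hf hg
        rw [map_add, map_add]
        convert this using 1
        abel
      | single l r =>
        rw [orbMap_single]
        have : s (Finsupp.single (Quotient.mk (orb H) l) r) =
            Finsupp.single (Quotient.mk (orb H) l).out r := by simp [s]
        rw [this]
        obtain ⟨h, hh, e⟩ := Quotient.exact (Quotient.out_eq (Quotient.mk (orb H) l))
        have := lsm_sub_mem_coin hh (Finsupp.single (Quotient.mk (orb H) l).out r)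
        rw [lsm_single, ← e] at this
        exact this
    have := key x
    rw [h] at this
    simpa using this
  · intro h
    have : coin H ≤ LinearMap.ker (orbMap H) := by
      rw [coin, Submodule.span_le]
      rintro _ ⟨g, hg, x, rfl⟩
      have : orbMap H ∘ₗ lsm g = orbMap H := ch_ext fun l => by
        rw [LinearMap.comp_apply, lsm_single, orbMap_single, orbMap_single]
        congr 1
        exact Quotient.sound (Setoid.symm' (orb H) ⟨g, hg, rfl⟩)
      have := LinearMap.congr_fun this x
      simpa [sub_eq_zero] using this
    exact this h

theorem mem_coin_of_sub_mem {H : Subgroup Γ} {t : Γ} (ht : ∀ h ∈ H, t * h = h * t)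
    (hn : ∀ n : ℕ, 0 < n → t ^ n ∉ H) {m : ℕ} {x : Ch Γ} (hx : x ∈ chn Γ (m + 1))
    (h : lsm t x - x ∈ coin H) : x ∈ coin H := by
  classical
  have hmap : ∀ (s : Γ) (l : List Γ), l.map (s * ·) = [] ↔ l = [] := by simp
  let τ : Quotient (orb H) → Quotient (orb H) :=
    Quotient.map (fun l => l.map (t * ·)) (by
      rintro l _ ⟨h, hh, rfl⟩
      refine ⟨h, hh, ?_⟩
      simp [Function.comp_def, ← mul_assoc, ht h hh])
  have hτmk : ∀ l : List Γ, τ (Quotient.mk (orb H) l) = Quotient.mk (orb H) (l.map (t * ·)) :=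
    fun l => rfl
  have hinj : Function.Injective τ := by
    intro a b
    induction a using Quotient.inductionOn with | h a => ?_
    induction b using Quotient.inductionOn with | h b => ?_
    intro e
    rw [hτmk, hτmk] at e
    obtain ⟨h, hh, e⟩ := Quotient.exact e
    refine Quotient.sound ⟨h, hh, ?_⟩
    have e2 := congrArg (List.map (t⁻¹ * ·)) e
    simp only [List.map_map, Function.comp_def, inv_mul_cancel_left, List.map_id'] at e2
    rw [e2]
    refine List.map_congr_left fun a _ => ?_
    rw [← mul_assoc h, ← ht h hh]
    group
  have hcomm : orbMap H (lsm t x) = Finsupp.mapDomain τ (orbMap H x) := by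
    have : orbMap H ∘ₗ lsm t = Finsupp.lmapDomain ℝ ℝ τ ∘ₗ orbMap H := ch_ext fun l => by
      simp [orbMap_single, hτmk]
    exact LinearMap.congr_fun this x
  rw [← orbMap_eq_zero] at h ⊢
  rw [map_sub, hcomm, sub_eq_zero] at h
  have hstep : ∀ y, orbMap H x (τ y) = orbMap H x y := fun y => by
    conv_lhs => rw [← h]
    exact Finsupp.mapDomain_apply hinj _ _
  have hiter : ∀ (n : ℕ) y, orbMap H x (τ^[n] y) = orbMap H x y := by
    intro n
    induction n with
    | zero => intro y; rfl
    | succ n ih => intro y; rw [Function.iterate_succ_apply, ih, hstep]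
  by_contra hne
  obtain ⟨y, hy⟩ := Finsupp.ne_iff.1 hne
  rw [Finsupp.zero_apply] at hy
  have hsupp : ∃ l : List Γ, l ≠ [] ∧ Quotient.mk (orb H) l = y := by
    have h1 : y ∈ (orbMap H x).support := Finsupp.mem_support_iff.2 hy
    obtain ⟨l, hl, rfl⟩ := Finset.mem_image.1 (Finsupp.mapDomain_support h1)
    have : l.length = m + 1 := hx (Finset.mem_coe.2 hl)
    exact ⟨l, by rintro rfl; simp at this, rfl⟩
  obtain ⟨l, hl, rfl⟩ := hsupp
  have hit : ∀ (n : ℕ) (l : List Γ),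
      τ^[n] (Quotient.mk (orb H) l) = Quotient.mk (orb H) (l.map (t ^ n * ·)) := by
    intro n
    induction n with
    | zero => intro l; simp
    | succ n ih =>
      intro l
      rw [Function.iterate_succ_apply, hτmk, ih]
      simp [Function.comp_def, pow_succ, mul_assoc]
  have hnofix : ∀ n : ℕ, 0 < n →
      τ^[n] (Quotient.mk (orb H) l) ≠ Quotient.mk (orb H) l := by
    intro n hn0 e
    rw [hit] at e
    obtain ⟨h, hh, e⟩ := Quotient.exact e
    cases l with
    | nil => exact hl rfl
    | cons a l =>
      simp only [List.map_cons, List.cons.injEq] at e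
      have e1 := e.1
      apply hn n hn0
      have : h * t ^ n = 1 := by
        have : h * t ^ n * a = 1 * a := by rw [one_mul, mul_assoc]; exact e1.symm
        exact mul_right_cancel this
      rw [eq_inv_of_mul_eq_one_right this]
      exact H.inv_mem hh
  have hinf : Function.Injective fun n : ℕ => τ^[n] (Quotient.mk (orb H) l) := by
    intro a b e
    wlog hab : a ≤ b generalizing a b
    · exact (this e.symm (le_of_not_ge hab)).symm
    by_contra hne
    obtain ⟨c, rfl⟩ := Nat.exists_eq_add_of_le hab
    simp only [Function.iterate_add_apply] at e
    exact hnofix c (by omega) ((hinj.iterate a) e).symm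
  refine (Set.infinite_range_of_injective hinf) ((orbMap H x).support.finite_toSet.subset ?_)
  rintro _ ⟨n, rfl⟩
  simp only [Finset.mem_coe, Finsupp.mem_support_iff, hiter]
  exact hy

/-! ### Subgroups with an iterated infinite cyclic filtration -/

/-- `H` is obtained from the trivial group by adjoining `j` commuting elements of infinite
order. -/
inductive PolyZ : ℕ → Subgroup Γ → Prop
  | bot : PolyZ 0 ⊥
  | step {j : ℕ} {H H' : Subgroup Γ} (t : Γ) : PolyZ j H → (∀ h ∈ H, t * h = h * t) →
      (∀ n : ℕ, 0 < n → t ^ n ∉ H) → t ∈ H' → H ≤ H' →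
      (∀ g ∈ H', ∃ n : ℤ, ∃ h ∈ H, g = h * t ^ n) → PolyZ (j + 1) H'

theorem exists_of_mem_coin {H H' : Subgroup Γ} {t : Γ}
    (hg : ∀ g ∈ H', ∃ n : ℤ, ∃ h ∈ H, g = h * t ^ n) {x : Ch Γ} (hx : x ∈ coin H') :
    ∃ w, x - (lsm t w - w) ∈ coin H := by
  let S : Submodule ℝ (Ch Γ) := coin H ⊔ LinearMap.range (lsm t - LinearMap.id)
  have hpow : ∀ n : ℕ, ∀ x, lsm (t ^ n) x - x ∈ LinearMap.range (lsm t - LinearMap.id) := by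
    intro n
    induction n with
    | zero => intro x; simp
    | succ n ih =>
      intro x
      have := add_mem (ih (lsm t x)) (LinearMap.mem_range_self (lsm t - LinearMap.id) x)
      rw [pow_succ, lsm_mul]
      simpa using this
  have hz : ∀ n : ℤ, ∀ x, lsm (t ^ n) x - x ∈ LinearMap.range (lsm t - LinearMap.id) := by
    rintro (n | n) x
    · simpa using hpow n x
    · have := neg_mem (hpow (n + 1) (lsm (t ^ (n + 1))⁻¹ x))
      rw [← lsm_mul] at this
      simpa using this
  have key : coin H' ≤ S := by
    rw [coin, Submodule.span_le]
    rintro _ ⟨g, hg', x, rfl⟩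
    obtain ⟨n, h, hh, rfl⟩ := hg g hg'
    have := add_mem (Submodule.mem_sup_left (T := LinearMap.range (lsm t - LinearMap.id))
      (lsm_sub_mem_coin hh (lsm (t ^ n) x))) (Submodule.mem_sup_right (hz n x))
    rw [lsm_mul]
    simpa using this
  obtain ⟨y, hy, _, ⟨w, rfl⟩, e⟩ := Submodule.mem_sup.1 (key hx)
  refine ⟨w, ?_⟩
  rw [← e]
  simpa using hy

theorem exists_chn_of_mem_coin {H H' : Subgroup Γ} {t : Γ}
    (hg : ∀ g ∈ H', ∃ n : ℤ, ∃ h ∈ H, g = h * t ^ n) {m : ℕ} {x : Ch Γ} (hm : x ∈ chn Γ m)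
    (hx : x ∈ coin H') :
    ∃ w ∈ chn Γ m, x - (lsm t w - w) ∈ coin H := by
  obtain ⟨w, hw⟩ := exists_of_mem_coin hg hx
  refine ⟨pr m w, pr_mem_chn m w, ?_⟩
  have := pr_mem_coin m hw
  rw [map_sub, map_sub, lsm, pr_mp, pr_of_mem hm] at this
  exact this

theorem lsm_mem_coin_of_comm {H : Subgroup Γ} {t : Γ} (ht : ∀ h ∈ H, t * h = h * t) {x : Ch Γ}
    (hx : x ∈ coin H) : lsm t x ∈ coin H :=
  lsm_mem_coin t (fun h hh => by rw [ht h hh]; simpa using hh) hx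

theorem bd_mem_coin_of_step {H : Subgroup Γ} {t : Γ} (ht : ∀ h ∈ H, t * h = h * t)
    (hn : ∀ n : ℕ, 0 < n → t ^ n ∉ H) {m : ℕ} {x w : Ch Γ} (hw : w ∈ chn Γ (m + 2))
    (h : bd x - (lsm t w - w) ∈ coin H) : bd w ∈ coin H := by
  refine mem_coin_of_sub_mem ht hn (bd_mem_chn hw) ?_
  have := neg_mem (bd_mem_coin h)
  simpa [bd_lsm] using this

theorem PolyZ.acyclic {j : ℕ} {H : Subgroup Γ} (hH : PolyZ j H) (m : ℕ) (hm : j + 2 ≤ m)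
    {x : Ch Γ} (hx : x ∈ chn Γ m) (hb : bd x ∈ coin H) :
    ∃ y ∈ chn Γ (m + 1), x - bd y ∈ coin H := by
  induction hH generalizing m x with
  | bot =>
    refine ⟨cone 1 x, cone_mem_chn _ hx, ?_⟩
    rw [coin_bot, Submodule.mem_bot] at hb
    simp [bd_cone, hb]
  | @step j H H' t hH ht hn htH hle hg ih =>
    obtain ⟨m, rfl⟩ := Nat.exists_eq_add_of_le hm
    obtain ⟨w, hw, hxw⟩ := exists_chn_of_mem_coin hg
      (bd_mem_chn (m := j + 1 + 1 + m) (by convert hx using 2; omega)) hb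
    have hbw : bd w ∈ coin H := by
      refine bd_mem_coin_of_step (m := j + m) (x := x) ht hn ?_ hxw
      convert hw using 2; omega
    obtain ⟨v, hv, hwv⟩ := ih (j + 2 + m) (by omega) (by convert hw using 2) hbw
    have h1 : bd (x - (lsm t v - v)) ∈ coin H := by
      have h2 := sub_mem (lsm_mem_coin_of_comm ht hwv) hwv
      have := add_mem hxw h2
      simp only [map_sub, bd_lsm] at this ⊢
      convert this using 1
      abel
    have hv' : v ∈ chn Γ (j + 1 + 2 + m) := by convert hv using 2; omega
    obtain ⟨y, hy, hxy⟩ := ih (j + 1 + 2 + m) (by omega)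
      (sub_mem hx (sub_mem (lsm_mem_chn t hv') hv')) h1
    refine ⟨y, hy, ?_⟩
    have := add_mem (coin_mono hle hxy) (lsm_sub_mem_coin htH v)
    convert this using 1
    abel

theorem exists_dependence_zero (x x' : Ch Γ) (hx : x ∈ chn Γ 1) (hx' : x' ∈ chn Γ 1) :
    ∃ a b : ℝ, (a ≠ 0 ∨ b ≠ 0) ∧ ∃ y ∈ chn Γ 2, a • x + b • x' = bd y := by
  have haug : ∀ z ∈ chn Γ 1, bd z = (ev 1 z) • Finsupp.single [] 1 := by
    intro z hz
    refine eq_on_chn bd ((LinearMap.toSpanSingleton ℝ (Ch Γ) (Finsupp.single [] 1)) ∘ₗ ev 1)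
      (fun l hl => ?_) hz
    obtain ⟨a, rfl⟩ := List.length_eq_one_iff.1 hl
    simp [bdL_cons]
  have hfill : ∀ z ∈ chn Γ 1, ev 1 z = 0 → ∃ y ∈ chn Γ 2, z = bd y := fun z hz h0 =>
    ⟨cone 1 z, cone_mem_chn _ hz, by simp [bd_cone, haug z hz, h0]⟩
  by_cases h : ev 1 x = 0
  · exact ⟨1, 0, Or.inl one_ne_zero, by simpa using hfill x hx h⟩
  · refine ⟨ev 1 x', - ev 1 x, Or.inr (neg_ne_zero.2 h), ?_⟩
    refine hfill _ (add_mem (Submodule.smul_mem _ _ hx) (Submodule.smul_mem _ _ hx')) ?_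
    simp; ring

theorem PolyZ.dependent {j : ℕ} {H : Subgroup Γ} (hH : PolyZ j H)
    {x x' : Ch Γ} (hx : x ∈ chn Γ (j + 1)) (hx' : x' ∈ chn Γ (j + 1))
    (hb : 1 ≤ j → bd x ∈ coin H) (hb' : 1 ≤ j → bd x' ∈ coin H) :
    ∃ a b : ℝ, (a ≠ 0 ∨ b ≠ 0) ∧ ∃ y ∈ chn Γ (j + 2), a • x + b • x' - bd y ∈ coin H := by
  induction hH generalizing x x' with
  | bot =>
    obtain ⟨a, b, hab, y, hy, e⟩ := exists_dependence_zero x x' hx hx'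
    exact ⟨a, b, hab, y, hy, by simp [e]⟩
  | @step j H H' t hH ht hn htH hle hg ih =>
    obtain ⟨w, hw, hxw⟩ := exists_chn_of_mem_coin hg (bd_mem_chn hx) (hb (by omega))
    obtain ⟨w', hw', hxw'⟩ := exists_chn_of_mem_coin hg (bd_mem_chn hx') (hb' (by omega))
    have hbw : ∀ (x w : Ch Γ), w ∈ chn Γ (j + 1) → bd x - (lsm t w - w) ∈ coin H →
        1 ≤ j → bd w ∈ coin H := by
      intro x w hw hxw hj
      obtain ⟨i, rfl⟩ := Nat.exists_eq_add_of_le' hj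
      exact bd_mem_coin_of_step (m := i) (x := x) ht hn hw hxw
    obtain ⟨a, b, hab, v, hv, hwv⟩ := ih hw hw' (hbw x w hw hxw) (hbw x' w' hw' hxw')
    refine ⟨a, b, hab, ?_⟩
    have h1 : bd (a • x + b • x' - (lsm t v - v)) ∈ coin H := by
      have h2 := sub_mem (lsm_mem_coin_of_comm ht hwv) hwv
      have := add_mem (add_mem (Submodule.smul_mem _ a hxw) (Submodule.smul_mem _ b hxw')) h2
      simp only [map_sub, map_add, map_smul, bd_lsm] at this ⊢
      convert this using 1
      simp only [smul_sub]
      abel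
    obtain ⟨y, hy, hxy⟩ := hH.acyclic (j + 2) le_rfl
      (sub_mem (add_mem (Submodule.smul_mem _ a hx) (Submodule.smul_mem _ b hx'))
        (sub_mem (lsm_mem_chn t hv) hv)) h1
    refine ⟨y, hy, ?_⟩
    have := add_mem (coin_mono hle hxy) (lsm_sub_mem_coin htH v)
    convert this using 1
    abel

end ListCx

namespace ListCx

/-! ### Summation over a group -/

variable {X Γ G : Type*} [Group Γ] [Group G]

/-- The summation of the translates of a cochain, weighted by a character. -/
noncomputable def sm (σ : G →* Γ) (χ : G →* ℝ) (f : List Γ → ℝ) : List Γ → ℝ :=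
  fun l => ∑ᶠ g, χ g * f (l.map (σ g * ·))

/-- Local finiteness of the family of translates of a cochain. -/
def LF (σ : G →* Γ) (f : List Γ → ℝ) : Prop :=
  ∀ l : List Γ, {g | f (l.map (σ g * ·)) ≠ 0}.Finite

theorem ev_finite {σ : G →* Γ} {f : List Γ → ℝ} (hf : LF σ f) (x : Ch Γ) :
    {g | ev f (lsm (σ g) x) ≠ 0}.Finite := by
  induction x using Finsupp.induction_linear with
  | zero => simp
  | add a b ha hb =>
    refine (ha.union hb).subset fun g hg => ?_
    by_contra h
    simp only [Set.mem_union, Set.mem_ofPred_eq, not_or, not_not] at h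
    exact hg (by rw [map_add, map_add, h.1, h.2, add_zero])
  | single l r =>
    refine (hf l).subset fun g hg h => hg ?_
    simp [h]

theorem support_finite {α : Type*} {χ f : α → ℝ} (h : {g | f g ≠ 0}.Finite) :
    (Function.support fun g => χ g * f g).Finite :=
  h.subset fun _ hg => right_ne_zero_of_mul hg

theorem ev_sm {σ : G →* Γ} (χ : G →* ℝ) {f : List Γ → ℝ} (hf : LF σ f) (x : Ch Γ) :
    ev (sm σ χ f) x = ∑ᶠ g, χ g * ev f (lsm (σ g) x) := by
  induction x using Finsupp.induction_linear with
  | zero => simp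
  | add a b ha hb =>
    rw [map_add, ha, hb, ← finsum_add_distrib (support_finite (ev_finite hf a))
      (support_finite (ev_finite hf b))]
    simp only [map_add, mul_add]
  | single l r =>
    rw [ev_single, sm, mul_finsum]
    refine finsum_congr fun g => ?_
    simp; ring

theorem LF.cod {σ : G →* Γ} {f : List Γ → ℝ} (hf : LF σ f) : LF σ (cod f) := fun l =>
  (ev_finite hf (bdL l)).subset fun g hg => by
    rw [Set.mem_ofPred_eq, lsm, mp_bdL]
    exact hg

theorem cod_sm {σ : G →* Γ} (χ : G →* ℝ) {f : List Γ → ℝ} (hf : LF σ f) :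
    cod (sm σ χ f) = sm σ χ (cod f) := by
  ext l
  rw [cod, ev_sm χ hf, sm]
  refine finsum_congr fun g => ?_
  rw [lsm, mp_bdL]
  rfl

theorem sm_add {σ : G →* Γ} (χ : G →* ℝ) {f f' : List Γ → ℝ} (hf : LF σ f) (hf' : LF σ f') :
    sm σ χ (f + f') = sm σ χ f + sm σ χ f' := by
  ext l
  rw [Pi.add_apply, sm, sm, sm, ← finsum_add_distrib (support_finite (hf l))
    (support_finite (hf' l))]
  simp only [Pi.add_apply, mul_add]

theorem sm_smul {σ : G →* Γ} (χ : G →* ℝ) (r : ℝ) (f : List Γ → ℝ) :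
    sm σ χ (r • f) = r • sm σ χ f := by
  ext l
  simp only [sm, Pi.smul_apply, smul_eq_mul]
  rw [mul_finsum]
  exact finsum_congr fun g => by ring

theorem sm_translate {σ : G →* Γ} (χ : G →* ℝ) (f : List Γ → ℝ) (h : G) (l : List Γ) :
    sm σ χ f (l.map (σ h * ·)) = χ h⁻¹ * sm σ χ f l := by
  have : sm σ χ f (l.map (σ h * ·)) = ∑ᶠ g, χ (g * h⁻¹) * f (l.map (σ g * ·)) := by
    rw [sm, ← finsum_comp_equiv (Equiv.mulRight h⁻¹)]
    refine finsum_congr fun g => ?_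
    simp [Function.comp_def, mul_assoc]
  rw [this, sm, mul_finsum]
  exact finsum_congr fun g => by rw [map_mul]; ring

theorem Homog.sm {σ : G →* Γ} (χ : G →* ℝ) {m : ℕ} {f : List Γ → ℝ} (hf : Homog m f) :
    Homog m (sm σ χ f) := fun l hl => by
  simp [ListCx.sm, hf (l.map _) (by simpa using hl)]

end ListCx

namespace ListCx

variable {P L : Type*} [Group P] [Group L]

/-- The linear extension of a map defined on lists. -/
noncomputable abbrev lin {X Y : Type*} (F : List X → Ch Y) : Ch X →ₗ[ℝ] Ch Y :=
  Finsupp.linearCombination ℝ F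

theorem lin_single {X Y : Type*} (F : List X → Ch Y) (l : List X) (r : ℝ) :
    lin F (Finsupp.single l r) = r • F l := by simp

theorem coin_map_equivariant {H : Subgroup L} {H' : Subgroup P} (F : Ch L →ₗ[ℝ] Ch P)
    (σ : L → P) (hσ : ∀ h ∈ H, σ h ∈ H') (hF : ∀ h ∈ H, ∀ x, F (lsm h x) = lsm (σ h) (F x))
    {x : Ch L} (hx : x ∈ coin H) : F x ∈ coin H' :=
  coin_map_of F _ (fun g hg x => by rw [hF g hg]; exact lsm_sub_mem_coin (hσ g hg) _) hx

/-! ### Equivariant chain maps homotopic to a multiple of the identity -/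

/-- The contraction of an equivariant chain endomorphism, one degree at a time. -/
noncomputable def contr {L : Type*} (D : Ch L →ₗ[ℝ] Ch L) : ℕ → (Ch L →ₗ[ℝ] Ch L)
  | 0 => 0
  | n + 1 => lin fun l =>
      match l with
      | [] => 0
      | a :: r => cone a (D (Finsupp.single (a :: r) 1) - contr D n (bdL (a :: r)))

theorem contr_equivariant {D : Ch L →ₗ[ℝ] Ch L} {g : L} (hD : ∀ x, D (lsm g x) = lsm g (D x))
    (n : ℕ) (x : Ch L) : contr D n (lsm g x) = lsm g (contr D n x) := by
  induction n generalizing x with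
  | zero => simp [contr]
  | succ n ih =>
    have : contr D (n + 1) ∘ₗ lsm g = lsm g ∘ₗ contr D (n + 1) := ch_ext fun l => by
      cases l with
      | nil => simp [contr]
      | cons a r =>
        have h1 := ih (bdL (a :: r))
        have h2 := hD (Finsupp.single (a :: r) 1)
        rw [lsm_single] at h2
        rw [lsm, mp_bdL] at h1
        simp only [List.map_cons] at h1 h2
        simp only [LinearMap.comp_apply, lsm_single, List.map_cons, contr, lin_single, one_smul, h1,
          h2]
        rw [lsm, mp_cone]
        simp only [map_sub]
    exact LinearMap.congr_fun this x

theorem bd_contr {L : Type*} {D : Ch L →ₗ[ℝ] Ch L} (hD : ∀ x, bd (D x) = D (bd x))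
    (h0 : D (Finsupp.single [] 1) = 0) (n : ℕ) {x : Ch L} (hx : x ∈ chn L (n + 1)) :
    bd (contr D (n + 1) x) + contr D n (bd x) = D x := by
  refine eq_on_chn (bd ∘ₗ contr D (n + 1) + contr D n ∘ₗ bd) D (fun l hl => ?_) hx
  obtain ⟨a, r, rfl⟩ := List.exists_cons_of_length_eq_add_one hl
  have key : bd (D (Finsupp.single (a :: r) 1) - contr D n (bdL (a :: r))) = 0 := by
    rw [map_sub, hD, bd_single, one_smul, sub_eq_zero]
    cases n with
    | zero =>
      obtain rfl : r = [] := by simpa using hl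
      simp [contr, bdL_cons, h0]
    | succ n =>
      have := bd_contr hD h0 n (bdL_mem_chn hl)
      rw [bd_bdL, map_zero, add_zero] at this
      exact this.symm
  simp only [LinearMap.add_apply, LinearMap.comp_apply, contr, lin_single, one_smul, bd_cone, key,
    map_zero, sub_zero, bd_single]
  abel

theorem eq_of_ev_eq {X : Type*} {m : ℕ} {x y : Ch X} (hx : x ∈ chn X (m + 1))
    (hy : y ∈ chn X (m + 1)) (h : ∀ f : List X → ℝ, f [] = 0 → ev f x = ev f y) : x = y := by
  classical
  ext l
  have hz : ∀ {x : Ch X}, x ∈ chn X (m + 1) → x [] = 0 := fun hx => by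
    by_contra h0
    have : ([] : List X).length = m + 1 := hx (Finset.mem_coe.2 (Finsupp.mem_support_iff.2 h0))
    simp at this
  have he : ∀ x : Ch X, ev (fun k => if k = l then 1 else 0) x = x l := fun x => by
    simp [ev, Finsupp.linearCombination_apply, Finsupp.sum, eq_comm]
  by_cases hl : l = []
  · rw [hl, hz hx, hz hy]
  · rw [← he, ← he]
    exact h _ (if_neg fun h => hl h.symm)

/-! ### Transfer of cycles along split extensions -/

/-- An equivariant chain map, up to the action of `N`, extending a relative cycle `z`. -/
structure Lift (N : Subgroup P) (σ : L →* P) (u : ℕ) (z : Ch P) where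
  /-- The underlying linear map. -/
  Θ : Ch L →ₗ[ℝ] Ch P
  mem : ∀ m, ∀ x ∈ chn L (m + 1), Θ x ∈ chn P (m + 1 + u)
  equivariant : ∀ l x, Θ (lsm l x) = lsm (σ l) (Θ x)
  bd_sub_mem : ∀ x, bd (Θ x) - (-1 : ℝ) ^ u • Θ (bd x) ∈ coin N
  apply_one : Θ (Finsupp.single [1] 1) = z

/-- The cap product with a cochain, followed by a projection. -/
noncomputable def cap (π : P →* L) (u : ℕ) (α : List P → ℝ) : Ch P →ₗ[ℝ] Ch L :=
  lin fun p => Finsupp.single ((p.drop u).map π) (α (p.take (u + 1)))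

theorem ev_cap (π : P →* L) (u : ℕ) (α : List P → ℝ) (f : List L → ℝ) (x : Ch P) :
    ev f (cap π u α x) = ev (cup u α fun l => f (l.map π)) x := by
  have : ev f ∘ₗ cap π u α = ev (cup u α fun l => f (l.map π)) := ch_ext fun l => by
    simp [cap, cup]
  exact LinearMap.congr_fun this x

theorem cap_lsm (π : P →* L) (u : ℕ) {α : List P → ℝ} {g : P}
    (hα : ∀ l, α (l.map (g * ·)) = α l) (x : Ch P) :
    cap π u α (lsm g x) = lsm (π g) (cap π u α x) := by
  have : cap π u α ∘ₗ lsm g = lsm (π g) ∘ₗ cap π u α := ch_ext fun l => by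
    have h1 : List.take (u + 1) (l.map (g * ·)) = (l.take (u + 1)).map (g * ·) := by
      rw [List.map_take]
    simp only [LinearMap.comp_apply, lsm_single, cap, lin_single, one_smul, h1, hα]
    simp [List.map_drop, Function.comp_def]
  exact LinearMap.congr_fun this x

theorem cap_coin {π : P →* L} {N : Subgroup P} (hN : N ≤ π.ker) (u : ℕ) {α : List P → ℝ}
    (hα : ∀ g ∈ N, ∀ l, α (l.map (g * ·)) = α l) {x : Ch P} (hx : x ∈ coin N) :
    cap π u α x = 0 := by
  have := coin_map_equivariant (H' := (⊥ : Subgroup L)) (cap π u α) π (fun g hg => hN hg)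
    (fun g hg x => cap_lsm π u (hα g hg) x) hx
  simpa using this

theorem ev_cup_lift {π : P →* L} {N : Subgroup P} {σ : L →* P} {u : ℕ} {z : Ch P}
    (T : Lift N σ u z) (hN : N ≤ π.ker) (hπσ : ∀ l, π (σ l) = l) {α : List P → ℝ} (hα : Homog (u + 1) α) (hcα : cod α = 0)
    (hinvN : ∀ g ∈ N, ∀ l, α (l.map (g * ·)) = α l)
    (hinv : ∀ h l, α (l.map (σ h * ·)) = α l) (H : Subgroup L)
    {m : ℕ} {x : Ch L} (hx : x ∈ chn L (m + 1)) (hbx : bd x ∈ coin H)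
    {c : List L → ℝ} (hc : cod c = 0) (hinvc : ∀ h ∈ H, ∀ l, c (l.map (h * ·)) = c l) :
    ev (cup u α fun l => c (l.map π)) (T.Θ x) = ev α z * ev c x := by
  set v := ev α z
  let K : Ch L →ₗ[ℝ] Ch L := cap π u α ∘ₗ T.Θ
  have hall : ∀ l, ev α (lsm (σ l) z) = ev α z := fun l => by
    rw [ev_lsm]; exact ev_congr fun k _ => hinv l k
  have hKmem : ∀ m, ∀ x ∈ chn L (m + 1), K x ∈ chn L (m + 1) := by
    intro m x hx
    refine map_chn_of_single (cap π u α) _ (fun l hl => ?_) (T.mem m x hx)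
    rw [cap, lin_single, one_smul]
    exact single_mem_chn (by simp [hl]) _
  have hKev : ∀ x (f : List L → ℝ), f [] = 0 → ev f (bd (K x)) = ev f (K (bd x)) := by
    intro x f hf
    have h1 : K (bd x) = (-1 : ℝ) ^ u • cap π u α (bd (T.Θ x)) := by
      have := cap_coin hN u hinvN (T.bd_sub_mem x)
      rw [map_sub, map_smul, sub_eq_zero] at this
      rw [this, smul_smul, ← mul_pow]
      simp [K]
    have h2 := cod_cup u (β := fun l => f (l.map π)) hα (by simpa using hf)
    rw [h1, map_smul, ev_cap, ev_bd, ev_bd, h2, hcα, ev_add, ev_smul, LinearMap.comp_apply,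
      ev_cap, cod_comp_map f π, smul_eq_mul, mul_add, ← mul_assoc, ← mul_pow]
    have : cup (u + 1) 0 (fun l => f (List.map (⇑π) l)) = 0 := by ext; simp [cup]
    rw [this]
    simp
  have hK1 : ∀ l, bd (K (Finsupp.single [l] 1)) = v • Finsupp.single [] 1 := by
    intro l
    have hm := hKmem 0 (Finsupp.single [l] 1) (single_mem_chn rfl _)
    have haug : ∀ z ∈ chn L 1, bd z = (ev 1 z) • Finsupp.single [] 1 := by
      intro z hz
      refine eq_on_chn bd ((LinearMap.toSpanSingleton ℝ (Ch L) (Finsupp.single [] 1)) ∘ₗ ev 1)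
        (fun l hl => ?_) hz
      obtain ⟨a, rfl⟩ := List.length_eq_one_iff.1 hl
      simp [bdL_cons]
    rw [haug _ hm, LinearMap.comp_apply, ev_cap]
    congr 1
    have h1 : T.Θ (Finsupp.single [l] 1) = lsm (σ l) z := by
      have := T.equivariant l (Finsupp.single [1] 1)
      rw [T.apply_one, lsm_single] at this
      simpa using this
    have hz : z ∈ chn P (u + 1) := by
      have := T.mem 0 (Finsupp.single [1] 1) (single_mem_chn rfl _)
      rw [T.apply_one] at this
      convert this using 2
      ring
    rw [h1]
    refine Eq.trans ?_ (hall l)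
    refine ev_congr fun k hk => ?_
    have hkl : k.length = u + 1 := lsm_mem_chn (σ l) hz (Finset.mem_coe.2 hk)
    simp [cup, List.take_of_length_le hkl.le]
  let D : Ch L →ₗ[ℝ] Ch L := lin fun l =>
    match l with
    | [] => 0
    | a :: r => K (Finsupp.single (a :: r) 1) - v • Finsupp.single (a :: r) 1
  have hDx : ∀ m, ∀ x ∈ chn L (m + 1), D x = K x - v • x := by
    intro m x hx
    refine eq_on_chn D (K - v • LinearMap.id) (fun l hl => ?_) hx
    obtain ⟨a, r, rfl⟩ := List.exists_cons_of_length_eq_add_one hl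
    simp [D]
  have hDbd : ∀ x, bd (D x) = D (bd x) := by
    have : bd ∘ₗ D = D ∘ₗ bd := ch_ext fun l => by
      rcases l with _ | ⟨a, _ | ⟨b, r⟩⟩
      · simp [D]
      · have := hK1 a
        simp [D, this, bdL_cons]
      · have h1 : Finsupp.single (a :: b :: r) (1 : ℝ) ∈ chn L (r.length + 1 + 1) :=
          single_mem_chn rfl _
        rw [LinearMap.comp_apply, LinearMap.comp_apply, hDx _ _ h1, hDx _ _ (bd_mem_chn h1)]
        have h2 := eq_of_ev_eq (bd_mem_chn (hKmem _ _ h1)) (hKmem _ _ (bd_mem_chn h1))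
          (fun f hf => hKev (Finsupp.single (a :: b :: r) 1) f hf)
        rw [map_sub, map_smul, h2]
    exact LinearMap.congr_fun this
  have hDeq : ∀ h ∈ H, ∀ x, D (lsm h x) = lsm h (D x) := by
    intro h hh
    have : D ∘ₗ lsm h = lsm h ∘ₗ D := ch_ext fun l => by
      cases l with
      | nil => simp [D]
      | cons a r =>
        have h1 : Finsupp.single (a :: r) (1 : ℝ) ∈ chn L (r.length + 1) := single_mem_chn rfl _
        rw [LinearMap.comp_apply, LinearMap.comp_apply, hDx _ _ h1, hDx _ _ (lsm_mem_chn h h1),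
          map_sub, map_smul]
        congr 1
        simp only [K, LinearMap.comp_apply]
        rw [T.equivariant, cap_lsm π u (hinv h), hπσ]
    exact LinearMap.congr_fun this
  have hfin := bd_contr hDbd (by simp [D]) m hx
  have h3 : contr D m (bd x) ∈ coin H :=
    coin_map_equivariant _ id (fun h hh => hh)
      (fun h hh x => contr_equivariant (hDeq h hh) m x) hbx
  have h4 : ev c (D x) = 0 := by
    rw [← hfin, map_add, ev_bd, hc, ev_zero, ev_coin hinvc h3, add_zero]
  rw [hDx m x hx, map_sub, map_smul, sub_eq_zero, LinearMap.comp_apply, ev_cap] at h4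
  exact h4

theorem bd_lift_mem {N : Subgroup P} {σ : L →* P} {u : ℕ} {z : Ch P} (T : Lift N σ u z)
    {H : Subgroup L} {H' : Subgroup P} (hσ : ∀ h ∈ H, σ h ∈ H') (hker : N ≤ H')
    {x : Ch L} (hbx : bd x ∈ coin H) : bd (T.Θ x) ∈ coin H' := by
  have h1 := coin_map_equivariant T.Θ σ hσ (fun h _ x => T.equivariant h x) hbx
  have := add_mem (coin_mono hker (T.bd_sub_mem x)) (Submodule.smul_mem _ ((-1 : ℝ) ^ u) h1)
  simpa using this

/-! ### Retraction onto a subgroup -/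

theorem exists_retraction (H : Subgroup P) :
    ∃ ρ : P → H, ∀ (h : H) (g : P), ρ (h * g) = h * ρ g := by
  let s := QuotientGroup.rightRel H
  have hr : ∀ g : P, g * (Quotient.out (Quotient.mk s g))⁻¹ ∈ H := fun g =>
    QuotientGroup.rightRel_apply.1 (Quotient.mk_out (s := s) g)
  refine ⟨fun g => ⟨_, hr g⟩, fun h g => Subtype.ext ?_⟩
  have : Quotient.mk s ((h : P) * g) = Quotient.mk s g :=
    Quotient.sound (QuotientGroup.rightRel_apply.2 (by simp))
  simp [this, mul_assoc]

theorem ev_retraction {H : Subgroup P} {ρ : P → H}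
    (hρ : ∀ (h : H) (g : P), ρ (h * g) = h * ρ g) {f : List P → ℝ} (hf : cod f = 0)
    (hinv : ∀ h ∈ H, ∀ l, f (l.map (h * ·)) = f l) {z : Ch P} (hz : bd z ∈ coin H) :
    ev (fun l => f (l.map Subtype.val)) (mp ρ z) = ev f z := by
  have h1 : ev (fun l => f (l.map Subtype.val)) (mp ρ z) = ev f (mp (fun g => (ρ g : P)) z) := by
    rw [ev_mp, ev_mp]; simp [Function.comp_def]
  have h2 := congrArg (ev f) (bd_prism (fun g : P => g) (fun g => (ρ g : P)) z)
  have h3 : prism (fun g : P => g) (fun g => (ρ g : P)) (bd z) ∈ coin H := by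
    refine coin_map_of _ _ (fun g hg x => ?_) hz
    rw [lsm, ← prism_mp_comm (fun g : P => g) (fun g => (ρ g : P)) (fun g : P => g)
      (fun g => (ρ g : P)) (g * ·) (g * ·)]
    · exact lsm_sub_mem_coin hg _
    · intro; rfl
    · intro x; simpa using (congrArg Subtype.val (hρ ⟨g, hg⟩ x)).symm
  have h4 := ev_coin hinv h3
  simp only [map_sub, map_add, mp_id, h4, ev_bd, hf, ev_zero] at h2
  rw [h1]
  linarith

theorem bd_retraction {H : Subgroup P} {ρ : P → H}
    (hρ : ∀ (h : H) (g : P), ρ (h * g) = h * ρ g) {z : Ch P} (hz : bd z ∈ coin H) :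
    bd (mp ρ z) ∈ coin (⊤ : Subgroup H) := by
  rw [bd_mp]
  refine coin_map_of _ _ (fun g hg x => ?_) hz
  have : mp ρ (lsm g x) = lsm (⟨g, hg⟩ : H) (mp ρ x) := by
    rw [lsm, lsm, mp_mp, mp_mp]
    congr 2
    ext a
    simpa using congrArg Subtype.val (hρ ⟨g, hg⟩ a)
  rw [this]
  exact lsm_sub_mem_coin (Subgroup.mem_top _) _

/-! ### Lifts through iterated extensions by infinite cyclic groups -/

theorem exists_lift {N : Subgroup P} {u : ℕ} (hN : PolyZ u N) (σ : L →* P)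
    (hσ : ∀ l, ∀ h ∈ N, σ l * h * (σ l)⁻¹ ∈ N) {z : Ch P} (hz : z ∈ chn P (u + 1))
    (hbz : bd z ∈ coin N) {α : List P → ℝ} (hα : cod α = 0)
    (hinv : ∀ h ∈ N, ∀ l, α (l.map (h * ·)) = α l)
    (hinvσ : ∀ h l, α (l.map (σ h * ·)) = α l) (hne : ev α z ≠ 0) :
    Nonempty (Lift N σ u z) := by
  classical
  have hH0 : ∀ l : L, ∃ y ∈ chn P (u + 2), lsm (σ l) z - z - bd y ∈ coin N := by
    intro l
    have hb' : bd (lsm (σ l) z) ∈ coin N := by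
      rw [bd_lsm]; exact lsm_mem_coin _ (hσ l) hbz
    obtain ⟨a, b, hab, y, hy, hy'⟩ := hN.dependent (lsm_mem_chn (σ l) hz) hz (fun _ => hb')
      (fun _ => hbz)
    have he := ev_coin hinv hy'
    have hl : ev α (lsm (σ l) z) = ev α z := by
      rw [ev_lsm]; exact ev_congr fun k _ => hinvσ l k
    rw [map_sub, map_add, map_smul, map_smul, hl, ev_bd, hα, ev_zero, sub_zero, smul_eq_mul,
      smul_eq_mul, ← add_mul, mul_eq_zero, or_iff_left hne] at he
    obtain rfl : b = -a := by linarith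
    have ha : a ≠ 0 := by rcases hab with h | h <;> simpa using h
    refine ⟨a⁻¹ • y, Submodule.smul_mem _ _ hy, ?_⟩
    convert Submodule.smul_mem _ a⁻¹ hy' using 1
    rw [smul_sub, smul_add, smul_smul, smul_smul, map_smul, inv_mul_cancel₀ ha,
      mul_neg, inv_mul_cancel₀ ha]
    module
  let Good : ℕ → (Ch L →ₗ[ℝ] Ch P) → Prop := fun m F =>
    (∀ l x, F (lsm l x) = lsm (σ l) (F x)) ∧ (∀ x ∈ chn L m, F x ∈ chn P (m + u)) ∧
    ∀ l : List L, l.length = m + 1 →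
      ∃ Y ∈ chn P (m + 1 + u), bd Y - (-1 : ℝ) ^ u • F (bdL l) ∈ coin N
  let Rel : ℕ → (Ch L →ₗ[ℝ] Ch P) → (Ch L →ₗ[ℝ] Ch P) → Prop := fun m F G =>
    ∀ x ∈ chn L (m + 1), bd (G x) - (-1 : ℝ) ^ u • F (bd x) ∈ coin N
  have hstep : ∀ m F, 1 ≤ m → Good m F → ∃ G, Good (m + 1) G ∧ Rel m F G := by
    rintro m F hm ⟨hFe, hFm, hFY⟩
    choose! Y hYm hYb using hFY
    let G : Ch L →ₗ[ℝ] Ch P := lin fun l =>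
      match l with
      | [] => 0
      | a :: r => lsm (σ a) (Y ((a :: r).map (a⁻¹ * ·)))
    have hGe : ∀ l x, G (lsm l x) = lsm (σ l) (G x) := by
      intro l
      have : G ∘ₗ lsm l = lsm (σ l) ∘ₗ G := ch_ext fun k => by
        cases k with
        | nil => simp [G]
        | cons a r => simp [G, lsm_mul, Function.comp_def, mul_assoc]
      exact LinearMap.congr_fun this
    have hrel : Rel m F G := by
      intro x hx
      have : ∀ x ∈ chn L (m + 1),
          (bd ∘ₗ G - (-1 : ℝ) ^ u • F ∘ₗ bd) x ∈ coin N := by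
        intro x hx
        refine map_chn_of_single _ _ (fun l hl => ?_) hx
        obtain ⟨a, r, rfl⟩ := List.exists_cons_of_length_eq_add_one hl
        have h1 := lsm_mem_coin (σ a) (hσ a)
          (hYb ((a :: r).map (a⁻¹ * ·)) (by simpa using hl))
        have h2 : F (bdL (a :: r)) = lsm (σ a) (F (bdL ((a :: r).map (a⁻¹ * ·)))) := by
          rw [← hFe, lsm, mp_bdL, List.map_map]
          congr 2
          simp [Function.comp_def]
        simpa only [G, LinearMap.sub_apply, LinearMap.comp_apply, LinearMap.smul_apply,
          lin_single, one_smul, bd_single, h2, map_sub, map_smul, bd_lsm] using h1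
      exact this x hx
    have hGm : ∀ x ∈ chn L (m + 1), G x ∈ chn P (m + 1 + u) := by
      intro x hx
      refine map_chn_of_single _ _ (fun l hl => ?_) hx
      obtain ⟨a, r, rfl⟩ := List.exists_cons_of_length_eq_add_one hl
      simp only [G, lin_single, one_smul]
      exact lsm_mem_chn _ (hYm _ (by simpa using hl))
    refine ⟨G, ⟨hGe, hGm, fun l hl => ?_⟩, hrel⟩
    have hb := bdL_mem_chn hl
    have h1 := hrel _ hb
    rw [bd_bdL, map_zero, smul_zero, sub_zero] at h1
    obtain ⟨y, hy, hy'⟩ := hN.acyclic (m + 1 + u) (by omega)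
      (Submodule.smul_mem _ ((-1 : ℝ) ^ u) (hGm _ hb))
      (by rw [map_smul]; exact Submodule.smul_mem _ _ h1)
    refine ⟨y, by convert hy using 2; ring, ?_⟩
    rw [← neg_sub]
    exact neg_mem hy'
  let F₁ : Ch L →ₗ[ℝ] Ch P := lin fun l =>
    match l with
    | [a] => lsm (σ a) z
    | _ => 0
  have hF₁ : Good 1 F₁ := by
    refine ⟨fun l x => ?_, fun x hx => ?_, fun l hl => ?_⟩
    · have : F₁ ∘ₗ lsm l = lsm (σ l) ∘ₗ F₁ := ch_ext fun k => by
        rcases k with _ | ⟨a, _ | ⟨b, r⟩⟩ <;> simp [F₁, lsm_mul]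
      exact LinearMap.congr_fun this x
    · refine map_chn_of_single _ _ (fun l hl => ?_) hx
      obtain ⟨a, rfl⟩ := List.length_eq_one_iff.1 hl
      simpa [F₁, add_comm] using lsm_mem_chn (σ a) hz
    · obtain ⟨a, b, rfl⟩ := List.length_eq_two.1 hl
      obtain ⟨y, hy, hy'⟩ := hH0 a
      obtain ⟨w, hw, hw'⟩ := hH0 b
      refine ⟨(-1 : ℝ) ^ u • (w - y), Submodule.smul_mem _ _ ?_, ?_⟩
      · convert sub_mem hw hy using 2; ring
      · convert Submodule.smul_mem _ ((-1 : ℝ) ^ u) (sub_mem hy' hw') using 1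
        simp [F₁, bdL_cons]
        module
  let s : (m : ℕ) → {F : Ch L →ₗ[ℝ] Ch P // Good (m + 1) F} := fun m =>
    Nat.rec ⟨F₁, hF₁⟩ (fun m F => ⟨(hstep (m + 1) F.1 (by omega) F.2).choose,
      (hstep (m + 1) F.1 (by omega) F.2).choose_spec.1⟩) m
  have hs : ∀ m, Rel (m + 1) (s m).1 (s (m + 1)).1 := fun m =>
    (hstep (m + 1) (s m).1 (by omega) (s m).2).choose_spec.2
  let Θ : Ch L →ₗ[ℝ] Ch P := lin fun l =>
    match l with
    | [] => 0
    | a :: r => (s r.length).1 (Finsupp.single (a :: r) 1)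
  have hΘ : ∀ m, ∀ x ∈ chn L (m + 1), Θ x = (s m).1 x := by
    intro m x hx
    refine eq_on_chn _ _ (fun l hl => ?_) hx
    obtain ⟨a, r, rfl⟩ := List.exists_cons_of_length_eq_add_one hl
    obtain rfl : r.length = m := by simpa using hl
    simp [Θ]
  refine ⟨⟨Θ, fun m x hx => by rw [hΘ m x hx]; exact (s m).2.2.1 x hx, fun l x => ?_,
    fun x => ?_, ?_⟩⟩
  · have : Θ ∘ₗ lsm l = lsm (σ l) ∘ₗ Θ := ch_ext fun k => by
      cases k with
      | nil => simp [Θ]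
      | cons a r =>
        have h1 : Finsupp.single (a :: r) (1 : ℝ) ∈ chn L (r.length + 1) := single_mem_chn rfl _
        rw [LinearMap.comp_apply, LinearMap.comp_apply, hΘ _ _ h1, hΘ _ _ (lsm_mem_chn l h1)]
        exact (s _).2.1 l _
    exact LinearMap.congr_fun this x
  · induction x using Finsupp.induction_linear with
    | zero => simp
    | add f g hf hg =>
      convert add_mem hf hg using 1
      simp only [map_add, smul_add]
      abel
    | single l r =>
      have : ∀ l : List L, bd (Θ (Finsupp.single l 1)) -
          (-1 : ℝ) ^ u • Θ (bd (Finsupp.single l 1)) ∈ coin N := by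
        intro l
        rcases l with _ | ⟨a, r⟩
        · simp [Θ]
        · have h1 : Finsupp.single (a :: r) (1 : ℝ) ∈ chn L (r.length + 1) := single_mem_chn rfl _
          rcases r with _ | ⟨b, r⟩
          · have h0 : Θ (Finsupp.single [] 1) = 0 := by simp [Θ]
            have h2 : Θ (Finsupp.single [a] 1) = lsm (σ a) z := by
              rw [hΘ 0 _ h1]; simp [s, F₁]
            rw [h2, bd_lsm]
            simpa [bdL_cons, h0] using lsm_mem_coin _ (hσ a) hbz
          · have h2 := bd_mem_chn h1
            rw [hΘ _ _ h1, hΘ _ _ h2]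
            exact hs _ _ h1
      have h2 := Submodule.smul_mem _ r (this l)
      rw [← mul_one r, ← smul_eq_mul, ← Finsupp.smul_single]
      convert h2 using 1
      simp only [map_smul, smul_sub]
      rw [smul_comm]
  · rw [hΘ 0 _ (single_mem_chn rfl _)]
    simp [s, F₁]

/-! ### Shuffle products -/

variable {A B : Type*}

/-- The shuffle product of two lists. -/
noncomputable def shuf : List A → List B → Ch (A × B)
  | [], t => if t.length = 1 then Finsupp.single [] 1 else 0
  | _ :: _, [] => 0
  | a :: s, b :: t => cone (a, b) (shuf s (b :: t) + (-1 : ℝ) ^ s.length • shuf (a :: s) t)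
  termination_by s t => s.length + t.length

/-- The shuffle product of two chains. -/
noncomputable def shuffle : Ch A →ₗ[ℝ] Ch B →ₗ[ℝ] Ch (A × B) :=
  Finsupp.linearCombination ℝ fun s => Finsupp.linearCombination ℝ (shuf s)

theorem shuffle_single (s : List A) (t : List B) :
    shuffle (Finsupp.single s 1) (Finsupp.single t 1) = shuf s t := by
  simp [shuffle]

theorem shuffle_ext {M : Type*} [AddCommGroup M] [Module ℝ M]
    {F G : Ch A →ₗ[ℝ] Ch B →ₗ[ℝ] M}
    (h : ∀ s t, F (Finsupp.single s 1) (Finsupp.single t 1) =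
      G (Finsupp.single s 1) (Finsupp.single t 1)) : F = G :=
  ch_ext fun s => ch_ext fun t => h s t

theorem shuffle_cone_right (a : A) (s : List A) (b : B) (y : Ch B) :
    shuffle (Finsupp.single (a :: s) 1) (cone b y) =
      cone (a, b) (shuffle (Finsupp.single s 1) (cone b y) +
        (-1 : ℝ) ^ s.length • shuffle (Finsupp.single (a :: s) 1) y) := by
  have : shuffle (Finsupp.single (a :: s) 1) ∘ₗ cone b =
      cone (a, b) ∘ₗ (shuffle (Finsupp.single s 1) ∘ₗ cone b +
        (-1 : ℝ) ^ s.length • shuffle (Finsupp.single (a :: s) 1)) := ch_ext fun t => by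
    simp only [LinearMap.comp_apply, LinearMap.add_apply, LinearMap.smul_apply, cone_single,
      shuffle_single]
    rw [shuf]
  exact LinearMap.congr_fun this y

theorem shuffle_cone_left (a : A) {m : ℕ} {x : Ch A} (hx : x ∈ chn A m) (b : B) (t : List B) :
    shuffle (cone a x) (Finsupp.single (b :: t) 1) =
      cone (a, b) (shuffle x (Finsupp.single (b :: t) 1) +
        (-1 : ℝ) ^ m • shuffle (cone a x) (Finsupp.single t 1)) := by
  refine eq_on_chn (shuffle.flip (Finsupp.single (b :: t) 1) ∘ₗ cone a)
    (cone (a, b) ∘ₗ (shuffle.flip (Finsupp.single (b :: t) 1) +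
        (-1 : ℝ) ^ m • shuffle.flip (Finsupp.single t 1) ∘ₗ cone a)) (fun s hs => ?_) hx
  simp only [LinearMap.comp_apply, LinearMap.add_apply, LinearMap.smul_apply, cone_single,
    LinearMap.flip_apply, shuffle_single]
  rw [shuf, hs]

theorem bd_shuf (s : List A) (t : List B) :
    bd (shuf s t) = shuffle (bdL s) (Finsupp.single t 1) +
      (-1 : ℝ) ^ (s.length + 1) • shuffle (Finsupp.single s 1) (bdL t) := by
  match s, t with
  | [], t =>
    rcases t with _ | ⟨a, _ | ⟨b, _ | ⟨c, t⟩⟩⟩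
    · simp [shuf]
    · simp [shuf, bdL_cons, shuffle]
    · simp [shuf, bdL_cons, shuffle]
    · have : shuffle (Finsupp.single ([] : List A) (1 : ℝ)) (bdL (a :: b :: c :: t)) = 0 :=
        eq_on_chn (shuffle (Finsupp.single ([] : List A) (1 : ℝ))) 0
          (fun l hl => by simp [shuffle, shuf, hl]) (bdL_mem_chn (m := t.length + 2) rfl)
      simp [shuf, this]
  | a :: s, [] =>
    have : shuffle.flip (Finsupp.single ([] : List B) (1 : ℝ)) (bdL (a :: s)) = 0 := by
      exact eq_on_chn _ 0 (fun l _ => by cases l <;> simp [shuffle, shuf])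
        (bdL_mem_chn (m := s.length) rfl)
    rw [LinearMap.flip_apply] at this
    simp [shuf, this]
  | a :: s, b :: t =>
    have h1 := bd_shuf s (b :: t)
    have h2 := bd_shuf (a :: s) t
    have h3 : shuffle (cone a (bdL s)) (Finsupp.single (b :: t) 1) =
        cone (a, b) (shuffle (bdL s) (Finsupp.single (b :: t) 1) -
          (-1 : ℝ) ^ s.length • shuffle (cone a (bdL s)) (Finsupp.single t 1)) := by
      rcases s with _ | ⟨c, s⟩
      · simp
      · rw [shuffle_cone_left a (bdL_mem_chn (m := s.length) rfl)]
        simp [pow_succ]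
    have h4 := shuffle_cone_right a s b (bdL t)
    have h5 : ((-1 : ℝ) ^ s.length) * (-1 : ℝ) ^ s.length = 1 := by
      rw [← mul_pow]; simp
    rw [shuf, bd_cone, map_add, map_smul, h1, h2, bdL_cons, bdL_cons]
    simp only [map_sub, LinearMap.sub_apply, h3, h4, List.length_cons, pow_succ, shuffle_single]
    simp only [map_add, map_sub, map_smul, smul_add, smul_sub, smul_smul, mul_neg, neg_mul, h5,
      mul_one]
    module
  termination_by s.length + t.length

theorem mp_shuffle {A' B' : Type*} (f : A → A') (g : B → B') (x : Ch A) (y : Ch B) :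
    shuffle (mp f x) (mp g y) = mp (Prod.map f g) (shuffle x y) := by
  have key : ∀ s t, shuf (s.map f) (t.map g) = mp (Prod.map f g) (shuf s t) := by
    intro s t
    induction s, t using shuf.induct with
    | case1 t h => simp [shuf, h]
    | case2 t h => simp [shuf, h]
    | case3 => simp [shuf]
    | case4 a s b t h1 h2 =>
      simp only [List.map_cons] at h1 h2 ⊢
      rw [shuf, shuf, mp_cone, h1, h2]
      simp
  have : (shuffle.compl₁₂ (mp f) (mp g) : Ch A →ₗ[ℝ] Ch B →ₗ[ℝ] Ch (A' × B')) =
      shuffle.compr₂ (mp (Prod.map f g)) := shuffle_ext fun s t => by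
    simp [shuffle_single, key]
  exact LinearMap.congr_fun₂ this x y

theorem bd_shuffle {m : ℕ} {x : Ch A} (hx : x ∈ chn A m) (y : Ch B) :
    bd (shuffle x y) = shuffle (bd x) y + (-1 : ℝ) ^ (m + 1) • shuffle x (bd y) := by
  have : ∀ t : List B, bd (shuffle x (Finsupp.single t 1)) =
      shuffle (bd x) (Finsupp.single t 1) + (-1 : ℝ) ^ (m + 1) • shuffle x (bdL t) := by
    intro t
    refine eq_on_chn (bd ∘ₗ shuffle.flip (Finsupp.single t 1))
      (shuffle.flip (Finsupp.single t 1) ∘ₗ bd + (-1 : ℝ) ^ (m + 1) • shuffle.flip (bdL t))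
      (fun s hs => ?_) hx
    simp [LinearMap.flip_apply, shuffle_single, bd_shuf, hs]
  have h : bd ∘ₗ shuffle x = shuffle (bd x) + (-1 : ℝ) ^ (m + 1) • shuffle x ∘ₗ bd :=
    ch_ext fun t => by
      rw [LinearMap.comp_apply, this t]
      simp
  exact LinearMap.congr_fun h y

theorem shuf_mem_chn (s : List A) (t : List B) {p q : ℕ} (hs : s.length = p)
    (ht : t.length = q + 1) : shuf s t ∈ chn (A × B) (q + p) := by
  induction s, t using shuf.induct generalizing p q with
  | case1 t h =>
    subst hs
    rw [shuf, if_pos h]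
    exact single_mem_chn (by simp; omega) _
  | case2 t h => simp [shuf, h]
  | case3 => simp at ht
  | case4 a s b t h1 h2 =>
    subst hs
    rw [shuf, List.length_cons, ← add_assoc]
    refine cone_mem_chn _ (add_mem (h1 rfl ht) (Submodule.smul_mem _ _ ?_))
    obtain rfl : t.length = q := by simpa using ht
    cases t with
    | nil => simp [shuf]
    | cons c t =>
      convert h2 (List.length_cons ..) (List.length_cons ..) using 2
      simp only [List.length_cons]
      ring

theorem shuf_singleton (s : List A) (b : B) :
    shuf s [b] = Finsupp.single (s.map fun a => (a, b)) 1 := by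
  induction s with
  | nil => simp [shuf]
  | cons a s ih => cases s <;> simp [shuf, ih]

/-- The lift given by the shuffle product with a cycle in the first factor. -/
noncomputable def shuffleLift [Group A] [Group B] {H : Subgroup A} {u : ℕ} {z : Ch A}
    (hz : z ∈ chn A (u + 1)) (hbz : bd z ∈ coin H) :
    Lift (H.map (MonoidHom.inl A B)) (MonoidHom.inr A B) u (mp (fun a => (a, 1)) z) where
  Θ := shuffle z
  mem m x hx := by
    refine map_chn_of_single _ _ (fun t ht => ?_) hx
    refine map_chn_of_single (shuffle.flip (Finsupp.single t 1)) _ (fun s hs => ?_) hz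
    rw [LinearMap.flip_apply, shuffle_single]
    convert shuf_mem_chn s t hs ht using 2
    ring
  equivariant l x := by
    have := mp_shuffle (fun a : A => a) (l * ·) z x
    rw [mp_id] at this
    rw [lsm, this, lsm]
    congr 2
    ext a <;> simp
  bd_sub_mem x := by
    rw [bd_shuffle hz, pow_add, pow_add]
    have : shuffle.flip x (bd z) ∈ coin (H.map (MonoidHom.inl A B)) := by
      refine coin_map_of _ _ (fun g hg y => ?_) hbz
      have := mp_shuffle (g * ·) (fun b : B => b) y x
      rw [mp_id] at this
      rw [LinearMap.flip_apply, LinearMap.flip_apply, lsm, this]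
      convert lsm_sub_mem_coin (Subgroup.mem_map_of_mem (MonoidHom.inl A B) hg) (shuffle y x)
        using 1
      rw [lsm]
      congr 3
      ext a <;> simp
    simpa using this
  apply_one := by
    refine eq_on_chn (shuffle.flip (Finsupp.single [1] 1)) _ (fun s _ => ?_) hz
    simp [LinearMap.flip_apply, shuffle_single, shuf_singleton]

end ListCx

namespace ListCx

/-! ### Generic vectors and the local degree cocycle -/

/-- The embedding of the reals in the hyperreals. -/
noncomputable def hr : ℝ →+* Hyperreal := Hyperreal.coeRingHom

/-- An infinite element. -/
noncomputable def om : Hyperreal := Hyperreal.omega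

theorem hr_lt {a b : ℝ} : hr a < hr b ↔ a < b := Hyperreal.coe_lt_coe

theorem hr_le {a b : ℝ} : hr a ≤ hr b ↔ a ≤ b := Hyperreal.coe_le_coe

theorem hr_pos {a : ℝ} : 0 < hr a ↔ 0 < a := Hyperreal.coe_pos

theorem hr_ne {a : ℝ} : hr a ≠ 0 ↔ a ≠ 0 := Hyperreal.coe_ne_zero

theorem hr_abs (a : ℝ) : hr |a| = |hr a| := Hyperreal.coe_abs a

theorem hr_lt_om (a : ℝ) : hr a < om := Hyperreal.coe_lt_omega a

theorem om_pos : 0 < om := Hyperreal.omega_pos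

theorem one_le_om : 1 ≤ om := by simpa using (hr_lt_om 1).le

/-- Real combinations of the powers of `om` below `N`. -/
noncomputable def omc (N : ℕ) (c : Fin N → ℝ) : Hyperreal :=
  ∑ j, hr (c j) * om ^ (N - 1 - (j : ℕ))

theorem omc_succ (N : ℕ) (c : Fin (N + 1) → ℝ) :
    omc (N + 1) c = hr (c 0) * om ^ N + omc N (fun j => c j.succ) := by
  rw [omc, Fin.sum_univ_succ, omc]
  congr 1
  refine Finset.sum_congr rfl fun j _ => ?_
  congr 2
  simp
  omega

theorem abs_omc_mul_le (N : ℕ) (c : Fin N → ℝ) :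
    |omc N c| * om ≤ hr (∑ j, |c j|) * om ^ N := by
  rw [map_sum, Finset.sum_mul, omc]
  refine (mul_le_mul_of_nonneg_right (Finset.abs_sum_le_sum_abs _ _) om_pos.le).trans ?_
  rw [Finset.sum_mul]
  refine Finset.sum_le_sum fun j _ => ?_
  rw [abs_mul, abs_of_pos (pow_pos om_pos _), mul_assoc, ← pow_succ, hr_abs]
  refine mul_le_mul_of_nonneg_left (pow_le_pow_right₀ one_le_om ?_) (abs_nonneg _)
  omega

theorem omc_ne_zero (N : ℕ) {c : Fin N → ℝ} (hc : c ≠ 0) : omc N c ≠ 0 := by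
  induction N with
  | zero => exact absurd (Subsingleton.elim _ _) hc
  | succ N ih =>
    intro h
    rw [omc_succ] at h
    by_cases h0 : c 0 = 0
    · rw [h0, map_zero, zero_mul, zero_add] at h
      refine ih (fun h' => hc ?_) h
      funext j
      refine Fin.cases h0 (fun i => congrFun h' i) j
    · have h1 := abs_omc_mul_le N (fun j => c j.succ)
      rw [eq_neg_of_add_eq_zero_right h, abs_neg, abs_mul, abs_of_pos (pow_pos om_pos N),
        ← hr_abs, mul_right_comm, mul_le_mul_iff_left₀ (pow_pos om_pos N)] at h1
      have h2 : 0 < hr |c 0| := hr_pos.2 (abs_pos.2 h0)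
      have h3 := hr_lt_om ((∑ j : Fin N, |c j.succ|) / |c 0|)
      rw [map_div₀, div_lt_iff₀ h2, mul_comm] at h3
      exact absurd h1 (not_le.2 h3)

theorem omc_lt_pow (N : ℕ) (c : Fin N → ℝ) : omc N c < om ^ N := by
  have h1 := abs_omc_mul_le N c
  have h2 := hr_lt_om (∑ j, |c j|)
  have h3 : |omc N c| * om < om ^ N * om := h1.trans_lt (by
    rw [mul_comm (om ^ N)]; exact mul_lt_mul_of_pos_right h2 (pow_pos om_pos N))
  exact (le_abs_self _).trans_lt (lt_of_mul_lt_mul_right h3 om_pos.le)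

theorem omc_sum {ι : Type*} (s : Finset ι) (N : ℕ) (c : ι → Fin N → ℝ) (x : ι → ℝ) :
    ∑ i ∈ s, omc N (c i) * hr (x i) = omc N (fun j => ∑ i ∈ s, c i j * x i) := by
  simp only [omc, map_sum, Finset.sum_mul]
  rw [Finset.sum_comm]
  refine Finset.sum_congr rfl fun j _ => Finset.sum_congr rfl fun i _ => ?_
  rw [map_mul]
  ring

/-- The real-valued sign. -/
noncomputable def sg (x : ℝ) : ℝ := SignType.sign x

theorem sg_mul (x y : ℝ) : sg (x * y) = sg x * sg y := by simp [sg, sign_mul]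

@[simp] theorem sg_zero : sg 0 = 0 := by simp [sg]

theorem sg_pos {x : ℝ} (h : 0 < x) : sg x = 1 := by simp [sg, h]

theorem sg_neg {x : ℝ} (h : x < 0) : sg x = -1 := by simp [sg, h]

theorem sg_neg_one_pow (n : ℕ) : sg ((-1) ^ n) = (-1) ^ n := by
  rcases neg_one_pow_eq_or ℝ n with h | h <;> rw [h] <;> simp [sg]

open Classical in
/-- Counting the ends of the positive part of a line. -/
theorem sum_sg_line {ι : Type*} [Fintype ι] (t : ι → Hyperreal) (k : ι → ℝ)
    (hgen : ∀ i j, i ≠ j → k i ≠ 0 → k j ≠ 0 → t j - t i * hr (k j / k i) ≠ 0)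
    (hp : ∃ i, 0 < k i) (hn : ∃ i, k i < 0) :
    ∑ i, sg (k i) * (if ∀ j, j ≠ i → 0 < t j - t i * hr (k j / k i) then 1 else 0) = 0 := by
  by_cases hz : ∃ z, k z = 0 ∧ t z ≤ 0
  · obtain ⟨z, hz, hz'⟩ := hz
    refine Finset.sum_eq_zero fun i _ => ?_
    by_cases hi : k i = 0
    · simp [hi]
    · rw [if_neg, mul_zero]
      intro h
      have := h z (by rintro rfl; exact hi hz)
      rw [hz, zero_div, map_zero, mul_zero, sub_zero] at this
      exact absurd this (not_lt.2 hz')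
  push Not at hz
  let s : ι → Hyperreal := fun i => - t i / hr (k i)
  have hs : ∀ i, k i ≠ 0 → ∀ j, k j ≠ 0 → t j - t i * hr (k j / k i) = (s i - s j) * hr (k j) := by
    intro i hi j hj
    have h1 := hr_ne.2 hi
    have h2 := hr_ne.2 hj
    simp only [s, map_div₀]
    field_simp
    ring
  have hcond : ∀ i, k i ≠ 0 → ((∀ j, j ≠ i → 0 < t j - t i * hr (k j / k i)) ↔
      ∀ j, j ≠ i → (0 < k j → s j < s i) ∧ (k j < 0 → s i < s j)) := by
    intro i hi
    refine forall₂_congr fun j hj => ?_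
    rcases lt_trichotomy (k j) 0 with h | h | h
    · have h' : hr (k j) < 0 := by simpa using hr_lt.2 h
      rw [hs i hi j h.ne, ← neg_mul_neg, mul_pos_iff_of_pos_right (neg_pos.2 h'), neg_sub, sub_pos]
      simp [h, h.le]
    · simp [h, hz j h]
    · rw [hs i hi j h.ne', mul_pos_iff_of_pos_right (hr_pos.2 h), sub_pos]
      simp [h, h.le]
  have hdist : ∀ i j, i ≠ j → k i ≠ 0 → k j ≠ 0 → s i ≠ s j := fun i j hij hi hj h => by
    have := hgen i j hij hi hj
    rw [hs i hi j hj, h, sub_self, zero_mul] at this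
    exact this rfl
  obtain ⟨p, hp, hpm⟩ := Finset.exists_max_image (Finset.univ.filter fun i => 0 < k i) s
    (by obtain ⟨i, hi⟩ := hp; exact ⟨i, by simpa using hi⟩)
  obtain ⟨q, hq, hqm⟩ := Finset.exists_min_image (Finset.univ.filter fun i => k i < 0) s
    (by obtain ⟨i, hi⟩ := hn; exact ⟨i, by simpa using hi⟩)
  simp only [Finset.mem_filter, Finset.mem_univ, true_and] at hp hq hpm hqm
  have hpq : p ≠ q := by rintro rfl; exact absurd hp (not_lt.2 hq.le)
  rw [Finset.sum_eq_add p q hpq]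
  · have h1 : (∀ j, j ≠ p → 0 < t j - t p * hr (k j / k p)) ↔ s p < s q := by
      rw [hcond p hp.ne']
      constructor
      · intro h; exact (h q hpq.symm).2 hq
      · intro h j hj
        exact ⟨fun hj' => lt_of_le_of_ne (hpm j hj') (hdist j p hj hj'.ne' hp.ne'),
          fun hj' => h.trans_le (hqm j hj')⟩
    have h2 : (∀ j, j ≠ q → 0 < t j - t q * hr (k j / k q)) ↔ s p < s q := by
      rw [hcond q hq.ne]
      constructor
      · intro h; exact (h p hpq).1 hp
      · intro h j hj
        exact ⟨fun hj' => (hpm j hj').trans_lt h,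
          fun hj' => lt_of_le_of_ne (hqm j hj') (hdist q j hj.symm hq.ne hj'.ne)⟩
    rw [if_congr h1 rfl rfl, if_congr h2 rfl rfl, sg_pos hp, sg_neg hq]
    ring
  · rintro i - ⟨hip, hiq⟩
    rcases lt_trichotomy (k i) 0 with h | h | h
    · rw [if_neg, mul_zero]
      rw [hcond i h.ne]
      intro hh
      exact absurd ((hh q hiq.symm).2 hq) (not_lt.2 (hqm i h))
    · simp [h]
    · rw [if_neg, mul_zero]
      rw [hcond i h.ne']
      intro hh
      exact absurd ((hh p hip.symm).1 hp) (not_lt.2 (hpm i h))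
  · simp
  · simp

/-- The matrix of the first `N` coordinates of `N` vectors. -/
def cmat (N : ℕ) (w : Fin N → ℕ → ℝ) : Matrix (Fin N) (Fin N) ℝ := Matrix.of fun i j => w i j

/-- The signed maximal minors of `N + 1` vectors. -/
noncomputable def minor (N : ℕ) (u : Fin (N + 1) → ℕ → ℝ) (i : Fin (N + 1)) : ℝ :=
  (-1) ^ (i : ℕ) * (cmat N (u ∘ i.succAbove)).det

/-- The coefficient vectors expressing the generic vector. -/
def IsSol {ι : Type*} [Fintype ι] (N : ℕ) (w : ι → ℕ → ℝ) (t : ι → Hyperreal) : Prop :=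
  ∀ j : Fin N, ∑ i, t i * hr (w i j) = om ^ (N - 1 - (j : ℕ))

theorem sum_minor_mul (N : ℕ) (u : Fin (N + 1) → ℕ → ℝ) (x : Fin (N + 1) → ℝ) :
    ∑ i, x i * minor N u i =
      (Matrix.of fun i (j : Fin (N + 1)) => (Fin.cons (x i) (fun b : Fin N => u i b) :
        Fin (N + 1) → ℝ) j).det := by
  rw [Matrix.det_succ_column_zero]
  refine Finset.sum_congr rfl fun i _ => ?_
  rw [minor]
  have : (Matrix.of fun i (j : Fin (N + 1)) => (Fin.cons (x i) (fun b : Fin N => u i b) :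
      Fin (N + 1) → ℝ) j).submatrix i.succAbove Fin.succ = cmat N (u ∘ i.succAbove) := by
    ext a b; simp [cmat]
  rw [this]
  simp
  ring

theorem sum_minor_mul_coord (N : ℕ) (u : Fin (N + 1) → ℕ → ℝ) (j : Fin N) :
    ∑ i, u i j * minor N u i = 0 := by
  rw [sum_minor_mul N u fun i => u i j]
  refine Matrix.det_zero_of_column_eq (i := 0) (j := j.succ) (Fin.succ_ne_zero j).symm fun i => ?_
  simp

theorem minor_kernel {N : ℕ} {u : Fin (N + 1) → ℕ → ℝ} {i : Fin (N + 1)} (hi : minor N u i ≠ 0)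
    {s : Fin (N + 1) → Hyperreal} (h0 : s i = 0)
    (hs : ∀ j : Fin N, ∑ a, s a * hr (u a j) = 0) : s = 0 := by
  have hd : ((cmat N (u ∘ i.succAbove)).map hr).det ≠ 0 := by
    rw [← RingHom.mapMatrix_apply, ← RingHom.map_det]
    exact hr_ne.2 fun h => hi (by rw [minor, h, mul_zero])
  have h1 : Matrix.vecMul (s ∘ i.succAbove) ((cmat N (u ∘ i.succAbove)).map hr) = 0 := by
    funext j
    have := hs j
    rw [Fin.sum_univ_succAbove _ i, h0, zero_mul, zero_add] at this
    simpa [Matrix.vecMul, dotProduct, cmat] using this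
  have h2 := Matrix.eq_zero_of_vecMul_eq_zero hd h1
  funext a
  rcases Fin.eq_self_or_eq_succAbove i a with rfl | ⟨b, rfl⟩
  · exact h0
  · exact congrFun h2 b

theorem exists_line {N : ℕ} {u : Fin (N + 1) → ℕ → ℝ} {i₀ : Fin (N + 1)}
    (h₀ : minor N u i₀ ≠ 0) :
    ∃ t : Fin (N + 1) → Hyperreal, IsSol N u t ∧
      (∀ i, minor N u i ≠ 0 → ∀ j, ∃ c : Fin N → ℝ,
        t j - t i * hr (minor N u j / minor N u i) = omc N c ∧ (j ≠ i → c ≠ 0)) ∧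
      ∀ t', IsSol N u t' → ∃ s, ∀ j, t' j = t j + s * hr (minor N u j) := by
  have hker : ∀ j : Fin N, ∑ a, hr (minor N u a) * hr (u a j) = 0 := fun j => by
    have := congrArg hr (sum_minor_mul_coord N u j)
    rw [map_sum, map_zero] at this
    simpa [mul_comm] using this
  have huniq : ∀ i, minor N u i ≠ 0 → ∀ t t', IsSol N u t → IsSol N u t' →
      ∀ j, t' j = t j + (t' i - t i) / hr (minor N u i) * hr (minor N u j) := by
    intro i hi t t' ht ht' j
    have := minor_kernel hi
      (s := fun j => t' j - t j - (t' i - t i) / hr (minor N u i) * hr (minor N u j)) (by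
        have := hr_ne.2 hi
        field_simp
        ring) (fun b => by
        have h1 := ht b
        have h2 := ht' b
        have h3 := hker b
        simp only [sub_mul, Finset.sum_sub_distrib, h1, h2, mul_assoc, ← Finset.mul_sum, h3]
        ring)
    have := congrFun this j
    simp only [Pi.zero_apply] at this
    linear_combination this
  have hex : ∀ i, minor N u i ≠ 0 → ∃ T : Fin (N + 1) → Hyperreal, IsSol N u T ∧ T i = 0 ∧
      ∀ j, ∃ c : Fin N → ℝ, T j = omc N c ∧ (j ≠ i → c ≠ 0) := by
    intro i hi
    set V := cmat N (u ∘ i.succAbove)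
    have hV : IsUnit V.det := isUnit_iff_ne_zero.2 fun h => hi (by rw [minor, h, mul_zero])
    refine ⟨i.insertNth 0 fun m => omc N fun j => V⁻¹ j m, fun b => ?_, by simp, fun j => ?_⟩
    · rw [Fin.sum_univ_succAbove _ i]
      simp only [Fin.insertNth_apply_same, zero_mul, zero_add, Fin.insertNth_apply_succAbove]
      rw [omc_sum _ N (fun m j => V⁻¹ j m) (fun m => u (i.succAbove m) b)]
      have : (fun j => ∑ m, V⁻¹ j m * u (i.succAbove m) b) = fun j => (1 : Matrix _ _ ℝ) j b := by
        funext j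
        rw [← Matrix.nonsing_inv_mul V hV, Matrix.mul_apply]
        rfl
      rw [this, omc, Finset.sum_eq_single b]
      · simp
      · intro c _ hc; simp [Matrix.one_apply_ne hc]
      · simp
    · rcases Fin.eq_self_or_eq_succAbove i j with rfl | ⟨b, rfl⟩
      · exact ⟨0, by simp [omc], by simp⟩
      · refine ⟨fun j => V⁻¹ j b, by simp, fun _ h => ?_⟩
        have h1 := Matrix.mul_nonsing_inv V hV
        have h2 := congrFun (congrFun h1 b) b
        rw [Matrix.mul_apply, Matrix.one_apply_eq] at h2
        simp [fun j => congrFun h j] at h2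
  obtain ⟨t, ht, -, -⟩ := hex i₀ h₀
  refine ⟨t, ht, fun i hi j => ?_, fun t' ht' => ⟨_, huniq i₀ h₀ t t' ht ht'⟩⟩
  obtain ⟨T, hT, hTi, hTc⟩ := hex i hi
  obtain ⟨c, hc, hc'⟩ := hTc j
  refine ⟨c, ?_, hc'⟩
  rw [← hc, huniq i hi t T ht hT j, hTi, map_div₀]
  ring

open Classical in
/-- The sign with which a simplex cone covers the generic vector. -/
noncomputable def thetaF (N : ℕ) (w : Fin N → ℕ → ℝ) : ℝ :=
  if ∃ t, (∀ i, 0 < t i) ∧ IsSol N w t then sg (cmat N w).det else 0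

/-- The cochain `thetaF` on lists. -/
noncomputable def theta (N : ℕ) (l : List (ℕ → ℝ)) : ℝ :=
  if l.length = N then thetaF N fun i => l.getD i 0 else 0

theorem theta_ofFn (N : ℕ) (w : Fin N → ℕ → ℝ) : theta N (List.ofFn w) = thetaF N w := by
  rw [theta, if_pos (by simp)]
  congr 1
  funext i
  simp

theorem homog_theta (N : ℕ) : Homog N (theta N) := fun _ hl => if_neg hl

/-- The local degree cocycle. -/
noncomputable def tau (N : ℕ) : List (ℕ → ℝ) → ℝ := cod (theta N)

theorem homog_tau (N : ℕ) : Homog (N + 1) (tau N) := (homog_theta N).cod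

theorem cod_tau (N : ℕ) : cod (tau N) = 0 := cod_cod _

theorem cod_ofFn {X : Type*} (f : List X → ℝ) {N : ℕ} (u : Fin (N + 1) → X) :
    cod f (List.ofFn u) = ∑ i : Fin (N + 1), (-1 : ℝ) ^ (i : ℕ) * f (List.ofFn (u ∘ i.succAbove)) := by
  induction N generalizing f with
  | zero => simp [cod_cons]
  | succ N ih =>
    rw [List.ofFn_succ, cod_cons, ih, sub_eq_add_neg, ← Finset.sum_neg_distrib]
    conv_rhs => rw [Fin.sum_univ_succ]
    congr 1
    · simp [Function.comp_def]
    · refine Finset.sum_congr rfl fun i _ => ?_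
      rw [List.ofFn_succ (f := u ∘ i.succ.succAbove)]
      simp [Function.comp_def, pow_succ]

theorem tau_ofFn (N : ℕ) (u : Fin (N + 1) → ℕ → ℝ) :
    tau N (List.ofFn u) = ∑ i : Fin (N + 1), (-1 : ℝ) ^ (i : ℕ) * thetaF N (u ∘ i.succAbove) := by
  rw [tau, cod_ofFn]
  simp only [theta_ofFn]

open Classical in
theorem thetaF_succAbove {N : ℕ} {u : Fin (N + 1) → ℕ → ℝ} {t : Fin (N + 1) → Hyperreal}
    (ht : IsSol N u t)
    (hu : ∀ t', IsSol N u t' → ∃ s, ∀ j, t' j = t j + s * hr (minor N u j)) (i : Fin (N + 1)) :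
    (-1 : ℝ) ^ (i : ℕ) * thetaF N (u ∘ i.succAbove) = sg (minor N u i) *
      (if ∀ j, j ≠ i → 0 < t j - t i * hr (minor N u j / minor N u i) then 1 else 0) := by
  by_cases hi : minor N u i = 0
  · have : (cmat N (u ∘ i.succAbove)).det = 0 := by simpa [minor] using hi
    simp [hi, thetaF, this]
  · have key : (∃ r, (∀ m, 0 < r m) ∧ IsSol N (u ∘ i.succAbove) r) ↔
        ∀ j, j ≠ i → 0 < t j - t i * hr (minor N u j / minor N u i) := by
      constructor
      · rintro ⟨r, hr0, hrs⟩
        obtain ⟨s, hs⟩ := hu (i.insertNth 0 r) fun j => by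
          rw [Fin.sum_univ_succAbove _ i]
          simpa using hrs j
        have h0 := hs i
        rw [Fin.insertNth_apply_same] at h0
        have hne := hr_ne.2 hi
        have hs' : s = - t i / hr (minor N u i) := by field_simp; linear_combination -h0
        intro j hj
        rcases Fin.eq_self_or_eq_succAbove i j with rfl | ⟨m, rfl⟩
        · exact absurd rfl hj
        · have := hs (i.succAbove m)
          rw [Fin.insertNth_apply_succAbove] at this
          have h2 := hr0 m
          rw [this, hs'] at h2
          convert h2 using 1
          rw [map_div₀]
          ring
      · intro h
        refine ⟨fun m => t (i.succAbove m) -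
          t i * hr (minor N u (i.succAbove m) / minor N u i), fun m => h _ (Fin.succAbove_ne i m),
          fun j => ?_⟩
        have h1 := ht j
        have h2 := congrArg hr (sum_minor_mul_coord N u j)
        rw [map_sum, map_zero] at h2
        have hne := hr_ne.2 hi
        have h3 : ∑ a, (t a - t i * hr (minor N u a / minor N u i)) * hr (u a j) =
            om ^ (N - 1 - (j : ℕ)) := by
          rw [← h1, ← sub_eq_zero, ← Finset.sum_sub_distrib,
            ← mul_zero (- t i / hr (minor N u i)), ← h2, Finset.mul_sum]
          refine Finset.sum_congr rfl fun a _ => ?_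
          rw [map_div₀, map_mul]
          field_simp
          ring
        rw [Fin.sum_univ_succAbove _ i, div_self hi, map_one, mul_one, sub_self, zero_mul,
          zero_add] at h3
        exact h3
    have hsg : sg (minor N u i) = (-1) ^ (i : ℕ) * sg (cmat N (u ∘ i.succAbove)).det := by
      rw [minor, sg_mul, sg_neg_one_pow]
    rw [thetaF, if_congr key rfl rfl, hsg]
    split_ifs <;> ring

/-- Some convex combination has vanishing initial coordinates. -/
def Hits (N : ℕ) (S : Set (ℕ → ℝ)) : Prop := ∃ v ∈ convexHull ℝ S, ∀ k < N, v k = 0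

theorem hits_of_minor {N : ℕ} {u : Fin (N + 1) → ℕ → ℝ} (h0 : ∃ i, minor N u i ≠ 0)
    (h : (∀ i, 0 ≤ minor N u i) ∨ ∀ i, minor N u i ≤ 0) : Hits N (Set.range u) := by
  obtain ⟨c, hc, hc0⟩ : ∃ c : ℝ, c ≠ 0 ∧ ∀ i, 0 ≤ c * minor N u i := by
    rcases h with h | h
    · exact ⟨1, one_ne_zero, by simpa using h⟩
    · exact ⟨-1, by norm_num, by simpa using h⟩
  obtain ⟨i₀, hi₀⟩ := h0
  have hpos : 0 < ∑ i, c * minor N u i :=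
    Finset.sum_pos' (fun i _ => hc0 i)
      ⟨i₀, Finset.mem_univ _, lt_of_le_of_ne (hc0 i₀) (mul_ne_zero hc hi₀).symm⟩
  refine ⟨∑ i, (c * minor N u i / ∑ i, c * minor N u i) • u i,
    (convex_convexHull ℝ _).sum_mem (fun i _ => div_nonneg (hc0 i) hpos.le)
      (by rw [← Finset.sum_div, div_self hpos.ne'])
      fun i _ => subset_convexHull ℝ _ ⟨i, rfl⟩, fun k hk => ?_⟩
  have := sum_minor_mul_coord N u ⟨k, hk⟩
  simp only at this
  rw [Finset.sum_apply]
  simp only [Pi.smul_apply, smul_eq_mul]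
  calc _ = (c / ∑ i, c * minor N u i) * ∑ i, u i k * minor N u i := by
        rw [Finset.mul_sum]; exact Finset.sum_congr rfl fun i _ => by ring
    _ = 0 := by rw [this, mul_zero]

theorem hits_of_tauF {N : ℕ} {u : Fin (N + 1) → ℕ → ℝ} (h : tau N (List.ofFn u) ≠ 0) :
    Hits N (Set.range u) := by
  classical
  by_contra hh
  apply h
  rw [tau_ofFn]
  by_cases h0 : ∃ i, minor N u i ≠ 0
  · have h1 := not_or.1 fun h' => hh (hits_of_minor h0 h')
    push Not at h1
    obtain ⟨i₀, hi₀⟩ := h0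
    obtain ⟨t, ht, hc, hu⟩ := exists_line hi₀
    rw [Finset.sum_congr rfl fun i _ => thetaF_succAbove ht hu i]
    convert sum_sg_line t (minor N u) (fun i j hij hi _ => ?_) h1.2 h1.1
    obtain ⟨c, hc, hc'⟩ := hc i hi j
    rw [hc]
    exact omc_ne_zero N (hc' hij.symm)
  · push Not at h0
    refine Finset.sum_eq_zero fun i _ => ?_
    have : (cmat N (u ∘ i.succAbove)).det = 0 := by simpa [minor] using h0 i
    simp [thetaF, this]

theorem exists_ofFn {X : Type*} {l : List X} {N : ℕ} (h : l.length = N) :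
    ∃ u : Fin N → X, l = List.ofFn u := by
  subst h
  exact ⟨l.get, (List.ofFn_get l).symm⟩

theorem hits_of_tau {N : ℕ} {l : List (ℕ → ℝ)} (h : tau N l ≠ 0) : Hits N {x | x ∈ l} := by
  obtain ⟨u, rfl⟩ := exists_ofFn (not_not.1 fun h' => h (homog_tau N l h'))
  convert hits_of_tauF h using 1
  ext x
  rw [Set.mem_ofPred_eq, List.mem_ofFn]
  rfl

/-- Dropping the first coordinate. -/
def tl (v : ℕ → ℝ) : ℕ → ℝ := fun k => v (k + 1)

/-- The defect of the product formula for `tau`. -/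
noncomputable def xi (N : ℕ) : List (ℕ → ℝ) → ℝ :=
  theta (N + 1) - cup 0 (theta 1) fun l => tau N (l.map tl)

theorem tau_succ (N : ℕ) :
    tau (N + 1) - cup 1 (tau 1) (fun l => tau N (l.map tl)) = cod (xi N) := by
  have h := cod_cup 0 (β := fun l => tau N (l.map tl)) (homog_theta 1) (by simp [tau])
  have h0 : cod (fun l => tau N (l.map tl)) = 0 := by
    rw [cod_comp_map, cod_tau]; rfl
  have h1 : cup 0 (theta 1) (0 : List (ℕ → ℝ) → ℝ) = 0 := by ext; simp [cup]
  rw [h0, h1, smul_zero, add_zero] at h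
  rw [xi, cod_sub, h]
  rfl

theorem theta_one (v : ℕ → ℝ) : theta 1 [v] = if 0 < v 0 then 1 else 0 := by
  classical
  have h1 : theta 1 [v] = thetaF 1 fun _ => v := by simpa using theta_ofFn 1 fun _ => v
  rw [h1, thetaF]
  have hdet : (cmat 1 fun _ => v).det = v 0 := by simp [cmat]
  by_cases hv : 0 < v 0
  · rw [if_pos, if_pos hv, hdet, sg_pos hv]
    refine ⟨fun _ => hr (v 0)⁻¹, fun _ => hr_pos.2 (inv_pos.2 hv), fun j => ?_⟩
    simp [(hr_ne.2 hv.ne')]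
  · rw [if_neg, if_neg hv]
    rintro ⟨t, ht, hs⟩
    have := hs 0
    simp only [Finset.univ_unique, Fin.default_eq_zero, Finset.sum_singleton] at this
    have h2 : hr (v 0) ≤ 0 := by simpa using hr_le.2 (not_lt.1 hv)
    have h3 := mul_nonpos_of_nonneg_of_nonpos (ht 0).le h2
    simp at this
    rw [this] at h3
    exact absurd h3 (by simp)

theorem tau_one (v w : ℕ → ℝ) :
    tau 1 [v, w] = (if 0 < w 0 then 1 else 0) - if 0 < v 0 then 1 else 0 := by
  rw [tau, cod_cons, cod_cons]
  simp [theta_one]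

theorem exists_separation {N M : ℕ} {u : Fin M → ℕ → ℝ} (h : ¬ Hits N (Set.range u)) :
    ∃ (c : Fin N → ℝ) (δ : ℝ), 0 < δ ∧ ∀ i, δ < ∑ j, c j * u i j := by
  let p : (ℕ → ℝ) →ₗ[ℝ] (Fin N → ℝ) := LinearMap.pi fun j => LinearMap.proj (j : ℕ)
  have h0 : (0 : Fin N → ℝ) ∉ convexHull ℝ (p '' Set.range u) := by
    rw [← p.image_convexHull]
    rintro ⟨v, hv, hv0⟩
    exact h ⟨v, hv, fun k hk => congrFun hv0 ⟨k, hk⟩⟩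
  obtain ⟨f, δ, hf, hδ⟩ := geometric_hahn_banach_point_closed (convex_convexHull ℝ _)
    (((Set.finite_range u).image p).isClosed_convexHull ℝ) h0
  refine ⟨fun j => f (Pi.single j 1), δ, by simpa using hf, fun i => ?_⟩
  have h1 := hδ (p (u i)) (subset_convexHull ℝ _ ⟨u i, ⟨i, rfl⟩, rfl⟩)
  have h2 := LinearMap.pi_apply_eq_sum_univ f.toLinearMap (p (u i))
  convert h1 using 1
  refine Eq.trans (Finset.sum_congr rfl fun j _ => ?_) h2.symm
  rw [smul_eq_mul, mul_comm]
  congr 1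
  refine congrArg f ?_
  funext k
  simp [Pi.single_apply, eq_comm]

theorem xi_ofFn (N : ℕ) (u : Fin (N + 1) → ℕ → ℝ) :
    xi N (List.ofFn u) = thetaF (N + 1) u -
      (if 0 < u 0 0 then 1 else 0) * tau N (List.ofFn (tl ∘ u)) := by
  simp only [xi, Pi.sub_apply, theta_ofFn, cup, List.drop_zero, List.map_ofFn]
  rw [List.ofFn_succ]
  simp [theta_one]

theorem sg_neg_eq (x : ℝ) : sg (-x) = - sg x := by
  rw [neg_eq_neg_one_mul, sg_mul, sg_neg (by norm_num), neg_one_mul]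

theorem IsSol.tl {N : ℕ} {u : Fin (N + 1) → ℕ → ℝ} {t : Fin (N + 1) → Hyperreal}
    (hs : IsSol (N + 1) u t) : IsSol N (tl ∘ u) t := fun j => by
  have := hs j.succ
  simp only [Fin.val_succ] at this
  rwa [show N + 1 - 1 - ((j : ℕ) + 1) = N - 1 - j by omega] at this

theorem thetaF_line {N : ℕ} {u : Fin (N + 1) → ℕ → ℝ} {t : Fin (N + 1) → Hyperreal}
    (ht : IsSol N (ListCx.tl ∘ u) t)
    (hu : ∀ t', IsSol N (ListCx.tl ∘ u) t' →
      ∃ s, ∀ j, t' j = t j + s * hr (minor N (ListCx.tl ∘ u) j))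
    {k₀ : ℝ} (hk : k₀ = -∑ i, u i 0 * minor N (ListCx.tl ∘ u) i) (hk0 : k₀ ≠ 0) :
    (∃ r, (∀ i, 0 < r i) ∧ IsSol (N + 1) u r) ↔
      ∀ j, 0 < t j - (om ^ N - ∑ i, t i * hr (u i 0)) *
        hr (minor N (ListCx.tl ∘ u) j / k₀) := by
  set k := minor N (ListCx.tl ∘ u) with hkdef
  have h3 := hr_ne.2 hk0
  have hsum : ∑ i, hr (k i) * hr (u i 0) = - hr k₀ := by
    rw [hk, map_neg, neg_neg, map_sum]
    exact Finset.sum_congr rfl fun i _ => by rw [map_mul, mul_comm]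
  constructor
  · rintro ⟨r, hr0, hs⟩ j
    obtain ⟨s, hs'⟩ := hu r hs.tl
    have h0 : ∑ i, r i * hr (u i 0) = om ^ N := by simpa using hs 0
    simp only [hs', add_mul, Finset.sum_add_distrib, mul_assoc, ← Finset.mul_sum, hsum] at h0
    have := hr0 j
    convert this using 1
    rw [hs', map_div₀]
    field_simp
    linear_combination (hr (k j)) * h0
  · intro h
    refine ⟨_, h, fun j => ?_⟩
    have h1 : ∀ a : Fin (N + 1), ∑ i, (t i - (om ^ N - ∑ i, t i * hr (u i 0)) * hr (k i / k₀)) *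
        hr (u i a) = ∑ i, t i * hr (u i a) - (om ^ N - ∑ i, t i * hr (u i 0)) / hr k₀ *
          ∑ i, hr (k i) * hr (u i a) := fun a => by
      rw [Finset.mul_sum, ← Finset.sum_sub_distrib]
      refine Finset.sum_congr rfl fun i _ => ?_
      rw [map_div₀]
      ring
    rw [h1]
    refine Fin.cases ?_ (fun j => ?_) j
    · simp only [Fin.val_zero, hsum]
      field_simp
      simp
    · have h4 := sum_minor_mul_coord N (ListCx.tl ∘ u) j
      have h5 : ∑ i, hr (k i) * hr (u i (j.succ : Fin (N + 1))) = 0 := by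
        have := congrArg hr h4
        rw [map_sum, map_zero] at this
        rw [← this]
        exact Finset.sum_congr rfl fun i _ => by rw [map_mul, mul_comm]; rfl
      rw [h5, mul_zero, sub_zero, Fin.val_succ, show N + 1 - 1 - ((j : ℕ) + 1) = N - 1 - j by omega]
      exact ht j

theorem thetaF_of_not_hits_tl {N : ℕ} {u : Fin (N + 1) → ℕ → ℝ}
    (h : ¬ Hits N (Set.range (tl ∘ u))) : thetaF (N + 1) u = 0 := by
  rw [thetaF, if_neg]
  rintro ⟨t, ht, hs⟩
  obtain ⟨c, δ, hδ, hc⟩ := exists_separation h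
  have h0 := hs 0
  have htail : ∀ j : Fin N, ∑ i, t i * hr ((tl ∘ u) i j) = om ^ (N - 1 - (j : ℕ)) := hs.tl
  obtain ⟨X, hX⟩ := (Set.finite_range fun i => u i 0).bddAbove
  have hX' : ∀ i, u i 0 ≤ |X| := fun i => (hX ⟨i, rfl⟩).trans (le_abs_self X)
  have hsum : hr δ * ∑ i, t i ≤ omc N c := by
    have : omc N c = ∑ i, t i * hr (∑ j, c j * (tl ∘ u) i j) := by
      simp only [omc, ← htail, map_sum, map_mul, Finset.mul_sum]
      rw [Finset.sum_comm]
      exact Finset.sum_congr rfl fun i _ => Finset.sum_congr rfl fun j _ => by ring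
    rw [this, Finset.mul_sum]
    refine Finset.sum_le_sum fun i _ => ?_
    rw [mul_comm]
    exact mul_le_mul_of_nonneg_left (hr_le.2 (hc i).le) (ht i).le
  have h1 : om ^ N ≤ hr |X| * ∑ i, t i := by
    have : om ^ N = ∑ i, t i * hr (u i 0) := by simpa using h0.symm
    rw [this, Finset.mul_sum]
    refine Finset.sum_le_sum fun i _ => ?_
    rw [mul_comm]
    exact mul_le_mul_of_nonneg_right (hr_le.2 (hX' i)) (ht i).le
  have h2 : hr δ * om ^ N < om ^ N * hr δ := by
    calc hr δ * om ^ N ≤ hr δ * (hr |X| * ∑ i, t i) :=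
          mul_le_mul_of_nonneg_left h1 (hr_pos.2 hδ).le
      _ = hr |X| * (hr δ * ∑ i, t i) := by ring
      _ ≤ hr |X| * omc N c :=
          mul_le_mul_of_nonneg_left hsum (by simpa using hr_le.2 (abs_nonneg X))
      _ = omc N (fun j => |X| / δ * c j) * hr δ := by
          simp only [omc, Finset.mul_sum, Finset.sum_mul]
          refine Finset.sum_congr rfl fun j _ => ?_
          rw [map_mul, map_div₀]
          have := hr_ne.2 hδ.ne'
          field_simp
      _ < om ^ N * hr δ := mul_lt_mul_of_pos_right (omc_lt_pow _ _) (hr_pos.2 hδ)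
  exact absurd h2 (by rw [mul_comm]; exact lt_irrefl _)

theorem hits_one_of_signs {M : ℕ} {u : Fin M → ℕ → ℝ} {i j : Fin M} (hi : u i 0 ≤ 0)
    (hj : 0 ≤ u j 0) : Hits 1 (Set.range u) := by
  by_cases h : u j 0 - u i 0 = 0
  · exact ⟨u i, subset_convexHull ℝ _ ⟨i, rfl⟩, fun k hk => by
      obtain rfl : k = 0 := by omega
      linarith⟩
  · have h' : 0 < u j 0 - u i 0 := lt_of_le_of_ne (by linarith) (Ne.symm h)
    refine ⟨(u j 0 / (u j 0 - u i 0)) • u i + (- u i 0 / (u j 0 - u i 0)) • u j,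
      (convex_convexHull ℝ _) (subset_convexHull ℝ _ (Set.mem_range_self i))
        (subset_convexHull ℝ _ (Set.mem_range_self j))
        (by positivity) (div_nonneg (by linarith) h'.le) (by field_simp; ring), fun k hk => ?_⟩
    obtain rfl : k = 0 := by omega
    simp only [Pi.add_apply, Pi.smul_apply, smul_eq_mul]
    field_simp
    ring

theorem det_cmat_succ (N : ℕ) (u : Fin (N + 1) → ℕ → ℝ) :
    (cmat (N + 1) u).det = ∑ i, u i 0 * minor N (tl ∘ u) i := by
  rw [sum_minor_mul N (tl ∘ u) fun i => u i 0]
  congr 1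
  ext i j
  refine Fin.cases ?_ (fun j => ?_) j <;> simp [cmat, tl]

theorem xi_hits_ofFn {N : ℕ} {u : Fin (N + 1) → ℕ → ℝ} (h : xi N (List.ofFn u) ≠ 0) :
    Hits 1 (Set.range u) ∧ Hits N (Set.range (tl ∘ u)) := by
  classical
  rw [xi_ofFn] at h
  refine ⟨?_, ?_⟩
  · by_contra hh
    by_cases hpos : ∀ i, 0 < u i 0
    · apply h
      rw [if_pos (hpos 0), one_mul, sub_eq_zero, tau_ofFn]
      by_cases hk : ∃ i, minor N (tl ∘ u) i ≠ 0
      · obtain ⟨i₀, hi₀⟩ := hk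
        obtain ⟨t, ht, hc, hu⟩ := exists_line hi₀
        rw [Finset.sum_congr rfl fun i _ => thetaF_succAbove ht hu i]
        set k := minor N (tl ∘ u) with hkdef
        have hdet := det_cmat_succ N u
        let k' : Option (Fin (N + 1)) → ℝ := fun o => o.elim (- ∑ i, u i 0 * k i) k
        let t' : Option (Fin (N + 1)) → Hyperreal := fun o =>
          o.elim (om ^ N - ∑ i, t i * hr (u i 0)) t
        have hstar : ∀ i, k i ≠ 0 → 0 < t' none - t i * hr (k' none / k i) := by
          intro i hi
          choose c hc hc' using hc i hi
          have h1 := omc_lt_pow N fun j => ∑ m, c m j * u m 0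
          rw [← omc_sum, ← sub_pos] at h1
          simp only [← hc, sub_mul, Finset.sum_sub_distrib] at h1
          convert h1 using 1
          simp only [t', k', Option.elim, sub_sub]
          congr 1
          rw [sub_eq_add_neg, neg_div, map_neg, mul_neg, Finset.sum_div, map_sum, Finset.mul_sum]
          congr 2
          refine Finset.sum_congr rfl fun m _ => ?_
          rw [mul_div_assoc, map_mul]
          ring
        have hgen : ∀ i j, i ≠ j → k' i ≠ 0 → k' j ≠ 0 →
            t' j - t' i * hr (k' j / k' i) ≠ 0 := by
          have hsome : ∀ i, k i ≠ 0 → ∀ j, some i ≠ j →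
              t' j - t i * hr (k' j / k i) ≠ 0 := by
            intro i hi j hj
            cases j with
            | none => exact (hstar i hi).ne'
            | some j =>
              obtain ⟨c, hc, hc'⟩ := hc i hi j
              show t j - t i * hr (k j / k i) ≠ 0
              rw [hc]
              exact omc_ne_zero N (hc' fun h => hj (by rw [h]))
          intro i j hij hi hj
          cases i with
          | some i => exact hsome i hi j hij
          | none =>
            cases j with
            | none => exact absurd rfl hij
            | some j =>
              have h1 := hsome j hj none (by simp)
              intro h2
              apply h1
              have h3 := hr_ne.2 hi
              have h4 : hr (k j) ≠ 0 := hr_ne.2 hj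
              change t j - t' none * hr (k j / k' none) = 0 at h2
              rw [map_div₀] at h2 ⊢
              field_simp at h2 ⊢
              linear_combination -h2
        have hkx : (∀ i, 0 ≤ k i) → k' none < 0 := fun hk0 => by
          have : 0 < ∑ i, u i 0 * k i := Finset.sum_pos'
            (fun i _ => mul_nonneg (hpos i).le (hk0 i))
            ⟨i₀, Finset.mem_univ _, mul_pos (hpos i₀) (lt_of_le_of_ne (hk0 i₀) hi₀.symm)⟩
          simpa [k'] using this
        have hkx' : (∀ i, k i ≤ 0) → 0 < k' none := fun hk0 => by
          have : 0 < ∑ i, u i 0 * - k i := Finset.sum_pos'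
            (fun i _ => mul_nonneg (hpos i).le (neg_nonneg.2 (hk0 i)))
            ⟨i₀, Finset.mem_univ _, mul_pos (hpos i₀) (neg_pos.2 (lt_of_le_of_ne (hk0 i₀) hi₀))⟩
          simpa [k'] using this
        have hn' : ∃ o, k' o < 0 := by
          by_contra hcon
          push Not at hcon
          exact absurd (hkx fun i => hcon (some i)) (not_lt.2 (hcon none))
        have hp' : ∃ o, 0 < k' o := by
          by_contra hcon
          push Not at hcon
          exact absurd (hkx' fun i => hcon (some i)) (not_lt.2 (hcon none))
        have hsum := sum_sg_line t' k' hgen hp' hn'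
        rw [Fintype.sum_option] at hsum
        have hs1 : ∀ i, sg (k' (some i)) *
            (if ∀ j, j ≠ some i → 0 < t' j - t' (some i) * hr (k' j / k' (some i)) then (1 : ℝ)
              else 0) =
            sg (k i) * (if ∀ j, j ≠ i → 0 < t j - t i * hr (k j / k i) then 1 else 0) := by
          intro i
          by_cases hi : k i = 0
          · have : k' (some i) = 0 := hi
            rw [this, hi, sg_zero, zero_mul, zero_mul]
          · congr 1
            refine if_congr ⟨fun h j hj => h (some j) (by simpa using hj), fun h j hj => ?_⟩ rfl rfl
            cases j with
            | none => exact hstar i hi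
            | some j => exact h j (by simpa using hj)
        have hs2 : sg (k' none) *
            (if ∀ j, j ≠ none → 0 < t' j - t' none * hr (k' j / k' none) then (1 : ℝ) else 0) =
            - thetaF (N + 1) u := by
          have hd : (cmat (N + 1) u).det = - k' none := by rw [hdet]; simp [k', hkdef]
          rw [thetaF, hd]
          by_cases h0 : k' none = 0
          · rw [h0, neg_zero, sg_zero, ite_self, zero_mul, neg_zero]
          · have := thetaF_line ht hu (k₀ := k' none) rfl h0
            rw [sg_neg_eq, if_congr this rfl rfl]
            split_ifs with h1 h2 h2
            · ring
            · exact absurd (fun j => h1 (some j) (by simp)) h2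
            · refine absurd (fun j hj => ?_) h1
              cases j with
              | none => exact absurd rfl hj
              | some j => exact h2 j
            · ring
        have hs3 : ∀ a b : ℝ, a = - thetaF (N + 1) u →
            b = ∑ i, sg (k i) * (if ∀ j, j ≠ i → 0 < t j - t i * hr (k j / k i) then 1 else 0) →
            a + b = 0 → thetaF (N + 1) u = ∑ i, sg (k i) *
              (if ∀ j, j ≠ i → 0 < t j - t i * hr (k j / k i) then 1 else 0) := by
          intro a b ha hb hab
          linarith
        refine Eq.trans (hs3 _ _ ?_ ?_ hsum) ?_
        · rw [← hs2]
          congr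
        · exact Finset.sum_congr rfl fun i _ => by rw [← hs1]; congr
        · exact Finset.sum_congr rfl fun i _ => by congr
      · push Not at hk
        have : (cmat (N + 1) u).det = 0 := by
          rw [det_cmat_succ]; exact Finset.sum_eq_zero fun i _ => by rw [hk i, mul_zero]
        rw [thetaF, this, sg_zero, ite_self, eq_comm]
        refine Finset.sum_eq_zero fun i _ => ?_
        have : (cmat N ((tl ∘ u) ∘ i.succAbove)).det = 0 := by simpa [minor] using hk i
        simp [thetaF, this]
    · push Not at hpos
      obtain ⟨i, hi⟩ := hpos
      have hneg : ∀ j, u j 0 < 0 := fun j => by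
        by_contra hj
        exact hh (hits_one_of_signs hi (not_lt.1 hj))
      apply h
      rw [if_neg (not_lt.2 (hneg 0).le), zero_mul, sub_zero, thetaF, if_neg]
      rintro ⟨t, ht, hs⟩
      have h1 : om ^ N = ∑ i, t i * hr (u i 0) := by simpa using (hs 0).symm
      have h2 : ∑ i, t i * hr (u i 0) ≤ 0 := Finset.sum_nonpos fun i _ =>
        mul_nonpos_of_nonneg_of_nonpos (ht i).le (by simpa using hr_le.2 (hneg i).le)
      exact absurd (pow_pos om_pos N) (not_lt.2 (h1 ▸ h2))
  · by_contra hh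
    apply h
    rw [thetaF_of_not_hits_tl hh, not_not.1 (mt hits_of_tauF hh), mul_zero, sub_zero]

theorem homog_xi (N : ℕ) : Homog (N + 1) (xi N) := fun l hl => by
  have h := Homog.cup (p := 0) (α := theta 1) (β := fun l => tau N (l.map tl)) (m := N)
    (fun l hl => homog_tau N _ (by simpa using hl)) l (by omega)
  rw [xi, Pi.sub_apply, homog_theta (N + 1) l hl, h, sub_zero]

theorem xi_hits {N : ℕ} {l : List (ℕ → ℝ)} (h : xi N l ≠ 0) :
    Hits 1 {x | x ∈ l} ∧ Hits N (tl '' {x | x ∈ l}) := by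
  obtain ⟨u, rfl⟩ := exists_ofFn (not_not.1 fun h' => h (homog_xi N l h'))
  have h1 : {x | x ∈ List.ofFn u} = Set.range u := by
    ext x
    rw [Set.mem_ofPred_eq, List.mem_ofFn]
    rfl
  rw [h1, ← Set.range_comp]
  exact xi_hits_ofFn h

/-! ### Iterated products of one-dimensional degree cocycles -/

/-- The iterated product of `M` one-dimensional cocycles and the cocycle of the remaining
coordinates. -/
noncomputable def nest : ℕ → ℕ → List (ℕ → ℝ) → ℝ
  | 0, N => tau N
  | M + 1, N => cup 1 (tau 1) fun l => nest M N (l.map tl)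

/-- The first `M` coordinates vanish separately, the next `N` simultaneously. -/
def PeelHits (M N : ℕ) (S : Set (ℕ → ℝ)) : Prop :=
  (∀ α < M, ∃ v ∈ convexHull ℝ S, v α = 0) ∧ ∃ v ∈ convexHull ℝ S, ∀ k < N, v (M + k) = 0

theorem Hits.mono {N : ℕ} {S T : Set (ℕ → ℝ)} (h : S ⊆ T) (hS : Hits N S) : Hits N T :=
  let ⟨v, hv, h0⟩ := hS
  ⟨v, convexHull_mono h hv, h0⟩

theorem PeelHits.mono {M N : ℕ} {S T : Set (ℕ → ℝ)} (h : S ⊆ T) (hS : PeelHits M N S) :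
    PeelHits M N T :=
  ⟨fun α hα => let ⟨v, hv, h0⟩ := hS.1 α hα; ⟨v, convexHull_mono h hv, h0⟩,
    let ⟨v, hv, h0⟩ := hS.2; ⟨v, convexHull_mono h hv, h0⟩⟩

theorem mem_convexHull_tl {S : Set (ℕ → ℝ)} {v : ℕ → ℝ} (hv : v ∈ convexHull ℝ (tl '' S)) :
    ∃ w ∈ convexHull ℝ S, tl w = v := by
  let T : (ℕ → ℝ) →ₗ[ℝ] (ℕ → ℝ) := { toFun := tl, map_add' := fun _ _ => rfl, map_smul' := fun _ _ => rfl }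
  have : v ∈ T '' convexHull ℝ S := by rw [T.image_convexHull]; exact hv
  exact this

theorem PeelHits.succ {M N : ℕ} {S : Set (ℕ → ℝ)} (h1 : Hits 1 S) (h : PeelHits M N (tl '' S)) :
    PeelHits (M + 1) N S := by
  refine ⟨fun α hα => ?_, ?_⟩
  · cases α with
    | zero => exact let ⟨v, hv, h0⟩ := h1; ⟨v, hv, h0 0 one_pos⟩
    | succ α =>
      obtain ⟨v, hv, h0⟩ := h.1 α (by omega)
      obtain ⟨w, hw, rfl⟩ := mem_convexHull_tl hv
      exact ⟨w, hw, h0⟩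
  · obtain ⟨v, hv, h0⟩ := h.2
    obtain ⟨w, hw, rfl⟩ := mem_convexHull_tl hv
    exact ⟨w, hw, fun k hk => by rw [add_right_comm]; exact h0 k hk⟩

theorem Hits.peel {M N : ℕ} {S : Set (ℕ → ℝ)} (h : Hits (M + N) S) : PeelHits M N S :=
  let ⟨v, hv, h0⟩ := h
  ⟨fun α hα => ⟨v, hv, h0 α (by omega)⟩, v, hv, fun k hk => h0 _ (by omega)⟩

theorem homog_nest (M N : ℕ) : Homog (M + N + 1) (nest M N) := by
  induction M with
  | zero => rw [zero_add]; exact homog_tau N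
  | succ M ih =>
    have := Homog.cup (p := 1) (α := tau 1) (β := fun l => nest M N (l.map tl)) (m := M + N)
      fun l hl => ih _ (by simpa using hl)
    rwa [show M + 1 + N + 1 = 1 + (M + N) + 1 by omega]

theorem nest_nil (M N : ℕ) : nest M N [] = 0 := homog_nest M N [] (by simp)

theorem cod_nest (M N : ℕ) : cod (nest M N) = 0 := by
  induction M with
  | zero => exact cod_tau N
  | succ M ih =>
    rw [nest, cod_cup 1 (homog_tau 1) (by simpa using nest_nil M N), cod_tau, cod_comp_map, ih]
    ext l
    simp [cup]

theorem cup_tau_one_hits {l : List (ℕ → ℝ)} {β : List (ℕ → ℝ) → ℝ}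
    (h : cup 1 (tau 1) (fun l => β (l.map tl)) l ≠ 0) :
    Hits 1 {x | x ∈ l} ∧ ∃ m, {x | x ∈ m} ⊆ tl '' {x | x ∈ l} ∧ β m ≠ 0 := by
  refine ⟨(hits_of_tau (left_ne_zero_of_mul h)).mono fun x hx => List.mem_of_mem_take hx,
    _, ?_, right_ne_zero_of_mul h⟩
  intro x hx
  obtain ⟨y, hy, rfl⟩ := List.mem_map.1 hx
  exact ⟨y, List.mem_of_mem_drop hy, rfl⟩

theorem nest_hits {M N : ℕ} {l : List (ℕ → ℝ)} (h : nest M N l ≠ 0) :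
    PeelHits M N {x | x ∈ l} := by
  induction M generalizing l with
  | zero => exact Hits.peel (by rw [zero_add]; exact hits_of_tau h)
  | succ M ih =>
    obtain ⟨h1, m, hm, h2⟩ := cup_tau_one_hits (β := nest M N) h
    exact PeelHits.succ h1 ((ih h2).mono hm)

theorem exists_peel (M N : ℕ) : ∃ h : List (ℕ → ℝ) → ℝ, h [] = 0 ∧
    tau (M + N) - nest M N = cod h ∧ ∀ l, h l ≠ 0 → PeelHits M N {x | x ∈ l} := by
  induction M with
  | zero => exact ⟨0, rfl, by rw [zero_add, nest, sub_self]; ext; simp [cod], by simp⟩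
  | succ M ih =>
    obtain ⟨h, h0, hc, hh⟩ := ih
    have hc' : cod (fun l => h (l.map tl)) =
        (fun l => tau (M + N) (l.map tl)) - fun l => nest M N (l.map tl) := by
      rw [cod_comp_map, ← hc]; rfl
    refine ⟨xi (M + N) - cup 1 (tau 1) fun l => h (l.map tl), ?_, ?_, fun l hl => ?_⟩
    · rw [Pi.sub_apply, homog_xi _ _ (by simp)]
      simp [cup, h0]
    · rw [cod_sub, ← tau_succ, cod_cup 1 (homog_tau 1) (by simpa using h0), hc', cod_tau,
        cup_sub_right, show M + 1 + N = M + N + 1 by omega]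
      ext l
      simp [nest, cup]
    · by_cases hx : xi (M + N) l = 0
      · obtain ⟨h1, m, hm, h2⟩ := cup_tau_one_hits (β := h) (l := l)
          fun h' => hl (by rw [Pi.sub_apply, hx, h', sub_zero])
        exact PeelHits.succ h1 ((hh m h2).mono hm)
      · exact PeelHits.succ (xi_hits hx).1 (Hits.peel (xi_hits hx).2)

theorem cup_tau_zero {β : List (ℕ → ℝ) → ℝ} (h : β [] = 0) : cup 0 (tau 0) β = β := by
  ext l
  cases l with
  | nil => simp [cup, h]
  | cons a l => simp [cup, tau, theta, thetaF, IsSol, cod_cons, cmat, sg]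

theorem nest_add (M₁ M₂ N : ℕ) :
    nest (M₁ + M₂) N = cup M₁ (nest M₁ 0) fun l => nest M₂ N (l.map tl^[M₁]) := by
  induction M₁ with
  | zero =>
    rw [nest, cup_tau_zero (by simpa using nest_nil M₂ N), zero_add]
    ext l
    simp
  | succ M ih =>
    rw [show M + 1 + M₂ = M + M₂ + 1 by omega, nest, ih, nest, add_comm M 1, cup_assoc]
    congr 1
    ext l
    rw [cup_comp_map]
    congr 1
    ext m
    rw [List.map_map, ← Function.iterate_succ, Nat.succ_eq_one_add]

/-! ### The sign of the two-dimensional degree cocycle -/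

theorem tau_two (w : Fin 3 → ℕ → ℝ) : tau 2 [w 0, w 1, w 2] =
    theta 2 [w 1, w 2] - theta 2 [w 0, w 2] + theta 2 [w 0, w 1] := by
  rw [tau, cod_cons, cod_cons, cod_cons]
  simp
  ring

/-- The determinant of the first two coordinates. -/
def det2 (v w : ℕ → ℝ) : ℝ := v 0 * w 1 - v 1 * w 0

open Classical in
theorem theta_two (v w : ℕ → ℝ) : theta 2 [v, w] =
    if ∃ t : Fin 2 → Hyperreal, (∀ i, 0 < t i) ∧ IsSol 2 ![v, w] t then sg (det2 v w) else 0 := by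
  have h1 : theta 2 [v, w] = thetaF 2 ![v, w] := by simpa using theta_ofFn 2 ![v, w]
  rw [h1, thetaF]
  have hdet : (cmat 2 ![v, w]).det = det2 v w := by simp [cmat, Matrix.det_fin_two, det2]
  rw [hdet]

theorem theta_two_of_det_zero {v w : ℕ → ℝ} (h : det2 v w = 0) : theta 2 [v, w] = 0 := by
  rw [theta_two, h, sg_zero, ite_self]

theorem theta_two_nonneg {v w : ℕ → ℝ} (h : 0 ≤ det2 v w) : 0 ≤ theta 2 [v, w] := by
  rw [theta_two]
  split_ifs
  · rcases h.eq_or_lt with h | h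
    · rw [← h, sg_zero]
    · rw [sg_pos h]; exact zero_le_one
  · exact le_rfl

theorem theta_two_swap (v w : ℕ → ℝ) : theta 2 [w, v] = - theta 2 [v, w] := by
  rw [theta_two, theta_two, show det2 w v = - det2 v w by simp [det2]; ring, sg_neg_eq]
  have : (∃ t : Fin 2 → Hyperreal, (∀ i, 0 < t i) ∧ IsSol 2 ![w, v] t) ↔
      ∃ t : Fin 2 → Hyperreal, (∀ i, 0 < t i) ∧ IsSol 2 ![v, w] t := by
    constructor <;> rintro ⟨t, ht, hs⟩ <;>
    · refine ⟨![t 1, t 0], fun i => by fin_cases i <;> simp [ht], fun j => ?_⟩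
      have := hs j
      simp only [Fin.sum_univ_two] at this ⊢
      rw [← this, add_comm]
      rfl
  by_cases h : ∃ t : Fin 2 → Hyperreal, (∀ i, 0 < t i) ∧ IsSol 2 ![v, w] t
  · rw [if_pos h, if_pos (this.2 h)]
  · rw [if_neg h, if_neg (mt this.1 h), neg_zero]

/-- The side of the generic ray on which a vector lies. -/
noncomputable def side (v : ℕ → ℝ) : Hyperreal := om * hr (v 1) - hr (v 0)

theorem side_ne_zero {v : ℕ → ℝ} (h : v 0 ≠ 0 ∨ v 1 ≠ 0) : side v ≠ 0 := by
  have := omc_ne_zero 2 (c := ![v 1, - v 0]) (by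
    intro hc
    have h0 := congrFun hc 0
    have h1 := congrFun hc 1
    simp at h0 h1
    tauto)
  simpa [omc, side, sub_eq_add_neg, mul_comm] using this

theorem theta_two_eq_one {v w : ℕ → ℝ} (h : 0 < det2 v w) (hv : side v < 0) (hw : 0 < side w) :
    theta 2 [v, w] = 1 := by
  have hd := hr_pos.2 h
  rw [theta_two, if_pos, sg_pos h]
  refine ⟨![side w / hr (det2 v w), - side v / hr (det2 v w)], fun i => ?_, fun j => ?_⟩
  · fin_cases i
    · exact div_pos hw hd
    · exact div_pos (neg_pos.2 hv) hd
  · have h2 : hr (det2 v w) = hr (v 0) * hr (w 1) - hr (v 1) * hr (w 0) := by simp [det2]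
    have h3 := hd.ne'
    fin_cases j <;> simp [Fin.sum_univ_two, side] <;> field_simp <;> rw [h2] <;> ring

theorem tau_two_nonneg {w : Fin 3 → ℕ → ℝ} (h0 : 0 ≤ det2 (w 1) (w 2)) (h1 : 0 ≤ det2 (w 2) (w 0))
    (h2 : 0 ≤ det2 (w 0) (w 1)) : 0 ≤ tau 2 [w 0, w 1, w 2] := by
  rw [tau_two, theta_two_swap (w 2) (w 0)]
  have := theta_two_nonneg h0
  have := theta_two_nonneg h1
  have := theta_two_nonneg h2
  linarith

theorem tau_two_pos {w : Fin 3 → ℕ → ℝ} (h0 : 0 < det2 (w 1) (w 2)) (h1 : 0 < det2 (w 2) (w 0))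
    (h2 : 0 < det2 (w 0) (w 1)) : 0 < tau 2 [w 0, w 1, w 2] := by
  rw [tau_two, theta_two_swap (w 2) (w 0)]
  have g0 := theta_two_nonneg h0.le
  have g1 := theta_two_nonneg h1.le
  have g2 := theta_two_nonneg h2.le
  have hne : ∀ {a b : ℕ → ℝ}, 0 < det2 a b → side a ≠ 0 := fun {a b} h => side_ne_zero (by
    by_contra hc
    push Not at hc
    simp [det2, hc.1, hc.2] at h)
  have hsum : hr (det2 (w 1) (w 2)) * side (w 0) + hr (det2 (w 2) (w 0)) * side (w 1) +
      hr (det2 (w 0) (w 1)) * side (w 2) = 0 := by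
    simp only [side, det2, map_sub, map_mul]
    ring
  have e0 := hr_pos.2 h0
  have e1 := hr_pos.2 h1
  have e2 := hr_pos.2 h2
  rcases lt_or_gt_of_ne (hne h2) with s0 | s0 <;> rcases lt_or_gt_of_ne (hne h0) with s1 | s1 <;>
    rcases lt_or_gt_of_ne (hne h1) with s2 | s2
  · nlinarith [mul_neg_of_pos_of_neg e0 s0, mul_neg_of_pos_of_neg e1 s1,
      mul_neg_of_pos_of_neg e2 s2]
  · have := theta_two_eq_one h0 s1 s2; linarith
  · have := theta_two_eq_one h2 s0 s1; linarith
  · have := theta_two_eq_one h2 s0 s1; linarith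
  · have := theta_two_eq_one h1 s2 s0; linarith
  · have := theta_two_eq_one h0 s1 s2; linarith
  · have := theta_two_eq_one h1 s2 s0; linarith
  · nlinarith [mul_pos e0 s0, mul_pos e1 s1, mul_pos e2 s2]

theorem tau_two_swap (a b c : ℕ → ℝ) : tau 2 [a, c, b] = - tau 2 [a, b, c] := by
  have h1 := tau_two ![a, c, b]
  have h2 := tau_two ![a, b, c]
  simp only [Matrix.cons_val] at h1 h2
  rw [h1, h2, theta_two_swap b c]
  ring

theorem tau_two_left (a b : ℕ → ℝ) : tau 2 [a, a, b] = 0 := by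
  have h1 := tau_two ![a, a, b]
  simp only [Matrix.cons_val] at h1
  rw [h1, theta_two_of_det_zero (v := a) (w := a) (by simp [det2]; ring)]
  ring

theorem tau_two_outer (a b : ℕ → ℝ) : tau 2 [a, b, a] = 0 := by
  rw [tau_two_swap, tau_two_left, neg_zero]

/-! ### Pairings for split extensions -/

section Primitive

variable {P : Type*} [Group P]

theorem exists_primitive {u : ℕ} {N : Subgroup P} (hN : PolyZ (u + 1) N) {z : Ch P}
    (hz : z ∈ chn P (u + 2)) (hbz : bd z ∈ coin N) {α : List P → ℝ} (hα : cod α = 0)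
    (hαN : ∀ h ∈ N, ∀ l, α (l.map (h * ·)) = α l) (hne : ev α z ≠ 0) {c : List P → ℝ}
    (hcH : Homog (u + 2) c) (hc : cod c = 0) (hcN : ∀ h ∈ N, ∀ l, c (l.map (h * ·)) = c l)
    (hcz : ev c z = 0) :
    ∃ η, Homog (u + 1) η ∧ (∀ h ∈ N, ∀ l, η (l.map (h * ·)) = η l) ∧ cod η = c := by
  have hW : ∀ x ∈ chn P (u + 2), bd x ∈ coin N → ev c x = 0 := by
    intro x hx hbx
    obtain ⟨a, b, hab, y, -, hy⟩ := hN.dependent hz hx (fun _ => hbz) (fun _ => hbx)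
    have h1 := ev_coin hcN hy
    have h2 := ev_coin hαN hy
    simp only [map_sub, map_add, map_smul, ev_bd, hc, hα, ev_zero, smul_eq_mul, hcz, mul_zero,
      zero_add, sub_zero] at h1 h2
    rcases mul_eq_zero.1 h1 with h | h
    · subst h
      simp [hne] at h2
      simp [h2] at hab
    · exact h
  let B : Ch P →ₗ[ℝ] (Ch P ⧸ coin N) := (coin N).mkQ ∘ₗ bd ∘ₗ pr (u + 2)
  have hmem : ev c ∘ₗ pr (u + 2) ∈ LinearMap.range B.dualMap := by
    rw [LinearMap.range_dualMap_eq_dualAnnihilator_ker, Submodule.mem_dualAnnihilator]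
    intro x hx
    refine hW _ (pr_mem_chn _ _) ?_
    simpa [B] using hx
  obtain ⟨g, hg⟩ := hmem
  have hg' : ∀ x ∈ chn P (u + 2), g ((coin N).mkQ (bd x)) = ev c x := by
    intro x hx
    have := LinearMap.congr_fun hg x
    simpa [B, pr_of_mem hx] using this
  let η : List P → ℝ := fun l => g ((coin N).mkQ (pr (u + 1) (Finsupp.single l 1)))
  have hη : ev η = g ∘ₗ (coin N).mkQ ∘ₗ pr (u + 1) := ch_ext fun l => by simp [η]
  have hH : Homog (u + 1) η := fun l hl => by simp [η, pr_single, hl]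
  refine ⟨η, hH, fun h hh l => ?_, ?_⟩
  · have : (coin N).mkQ (pr (u + 1) (Finsupp.single (l.map (h * ·)) 1)) =
        (coin N).mkQ (pr (u + 1) (Finsupp.single l 1)) := by
      rw [← sub_eq_zero, ← map_sub, ← map_sub, ← lsm_single, Submodule.mkQ_apply,
        Submodule.Quotient.mk_eq_zero]
      exact pr_mem_coin _ (lsm_sub_mem_coin hh _)
    simp only [η, this]
  · ext l
    by_cases hl : l.length = u + 2
    · rw [cod, hη, LinearMap.comp_apply, LinearMap.comp_apply, pr_of_mem (bdL_mem_chn hl)]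
      have := hg' (Finsupp.single l 1) (single_mem_chn hl _)
      simpa using this
    · rw [hH.cod l hl, hcH l hl]

end Primitive

section Sums

variable {Γ G : Type*} [Group Γ] [Group G]

theorem sm_translate_of_le_ker {χ : Γ →* ℝ} {H : Subgroup Γ} (hH : H ≤ χ.ker) (c : List Γ → ℝ)
    (h : Γ) (hh : h ∈ H) (l : List Γ) :
    sm (MonoidHom.id Γ) χ c (l.map (h * ·)) = sm (MonoidHom.id Γ) χ c l := by
  have := sm_translate (σ := MonoidHom.id Γ) χ c h l
  rw [MonoidHom.mem_ker.1 (inv_mem (hH hh)), one_mul] at this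
  exact this

theorem sm_zero (σ : G →* Γ) (χ : G →* ℝ) : sm σ χ 0 = 0 := by
  ext l; simp [sm]

theorem ev_sm_eq_of_sub_eq_cod {χ : Γ →* ℝ} {f f' h : List Γ → ℝ} (hf' : LF (MonoidHom.id Γ) f') (hh : LF (MonoidHom.id Γ) h) (e : f - f' = cod h)
    {H : Subgroup Γ} (hH : H ≤ χ.ker) {z : Ch Γ} (hz : bd z ∈ coin H) :
    ev (sm (MonoidHom.id Γ) χ f) z = ev (sm (MonoidHom.id Γ) χ f') z := by
  have h1 : f = f' + cod h := by rw [← e]; abel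
  have h2 : ev (sm (MonoidHom.id Γ) χ h) (bd z) = 0 := by
    exact ev_coin (sm_translate_of_le_ker hH h) hz
  rw [h1, sm_add χ hf' hh.cod, ev_add, ← cod_sm χ hh, ← ev_bd, h2, add_zero]

theorem finsum_prod_mul {α β : Type*} {F : α → ℝ} {G : β → ℝ} (hF : F.HasFiniteSupport)
    (hG : G.HasFiniteSupport) : ∑ᶠ p : α × β, F p.1 * G p.2 = (∑ᶠ a, F a) * ∑ᶠ b, G b := by
  rw [finsum_curry, finsum_mul]
  · exact finsum_congr fun a => (mul_finsum G (F a)).symm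
  · refine (Set.Finite.prod hF hG).subset fun p hp => ?_
    exact ⟨left_ne_zero_of_mul hp, right_ne_zero_of_mul hp⟩

end Sums

section Fibre

variable {A L P : Type*} [Group A] [Group L] [Group P] {inl : A →* P} {inr : L →* P} {π : P →* L}

theorem finite_of_factor (hb : Function.Bijective fun p : A × L => inl p.1 * inr p.2) {S : Set P}
    {T : Set L} (hT : T.Finite) {R : L → Set A} (hR : ∀ l, (R l).Finite)
    (h : ∀ a l, inl a * inr l ∈ S → l ∈ T ∧ a ∈ R l) : S.Finite := by
  refine (hT.biUnion fun l _ => ((hR l).image fun a => inl a * inr l)).subset fun p hp => ?_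
  obtain ⟨⟨a, l⟩, rfl⟩ := hb.2 p
  exact Set.mem_biUnion (h a l hp).1 ⟨a, (h a l hp).2, rfl⟩

theorem LF.cup_comp (hπr : ∀ l, π (inr l) = l) (hπl : ∀ a, π (inl a) = 1)
    (hb : Function.Bijective fun p : A × L => inl p.1 * inr p.2) {u : ℕ} {f : List P → ℝ}
    (hf : LF inl f) {c : List L → ℝ} (hc : LF (MonoidHom.id L) c) :
    LF (MonoidHom.id P) (cup u f fun l => c (l.map π)) := by
  intro m
  refine finite_of_factor hb (hc ((m.drop u).map π))
    (fun l => hf ((m.take (u + 1)).map (inr l * ·))) fun a l h => ?_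
  simp only [Set.mem_ofPred_eq, cup, ← List.map_take, ← List.map_drop, List.map_map,
    MonoidHom.id_apply] at h
  refine ⟨?_, ?_⟩
  · have := right_ne_zero_of_mul h
    simpa [Function.comp_def, hπr, hπl] using this
  · have := left_ne_zero_of_mul h
    simpa [Function.comp_def, mul_assoc] using this

theorem sm_cup_comp (hπr : ∀ l, π (inr l) = l) (hπl : ∀ a, π (inl a) = 1)
    (hb : Function.Bijective fun p : A × L => inl p.1 * inr p.2) {u : ℕ} {f : List P → ℝ}
    (hf : LF inl f) {c : List L → ℝ} (hc : LF (MonoidHom.id L) c) (χ : L →* ℝ) :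
    sm (MonoidHom.id P) (χ.comp π) (cup u f fun l => c (l.map π)) =
      sm inr χ (cup u (sm inl 1 f) fun l => c (l.map π)) := by
  ext m
  rw [sm, ← finsum_comp_equiv ((Equiv.prodComm L A).trans (Equiv.ofBijective _ hb)), finsum_curry]
  · rw [sm]
    refine finsum_congr fun l => ?_
    simp only [cup, sm, ← List.map_take, ← List.map_drop, List.map_map, MonoidHom.id_apply]
    simp only [Equiv.trans_apply, Equiv.prodComm_apply, Prod.swap_prod_mk, Equiv.ofBijective_apply,
      MonoidHom.comp_apply, map_mul, hπr, hπl, one_mul, Function.comp_def, MonoidHom.one_apply]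
    rw [finsum_mul, mul_finsum]
    refine finsum_congr fun a => ?_
    simp [mul_assoc]
  · refine (support_finite (LF.cup_comp hπr hπl hb hf hc (u := u) m)).preimage ?_
    exact Equiv.injective _ |>.injOn

theorem ev_fibre (hπr : ∀ l, π (inr l) = l) (hπl : ∀ a, π (inl a) = 1)
    (hb : Function.Bijective fun p : A × L => inl p.1 * inr p.2) {u : ℕ}
    (hN : PolyZ (u + 1) inl.range) {z : Ch P} (hz : z ∈ chn P (u + 2))
    (hbz : bd z ∈ coin inl.range) (T : Lift inl.range inr (u + 1) z)
    {vol : List P → ℝ} (hvol : Homog (u + 2) vol) (hcvol : cod vol = 0)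
    (hvolN : ∀ a l, vol (l.map (inl a * ·)) = vol l)
    (hvolL : ∀ b l, vol (l.map (inr b * ·)) = vol l) (hne : ev vol z ≠ 0)
    {f : List P → ℝ} (hf : LF inl f) (hfH : Homog (u + 2) f) (hcf : cod f = 0)
    {c : List L → ℝ} (hc : LF (MonoidHom.id L) c) (hc0 : c [] = 0) (hcc : cod c = 0)
    {χ : L →* ℝ} {H : Subgroup L} (hH : H ≤ χ.ker) {m : ℕ} {x : Ch L} (hx : x ∈ chn L (m + 1))
    (hbx : bd x ∈ coin H) :
    ev (sm (MonoidHom.id P) (χ.comp π) (cup (u + 1) f fun l => c (l.map π))) (T.Θ x) =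
      ev (sm inl 1 f) z * ev (sm (MonoidHom.id L) χ c) x := by
  have hNker : inl.range ≤ π.ker := by rintro _ ⟨a, rfl⟩; exact hπl a
  have hvolN' : ∀ h ∈ inl.range, ∀ l, vol (l.map (h * ·)) = vol l := by
    rintro _ ⟨a, rfl⟩; exact hvolN a
  have hcomm : ∀ l a, ∃ a', inr l * inl a = inl a' * inr l := by
    intro l a
    obtain ⟨⟨a', l'⟩, h⟩ := hb.2 (inr l * inl a)
    have := congr_arg π h
    simp only [map_mul, hπl, hπr, one_mul, mul_one] at this
    exact ⟨a', by rw [← h, this]⟩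
  set F := sm inl 1 f with hF
  have hFinv : ∀ h ∈ inl.range, ∀ l, F (l.map (h * ·)) = F l := by
    rintro _ ⟨a, rfl⟩ l
    rw [hF, sm_translate]; simp
  set lam := ev F z / ev vol z with hlam
  obtain ⟨η, hηH, hηN, hη⟩ := exists_primitive hN hz hbz hcvol hvolN' hne
    (c := F - lam • vol) (fun l hl => by simp [hF, (hfH.sm 1) l hl, hvol l hl])
    (by rw [cod_sub, cod_smul, hcvol, hF, cod_sm 1 hf, hcf, smul_zero, sub_zero]
        ext l; simp [sm])
    (fun h hh l => by simp [hFinv h hh l, hvolN' h hh l])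
    (by rw [ev_sub, ev_smul, hlam, div_mul_cancel₀ _ hne, sub_self])
  let β : List P → ℝ := fun l => c (l.map π)
  have hβ : cod β = 0 := by
    rw [cod_comp_map c π, hcc]; rfl
  have hβ0 : β [] = 0 := by simpa [β] using hc0
  have hLFr : ∀ (p : ℕ) (α : List P → ℝ), LF inr (cup p α β) := by
    intro p α l
    refine (hc ((l.drop p).map π)).subset fun g hg => ?_
    have := right_ne_zero_of_mul hg
    simpa [β, ← List.map_drop, Function.comp_def, hπr] using this
  have hsplit : cup (u + 1) F β = lam • cup (u + 1) vol β + cod (cup u η β) := by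
    rw [cod_cup u hηH hβ0, hη, hβ]
    ext l
    simp only [cup, Pi.add_apply, Pi.smul_apply, Pi.sub_apply, smul_eq_mul, Pi.zero_apply]
    ring
  have hLFs : LF inr (lam • cup (u + 1) vol β) := fun l =>
    (hLFr (u + 1) vol l).subset fun g hg h => hg (by simp [h])
  rw [sm_cup_comp hπr hπl hb hf hc χ, ← hF]
  change ev (sm inr χ (cup (u + 1) F β)) (T.Θ x) = _
  rw [hsplit, sm_add χ hLFs (hLFr u η).cod, ev_add, sm_smul, ev_smul, ← cod_sm χ (hLFr u η),
    ← ev_bd]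
  have h1 : sm inr χ (cup (u + 1) vol β) =
      cup (u + 1) vol fun l => sm (MonoidHom.id L) χ c (l.map π) := by
    ext l
    simp only [sm, cup, β, ← List.map_take, ← List.map_drop, hvolL, mul_finsum, List.map_map]
    refine finsum_congr fun g => ?_
    simp only [Function.comp_def, map_mul, hπr, MonoidHom.id_apply]
    ring
  have h2 : ev (sm inr χ (cup u η β)) (bd (T.Θ x)) = 0 := by
    have hmem := bd_lift_mem T (H' := H.comap π) (fun h hh => by simpa [hπr] using hh)
      (hNker.trans fun p hp => by
        rw [Subgroup.mem_comap, MonoidHom.mem_ker.1 hp]; exact one_mem _) hbx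
    refine ev_coin (fun p hp l => ?_) hmem
    obtain ⟨⟨a, h⟩, rfl⟩ := hb.2 p
    have hh : h ∈ H := by simpa [hπl, hπr] using hp
    have e : ∀ l : List P, sm inr χ (cup u η β) (l.map (inl a * ·)) = sm inr χ (cup u η β) l := by
      intro l
      refine finsum_congr fun g => ?_
      obtain ⟨a', ha'⟩ := hcomm g a
      have e1 : ∀ l : List P, (l.map (inl a * ·)).map (inr g * ·) =
          (l.map (inr g * ·)).map (inl a' * ·) := by
        intro l
        simp [Function.comp_def, ← mul_assoc, ha']
      rw [e1]
      congr 1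
      simp only [cup, ← List.map_take, ← List.map_drop, hηN _ ⟨a', rfl⟩]
      simp [β, Function.comp_def, hπl]
    have e2 : l.map ((fun p : A × L => inl p.1 * inr p.2) (a, h) * ·) =
        (l.map (inr h * ·)).map (inl a * ·) := by simp [Function.comp_def, mul_assoc]
    rw [e2, e, sm_translate, MonoidHom.mem_ker.1 (inv_mem (hH hh)), one_mul]
  have hcs : cod (sm (MonoidHom.id L) χ c) = 0 := by
    rw [cod_sm χ hc, hcc, sm_zero]
  rw [h2, add_zero, h1, ev_cup_lift T hNker hπr hvol hcvol hvolN' hvolL H hx hbx hcs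
    (sm_translate_of_le_ker hH c), ← mul_assoc, hlam, div_mul_cancel₀ _ hne]

end Fibre

section Product

variable {A B : Type*} [Group A] [Group B]

theorem LF.cup_prod {p : ℕ} {f : List A → ℝ} {c : List B → ℝ} (hf : LF (MonoidHom.id A) f)
    (hc : LF (MonoidHom.id B) c) : LF (MonoidHom.id (A × B))
      (cup p (fun l => f (l.map Prod.fst)) fun l => c (l.map Prod.snd)) := by
  intro l
  refine (Set.Finite.prod (hf ((l.take (p + 1)).map Prod.fst))
    (hc ((l.drop p).map Prod.snd))).subset fun g hg => ⟨?_, ?_⟩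
  · have := left_ne_zero_of_mul hg
    simpa [← List.map_take, Function.comp_def] using this
  · have := right_ne_zero_of_mul hg
    simpa [← List.map_drop, Function.comp_def] using this

theorem sm_cup_prod {p : ℕ} {f : List A → ℝ} {c : List B → ℝ} (hf : LF (MonoidHom.id A) f)
    (hc : LF (MonoidHom.id B) c) (χ : A →* ℝ) (ψ : B →* ℝ) :
    sm (MonoidHom.id (A × B)) (χ.coprod ψ)
      (cup p (fun l => f (l.map Prod.fst)) fun l => c (l.map Prod.snd)) =
    cup p (fun l => sm (MonoidHom.id A) χ f (l.map Prod.fst))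
      fun l => sm (MonoidHom.id B) ψ c (l.map Prod.snd) := by
  ext l
  simp only [cup]
  rw [sm, sm, sm, ← finsum_prod_mul (support_finite (hf _)) (support_finite (hc _))]
  refine finsum_congr fun g => ?_
  simp only [MonoidHom.coprod_apply, cup, ← List.map_take, ← List.map_drop, List.map_map,
    Function.comp_def, MonoidHom.id_apply, Prod.fst_mul, Prod.snd_mul]
  ring

theorem ev_product {u : ℕ} {f : List A → ℝ} {c : List B → ℝ} (hf : LF (MonoidHom.id A) f)
    (hfH : Homog (u + 1) f) (hcf : cod f = 0) (hc : LF (MonoidHom.id B) c) (hcc : cod c = 0)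
    {χ : A →* ℝ} {ψ : B →* ℝ} {H : Subgroup A} (hH : H ≤ χ.ker) {K : Subgroup B} (hK : K ≤ ψ.ker)
    {z : Ch A} (hz : z ∈ chn A (u + 1)) (hbz : bd z ∈ coin H) {m : ℕ} {y : Ch B}
    (hy : y ∈ chn B (m + 1)) (hby : bd y ∈ coin K) :
    ev (sm (MonoidHom.id (A × B)) (χ.coprod ψ)
      (cup u (fun l => f (l.map Prod.fst)) fun l => c (l.map Prod.snd)))
      ((shuffleLift hz hbz : Lift _ (MonoidHom.inr A B) u _).Θ y) =
    ev (sm (MonoidHom.id A) χ f) z * ev (sm (MonoidHom.id B) ψ c) y := by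
  rw [sm_cup_prod hf hc]
  have h := ev_cup_lift (shuffleLift hz hbz : Lift _ (MonoidHom.inr A B) u _)
    (π := MonoidHom.snd A B) (α := fun l => sm (MonoidHom.id A) χ f (l.map Prod.fst))
    (by rintro _ ⟨a, -, rfl⟩; rfl) (fun b => rfl)
    (fun l hl => (hfH.sm χ) _ (by simpa using hl))
    (by rw [cod_comp_map (sm (MonoidHom.id A) χ f) Prod.fst, cod_sm χ hf, hcf, sm_zero]; rfl)
    (by
      rintro _ ⟨a, ha, rfl⟩ l
      rw [List.map_map]
      have := sm_translate_of_le_ker hH f a ha (l.map Prod.fst)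
      rw [List.map_map] at this
      exact this)
    (by
      intro b l
      rw [List.map_map]
      congr 2
      ext a
      simp)
    K hy hby (c := sm (MonoidHom.id B) ψ c) (by rw [cod_sm ψ hc, hcc, sm_zero]) (sm_translate_of_le_ker hK c)
  refine Eq.trans h ?_
  rw [ev_mp]
  congr 1
  refine ev_congr fun l _ => ?_
  simp [Function.comp_def]

end Product

/-! ### Lattices of translations -/

theorem ev_prismL {X : Type*} (ψ : X → X) (f : List X → ℝ) (l : List X) :
    ev f (prismL id ψ l) = ∑ i ∈ Finset.range l.length,
      (-1 : ℝ) ^ i * f (l.take (i + 1) ++ (l.drop i).map ψ) := by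
  induction l generalizing f with
  | nil => simp [prismL]
  | cons a l ih =>
    rw [prismL, map_sub, ev_cone, ih, List.length_cons, Finset.sum_range_succ']
    simp [pow_succ]
    ring

theorem getD_prism {X : Type*} (ψ : X → X) (d : X) {l : List X} {i k : ℕ} (hi : i < l.length)
    (hk : k ≤ l.length) : (l.take (i + 1) ++ (l.drop i).map ψ).getD k d =
      if k ≤ i then l.getD k d else ψ (l.getD (k - 1) d) := by
  split_ifs with h
  · rw [List.getD_append _ _ _ _ (by simp; omega)]
    rw [List.getD_eq_getElem _ _ (by simp; omega), List.getD_eq_getElem _ _ (by omega)]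
    simp
  · rw [List.getD_append_right _ _ _ _ (by simp; omega), List.length_take,
      List.getD_eq_getElem _ _ (by simp; omega), List.getD_eq_getElem _ _ (by omega)]
    simp only [List.getElem_map, List.getElem_drop]
    congr 2
    omega

theorem getD_prism_le {X : Type*} (ψ : X → X) (d : X) {l : List X} {i k : ℕ} (hi : i < l.length)
    (hk : k ≤ i) : (l.take (i + 1) ++ (l.drop i).map ψ).getD k d = l.getD k d := by
  rw [getD_prism ψ d hi (by omega), if_pos hk]

theorem getD_prism_succ {X : Type*} (ψ : X → X) (d : X) {l : List X} {i k : ℕ}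
    (hi : i < l.length) (hk : i ≤ k) (hk' : k < l.length) :
    (l.take (i + 1) ++ (l.drop i).map ψ).getD (k + 1) d = ψ (l.getD k d) := by
  rw [getD_prism ψ d hi hk', if_neg (by omega)]
  rfl

theorem getD_prism_of_lt {X : Type*} (ψ : X → X) (d : X) {l : List X} {i k : ℕ}
    (hi : i < l.length) (hk : i < k) (hk' : k ≤ l.length) :
    (l.take (i + 1) ++ (l.drop i).map ψ).getD k d = ψ (l.getD (k - 1) d) := by
  rw [getD_prism ψ d hi hk', if_neg (by omega)]

/-- The translation of the `j`-th coordinate by `M`. -/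
def shiftAt (j : ℕ) (M : ℝ) (v : ℕ → ℝ) : ℕ → ℝ := v + Pi.single j M

theorem shiftAt_same (j : ℕ) (M : ℝ) (v : ℕ → ℝ) : shiftAt j M v j = v j + M := by
  simp [shiftAt]

/-- The fundamental chain of the parallelepiped with edges `M j`, based at `c`. -/
noncomputable def cyc (M : ℕ → ℝ) (c : ℕ → ℝ) : ℕ → Ch (ℕ → ℝ)
  | 0 => Finsupp.single [c] 1
  | j + 1 => prism id (shiftAt j (M j)) (cyc M c j)

theorem cyc_support (M c : ℕ → ℝ) (j : ℕ) {l : List (ℕ → ℝ)} (hl : l ∈ (cyc M c j).support) :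
    l.length = j + 1 ∧ ∀ v ∈ l, ∀ k, j ≤ k → v k = c k := by
  classical
  induction j generalizing l with
  | zero =>
    have : l = [c] := by simpa [cyc] using hl
    simp [this]
  | succ j ih =>
    have : ∃ l' ∈ (cyc M c j).support, l ∈ (prismL id (shiftAt j (M j)) l').support := by
      by_contra! h
      apply Finsupp.mem_support_iff.1 hl
      rw [cyc, prism, Finsupp.linearCombination_apply, Finsupp.sum, Finsupp.finsetSum_apply]
      refine Finset.sum_eq_zero fun l' hl' => ?_
      simp [Finsupp.notMem_support_iff.1 (h l' hl')]
    obtain ⟨l', hl', h⟩ := this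
    obtain ⟨h1, h2⟩ := ih hl'
    obtain ⟨h3, h4⟩ := prismL_support _ _ h
    refine ⟨by omega, fun v hv k hk => ?_⟩
    obtain ⟨x, hx, h | h⟩ := h4 v hv
    · exact h ▸ h2 x hx k (by omega)
    · simp [h, shiftAt, h2 x hx k (by omega), show k ≠ j by omega]

theorem ev_cyc_succ (M c : ℕ → ℝ) (j : ℕ) (f g : List (ℕ → ℝ) → ℝ) (r : ℝ)
    (h : ∀ l : List (ℕ → ℝ), l.length = j + 1 → (∀ i ≤ j, l.getD i 0 j = c j) →
      ∑ i ∈ Finset.range (j + 1), (-1 : ℝ) ^ i *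
        f (l.take (i + 1) ++ (l.drop i).map (shiftAt j (M j))) = r * g l) :
    ev f (cyc M c (j + 1)) = r * ev g (cyc M c j) := by
  have h1 : ev f ∘ₗ prism id (shiftAt j (M j)) =
      ev fun l => ev f (prismL id (shiftAt j (M j)) l) := ch_ext fun l => by simp
  have h2 := LinearMap.congr_fun h1 (cyc M c j)
  rw [LinearMap.comp_apply] at h2
  rw [cyc, h2, ← ev_smul]
  refine ev_congr fun l hl => ?_
  obtain ⟨h3, h4⟩ := cyc_support M c j hl
  rw [ev_prismL, h3, h l h3 fun i hi => ?_]
  · simp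
  · rw [List.getD_eq_getElem _ _ (by omega)]
    exact h4 _ (List.getElem_mem _) j le_rfl

theorem nest_zero_apply {M : ℕ} {l : List (ℕ → ℝ)} (hl : l.length = M + 1) :
    nest M 0 l = ∏ a ∈ Finset.range M, ((if 0 < l.getD (a + 1) 0 a then 1 else 0) -
      if 0 < l.getD a 0 a then 1 else 0) := by
  induction M generalizing l with
  | zero =>
    obtain ⟨v, rfl⟩ := List.length_eq_one_iff.1 hl
    simp [nest, tau, theta, thetaF, IsSol, cod_cons, cmat, sg]
  | succ M ih =>
    match l, hl with
    | v :: w :: l, hl =>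
      rw [nest, cup, Finset.prod_range_succ']
      simp only [List.take_succ_cons, List.take_zero, tau_one, List.drop_succ_cons, List.drop_zero,
        List.getD_cons_succ, List.getD_cons_zero, zero_add]
      rw [ih (by simpa using hl), mul_comm]
      congr 1
      refine Finset.prod_congr rfl fun a ha => ?_
      have hM := Finset.mem_range.1 ha
      have hl' : l.length = M := by simpa using hl
      have key : ∀ b, b < M + 1 → ((w :: l).map tl).getD b 0 a = (w :: l).getD b 0 (a + 1) := by
        intro b hb
        rw [List.getD_eq_getElem _ _ (by simp; omega), List.getD_eq_getElem _ _ (by simp; omega),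
          List.getElem_map, tl]
      rw [key a (by omega), key (a + 1) (by omega)]
      simp

theorem ev_nest_cyc (M c : ℕ → ℝ) (j : ℕ) : ev (nest j 0) (cyc M c j) =
    ∏ i ∈ Finset.range j, (-1 : ℝ) ^ i *
      ((if 0 < c i + M i then 1 else 0) - if 0 < c i then 1 else 0) := by
  induction j with
  | zero =>
    simp [cyc, nest_zero_apply]
  | succ j ih =>
    rw [Finset.prod_range_succ, ← ih, mul_comm]
    refine ev_cyc_succ M c j _ _ _ fun l hl hc => ?_
    have hT : ∀ i < j + 1, (l.take (i + 1) ++ (l.drop i).map (shiftAt j (M j))).length =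
        j + 1 + 1 := by intro i hi; simp; omega
    rw [Finset.sum_range_succ, Finset.sum_eq_zero, zero_add]
    · rw [nest_zero_apply (hT j (by omega)), nest_zero_apply hl, Finset.prod_range_succ,
        getD_prism_succ _ _ (by omega) le_rfl (by omega), getD_prism_le _ _ (by omega) le_rfl,
        shiftAt_same, hc j le_rfl,
        mul_comm (∏ _ ∈ _, _), mul_assoc]
      congr 2
      refine Finset.prod_congr rfl fun a ha => ?_
      have := Finset.mem_range.1 ha
      rw [getD_prism_le _ _ (by omega) (by omega), getD_prism_le _ _ (by omega) (by omega)]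
    · intro i hi
      have hi := Finset.mem_range.1 hi
      rw [nest_zero_apply (hT i (by omega)), Finset.prod_range_succ,
        getD_prism_succ _ _ (by omega) (by omega) (by omega),
        getD_prism_of_lt _ _ (by omega) (by omega) (by omega), shiftAt_same, shiftAt_same, hc _ (by omega),
        hc _ (by omega), sub_self, mul_zero, mul_zero]

/-! ### The volume cocycle -/

/-- The determinant of the first `u` coordinates of `u` vectors. -/
noncomputable def detL (u : ℕ) (l : List (ℕ → ℝ)) : ℝ :=
  if l.length = u then (Matrix.of fun a b : Fin u => l.getD a 0 b).det else 0

/-- The volume cocycle. -/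
noncomputable def volL (u : ℕ) : List (ℕ → ℝ) → ℝ := cod (detL u)

theorem homog_volL (u : ℕ) : Homog (u + 1) (volL u) :=
  Homog.cod fun _ hl => if_neg hl

theorem volL_apply {u : ℕ} {l : List (ℕ → ℝ)} (hl : l.length = u + 1) :
    volL u l =
      (Matrix.of fun a b : Fin u => l.getD (a + 1) 0 b - l.getD a 0 b).det := by
  obtain ⟨v, rfl⟩ := exists_ofFn hl
  let A : Matrix (Fin (u + 1)) (Fin (u + 1)) ℝ :=
    Matrix.of fun i => Fin.cons 1 fun b : Fin u => v i b
  let B : Matrix (Fin (u + 1)) (Fin (u + 1)) ℝ := Matrix.of fun i j =>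
    Fin.cases (A 0 j) (fun i : Fin u => A i.succ j - A i.castSucc j) i
  have hAB : A.det = B.det := by
    refine Matrix.det_eq_of_forall_row_eq_smul_add_pred (fun _ => 1) (fun j => rfl) fun i j => ?_
    simp [B]
  have hA : volL u (List.ofFn v) = A.det := by
    rw [volL, cod_ofFn, Matrix.det_succ_column_zero]
    refine Finset.sum_congr rfl fun i _ => ?_
    rw [detL, if_pos (by simp)]
    simp only [A, Matrix.of_apply, Fin.cons_zero, mul_one]
    congr 2
    ext a b
    simp
  have hB : B.det = (Matrix.of fun a b : Fin u => v a.succ b - v a.castSucc b).det := by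
    rw [Matrix.det_succ_column_zero, Fin.sum_univ_succ, Finset.sum_eq_zero]
    · simp only [B, A, Matrix.of_apply, Fin.cases_zero, Fin.cons_zero]
      simp only [Fin.val_zero, pow_zero, one_mul, add_zero]
      congr 1
    · intro i _
      simp [B, A]
  rw [hA, hAB, hB]
  congr 1
  ext a b
  have h1 : (a : ℕ) < u + 1 := by omega
  have h2 : (a : ℕ) + 1 < u + 1 := by omega
  simp only [Matrix.of_apply]
  rw [List.getD_eq_getElem _ _ (by simp), List.getD_eq_getElem _ _ (by simp)]
  simp only [List.getElem_ofFn]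
  rfl

theorem volL_map {X : Type*} {u : ℕ} (y y' : X → ℕ → ℝ) (C : Matrix (Fin u) (Fin u) ℝ)
    (hC : C.det = 1)
    (hy : ∀ v w, ∀ b : Fin u, y' v b - y' w b = ∑ k : Fin u, (y v k - y w k) * C k b)
    (l : List X) : volL u (l.map y') = volL u (l.map y) := by
  by_cases hl : l.length = u + 1
  · rw [volL_apply (by simpa using hl), volL_apply (by simpa using hl),
      ← mul_one (Matrix.det (Matrix.of fun a b : Fin u => (l.map y).getD (a + 1) 0 b - _)),
      ← hC, ← Matrix.det_mul]
    congr 1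
    ext a b
    rw [Matrix.mul_apply, Matrix.of_apply]
    simp only [Matrix.of_apply]
    have key : ∀ (z : X → ℕ → ℝ) (i : ℕ) (hi : i < u + 1),
        (l.map z).getD i 0 = z (l[i]'(hl ▸ hi)) := by
      intro z i hi
      rw [List.getD_eq_getElem _ _ (by simp; omega), List.getElem_map]
    simp only [key _ _ (show (a : ℕ) + 1 < u + 1 by omega), key _ _ (show (a : ℕ) < u + 1 by omega)]
    exact hy _ _ _
  · rw [homog_volL u _ (by simpa using hl), homog_volL u _ (by simpa using hl)]

theorem ev_volL_cyc (M c : ℕ → ℝ) (j : ℕ) : ev (volL j) (cyc M c j) =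
    ∏ i ∈ Finset.range j, (-1 : ℝ) ^ i * ((i + 1) * M i) := by
  induction j with
  | zero => simp [cyc, volL_apply]
  | succ j ih =>
    rw [Finset.prod_range_succ, ← ih, mul_comm]
    refine ev_cyc_succ M c j _ _ _ fun l hl hc => ?_
    have hz : ∀ i < j + 1, ∀ a < j + 1, a ≠ i →
        ((l.take (i + 1) ++ (l.drop i).map (shiftAt j (M j))).getD (a + 1) 0 j -
            (l.take (i + 1) ++ (l.drop i).map (shiftAt j (M j))).getD a 0 j) = 0 := by
      intro i hi a ha hai
      by_cases h : a < i
      · rw [getD_prism_le _ _ (by omega) (by omega), getD_prism_le _ _ (by omega) (by omega),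
          hc _ (by omega), hc _ (by omega), sub_self]
      · rw [getD_prism_succ _ _ (by omega) (by omega) (by omega),
          getD_prism_of_lt _ _ (by omega) (by omega) (by omega), shiftAt_same, shiftAt_same,
          hc _ (by omega), hc _ (by omega), sub_self]
    have key : ∀ i ∈ Finset.range (j + 1), (-1 : ℝ) ^ i *
        volL (j + 1) (l.take (i + 1) ++ (l.drop i).map (shiftAt j (M j))) =
        (-1 : ℝ) ^ j * M j * volL j l := by
      intro i hi
      have hi := Finset.mem_range.1 hi
      rw [volL_apply (by simp; omega), volL_apply hl, Matrix.det_succ_column _ (Fin.last j),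
        Finset.sum_eq_single (⟨i, hi⟩ : Fin (j + 1))]
      · simp only [Matrix.of_apply, Fin.val_last]
        rw [getD_prism_succ _ _ (by omega) le_rfl (by omega),
          getD_prism_le _ _ (by omega) le_rfl, shiftAt_same, add_sub_cancel_left,
          ← mul_assoc, ← mul_assoc, ← pow_add, show i + (i + j) = i + i + j by omega, pow_add,
          Even.neg_one_pow ⟨i, rfl⟩, one_mul]
        congr 2
        ext a b
        simp only [Matrix.submatrix_apply, Matrix.of_apply]
        have hb : ((Fin.last j).succAbove b : ℕ) = b := by simp
        have hsh : ∀ v : ℕ → ℝ, shiftAt j (M j) v b = v b := by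
          intro v; simp [shiftAt, b.2.ne]
        rw [hb]
        by_cases hai : (a : ℕ) < i
        · have : ((⟨i, hi⟩ : Fin (j + 1)).succAbove a : ℕ) = a := by
            rw [Fin.succAbove_of_castSucc_lt _ _ (by simpa [Fin.lt_def] using hai), Fin.val_castSucc]
          rw [this, getD_prism_le _ _ (by omega) (by omega),
            getD_prism_le _ _ (by omega) (by omega)]
        · have : ((⟨i, hi⟩ : Fin (j + 1)).succAbove a : ℕ) = a + 1 := by
            rw [Fin.succAbove_of_le_castSucc _ _ (by simpa [Fin.le_def] using hai), Fin.val_succ]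
          rw [this, getD_prism_succ _ _ (by omega) (by omega) (by omega),
            getD_prism_succ _ _ (by omega) (by omega) (by omega), hsh, hsh]
      · intro a _ ha
        have ha' : (a : ℕ) ≠ i := by simpa only [Fin.ext_iff, ne_eq] using ha
        have h0 := hz i hi a a.2 ha'
        simp only [Matrix.of_apply, Fin.val_last, h0, mul_zero, zero_mul]
      · simp
    rw [Finset.sum_congr rfl key]
    simp
    ring

theorem mp_cyc (M c w : ℕ → ℝ) (j : ℕ) : mp (· + w) (cyc M c j) = cyc M (c + w) j := by
  induction j with
  | zero => simp [cyc]
  | succ j ih =>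
    rw [cyc, cyc, ← ih]
    exact prism_mp_comm id (shiftAt j (M j)) id (shiftAt j (M j)) (· + w) (· + w) (fun _ => rfl)
      (fun x => by simp only [shiftAt]; abel) _

section Fibre

variable {A P : Type*} [CommGroup A] [Group P] {inl : A →* P}

/-- The parallelepiped spanned by the elements `e j`. -/
noncomputable def cycP (inl : A →* P) (e : ℕ → A) : ℕ → Ch P
  | 0 => Finsupp.single [1] 1
  | j + 1 => prism id (inl (e j) * ·) (cycP inl e j)

theorem prism_mem_chn {X Y : Type*} (φ ψ : X → Y) {m : ℕ} {x : Ch X} (hx : x ∈ chn X m) :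
    prism φ ψ x ∈ chn Y (m + 1) :=
  map_chn_of_single _ _ (fun l hl => by
    rw [prism_single, one_smul]
    intro k hk
    have := (prismL_support φ ψ hk).1
    simp only [Set.mem_ofPred_eq]
    omega) hx

theorem cycP_mem_chn (e : ℕ → A) (j : ℕ) : cycP inl e j ∈ chn P (j + 1) := by
  induction j with
  | zero => exact single_mem_chn rfl _
  | succ j ih => exact prism_mem_chn _ _ ih

theorem bd_cycP_mem (e : ℕ → A) (j : ℕ) (hj : 0 < j) : bd (cycP inl e j) ∈ coin inl.range := by
  have step : ∀ j, prism id (inl (e j) * ·) (bd (cycP inl e j)) ∈ coin inl.range →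
      bd (cycP inl e (j + 1)) ∈ coin inl.range := by
    intro j h
    have h1 := bd_prism id (inl (e j) * ·) (cycP inl e j)
    have hid : mp id (cycP inl e j) = cycP inl e j := mp_id _
    rw [hid] at h1
    rw [cycP, eq_sub_of_add_eq h1]
    exact sub_mem (lsm_sub_mem_coin (H := inl.range) (h := inl (e j)) ⟨e j, rfl⟩ _) h
  induction j with
  | zero => omega
  | succ j ih =>
    apply step
    rcases Nat.eq_zero_or_pos j with rfl | hj
    · simp [cycP, bdL_cons, prismL]
    · refine coin_map_equivariant (H := inl.range) _ id (fun g hg => hg) ?_ (ih hj)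
      rintro _ ⟨a, rfl⟩ x
      refine (prism_mp_comm id (inl (e j) * ·) id (inl (e j) * ·) (inl a * ·) (inl a * ·)
        (fun _ => rfl) (fun x => ?_) _).symm
      simp only [← mul_assoc, ← map_mul, mul_comm]

theorem mp_cycP {y : P → ℕ → ℝ} {e : ℕ → A} {M : ℕ → ℝ} {u : ℕ}
    (he : ∀ j < u, ∀ p, y (inl (e j) * p) = shiftAt j (M j) (y p)) :
    mp y (cycP inl e u) = cyc M (y 1) u := by
  induction u with
  | zero => simp [cycP, cyc]
  | succ j ih =>
    rw [cycP, cyc, ← ih fun i hi => he i (by omega)]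
    exact prism_mp_comm id (inl (e j) * ·) id (shiftAt j (M j)) y y (fun _ => rfl)
      (fun x => he j (by omega) x) _

theorem ev_volL_cycP_ne {y : P → ℕ → ℝ} {e : ℕ → A} {M : ℕ → ℝ} {u : ℕ}
    (he : ∀ j < u, ∀ p, y (inl (e j) * p) = shiftAt j (M j) (y p)) (hM : ∀ j < u, 0 < M j) :
    ev (fun l => volL u (l.map y)) (cycP inl e u) ≠ 0 := by
  rw [← ev_mp, mp_cycP he, ev_volL_cyc]
  refine Finset.prod_ne_zero_iff.2 fun i hi => ?_
  have := hM i (Finset.mem_range.1 hi)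
  positivity

theorem ev_sm_nest_cycP_ne {y : P → ℕ → ℝ} {ℓ : A → ℕ → ℝ} {e : ℕ → A} {M : ℕ → ℝ} {u : ℕ}
    (hℓ : ∀ a p, y (inl a * p) = y p + ℓ a)
    (he : ∀ j < u, ∀ p, y (inl (e j) * p) = shiftAt j (M j) (y p)) (hM : ∀ j < u, 0 < M j)
    (hs : ∀ n : ℕ → ℤ, ∃ a, ∀ j < u, ℓ a j = n j * M j)
    (hLF : LF inl fun l => nest u 0 (l.map y)) :
    ev (sm inl 1 fun l => nest u 0 (l.map y)) (cycP inl e u) ≠ 0 := by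
  have key : ∀ a, ev (fun l => nest u 0 (l.map y)) (lsm (inl a) (cycP inl e u)) =
      (∏ i ∈ Finset.range u, (-1 : ℝ) ^ i) * ∏ i ∈ Finset.range u,
        ((if 0 < y 1 i + ℓ a i + M i then 1 else 0) - if 0 < y 1 i + ℓ a i then 1 else 0) := by
    intro a
    rw [← ev_mp, lsm, mp_mp]
    have : mp (y ∘ (inl a * ·)) (cycP inl e u) = mp (· + ℓ a) (mp y (cycP inl e u)) := by
      rw [mp_mp]
      congr 2
      ext1 p
      exact hℓ a p
    rw [this, mp_cycP he, mp_cyc, ev_nest_cyc, ← Finset.prod_mul_distrib]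
    rfl
  have hnn : ∀ a, 0 ≤ ∏ i ∈ Finset.range u,
      ((if 0 < y 1 i + ℓ a i + M i then (1 : ℝ) else 0) - if 0 < y 1 i + ℓ a i then 1 else 0) := by
    refine fun a => Finset.prod_nonneg fun i hi => ?_
    have := hM i (Finset.mem_range.1 hi)
    split_ifs <;> linarith
  rw [ev_sm 1 hLF]
  simp only [MonoidHom.one_apply, one_mul, key]
  rw [← mul_finsum]
  refine mul_ne_zero (Finset.prod_ne_zero_iff.2 fun i _ => by positivity) (ne_of_gt ?_)
  have hn : ∀ j, ∃ n : ℤ, j < u → 0 < y 1 j + n * M j + M j ∧ y 1 j + n * M j ≤ 0 := by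
    intro j
    by_cases hj : j < u
    · obtain ⟨m, hm, -⟩ := existsUnique_add_zsmul_mem_Ioc (hM j hj) (y 1 j + M j) 0
      refine ⟨m, fun _ => ?_⟩
      rw [zsmul_eq_mul, Set.mem_Ioc] at hm
      constructor <;> linarith
    · exact ⟨0, fun h => absurd h hj⟩
  choose n hn using hn
  obtain ⟨a, ha⟩ := hs n
  refine finsum_pos hnn ⟨a, Finset.prod_pos fun i hi => ?_⟩ ?_
  · have hi := Finset.mem_range.1 hi
    rw [ha i hi, if_pos (hn i hi).1, if_neg (not_lt.2 (hn i hi).2)]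
    norm_num
  · refine (ev_finite hLF (cycP inl e u)).subset fun a ha => ?_
    rw [Set.mem_ofPred_eq, key]
    exact mul_ne_zero (Finset.prod_ne_zero_iff.2 fun i _ => by positivity) ha

end Fibre

/-! ### Positive definite matrices and convex combinations -/

/-- Convex weights on a finite set. -/
def Wt {Y : Type*} (s : Finset Y) (w : Y → ℝ) : Prop := (∀ y ∈ s, 0 ≤ w y) ∧ ∑ y ∈ s, w y = 1

theorem exists_wt {Y E : Type*} [AddCommGroup E] [Module ℝ E] {s : Finset Y} {f : Y → E} {v : E}
    {S : Set E} (hv : v ∈ convexHull ℝ S) (hS : ∀ x ∈ S, ∃ y ∈ s, f y = x) :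
    ∃ w, Wt s w ∧ ∑ y ∈ s, w y • f y = v := by
  classical
  refine convexHull_min (t := {v | ∃ w, Wt s w ∧ ∑ y ∈ s, w y • f y = v}) ?_ ?_ hv
  · intro x hx
    obtain ⟨y, hy, rfl⟩ := hS x hx
    refine ⟨Pi.single y 1, ⟨fun z _ => ?_, ?_⟩, ?_⟩
    · by_cases h : z = y
      · subst h; simp
      · simp [h]
    · simp [Finset.sum_pi_single', hy]
    · rw [Finset.sum_eq_single y (fun z _ h => by simp [h]) (fun h => absurd hy h)]
      simp
  · rintro x ⟨w, ⟨hw, hw1⟩, rfl⟩ x' ⟨w', ⟨hw', hw1'⟩, rfl⟩ a b ha hb hab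
    refine ⟨fun y => a * w y + b * w' y, ⟨fun y hy => ?_, ?_⟩, ?_⟩
    · exact add_nonneg (mul_nonneg ha (hw y hy)) (mul_nonneg hb (hw' y hy))
    · rw [Finset.sum_add_distrib, ← Finset.mul_sum, ← Finset.mul_sum, hw1, hw1']
      linarith
    · simp only [add_smul, Finset.sum_add_distrib, Finset.smul_sum, mul_smul]

theorem Wt.norm_sum_le {Y E : Type*} [SeminormedAddCommGroup E] [NormedSpace ℝ E] {s : Finset Y}
    {w : Y → ℝ} (hw : Wt s w) {f : Y → E} {C : ℝ} (hf : ∀ y ∈ s, ‖f y‖ ≤ C) :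
    ‖∑ y ∈ s, w y • f y‖ ≤ C := by
  calc ‖∑ y ∈ s, w y • f y‖ ≤ ∑ y ∈ s, w y * C := norm_sum_le_of_le _ fun y hy => by
        rw [norm_smul, Real.norm_of_nonneg (hw.1 y hy)]
        exact mul_le_mul_of_nonneg_left (hf y hy) (hw.1 y hy)
    _ = C := by rw [← Finset.sum_mul, hw.2, one_mul]

theorem exists_bound {Y E : Type*} [SeminormedAddCommGroup E] (s : Finset Y) (f : Y → E) :
    ∃ C, 0 ≤ C ∧ ∀ y ∈ s, ‖f y‖ ≤ C :=
  ⟨∑ y ∈ s, ‖f y‖, by positivity, fun _ hy =>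
    Finset.single_le_sum (f := fun y => ‖f y‖) (fun _ _ => norm_nonneg _) hy⟩

section Geo

variable {n m : Type*} [Fintype n] [Fintype m]

/-- The squared length of a row vector. -/
noncomputable def nsq (r : n → ℂ) : ℝ := ∑ i, ‖r i‖ ^ 2

/-- The real quadratic form of a Hermitian matrix. -/
noncomputable def qf (M : Matrix n n ℂ) (r : n → ℂ) : ℝ := (r ⬝ᵥ M.mulVec (star r)).re

theorem nsq_nonneg (r : n → ℂ) : 0 ≤ nsq r := Finset.sum_nonneg fun _ _ => by positivity

theorem sq_le_nsq (r : n → ℂ) (i : n) : ‖r i‖ ^ 2 ≤ nsq r :=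
  Finset.single_le_sum (f := fun i => ‖r i‖ ^ 2) (fun _ _ => by positivity) (Finset.mem_univ i)

theorem conj_apply (Q : Matrix m n ℂ) (M : Matrix n n ℂ) (i j : m) :
    (Q * M * Q.conjTranspose) i j = Q i ⬝ᵥ M.mulVec (star (Q j)) := by
  rw [Matrix.dotProduct_mulVec, ← Matrix.mul_apply_eq_vecMul, Matrix.mul_apply]
  rfl

theorem qf_row (Q : Matrix m n ℂ) (M : Matrix n n ℂ) (i : m) :
    ((Q * M * Q.conjTranspose) i i).re = qf M (Q i) := by
  rw [conj_apply]; rfl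

theorem qf_conj (Q : Matrix n m ℂ) (M : Matrix m m ℂ) (r : n → ℂ) :
    qf (Q * M * Q.conjTranspose) r = qf M (Matrix.vecMul r Q) := by
  rw [qf, qf, ← Matrix.mulVec_mulVec, ← Matrix.mulVec_mulVec, Matrix.dotProduct_mulVec,
    Matrix.star_vecMul]

theorem qf_sum {Y : Type*} (s : Finset Y) (w : Y → ℝ) (S : Y → Matrix n n ℂ) (r : n → ℂ) :
    qf (∑ y ∈ s, w y • S y) r = ∑ y ∈ s, w y * qf (S y) r := by
  simp only [qf, Matrix.sum_mulVec, dotProduct_sum, Complex.re_sum, Matrix.smul_mulVec,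
    dotProduct_smul, Complex.real_smul, Complex.re_ofReal_mul]

/-- Positive definiteness, in a quantitative form. -/
def PD (M : Matrix n n ℂ) : Prop := M.IsHermitian ∧ ∃ c > 0, ∀ r, c * nsq r ≤ qf M r

/-- Hermitian matrices that are bounded from below and above. -/
def Bd (c C : ℝ) (M : Matrix n n ℂ) : Prop :=
  M.IsHermitian ∧ (∀ r, c * nsq r ≤ qf M r) ∧ ∀ i j, ‖M i j‖ ≤ C

theorem isHermitian_sum {Y : Type*} {s : Finset Y} {w : Y → ℝ} {S : Y → Matrix n n ℂ}
    (hS : ∀ y ∈ s, (S y).IsHermitian) : (∑ y ∈ s, w y • S y).IsHermitian := by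
  rw [Matrix.IsHermitian, Matrix.conjTranspose_sum]
  refine Finset.sum_congr rfl fun y hy => ?_
  rw [Matrix.conjTranspose_smul, (hS y hy).eq, star_trivial]

theorem exists_bd {Y : Type*} (s : Finset Y) {S : Y → Matrix n n ℂ} (hS : ∀ y ∈ s, PD (S y)) :
    ∃ c > 0, ∃ C ≥ 0, ∀ w, Wt s w → Bd c C (∑ y ∈ s, w y • S y) := by
  have h1 : ∃ c > 0, ∀ y ∈ s, ∀ r, c * nsq r ≤ qf (S y) r := by
    classical
    induction s using Finset.induction_on with
    | empty => exact ⟨1, one_pos, by simp⟩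
    | insert y s hy ih =>
      obtain ⟨c, hc, h⟩ := ih fun z hz => hS z (Finset.mem_insert_of_mem hz)
      obtain ⟨-, c', hc', h'⟩ := hS y (Finset.mem_insert_self _ _)
      refine ⟨min c c', lt_min hc hc', fun z hz r => ?_⟩
      rcases Finset.mem_insert.1 hz with rfl | hz
      · exact (mul_le_mul_of_nonneg_right (min_le_right _ _) (nsq_nonneg r)).trans (h' r)
      · exact (mul_le_mul_of_nonneg_right (min_le_left _ _) (nsq_nonneg r)).trans (h z hz r)
  obtain ⟨c, hc, h⟩ := h1
  obtain ⟨C, hC, hb⟩ := exists_bound s fun y => (fun p : n × n => S y p.1 p.2)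
  refine ⟨c, hc, C, hC, fun w hw => ⟨isHermitian_sum fun y hy => (hS y hy).1, fun r => ?_,
    fun i j => ?_⟩⟩
  · rw [qf_sum]
    calc c * nsq r = ∑ y ∈ s, w y * (c * nsq r) := by rw [← Finset.sum_mul, hw.2, one_mul]
      _ ≤ _ := Finset.sum_le_sum fun y hy => mul_le_mul_of_nonneg_left (h y hy r) (hw.1 y hy)
  · rw [Matrix.sum_apply]
    refine hw.norm_sum_le (f := fun y => S y i j) fun y hy => ?_
    exact (norm_le_pi_norm (fun p : n × n => S y p.1 p.2) (i, j)).trans (hb y hy)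

theorem norm_dot_le (r s : n → ℂ) : ‖r ⬝ᵥ star s‖ ^ 2 ≤ nsq r * nsq s := by
  calc ‖r ⬝ᵥ star s‖ ^ 2 ≤ (∑ i, ‖r i‖ * ‖s i‖) ^ 2 := by
        gcongr
        refine norm_sum_le_of_le _ fun i _ => ?_
        simp
    _ ≤ _ := Finset.sum_mul_sq_le_sq_mul_sq _ _ _

theorem nsq_vecMul_le (Q : Matrix n m ℂ) :
    ∃ K ≥ 0, ∀ r, nsq (Matrix.vecMul r Q) ≤ K * nsq r := by
  refine ⟨∑ j, nsq fun i => star (Q i j), Finset.sum_nonneg fun _ _ => nsq_nonneg _, fun r => ?_⟩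
  rw [Finset.sum_mul]
  refine Finset.sum_le_sum fun j _ => ?_
  have e : Matrix.vecMul r Q j = r ⬝ᵥ star fun i => star (Q i j) := by
    simp [Matrix.vecMul, dotProduct]
  rw [e, mul_comm]
  exact norm_dot_le r fun i => star (Q i j)

theorem PD.conj [DecidableEq n] {M : Matrix n n ℂ} (hM : PD M) {Q : Matrix n n ℂ}
    (hQ : IsUnit Q.det) :
    PD (Q * M * Q.conjTranspose) := by
  obtain ⟨h, c, hc, hb⟩ := hM
  obtain ⟨K, hK, hK'⟩ := nsq_vecMul_le Q⁻¹
  refine ⟨Matrix.isHermitian_mul_mul_conjTranspose Q h, c / (K + 1), by positivity, fun r => ?_⟩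
  rw [qf_conj]
  refine le_trans ?_ (hb _)
  have := hK' (Matrix.vecMul r Q)
  rw [Matrix.vecMul_vecMul, Matrix.mul_nonsing_inv _ hQ, Matrix.vecMul_one] at this
  rw [div_mul_eq_mul_div, div_le_iff₀ (by positivity), mul_assoc]
  refine mul_le_mul_of_nonneg_left ?_ hc.le
  nlinarith [nsq_nonneg (Matrix.vecMul r Q)]

theorem PD.smul {M : Matrix n n ℂ} (hM : PD M) {a : ℝ} (ha : 0 < a) : PD (a • M) := by
  obtain ⟨h, c, hc, hb⟩ := hM
  refine ⟨?_, a * c, by positivity, fun r => ?_⟩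
  · rw [Matrix.IsHermitian, Matrix.conjTranspose_smul, h.eq, star_trivial]
  · have : qf (a • M) r = a * qf M r := by
      simp [qf, Matrix.smul_mulVec]
    rw [this, mul_assoc]
    exact mul_le_mul_of_nonneg_left (hb r) ha.le

theorem qf_add (M M' : Matrix n n ℂ) (r : n → ℂ) : qf (M + M') r = qf M r + qf M' r := by
  simp [qf, Matrix.add_mulVec]

theorem PD.add {M M' : Matrix n n ℂ} (hM : PD M) (h' : M'.IsHermitian) (hM' : ∀ r, 0 ≤ qf M' r) :
    PD (M + M') := by
  obtain ⟨h, c, hc, hb⟩ := hM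
  refine ⟨h.add h', c, hc, fun r => ?_⟩
  rw [qf_add]
  linarith [hb r, hM' r]

theorem PD.qf_nonneg {M : Matrix n n ℂ} (hM : PD M) (r : n → ℂ) : 0 ≤ qf M r := by
  obtain ⟨_, c, hc, hb⟩ := hM
  exact (mul_nonneg hc.le (nsq_nonneg r)).trans (hb r)

theorem nsq_eq_zero {r : n → ℂ} (h : nsq r ≤ 0) : r = 0 := by
  ext i
  have := (sq_le_nsq r i).trans h
  have : ‖r i‖ = 0 := by nlinarith [norm_nonneg (r i)]
  simpa using this

theorem Bd.det_ne_zero [DecidableEq n] {c C : ℝ} (hc : 0 < c) {M : Matrix n n ℂ} (hM : Bd c C M) :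
    M.det ≠ 0 := by
  intro h
  obtain ⟨v, hv, h0⟩ := Matrix.exists_vecMul_eq_zero_iff.2 h
  apply hv
  apply nsq_eq_zero
  have h1 := hM.2.1 v
  rw [qf, Matrix.dotProduct_mulVec, h0, zero_dotProduct, Complex.zero_re] at h1
  by_contra h2
  have := mul_pos hc (not_le.1 h2)
  linarith

theorem Bd.norm_inv_le [DecidableEq n] {c C : ℝ} (hc : 0 < c) {M : Matrix n n ℂ} (hM : Bd c C M)
    (i j : n) : ‖M⁻¹ i j‖ ≤ 1 / c := by
  have hu : IsUnit M.det := isUnit_iff_ne_zero.2 (hM.det_ne_zero hc)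
  have h1 := hM.2.1 (M⁻¹ i)
  have h2 : qf M (M⁻¹ i) ≤ ‖M⁻¹ i i‖ := by
    rw [qf, Matrix.dotProduct_mulVec]
    have : Matrix.vecMul (M⁻¹ i) M = Pi.single i 1 := by
      rw [← Matrix.mul_apply_eq_vecMul, Matrix.nonsing_inv_mul _ hu]
      ext j
      simp [Matrix.one_apply, Pi.single_apply, eq_comm]
    rw [this, single_dotProduct, one_mul]
    exact (Complex.re_le_norm _).trans (by simp)
  have h3 := sq_le_nsq (M⁻¹ i) i
  have hi : c * ‖M⁻¹ i i‖ ≤ 1 := by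
    by_contra! h
    have : 0 < ‖M⁻¹ i i‖ := by
      rcases (norm_nonneg (M⁻¹ i i)).eq_or_lt with h0 | h0
      · rw [← h0] at h; norm_num at h
      · exact h0
    nlinarith
  have h4 := sq_le_nsq (M⁻¹ i) j
  rw [le_div_iff₀ hc]
  have h5 : (‖M⁻¹ i j‖ * c) ^ 2 ≤ 1 := by
    have : c * (c * ‖M⁻¹ i j‖ ^ 2) ≤ c * ‖M⁻¹ i i‖ := by gcongr; nlinarith
    nlinarith
  exact (sq_le_one_iff₀ (by positivity)).1 h5

theorem norm_mul_le {l : Type*} {A : Matrix l n ℂ} {B : Matrix n m ℂ} {a b : ℝ} (ha : 0 ≤ a)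
    (hA : ∀ i j, ‖A i j‖ ≤ a) (hB : ∀ i j, ‖B i j‖ ≤ b) (i : l) (j : m) :
    ‖(A * B) i j‖ ≤ Fintype.card n * (a * b) := by
  rw [Matrix.mul_apply]
  calc ‖∑ k, A i k * B k j‖ ≤ ∑ _k : n, a * b := norm_sum_le_of_le _ fun k _ => by
        rw [norm_mul]
        exact mul_le_mul (hA i k) (hB k j) (norm_nonneg _) ha
    _ = _ := by simp

theorem exists_norm_le (A : Matrix m n ℂ) : ∃ a ≥ 0, ∀ i j, ‖A i j‖ ≤ a := by
  obtain ⟨C, hC, h⟩ := exists_bound Finset.univ fun p : m × n => A p.1 p.2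
  exact ⟨C, hC, fun i j => h (i, j) (Finset.mem_univ _)⟩

theorem Wt.norm_sum_apply_le {Y : Type*} (s : Finset Y) (V : Y → Matrix m n ℂ) :
    ∃ K ≥ 0, ∀ w, Wt s w → ∀ i j, ‖(∑ y ∈ s, w y • V y) i j‖ ≤ K := by
  obtain ⟨C, hC, hb⟩ := exists_bound s fun y => (fun p : m × n => V y p.1 p.2)
  refine ⟨C, hC, fun w hw i j => ?_⟩
  rw [Matrix.sum_apply]
  refine hw.norm_sum_le (f := fun y => V y i j) fun y hy => ?_
  exact (norm_le_pi_norm (fun p : m × n => V y p.1 p.2) (i, j)).trans (hb y hy)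

theorem Bd.norm_det_le [DecidableEq n] {c C : ℝ} {M : Matrix n n ℂ} (hM : Bd c C M) :
    ‖M.det‖ ≤ (Fintype.card n).factorial * C ^ Fintype.card n := by
  have := Matrix.det_le (A := M) (abv := NormedField.toAbsoluteValue ℂ) (x := C) hM.2.2
  rw [nsmul_eq_mul] at this
  exact this

/-- If `Q M Qᴴ` is diagonal, its entries are bounded by the determinant. -/
theorem diag_le [DecidableEq n] {M Q : Matrix n n ℂ} {c : ℝ} (hc : 0 < c)
    (hM : M.IsHermitian) (hrow : ∀ i, c ≤ qf M (Q i))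
    (hd : ∀ i j, i ≠ j → (Q * M * Q.conjTranspose) i j = 0) :
    ∏ i, qf M (Q i) = ‖Q.det‖ ^ 2 * ‖M.det‖ := by
  have h1 : Q * M * Q.conjTranspose = Matrix.diagonal fun i => ((qf M (Q i) : ℝ) : ℂ) := by
    ext i j
    by_cases h : i = j
    · subst h
      rw [Matrix.diagonal_apply_eq, ← qf_row]
      have h2 := (Matrix.isHermitian_mul_mul_conjTranspose Q hM).apply i i
      exact (Complex.conj_eq_iff_re.1 h2).symm
    · rw [hd i j h, Matrix.diagonal_apply_ne _ h]
  have h2 := congrArg (fun A => ‖Matrix.det A‖) h1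
  simp only [Matrix.det_mul, Matrix.det_conjTranspose, Matrix.det_diagonal, norm_mul, norm_star,
    norm_prod] at h2
  rw [Finset.prod_congr rfl fun i _ => Complex.norm_of_nonneg (hc.le.trans (hrow i))] at h2
  rw [← h2]
  ring

end Geo

section Disc

variable {O : Type*} [CommRing O]

/-- A discrete embedding of a ring into the complex numbers. -/
structure Disc (ι : O →+* ℂ) : Prop where
  finite : ∀ C : ℝ, {x | ‖ι x‖ ≤ C}.Finite
  one_le : ∀ x, x ≠ 0 → 1 ≤ ‖ι x‖

variable {ι : O →+* ℂ}

theorem Disc.injective (h : Disc ι) : Function.Injective ι := by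
  refine (injective_iff_map_eq_zero ι).2 fun x hx => ?_
  by_contra h0
  have := h.one_le x h0
  rw [hx, norm_zero] at this
  linarith

theorem Disc.norm_unit (h : Disc ι) (u : Oˣ) : ‖ι u‖ = 1 := by
  have : Nontrivial O := ι.domain_nontrivial
  have h1 := h.one_le u u.ne_zero
  have h2 := h.one_le (u⁻¹ : Oˣ) (u⁻¹).ne_zero
  have h3 : ‖ι u‖ * ‖ι (u⁻¹ : Oˣ)‖ = 1 := by rw [← norm_mul, ← map_mul, u.mul_inv]; simp
  nlinarith

variable {n m : Type*} [Fintype n] [DecidableEq n] [Fintype m]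

theorem Disc.finite_matrix (h : Disc ι) (C : ℝ) :
    {A : Matrix m n O | ∀ i j, ‖ι (A i j)‖ ≤ C}.Finite := by
  have := Set.Finite.pi fun _ : m => Set.Finite.pi fun _ : n => h.finite C
  refine this.subset fun A hA => ?_
  simp only [Set.mem_pi, Set.mem_univ, true_implies]
  exact hA

theorem Disc.one_le_nsq (h : Disc ι) {r : n → O} (hr : r ≠ 0) : 1 ≤ nsq fun i => ι (r i) := by
  obtain ⟨i, hi⟩ := Function.ne_iff.1 hr
  have := h.one_le _ hi
  exact le_trans (by nlinarith) (sq_le_nsq _ i)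

theorem Disc.row_ne_zero {Q : Matrix n n O} (hQ : Q.det ≠ 0) (i : n) : Q i ≠ 0 :=
  fun h0 => hQ (Matrix.det_eq_zero_of_row_eq_zero i fun j => congrFun h0 j)

theorem Disc.det_mul_ne_zero (h : Disc ι) {q : Matrix n n O} (hq : q.det ≠ 0)
    (γ : Matrix.GeneralLinearGroup n O) : (q * γ.val).det ≠ 0 := by
  have : IsDomain O := h.injective.isDomain
  rw [Matrix.det_mul]
  exact mul_ne_zero hq ((Matrix.isUnits_det_units γ).ne_zero)

theorem Disc.norm_det_mul (h : Disc ι) (q : Matrix n n O) (γ : Matrix.GeneralLinearGroup n O) :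
    ‖((q * γ.val).map ι).det‖ = ‖ι q.det‖ := by
  have h1 := h.norm_unit (Matrix.GeneralLinearGroup.det γ)
  rw [Matrix.GeneralLinearGroup.val_det_apply] at h1
  rw [← RingHom.mapMatrix_apply, ← RingHom.map_det, Matrix.det_mul, map_mul, norm_mul, h1, mul_one]

theorem Disc.finite_of_norm (h : Disc ι) {q : Matrix n n O} (hq : q.det ≠ 0) (C : ℝ)
    {G : Set (Matrix.GeneralLinearGroup n O)}
    (hG : ∀ γ ∈ G, ∀ i, nsq (((q * γ.val).map ι) i) ≤ C) : G.Finite := by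
  have : IsDomain O := h.injective.isDomain
  refine Set.Finite.of_finite_image (f := fun γ => q * γ.val)
    ((h.finite_matrix (m := n) (C + 1)).subset ?_) ?_
  · rintro _ ⟨γ, hγ, rfl⟩ i j
    have h1 := hG γ hγ i
    have h2 := sq_le_nsq (((q * γ.val).map ι) i) j
    rw [Matrix.map_apply] at h2
    nlinarith [norm_nonneg (ι ((q * γ.val) i j))]
  · intro γ _ γ' _ e
    refine Units.ext ?_
    have h1 := congrArg (q.adjugate * ·) e
    simp only [← Matrix.mul_assoc, Matrix.adjugate_mul, Matrix.smul_mul, Matrix.one_mul] at h1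
    ext i j
    exact mul_left_cancel₀ hq (congrFun (congrFun h1 i) j)

end Disc

section

variable {O : Type*} [CommRing O] {ι : O →+* ℂ} {n Y : Type*} [Fintype n] [DecidableEq n]

theorem Disc.le_qf (h : Disc ι) {c C : ℝ} (hc : 0 < c) {M : Matrix n n ℂ} (hM : Bd c C M)
    {Q : Matrix n n O} (hQ : Q.det ≠ 0) (i : n) : c ≤ qf M ((Q.map ι) i) := by
  have h1 := h.one_le_nsq (Disc.row_ne_zero hQ i)
  have h2 := hM.2.1 ((Q.map ι) i)
  have h3 : nsq ((Q.map ι) i) = nsq fun j => ι (Q i j) := rfl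
  rw [h3] at h2
  nlinarith

theorem Disc.finite_diag (h : Disc ι) (s : Finset Y) {S : Y → Matrix n n ℂ}
    (hS : ∀ y ∈ s, PD (S y)) {q : Matrix n n O} (hq : q.det ≠ 0) :
    {γ : Matrix.GeneralLinearGroup n O | ∃ w, Wt s w ∧ ∀ i j, i ≠ j →
      ((q * γ.val).map ι * (∑ y ∈ s, w y • S y) * ((q * γ.val).map ι).conjTranspose) i j =
        0}.Finite := by
  obtain ⟨c, hc, C, hC, hb⟩ := exists_bd s hS
  refine h.finite_of_norm hq
    (‖ι q.det‖ ^ 2 * ((Fintype.card n).factorial * C ^ Fintype.card n) /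
      c ^ (Fintype.card n - 1) / c) ?_
  rintro γ ⟨w, hw, h0⟩ i
  have hM := hb w hw
  have hrow := h.le_qf hc hM (h.det_mul_ne_zero hq γ)
  have h1 := diag_le hc hM.1 hrow h0
  rw [h.norm_det_mul, ← Finset.mul_prod_erase _ _ (Finset.mem_univ i)] at h1
  have h2 : c ^ (Fintype.card n - 1) ≤
      ∏ j ∈ Finset.univ.erase i, qf (∑ y ∈ s, w y • S y) (((q * γ.val).map ι) j) := by
    have : c ^ (Fintype.card n - 1) = ∏ j ∈ Finset.univ.erase i, c := by
      rw [Finset.prod_const, Finset.card_erase_of_mem (Finset.mem_univ i), Finset.card_univ]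
    rw [this]
    exact Finset.prod_le_prod (fun _ _ => hc.le) fun j _ => hrow j
  have h3 := hM.norm_det_le
  have h4 := hM.2.1 (((q * γ.val).map ι) i)
  have hcp : 0 < c ^ (Fintype.card n - 1) := by positivity
  rw [le_div_iff₀ hc, le_div_iff₀ hcp]
  calc nsq (((q * γ.val).map ι) i) * c * c ^ (Fintype.card n - 1)
      ≤ qf (∑ y ∈ s, w y • S y) (((q * γ.val).map ι) i) * c ^ (Fintype.card n - 1) := by
        gcongr; linarith
    _ ≤ qf (∑ y ∈ s, w y • S y) (((q * γ.val).map ι) i) *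
        ∏ j ∈ Finset.univ.erase i, qf (∑ y ∈ s, w y • S y) (((q * γ.val).map ι) j) := by
        have := hc.le.trans (hrow i)
        gcongr
    _ = ‖ι q.det‖ ^ 2 * ‖(∑ y ∈ s, w y • S y).det‖ := h1
    _ ≤ _ := by gcongr

theorem re_dot_le {c C : ℝ} (hc : 0 < c) (hC : 0 ≤ C) {M : Matrix (Fin 2) (Fin 2) ℂ}
    (hM : Bd c C M) {r s : Fin 2 → ℂ} (h0 : (r ⬝ᵥ M.mulVec (star s)).re = 0) (hs : 0 < nsq s) :
    c * |(r ⬝ᵥ star s).re| ≤ 4 * C * ‖r 0 * s 1 - r 1 * s 0‖ := by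
  set p := r ⬝ᵥ star s with hp
  set D := r 0 * s 1 - r 1 * s 0 with hD
  have hns : (nsq s : ℂ) = s 0 * star (s 0) + s 1 * star (s 1) := by
    simp [nsq, Complex.mul_conj, Complex.normSq_eq_norm_sq]
  have hMs : (((s ⬝ᵥ M.mulVec (star s)).re : ℝ) : ℂ) = s ⬝ᵥ M.mulVec (star s) := by
    have h1 := (Matrix.isHermitian_mul_mul_conjTranspose (Matrix.of fun _ : Fin 1 => s)
      hM.1).apply 0 0
    rw [conj_apply] at h1
    exact Complex.conj_eq_iff_re.1 h1
  have e : (nsq s : ℂ) * (r ⬝ᵥ M.mulVec (star s)) = p * (qf M s : ℝ) +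
      D * (star (s 1) * (M 0 0 * star (s 0) + M 0 1 * star (s 1)) -
        star (s 0) * (M 1 0 * star (s 0) + M 1 1 * star (s 1))) := by
    rw [qf, hMs, hns, hp, hD]
    simp [dotProduct, Matrix.mulVec, Fin.sum_univ_two]
    ring
  have e2 := congrArg Complex.re e
  rw [Complex.re_ofReal_mul, h0, mul_zero, Complex.add_re, Complex.re_mul_ofReal] at e2
  have hb : ‖star (s 1) * (M 0 0 * star (s 0) + M 0 1 * star (s 1)) -
        star (s 0) * (M 1 0 * star (s 0) + M 1 1 * star (s 1))‖ ≤ 4 * C * nsq s := by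
    have key : ∀ i j, ‖M i j‖ ≤ C := hM.2.2
    have hN : nsq s = ‖s 0‖ ^ 2 + ‖s 1‖ ^ 2 := by simp [nsq]
    have h3 : ∀ a b i j, ‖star (s a) * (M i j * star (s b))‖ ≤ C * (‖s a‖ * ‖s b‖) := by
      intro a b i j
      rw [norm_mul, norm_mul, norm_star, norm_star]
      have := mul_le_mul_of_nonneg_right (key i j) (mul_nonneg (norm_nonneg (s a))
        (norm_nonneg (s b)))
      linarith
    rw [mul_add, mul_add]
    refine (norm_sub_le _ _).trans ?_
    have g1 := norm_add_le (star (s 1) * (M 0 0 * star (s 0))) (star (s 1) * (M 0 1 * star (s 1)))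
    have g2 := norm_add_le (star (s 0) * (M 1 0 * star (s 0))) (star (s 0) * (M 1 1 * star (s 1)))
    have k1 := h3 1 0 0 0
    have k2 := h3 1 1 0 1
    have k3 := h3 0 0 1 0
    have k4 := h3 0 1 1 1
    have k5 : ‖s 0‖ * ‖s 1‖ ≤ ‖s 0‖ ^ 2 + ‖s 1‖ ^ 2 := by
      nlinarith [sq_nonneg (‖s 0‖ - ‖s 1‖), sq_nonneg (‖s 0‖), sq_nonneg ‖s 1‖]
    rw [hN]
    nlinarith [mul_le_mul_of_nonneg_left k5 hC, sq_nonneg (‖s 0‖), sq_nonneg ‖s 1‖]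
  have h5 : |p.re| * qf M s ≤ ‖D‖ * (4 * C * nsq s) := by
    have h6 : p.re * qf M s = -(D * (star (s 1) * (M 0 0 * star (s 0) + M 0 1 * star (s 1)) -
        star (s 0) * (M 1 0 * star (s 0) + M 1 1 * star (s 1)))).re := by linarith
    have hq : 0 ≤ qf M s := le_trans (by positivity) (hM.2.1 s)
    rw [← abs_of_nonneg hq, ← abs_mul, h6, abs_neg]
    refine (Complex.abs_re_le_norm _).trans ?_
    rw [norm_mul]
    gcongr
  have h6 := mul_le_mul_of_nonneg_left (hM.2.1 s) (abs_nonneg p.re)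
  have h7 : c * |p.re| * nsq s ≤ 4 * C * ‖D‖ * nsq s := by linarith
  exact le_of_mul_le_mul_right h7 hs

theorem nsq_mul_nsq (r s : Fin 2 → ℂ) :
    nsq r * nsq s = ‖r ⬝ᵥ star s‖ ^ 2 + ‖r 0 * s 1 - r 1 * s 0‖ ^ 2 := by
  simp only [nsq, Fin.sum_univ_two, ← Complex.normSq_eq_norm_sq, dotProduct, Pi.star_apply,
    Complex.normSq_apply, Complex.star_def, Complex.add_re, Complex.add_im, Complex.mul_re,
    Complex.mul_im, Complex.conj_re, Complex.conj_im, Complex.sub_re, Complex.sub_im]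
  ring

theorem Disc.finite_re_im (h : Disc ι) (s : Finset Y) {S : Y → Matrix (Fin 2) (Fin 2) ℂ}
    (hS : ∀ y ∈ s, PD (S y)) {q : Matrix (Fin 2) (Fin 2) O} (hq : q.det ≠ 0) :
    {γ : Matrix.GeneralLinearGroup (Fin 2) O |
      (∃ w, Wt s w ∧ (((q * γ.val).map ι * (∑ y ∈ s, w y • S y) *
        ((q * γ.val).map ι).conjTranspose) 0 1).re = 0) ∧
      ∃ w, Wt s w ∧ (((q * γ.val).map ι * (∑ y ∈ s, w y • S y) *
        ((q * γ.val).map ι).conjTranspose) 0 1).im = 0}.Finite := by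
  obtain ⟨c, hc, C, hC, hb⟩ := exists_bd s hS
  set K := 4 * C * ‖ι q.det‖ / c
  refine h.finite_of_norm hq (K ^ 2 + K ^ 2 + ‖ι q.det‖ ^ 2) ?_
  rintro γ ⟨⟨w, hw, h0⟩, w', hw', h0'⟩
  have hdet := h.norm_det_mul q γ
  have hne := h.det_mul_ne_zero hq γ
  set Q := (q * γ.val).map ι with hQ
  have hrow : ∀ i, 1 ≤ nsq (Q i) := fun i => h.one_le_nsq (Disc.row_ne_zero hne i)
  rw [conj_apply] at h0 h0'
  have hD : ‖Q 0 0 * Q 1 1 - Q 0 1 * Q 1 0‖ = ‖ι q.det‖ := by rw [← hdet, Matrix.det_fin_two]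
  have h1 := re_dot_le hc hC (hb w hw) h0 (by linarith [hrow 1])
  have h2 := re_dot_le (r := fun j => Complex.I * Q 0 j) hc hC (hb w' hw') (s := Q 1) (by
    have : (fun j => Complex.I * Q 0 j) = Complex.I • Q 0 := rfl
    rw [this, smul_dotProduct, smul_eq_mul, Complex.I_mul_re, h0', neg_zero]) (by linarith [hrow 1])
  have e1 : ((fun j => Complex.I * Q 0 j) ⬝ᵥ star (Q 1)).re = -(Q 0 ⬝ᵥ star (Q 1)).im := by
    have : (fun j => Complex.I * Q 0 j) = Complex.I • Q 0 := rfl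
    rw [this, smul_dotProduct, smul_eq_mul, Complex.I_mul_re]
  have e2 : ‖Complex.I * Q 0 0 * Q 1 1 - Complex.I * Q 0 1 * Q 1 0‖ = ‖ι q.det‖ := by
    rw [← hD, mul_assoc, mul_assoc, ← mul_sub, norm_mul, Complex.norm_I, one_mul]
  rw [hD, ← le_div_iff₀' hc] at h1
  rw [e1, e2, abs_neg, ← le_div_iff₀' hc] at h2
  have h3 := nsq_mul_nsq (Q 0) (Q 1)
  rw [hD, ← Complex.normSq_eq_norm_sq, Complex.normSq_apply] at h3
  have h4 : (Q 0 ⬝ᵥ star (Q 1)).re * (Q 0 ⬝ᵥ star (Q 1)).re ≤ K ^ 2 := by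
    rw [← sq, ← sq_abs]; exact pow_le_pow_left₀ (abs_nonneg _) h1 2
  have h5 : (Q 0 ⬝ᵥ star (Q 1)).im * (Q 0 ⬝ᵥ star (Q 1)).im ≤ K ^ 2 := by
    rw [← sq, ← sq_abs]; exact pow_le_pow_left₀ (abs_nonneg _) h2 2
  intro i
  have := hrow 0
  have := hrow 1
  fin_cases i
  · show nsq (Q 0) ≤ _
    nlinarith
  · show nsq (Q 1) ≤ _
    nlinarith

end

/-! ### Imaginary quadratic rings -/

/-- The ring `ℤ[ω]` with `ω = (1 + √-(4 N + 3)) / 2`. -/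
structure QuadRing {O : Type*} [CommRing O] (ι : O →+* ℂ) (ω : O) (N : ℕ) : Prop where
  rep : ∀ x, ∃ a b : ℤ, x = a + b * ω
  re : (ι ω).re = 1 / 2
  im : (ι ω).im = √(4 * N + 3) / 2

namespace QuadRing

variable {O : Type*} [CommRing O] {ι : O →+* ℂ} {ω : O} {N : ℕ} (h : QuadRing ι ω N)
include h

theorem im_pos : 0 < (ι ω).im := by rw [h.im]; positivity

theorem im_sq : (ι ω).im ^ 2 = (4 * N + 3) / 4 := by
  rw [h.im, div_pow, Real.sq_sqrt (by positivity)]; norm_num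

theorem re_apply (a b : ℤ) : (ι (a + b * ω)).re = a + b / 2 := by
  simp [h.re]; ring

theorem im_apply (a b : ℤ) : (ι (a + b * ω)).im = b * (ι ω).im := by
  simp

theorem norm_sq (a b : ℤ) : ‖ι (a + b * ω)‖ ^ 2 = (a ^ 2 + a * b + (N + 1) * b ^ 2 : ℤ) := by
  rw [← Complex.normSq_eq_norm_sq, Complex.normSq_apply, h.re_apply, h.im_apply]
  push_cast
  linear_combination (b : ℝ) ^ 2 * h.im_sq

theorem eq_zero_of {a b : ℤ} (h0 : ι (a + b * ω) = 0) : a = 0 ∧ b = 0 := by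
  have h1 := h.re_apply a b
  have h2 := h.im_apply a b
  rw [h0] at h1 h2
  have hb : b = 0 := by
    have := h.im_pos
    rw [Complex.zero_im, eq_comm, mul_eq_zero] at h2
    exact_mod_cast h2.resolve_right this.ne'
  subst hb
  exact ⟨by simpa [eq_comm] using h1, rfl⟩

theorem disc : Disc ι where
  finite C := by
    obtain ⟨K, hK⟩ := exists_nat_gt (C / (ι ω).im)
    obtain ⟨K', hK'⟩ := exists_nat_gt (C + K)
    refine ((Set.finite_Icc (-K' : ℤ) K').prod (Set.finite_Icc (-K : ℤ) K)).image
      (fun p : ℤ × ℤ => (p.1 : O) + p.2 * ω) |>.subset ?_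
    intro x hx
    obtain ⟨a, b, rfl⟩ := h.rep x
    rw [Set.mem_ofPred_eq] at hx
    have h1 := (Complex.abs_re_le_norm _).trans hx
    have h2 := (Complex.abs_im_le_norm _).trans hx
    rw [h.re_apply] at h1
    rw [h.im_apply, abs_mul, abs_of_pos h.im_pos, ← le_div_iff₀ h.im_pos] at h2
    have h3 : |(b : ℝ)| ≤ K := h2.trans hK.le
    have h4 : |(a : ℝ)| ≤ K' := by
      have := abs_sub_abs_le_abs_sub (a : ℝ) (-(b / 2))
      rw [sub_neg_eq_add, abs_neg, abs_div, abs_two] at this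
      linarith [abs_nonneg (b : ℝ)]
    refine ⟨(a, b), ⟨?_, ?_⟩, rfl⟩
    · rw [Set.mem_Icc, ← abs_le]; exact_mod_cast h4
    · rw [Set.mem_Icc, ← abs_le]; exact_mod_cast h3
  one_le x hx := by
    obtain ⟨a, b, rfl⟩ := h.rep x
    have h1 := h.norm_sq a b
    have h2 : 0 < ‖ι (a + b * ω)‖ := by
      rw [norm_pos_iff]
      intro h0
      obtain ⟨rfl, rfl⟩ := h.eq_zero_of h0
      simp at hx
    have h3 : (0 : ℝ) < (a ^ 2 + a * b + (N + 1) * b ^ 2 : ℤ) := by rw [← h1]; positivity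
    have h4 : (1 : ℝ) ≤ (a ^ 2 + a * b + (N + 1) * b ^ 2 : ℤ) := by
      exact_mod_cast Int.cast_pos.1 h3
    rw [← h1] at h4
    nlinarith

theorem injective : Function.Injective ι := h.disc.injective

theorem isDomain : IsDomain O := h.injective.isDomain

/-- The square root of `-(4 N + 3)`. -/
theorem map_sqrt : ι (2 * ω - 1) = (√(4 * N + 3) : ℝ) * Complex.I := by
  have h2 : ι 2 = 2 := map_ofNat ι 2
  apply Complex.ext
  · simp [h.re, h2]
  · simp [h.im, h2]; ring

theorem units (hN : 1 ≤ N) (u : Oˣ) : u = 1 ∨ u = -1 := by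
  obtain ⟨a, b, hab⟩ := h.rep u
  have h1 := h.norm_sq a b
  rw [← hab, h.disc.norm_unit, one_pow] at h1
  have h1 : a ^ 2 + a * b + (N + 1) * b ^ 2 = 1 := by exact_mod_cast h1.symm
  have hN' : (1 : ℤ) ≤ N := by exact_mod_cast hN
  have hb : b = 0 := by
    by_contra hb
    have : 1 ≤ b ^ 2 := Int.one_le_abs (pow_ne_zero 2 hb) |>.trans (by rw [abs_of_nonneg (sq_nonneg b)])
    nlinarith [sq_nonneg (2 * a + b)]
  subst hb
  have : a * a = 1 := by linarith
  rcases Int.eq_one_or_neg_one_of_mul_eq_one this with rfl | rfl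
  · exact Or.inl (Units.ext (by simpa using hab))
  · exact Or.inr (Units.ext (by simpa using hab))

end QuadRing

/-- The sign of a unit. -/
noncomputable def unitSign {O : Type*} [CommRing O] {ι : O →+* ℂ} {ω : O} {N : ℕ}
    (h : QuadRing ι ω N) (hN : 1 ≤ N) : Oˣ →* ℝ where
  toFun u := (ι u).re
  map_one' := by simp
  map_mul' u v := by
    rcases h.units hN u with rfl | rfl <;> rcases h.units hN v with rfl | rfl <;> simp

/-! ### Free abelian subgroups -/

theorem polyZ_range {Γ : Type*} [Group Γ] {u : ℕ} (f : Multiplicative (Fin u → ℤ) →* Γ)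
    (hf : Function.Injective f) : PolyZ u f.range := by
  let K : ℕ → Subgroup (Multiplicative (Fin u → ℤ)) := fun j =>
    { carrier := {v | ∀ i : Fin u, j ≤ i → v.toAdd i = 0}
      mul_mem' := fun {v w} hv hw i hi => by
        rw [toAdd_mul, Pi.add_apply, hv i hi, hw i hi, add_zero]
      one_mem' := fun i _ => rfl
      inv_mem' := fun {v} hv i hi => by rw [toAdd_inv, Pi.neg_apply, hv i hi, neg_zero] }
  have key : ∀ j ≤ u, PolyZ j ((K j).map f) := by
    intro j
    induction j with
    | zero =>
      intro _
      have : K 0 = ⊥ := by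
        rw [eq_bot_iff]
        intro v hv
        exact Subgroup.mem_bot.2 (Multiplicative.toAdd.injective (funext fun i => hv i (by omega)))
      rw [this, Subgroup.map_bot]
      exact .bot
    | succ j ih =>
      intro hj
      let e : Multiplicative (Fin u → ℤ) := .ofAdd (Pi.single ⟨j, hj⟩ 1)
      refine .step (f e) (ih (by omega)) ?_ ?_ ⟨e, fun i hi => ?_, rfl⟩
        (Subgroup.map_mono fun v hv i hi => hv i (by omega)) ?_
      · rintro _ ⟨v, -, rfl⟩
        rw [← map_mul, ← map_mul, mul_comm]
      · rintro n hn ⟨v, hv, e'⟩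
        rw [← map_pow] at e'
        have := hv ⟨j, hj⟩ le_rfl
        rw [hf e', toAdd_pow] at this
        simp [e] at this
        omega
      · have : i ≠ ⟨j, hj⟩ := fun h => by rw [h] at hi; simp at hi
        simp [e, this]
      · rintro _ ⟨v, hv, rfl⟩
        refine ⟨v.toAdd ⟨j, hj⟩, f (v * (e ^ v.toAdd ⟨j, hj⟩)⁻¹), ⟨_, fun i hi => ?_, rfl⟩, ?_⟩
        · rw [toAdd_mul, toAdd_inv, toAdd_zpow]
          by_cases hij : i = ⟨j, hj⟩
          · subst hij; simp [e]
          · have : (i : ℕ) ≠ j := fun h => hij (Fin.ext h)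
            simp [e, hij, hv i (by omega)]
        · rw [map_mul, map_inv, map_zpow]; group
  have := key u le_rfl
  have hu : (K u) = ⊤ := eq_top_iff.2 fun v _ i hi => by omega
  rwa [hu, ← MonoidHom.range_eq_map] at this

/-! ### Coordinates -/

/-- Concatenation of the first `u` coordinates of `v` with `w`. -/
def app (u : ℕ) (v w : ℕ → ℝ) : ℕ → ℝ := fun i => if i < u then v i else w (i - u)

theorem app_of_lt {u : ℕ} {v w : ℕ → ℝ} {i : ℕ} (hi : i < u) : app u v w i = v i := if_pos hi

theorem app_add (u : ℕ) (v w : ℕ → ℝ) (i : ℕ) : app u v w (u + i) = w i := by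
  simp [app]

theorem tl_iterate (u : ℕ) (v : ℕ → ℝ) : tl^[u] v = fun i => v (u + i) := by
  induction u generalizing v with
  | zero => simp
  | succ u ih =>
    rw [Function.iterate_succ_apply, ih]
    ext i
    simp only [tl]
    congr 1
    omega

theorem tl_app (u : ℕ) (v w : ℕ → ℝ) : tl^[u] (app u v w) = w := by
  rw [tl_iterate]
  ext i
  exact app_add u v w i

theorem sum_app {Y : Type*} (s : Finset Y) (c : Y → ℝ) (u : ℕ) (v w : Y → ℕ → ℝ) :
    ∑ y ∈ s, c y • app u (v y) (w y) = app u (∑ y ∈ s, c y • v y) (∑ y ∈ s, c y • w y) := by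
  ext i
  simp only [Finset.sum_apply, Pi.smul_apply, app]
  split_ifs <;> simp

/-- The real and imaginary part. -/
noncomputable def reim : ℂ →ₗ[ℝ] (ℕ → ℝ) :=
  LinearMap.pi fun i => if i = 0 then Complex.reLm else if i = 1 then Complex.imLm else 0

@[simp] theorem reim_zero (z : ℂ) : reim z 0 = z.re := rfl

@[simp] theorem reim_one (z : ℂ) : reim z 1 = z.im := rfl

variable {J : Type*} {u : ℕ}

/-- The real coordinates of a matrix with two rows. -/
noncomputable def coords (e : (Fin 2 × J) × Fin 2 ≃ Fin u) : Matrix (Fin 2) J ℂ →ₗ[ℝ] (ℕ → ℝ) :=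
  LinearMap.pi fun i => if h : i < u then
    (LinearMap.proj ((e.symm ⟨i, h⟩).2 : ℕ) ∘ₗ reim) ∘ₗ
      ((LinearMap.proj (e.symm ⟨i, h⟩).1.2 : (J → ℂ) →ₗ[ℝ] ℂ) ∘ₗ
        (LinearMap.proj (e.symm ⟨i, h⟩).1.1 : (Fin 2 → J → ℂ) →ₗ[ℝ] (J → ℂ)) ∘ₗ
        (Matrix.ofLinearEquiv ℝ).symm.toLinearMap)
    else 0

theorem coords_apply (e : (Fin 2 × J) × Fin 2 ≃ Fin u) (B : Matrix (Fin 2) J ℂ) (i : Fin 2)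
    (j : J) (b : Fin 2) : coords e B (e ((i, j), b)) = reim (B i j) b := by
  simp [coords]

theorem coords_of_le (e : (Fin 2 × J) × Fin 2 ≃ Fin u) (B : Matrix (Fin 2) J ℂ) {i : ℕ}
    (hi : u ≤ i) : coords e B i = 0 := by
  simp [coords, not_lt.2 hi]

theorem coords_eq_zero (e : (Fin 2 × J) × Fin 2 ≃ Fin u) {B : Matrix (Fin 2) J ℂ}
    (hB : ∀ i < u, coords e B i = 0) : B = 0 := by
  ext i j
  have h0 := hB (e ((i, j), 0)) (Fin.is_lt _)
  have h1 := hB (e ((i, j), 1)) (Fin.is_lt _)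
  rw [coords_apply] at h0 h1
  exact Complex.ext h0 h1

variable [Fintype J] [DecidableEq J] {O : Type*} [CommRing O]

/-! ### The parabolic subgroup -/

/-- The translations. -/
abbrev UM (O J : Type*) := Multiplicative (Matrix (Fin 2) J O)

/-- The Levi factor. -/
abbrev LM (O J : Type*) [CommRing O] [Fintype J] [DecidableEq J] :=
  Matrix.GeneralLinearGroup (Fin 2) O × Matrix.GeneralLinearGroup J O

/-- The action of the Levi factor on the translations. -/
def act : LM O J →* MulAut (UM O J) where
  toFun l :=
    { toFun := fun v => .ofAdd (l.1.val * v.toAdd * (l.2⁻¹).val)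
      invFun := fun v => .ofAdd ((l.1⁻¹).val * v.toAdd * l.2.val)
      left_inv := fun v => by
        simp only [toAdd_ofAdd, Matrix.mul_assoc, Units.inv_mul, Matrix.mul_one]
        rw [← Matrix.mul_assoc, Units.inv_mul, Matrix.one_mul, ofAdd_toAdd]
      right_inv := fun v => by
        simp only [toAdd_ofAdd, Matrix.mul_assoc, Units.mul_inv, Matrix.mul_one]
        rw [← Matrix.mul_assoc, Units.mul_inv, Matrix.one_mul, ofAdd_toAdd]
      map_mul' := fun v w => by
        simp only [toAdd_mul, Matrix.mul_add, Matrix.add_mul, ofAdd_add] }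
  map_one' := by ext v; simp
  map_mul' l l' := by ext v; simp [Matrix.mul_assoc]

theorem toAdd_act (l : LM O J) (v : UM O J) :
    (act l v).toAdd = l.1.val * v.toAdd * (l.2⁻¹).val := rfl

/-- The maximal parabolic group. -/
abbrev PM (O J : Type*) [CommRing O] [Fintype J] [DecidableEq J] := UM O J ⋊[act (O := O) (J := J)] LM O J

/-- The embedding into the general linear group. -/
def toG : PM O J →* Matrix.GeneralLinearGroup (Fin 2 ⊕ J) O :=
  MonoidHom.toHomUnits
    { toFun := fun p => Matrix.fromBlocks p.right.1.val (p.left.toAdd * p.right.2.val) 0 p.right.2.val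
      map_one' := by simp
      map_mul' := fun p p' => by
        simp only [SemidirectProduct.mul_left, SemidirectProduct.mul_right, Prod.fst_mul,
          Prod.snd_mul, Units.val_mul, toAdd_mul, toAdd_act, Matrix.fromBlocks_multiply,
          Matrix.mul_zero, Matrix.zero_mul, add_zero, zero_add, Matrix.add_mul, Matrix.mul_assoc]
        congr 1
        rw [← Matrix.mul_assoc ((p.right.2⁻¹).val), Units.inv_mul, Matrix.one_mul, add_comm] }

theorem toG_val (p : PM O J) : (toG p).val =
    Matrix.fromBlocks p.right.1.val (p.left.toAdd * p.right.2.val) 0 p.right.2.val := rfl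

theorem toG_injective : Function.Injective (toG (O := O) (J := J)) := by
  intro p p' e
  have e := congrArg Units.val e
  rw [toG_val, toG_val, Matrix.fromBlocks_inj] at e
  obtain ⟨e1, e2, -, e3⟩ := e
  have h2 : p.right = p'.right := Prod.ext (Units.ext e1) (Units.ext e3)
  refine SemidirectProduct.ext ?_ h2
  rw [e3] at e2
  have := congrArg (· * (p'.right.2⁻¹).val) e2
  simpa [Matrix.mul_assoc] using this

theorem mem_range_toG {γ : Matrix.GeneralLinearGroup (Fin 2 ⊕ J) O}
    (h : γ.val.toBlocks₂₁ = 0) : γ ∈ (toG (O := O) (J := J)).range := by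
  have h1 := Matrix.isUnits_det_units γ
  rw [← Matrix.fromBlocks_toBlocks γ.val, h, Matrix.det_fromBlocks_zero₂₁, IsUnit.mul_iff] at h1
  let l1 := Matrix.GeneralLinearGroup.mk'' _ h1.1
  let l2 := Matrix.GeneralLinearGroup.mk'' _ h1.2
  refine ⟨⟨.ofAdd (γ.val.toBlocks₁₂ * (l2⁻¹).val), (l1, l2)⟩, Units.ext ?_⟩
  rw [toG_val]
  conv_rhs => rw [← Matrix.fromBlocks_toBlocks γ.val, h]
  refine Matrix.fromBlocks_inj.2 ⟨rfl, ?_, rfl, rfl⟩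
  rw [toAdd_ofAdd, Matrix.mul_assoc, Units.inv_mul, Matrix.mul_one]

theorem det_toG (p : PM O J) : Matrix.GeneralLinearGroup.det (toG p) =
    Matrix.GeneralLinearGroup.det p.right.1 * Matrix.GeneralLinearGroup.det p.right.2 := by
  refine Units.ext ?_
  rw [Units.val_mul, Matrix.GeneralLinearGroup.val_det_apply, toG_val,
    Matrix.det_fromBlocks_zero₂₁]
  rfl

theorem left_mul (p p' : PM O J) : (p * p').left.toAdd =
    p.left.toAdd + p.right.1.val * p'.left.toAdd * (p.right.2⁻¹).val := rfl

theorem bijective_inl_inr : Function.Bijective fun p : UM O J × LM O J =>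
    ((SemidirectProduct.inl p.1 * SemidirectProduct.inr p.2 : PM O J)) := by
  constructor
  · rintro ⟨a, l⟩ ⟨a', l'⟩ e
    have h1 := congrArg SemidirectProduct.left e
    have h2 := congrArg SemidirectProduct.right e
    simp at h1 h2
    simp [h1, h2]
  · intro p
    exact ⟨(p.left, p.right), SemidirectProduct.inl_left_mul_inr_right p⟩

/-! ### The lattice of translations -/

/-- The matrix with prescribed coordinates with respect to `1` and `s`. -/
def latMat (e : (Fin 2 × J) × Fin 2 ≃ Fin u) (s : O) (n : Fin u → ℤ) : Matrix (Fin 2) J O :=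
  Matrix.of fun i j => n (e ((i, j), 0)) + n (e ((i, j), 1)) * s

theorem polyZ_inl {ι : O →+* ℂ} {ω : O} {N : ℕ} (h : QuadRing ι ω N)
    (e : (Fin 2 × J) × Fin 2 ≃ Fin u) :
    PolyZ u (SemidirectProduct.inl : UM O J →* PM O J).range := by
  let V : Multiplicative (Fin u → ℤ) →* UM O J :=
    { toFun := fun n => .ofAdd (latMat e ω n.toAdd)
      map_one' := by
        rw [← ofAdd_zero]; congr 1; ext i j; simp [latMat]
      map_mul' := fun n m => by
        rw [← ofAdd_add]; congr 1; ext i j; simp [latMat]; ring }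
  have hV : Function.Injective V := by
    refine (injective_iff_map_eq_one V).2 fun n hn => ?_
    have h0 : latMat e ω n.toAdd = 0 := hn
    refine Multiplicative.toAdd.injective (funext fun k => ?_)
    obtain ⟨⟨⟨i, j⟩, b⟩, rfl⟩ := e.surjective k
    have h1 := congrArg ι (congrFun (congrFun h0 i) j)
    rw [Matrix.zero_apply, map_zero] at h1
    obtain ⟨h2, h3⟩ := h.eq_zero_of h1
    fin_cases b
    · exact h2
    · exact h3
  have hV' : Function.Surjective V := by
    intro A
    choose a b hab using fun i j => h.rep (A.toAdd i j)
    refine ⟨.ofAdd fun k => if (e.symm k).2 = 0 then a (e.symm k).1.1 (e.symm k).1.2 else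
      b (e.symm k).1.1 (e.symm k).1.2, Multiplicative.toAdd.injective ?_⟩
    ext i j
    simp [V, latMat, hab i j]
  have := polyZ_range (SemidirectProduct.inl.comp V)
    (SemidirectProduct.inl_injective.comp hV : Function.Injective
      ((SemidirectProduct.inl : UM O J →* PM O J).comp V))
  rwa [MonoidHom.range_comp, MonoidHom.range_eq_top.2 hV', ← MonoidHom.range_eq_map] at this

end ListCx

namespace ListCx

/-! ### Conjugation of Hermitian forms -/

section conj

variable {m n l : Type*} [Fintype m] [Fintype n] [Fintype l]

/-- The map `M ↦ Q M Q*`. -/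
def cj (Q : Matrix m n ℂ) : Matrix n n ℂ →ₗ[ℝ] Matrix m m ℂ where
  toFun M := Q * M * Q.conjTranspose
  map_add' M M' := by rw [Matrix.mul_add, Matrix.add_mul]
  map_smul' a M := by simp

theorem cj_apply (Q : Matrix m n ℂ) (M : Matrix n n ℂ) : cj Q M = Q * M * Q.conjTranspose := rfl

theorem cj_mul (P : Matrix l m ℂ) (Q : Matrix m n ℂ) (M : Matrix n n ℂ) :
    cj (P * Q) M = cj P (cj Q M) := by
  simp only [cj_apply, Matrix.conjTranspose_mul, Matrix.mul_assoc]

theorem cj_isHermitian (Q : Matrix m n ℂ) {M : Matrix n n ℂ} (hM : M.IsHermitian) :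
    (cj Q M).IsHermitian := by
  rw [cj_apply]
  exact Matrix.isHermitian_mul_mul_conjTranspose Q hM

end conj

theorem exists_wt_map {X E : Type*} [DecidableEq X] [AddCommGroup E] [Module ℝ E] {f : X → E} {l : List X} {v : E}
    (hv : v ∈ convexHull ℝ {x | x ∈ l.map f}) :
    ∃ w, Wt l.toFinset w ∧ ∑ y ∈ l.toFinset, w y • f y = v :=
  exists_wt hv fun _ hx => by
    obtain ⟨y, hy, rfl⟩ := List.mem_map.1 hx
    exact ⟨y, List.mem_toFinset.2 hy, rfl⟩

variable {O : Type*} [CommRing O] {J : Type*} [Fintype J] [DecidableEq J] {ι : O →+* ℂ}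

/-- The form `S` moved by `y`. -/
noncomputable def tw (ι : O →+* ℂ) (S : Matrix J J ℂ) (y : Matrix.GeneralLinearGroup J O) :
    Matrix J J ℂ := cj (y.val.map ι) S

theorem isUnit_det_map (y : Matrix.GeneralLinearGroup J O) : IsUnit (y.val.map ι).det := by
  rw [← RingHom.mapMatrix_apply, ← RingHom.map_det]
  exact (Matrix.isUnits_det_units y).map ι

theorem pd_tw {S : Matrix J J ℂ} (hS : PD S) (y : Matrix.GeneralLinearGroup J O) :
    PD (tw ι S y) := hS.conj (isUnit_det_map y)

/-! ### Frames -/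

/-- A matrix `q` which is invertible up to the integer `μ`, with a cofactor `E` any two columns of
which are jointly unimodular, apart from two special ones. -/
structure Frame (O J : Type*) [CommRing O] [Fintype J] [DecidableEq J] where
  sp : Fin 2 → J
  sp_injective : Function.Injective sp
  q : Matrix J J O
  E : Matrix J J O
  μ : ℕ
  μ_pos : 0 < μ
  q_mul_E : q * E = (μ : O) • 1
  E_mul_q : E * q = (μ : O) • 1
  prim : ∀ j, ∃ R : J → O, ∑ i, R i * E i j = 1
  unimod : ∀ p : Fin 2 → J, Function.Injective p → (∃ a, p a ∉ Set.range sp) →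
    ∃ R : Matrix (Fin 2) J O, R * E.submatrix id p = 1

/-- A frame together with coordinates on the off-diagonal entries of Hermitian matrices. -/
structure Datum (O J : Type*) [CommRing O] [Fintype J] [DecidableEq J] extends Frame O J where
  N : ℕ
  Φ : Matrix J J ℂ →ₗ[ℝ] (ℕ → ℝ)
  hΦ : ∀ H : Matrix J J ℂ, H.IsHermitian → (∀ i < N, Φ H i = 0) → ∀ i j, i ≠ j → H i j = 0

theorem Frame.det_ne_zero [IsDomain O] [CharZero O] (F : Frame O J) : F.q.det ≠ 0 := by
  intro h
  have h1 := congrArg Matrix.det F.q_mul_E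
  rw [Matrix.det_mul, h, zero_mul, Matrix.det_smul, Matrix.det_one, mul_one, eq_comm] at h1
  exact F.μ_pos.ne' (by exact_mod_cast eq_zero_of_pow_eq_zero h1)

namespace Datum

/-- The position of a group element. -/
noncomputable def pos (D : Datum O J) (ι : O →+* ℂ) (S : Matrix J J ℂ)
    (γ : Matrix.GeneralLinearGroup J O) : ℕ → ℝ :=
  D.Φ (cj ((D.q * γ.val).map ι) S)

theorem pos_mul (D : Datum O J) (S : Matrix J J ℂ) (γ y : Matrix.GeneralLinearGroup J O) :
    D.pos ι S (γ * y) = D.Φ (cj ((D.q * γ.val).map ι) (tw ι S y)) := by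
  rw [pos, Units.val_mul, ← Matrix.mul_assoc, Matrix.map_mul, cj_mul, tw]

theorem sum_cj_eq_zero (D : Datum O J) {Y : Type*} (s : Finset Y) {S : Y → Matrix J J ℂ}
    (hS : ∀ y ∈ s, PD (S y)) {w : Y → ℝ} {Q : Matrix J J ℂ}
    (h0 : ∀ i < D.N, D.Φ (cj Q (∑ y ∈ s, w y • S y)) i = 0) (i j : J) (hij : i ≠ j) :
    (Q * (∑ y ∈ s, w y • S y) * Q.conjTranspose) i j = 0 :=
  D.hΦ _ (cj_isHermitian Q (isHermitian_sum fun y hy => (hS y hy).1)) h0 i j hij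

theorem lf_pos (D : Datum O J) [IsDomain O] [CharZero O] (h : Disc ι) {S : Matrix J J ℂ}
    (hS : PD S) : LF (MonoidHom.id (Matrix.GeneralLinearGroup J O))
      fun l => tau D.N (l.map (D.pos ι S)) := by
  classical
  intro l
  refine (h.finite_diag l.toFinset (S := tw ι S) (fun y _ => pd_tw hS y)
    D.toFrame.det_ne_zero).subset ?_
  intro γ hγ
  obtain ⟨v, hv, hv0⟩ := hits_of_tau hγ
  rw [List.map_map] at hv
  obtain ⟨w, hw, rfl⟩ := exists_wt_map hv
  refine ⟨w, hw, fun i j hij => D.sum_cj_eq_zero _ (fun y _ => pd_tw hS y) (fun k hk => ?_) i j hij⟩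
  rw [← hv0 k hk]
  simp only [map_sum, map_smul, Function.comp_apply, MonoidHom.id_apply, pos_mul]

end Datum

/-- The real and imaginary part of the entry in position `(a, b)`. -/
noncomputable def entry {m : Type*} (a b : m) : Matrix m m ℂ →ₗ[ℝ] (ℕ → ℝ) where
  toFun H := reim (H a b)
  map_add' H H' := by rw [Matrix.add_apply, map_add]
  map_smul' c H := by rw [Matrix.smul_apply, map_smul]; rfl

theorem entry_apply {m : Type*} (a b : m) (H : Matrix m m ℂ) : entry a b H = reim (H a b) := rfl

theorem entry_eq_zero {m : Type*} {a b : m} {H : Matrix m m ℂ} (h : ∀ i < 2, entry a b H i = 0) :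
    H a b = 0 :=
  Complex.ext (h 0 (by omega)) (h 1 (by omega))

theorem isHermitian_apply_eq_zero {m : Type*} {H : Matrix m m ℂ} (hH : H.IsHermitian)
    {a b : m} (h : H a b = 0) : H b a = 0 := by
  rw [← hH.apply, h, star_zero]

namespace Frame

/-- The datum of a frame in dimension two. -/
noncomputable def baseDatum (B : Frame O (Fin 2)) : Datum O (Fin 2) :=
  { B with
    N := 2
    Φ := entry 0 1
    hΦ := fun H hH h0 => by
      have h1 := entry_eq_zero h0
      have h2 := isHermitian_apply_eq_zero hH h1
      intro i j hij
      fin_cases i <;> fin_cases j <;> first | exact h1 | exact h2 | simp at hij }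

/-- The inclusion of the special columns. -/
def St (D : Frame O J) : Matrix (Fin 2) J O := Matrix.of fun a j => if j = D.sp a then 1 else 0

/-- The matrix `q` of the enlarged frame. -/
def stepQ (B : Frame O (Fin 2)) (D : Frame O J) : Matrix (Fin 2 ⊕ J) (Fin 2 ⊕ J) O :=
  Matrix.fromBlocks ((D.μ : O) • B.q) (-(B.q * D.St * D.q)) 0 ((B.μ : O) • D.q)

/-- The cofactor of the enlarged frame. -/
def stepE (B : Frame O (Fin 2)) (D : Frame O J) : Matrix (Fin 2 ⊕ J) (Fin 2 ⊕ J) O :=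
  Matrix.fromBlocks B.E D.St 0 D.E

theorem step_unimod (B : Frame O (Fin 2)) (D : Frame O J) (p : Fin 2 → Fin 2 ⊕ J)
    (hp : Function.Injective p) (hs : ∃ a, p a ∉ Set.range (Sum.inl : Fin 2 → Fin 2 ⊕ J)) :
    ∃ R : Matrix (Fin 2) (Fin 2 ⊕ J) O, R * (stepE B D).submatrix id p = 1 := by
  have hl : ∀ (R : Matrix (Fin 2) (Fin 2 ⊕ J) O) a b c, p b = .inl c →
      (R * (stepE B D).submatrix id p) a b = ∑ k, R a (.inl k) * B.E k c := by
    intro R a b c e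
    simp [Matrix.mul_apply, e, stepE, Fintype.sum_sum_type]
  have hr : ∀ (R : Matrix (Fin 2) (Fin 2 ⊕ J) O) a b j, p b = .inr j →
      (R * (stepE B D).submatrix id p) a b =
        ∑ k, R a (.inl k) * D.St k j + ∑ k, R a (.inr k) * D.E k j := by
    intro R a b j e
    simp [Matrix.mul_apply, e, stepE, Fintype.sum_sum_type]
  by_cases hm : ∃ a c, p a = .inl c
  · obtain ⟨a, c, hac⟩ := hm
    obtain ⟨b, hb⟩ := hs
    have hab : a ≠ b := by
      rintro rfl
      exact hb ⟨c, hac.symm⟩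
    obtain ⟨j, hj⟩ : ∃ j, p b = .inr j := by
      rcases e : p b with k | j
      · exact absurd ⟨k, e.symm⟩ hb
      · exact ⟨j, rfl⟩
    obtain ⟨ρ, hρ⟩ := B.prim c
    obtain ⟨σ, hσ⟩ := D.prim j
    have hcov : ∀ i : Fin 2, i = a ∨ i = b := by omega
    refine ⟨Matrix.of fun i => if i = a then
      Sum.elim ρ (fun k => -((∑ k, ρ k * D.St k j) * σ k)) else Sum.elim 0 σ, ?_⟩
    ext i k
    rcases hcov i with rfl | rfl <;> rcases hcov k with rfl | rfl
    · rw [hl _ _ _ _ hac]; simp [hρ]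
    · rw [hr _ _ _ _ hj]
      simp only [Matrix.of_apply, if_true, Sum.elim_inl, Sum.elim_inr, neg_mul, mul_assoc,
        Finset.sum_neg_distrib, ← Finset.mul_sum, hσ, mul_one, add_neg_cancel]
      rw [Matrix.one_apply_ne hab]
    · rw [hl _ _ _ _ hac]; simp [hab.symm]
    · rw [hr _ _ _ _ hj]; simp [hσ, hab.symm]
  · push Not at hm
    have hp' : ∀ a, ∃ j, p a = .inr j := by
      intro a
      rcases e : p a with k | j
      · exact absurd e (hm a k)
      · exact ⟨j, rfl⟩
    choose p' hp' using hp'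
    have hi : Function.Injective p' := fun a b e => hp (by rw [hp', hp', e])
    by_cases hsp : ∃ a, p' a ∉ Set.range D.sp
    · obtain ⟨R, hR⟩ := D.unimod p' hi hsp
      refine ⟨Matrix.of fun i => Sum.elim 0 (R i), ?_⟩
      ext i k
      rw [hr _ _ _ _ (hp' k), ← hR]
      simp [Matrix.mul_apply]
    · push Not at hsp
      choose τ hτ using hsp
      refine ⟨Matrix.of fun i => Sum.elim (fun c => if c = τ i then 1 else 0) 0, ?_⟩
      ext i k
      rw [hr _ _ _ _ (hp' k)]
      have hτi : Function.Injective τ := fun a b e => hi (by rw [← hτ, ← hτ, e])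
      have : (p' k = D.sp (τ i)) ↔ i = k := by
        rw [← hτ k, D.sp_injective.eq_iff, hτi.eq_iff, eq_comm]
      simp only [Matrix.of_apply, Sum.elim_inl, Sum.elim_inr, Pi.zero_apply, zero_mul,
        Finset.sum_const_zero, add_zero, ite_mul, one_mul, Finset.sum_ite_eq', Finset.mem_univ, if_true,
        St, this, Matrix.one_apply]

/-- The enlarged frame. -/
def step (B : Frame O (Fin 2)) (D : Frame O J) : Frame O (Fin 2 ⊕ J) where
  sp := Sum.inl
  sp_injective := Sum.inl_injective
  q := stepQ B D
  E := stepE B D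
  μ := B.μ * D.μ
  μ_pos := Nat.mul_pos B.μ_pos D.μ_pos
  q_mul_E := by
    rw [stepQ, stepE, Matrix.fromBlocks_multiply, ← Matrix.fromBlocks_one,
      Matrix.fromBlocks_smul]
    congr 1
    · simp [B.q_mul_E, smul_smul, mul_comm]
    · rw [Matrix.neg_mul, Matrix.mul_assoc _ D.q, D.q_mul_E]
      simp
    · simp
    · simp [D.q_mul_E, smul_smul]
  E_mul_q := by
    rw [stepQ, stepE, Matrix.fromBlocks_multiply, ← Matrix.fromBlocks_one,
      Matrix.fromBlocks_smul]
    congr 1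
    · simp [B.E_mul_q, smul_smul, mul_comm]
    · rw [Matrix.mul_neg, ← Matrix.mul_assoc, ← Matrix.mul_assoc, B.E_mul_q]
      simp
    · simp
    · simp [D.E_mul_q, smul_smul]
  prim := by
    rintro (c | j)
    · obtain ⟨ρ, hρ⟩ := B.prim c
      exact ⟨Sum.elim ρ 0, by simpa [Fintype.sum_sum_type, stepE] using hρ⟩
    · obtain ⟨σ, hσ⟩ := D.prim j
      exact ⟨Sum.elim 0 σ, by simpa [Fintype.sum_sum_type, stepE] using hσ⟩
  unimod := step_unimod B D

end Frame

namespace Datum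

variable {u : ℕ}

/-- The coordinates of the enlarged datum. -/
noncomputable def stepΦ (D : Datum O J) (e : (Fin 2 × J) × Fin 2 ≃ Fin u) :
    Matrix (Fin 2 ⊕ J) (Fin 2 ⊕ J) ℂ →ₗ[ℝ] (ℕ → ℝ) where
  toFun H := app u (coords e H.toBlocks₁₂) (app 2 (entry 0 1 H.toBlocks₁₁) (D.Φ H.toBlocks₂₂))
  map_add' H H' := by
    have h1 : (H + H').toBlocks₁₂ = H.toBlocks₁₂ + H'.toBlocks₁₂ := rfl
    have h2 : (H + H').toBlocks₁₁ = H.toBlocks₁₁ + H'.toBlocks₁₁ := rfl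
    have h3 : (H + H').toBlocks₂₂ = H.toBlocks₂₂ + H'.toBlocks₂₂ := rfl
    rw [h1, h2, h3, map_add, map_add, map_add]
    ext i
    simp only [app, Pi.add_apply]
    split_ifs <;> rfl
  map_smul' c H := by
    have h1 : (c • H).toBlocks₁₂ = c • H.toBlocks₁₂ := rfl
    have h2 : (c • H).toBlocks₁₁ = c • H.toBlocks₁₁ := rfl
    have h3 : (c • H).toBlocks₂₂ = c • H.toBlocks₂₂ := rfl
    rw [h1, h2, h3, map_smul, map_smul, map_smul]
    ext i
    simp only [app, Pi.smul_apply, RingHom.id_apply]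
    split_ifs <;> rfl

theorem stepΦ_apply (D : Datum O J) (e : (Fin 2 × J) × Fin 2 ≃ Fin u)
    (H : Matrix (Fin 2 ⊕ J) (Fin 2 ⊕ J) ℂ) : D.stepΦ e H =
      app u (coords e H.toBlocks₁₂) (app 2 (entry 0 1 H.toBlocks₁₁) (D.Φ H.toBlocks₂₂)) := rfl

theorem app_eq_zero {v : ℕ} {n : ℕ} {a b : ℕ → ℝ} (h : ∀ i < v + n, app v a b i = 0) :
    (∀ i < v, a i = 0) ∧ ∀ i < n, b i = 0 :=
  ⟨fun i hi => by rw [← h i (by omega), app_of_lt hi],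
    fun i hi => by rw [← h (v + i) (by omega), app_add]⟩

/-- The enlarged datum. -/
noncomputable def step (B : Frame O (Fin 2)) (D : Datum O J) (e : (Fin 2 × J) × Fin 2 ≃ Fin u) :
    Datum O (Fin 2 ⊕ J) :=
  { Frame.step B D.toFrame with
    N := u + (2 + D.N)
    Φ := D.stepΦ e
    hΦ := fun H hH h0 => by
      obtain ⟨h1, h2⟩ := app_eq_zero h0
      obtain ⟨h2, h3⟩ := app_eq_zero h2
      have h1 := coords_eq_zero e h1
      have h1' : ∀ a j, H (.inl a) (.inr j) = 0 := fun a j => congrFun (congrFun h1 a) j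
      have h2 := entry_eq_zero h2
      have h3 := D.hΦ _ (hH.submatrix Sum.inr) h3
      have h2' : H (.inl 0) (.inl 1) = 0 := h2
      rintro (a | j) (b | k) hab
      · fin_cases a <;> fin_cases b
        · simp at hab
        · exact h2'
        · exact isHermitian_apply_eq_zero hH h2'
        · simp at hab
      · exact h1' a k
      · exact isHermitian_apply_eq_zero hH (h1' b j)
      · exact h3 j k fun h => hab (h ▸ rfl) }

end Datum

end ListCx

namespace ListCx

theorem finite_of_fibers {P A C : Type*} (f : P → A) (g : P → C) {S : Set P} (hF : (f '' S).Finite)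
    (hG : ∀ a, (g '' {p ∈ S | f p = a}).Finite)
    (hi : ∀ p p', f p = f p' → g p = g p' → p = p') : S.Finite := by
  refine ((hF.biUnion fun a _ => ((hG a).image fun c => (a, c))).preimage
    (f := fun p => (f p, g p)) fun p _ p' _ h => ?_).subset ?_
  · exact hi p p' (congrArg Prod.fst h) (congrArg Prod.snd h)
  · intro p hp
    exact Set.mem_biUnion ⟨p, hp, rfl⟩ ⟨g p, ⟨p, ⟨hp, rfl⟩, rfl⟩, rfl⟩

theorem pd_one {m : Type*} [Fintype m] [DecidableEq m] : PD (1 : Matrix m m ℂ) := by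
  refine ⟨Matrix.isHermitian_one, 1, one_pos, fun r => ?_⟩
  simp only [qf, nsq, dotProduct, Matrix.one_mulVec, Pi.star_apply, Complex.star_def,
    Complex.mul_conj, Complex.normSq_eq_norm_sq, ← Complex.ofReal_sum, Complex.ofReal_re, one_mul]
  exact le_rfl

section

variable {Y : Type*} {J : Type*} [Fintype J] [DecidableEq J] {O : Type*} [CommRing O]
  {ι : O →+* ℂ}

theorem Disc.finite_cross (h : Disc ι) (s : Finset Y) (V : Y → Matrix (Fin 2) J O)
    {M : Y → Matrix J J ℂ} (hM : ∀ y ∈ s, PD (M y)) :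
    {w : Matrix (Fin 2) J O | ∃ c, Wt s c ∧
      ∑ y ∈ s, c y • ((w + V y).map ι * M y) = 0}.Finite := by
  obtain ⟨a, ha, C, hC, hb⟩ := exists_bd s hM
  obtain ⟨K, hK, hKb⟩ := Wt.norm_sum_apply_le s fun y => (V y).map ι * M y
  refine (h.finite_matrix (Fintype.card J * (K * (1 / a)))).subset ?_
  rintro w ⟨c, hc, h0⟩
  have h1 : w.map ι * ∑ y ∈ s, c y • M y = -∑ y ∈ s, c y • ((V y).map ι * M y) := by
    rw [eq_neg_iff_add_eq_zero, ← h0, Matrix.mul_sum, ← Finset.sum_add_distrib]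
    refine Finset.sum_congr rfl fun y _ => ?_
    rw [Matrix.map_add _ (map_add ι), Matrix.add_mul, smul_add, Matrix.mul_smul]
  have hM' := hb c hc
  have hu : IsUnit (∑ y ∈ s, c y • M y).det := isUnit_iff_ne_zero.2 (hM'.det_ne_zero ha)
  have h2 : w.map ι = -((∑ y ∈ s, c y • ((V y).map ι * M y)) * (∑ y ∈ s, c y • M y)⁻¹) := by
    rw [← Matrix.neg_mul, ← h1, Matrix.mul_assoc, Matrix.mul_nonsing_inv _ hu, Matrix.mul_one]
  intro i j
  have h3 := congrFun (congrFun h2 i) j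
  rw [Matrix.map_apply] at h3
  rw [h3, Matrix.neg_apply, norm_neg]
  exact norm_mul_le hK (hKb c hc) (hM'.norm_inv_le ha) i j

end

variable {O : Type*} [CommRing O] [IsDomain O] [CharZero O] {J : Type*} [Fintype J] [DecidableEq J]
  {ι : O →+* ℂ} {u : ℕ}

namespace Datum

/-- The translation part of a parabolic element, in shifted coordinates. -/
def shiftW (D : Datum O J) (p : PM O J) : Matrix (Fin 2) J O := p.left.toAdd * D.E - D.St

theorem shiftW_mul (D : Datum O J) (p x : PM O J) : D.shiftW (p * x) =
    D.shiftW p + p.right.1.val * x.left.toAdd * (p.right.2⁻¹).val * D.E := by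
  rw [shiftW, left_mul, Matrix.add_mul, shiftW, add_sub_right_comm]

theorem shiftW_injective (D : Datum O J) {p p' : PM O J} (h : D.shiftW p = D.shiftW p') :
    p.left = p'.left := by
  have h1 := congrArg (· * D.q) (sub_left_injective h)
  simp only [Matrix.mul_assoc, D.E_mul_q, Matrix.mul_smul, Matrix.mul_one] at h1
  have h2 : (D.μ : O) ≠ 0 := by exact_mod_cast D.μ_pos.ne'
  exact Multiplicative.toAdd.injective (smul_right_injective _ h2 h1)

/-- The translation part of a parabolic element, seen from the Levi factor. -/
def innerW (D : Datum O J) (p : PM O J) : Matrix (Fin 2) J O :=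
  (p.right.1⁻¹).val * (D.shiftW p * (D.q * p.right.2.val))

theorem mul_innerW (D : Datum O J) (p : PM O J) :
    p.right.1.val * D.innerW p = D.shiftW p * (D.q * p.right.2.val) := by
  rw [innerW, ← Matrix.mul_assoc, Units.mul_inv, Matrix.one_mul]

theorem shiftW_mul_q (D : Datum O J) (p x : PM O J) :
    D.shiftW (p * x) * (D.q * p.right.2.val) =
      p.right.1.val * (D.innerW p + (D.μ : O) • x.left.toAdd) := by
  rw [shiftW_mul, Matrix.add_mul, Matrix.mul_add, mul_innerW]
  congr 1
  rw [Matrix.mul_assoc _ D.E, ← Matrix.mul_assoc D.E, D.E_mul_q, Matrix.smul_mul, Matrix.one_mul,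
    Matrix.mul_smul, Matrix.mul_assoc _ (p.right.2⁻¹).val, Units.inv_mul, Matrix.mul_one,
    Matrix.mul_smul]

theorem innerW_injective (D : Datum O J) {p p' : PM O J} (hr : p.right = p'.right)
    (h : D.innerW p = D.innerW p') : p = p' := by
  refine SemidirectProduct.ext (D.shiftW_injective ?_) hr
  have h1 : D.shiftW p * (D.q * p.right.2.val) = D.shiftW p' * (D.q * p.right.2.val) := by
    rw [← mul_innerW, h, hr, mul_innerW]
  have h2 := congrArg (fun M => M * (p.right.2⁻¹).val * D.E) h1
  simp only [Matrix.mul_assoc, Units.mul_inv_cancel_left] at h2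
  rw [D.q_mul_E, Matrix.mul_smul, Matrix.mul_smul, Matrix.mul_one, Matrix.mul_one] at h2
  have h3 : (D.μ : O) ≠ 0 := by exact_mod_cast D.μ_pos.ne'
  exact smul_right_injective _ h3 h2

/-- The general shape of the positions of the translates of a parabolic element. -/
noncomputable def gen (B : Frame O (Fin 2)) (D : Datum O J) (e : (Fin 2 × J) × Fin 2 ≃ Fin u)
    (ι : O →+* ℂ) (p : PM O J) (V : Matrix (Fin 2) J O) (A : Matrix (Fin 2) (Fin 2) ℂ)
    (M Z : Matrix J J ℂ) : ℕ → ℝ :=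
  app u (coords e ((B.q * p.right.1.val).map ι * ((D.innerW p + V).map ι * M) *
      ((D.q * p.right.2.val).map ι).conjTranspose))
    (app 2 (entry 0 1 (cj ((B.q * p.right.1.val).map ι) A))
      (D.Φ (cj ((D.q * p.right.2.val).map ι) Z)))

theorem sum_gen (B : Frame O (Fin 2)) (D : Datum O J) (e : (Fin 2 × J) × Fin 2 ≃ Fin u)
    (p : PM O J) {Y : Type*} (s : Finset Y) (c : Y → ℝ) (V : Y → Matrix (Fin 2) J O)
    (A : Y → Matrix (Fin 2) (Fin 2) ℂ) (M Z : Y → Matrix J J ℂ) :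
    ∑ y ∈ s, c y • gen B D e ι p (V y) (A y) (M y) (Z y) =
    app u (coords e ((B.q * p.right.1.val).map ι *
      (∑ y ∈ s, c y • ((D.innerW p + V y).map ι * M y)) *
      ((D.q * p.right.2.val).map ι).conjTranspose))
    (app 2 (entry 0 1 (cj ((B.q * p.right.1.val).map ι) (∑ y ∈ s, c y • A y)))
      (D.Φ (cj ((D.q * p.right.2.val).map ι) (∑ y ∈ s, c y • Z y)))) := by
  simp only [gen, sum_app]
  congr 1
  · simp only [← map_smul, ← map_sum]
    congr 1
    rw [Matrix.mul_sum, Matrix.sum_mul]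
    simp only [Matrix.mul_smul, Matrix.smul_mul]
  · simp only [← map_smul, ← map_sum]

theorem isUnit_map_mul {m : Type*} [Fintype m] [DecidableEq m] (hι : Function.Injective ι)
    {q : Matrix m m O} (hq : q.det ≠ 0) (l : Matrix.GeneralLinearGroup m O) :
    IsUnit ((q * l.val).map ι).det := by
  rw [Matrix.map_mul, Matrix.det_mul]
  refine IsUnit.mul ?_ (isUnit_det_map l)
  rw [← RingHom.mapMatrix_apply, ← RingHom.map_det, isUnit_iff_ne_zero]
  exact (map_ne_zero_iff ι hι).2 hq

theorem finite_gen (h : Disc ι) (B : Frame O (Fin 2)) (D : Datum O J)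
    (e : (Fin 2 × J) × Fin 2 ≃ Fin u) {Y : Type*} (s : Finset Y) (V : Y → Matrix (Fin 2) J O)
    (A : Matrix (Fin 2) J O → Y → Matrix (Fin 2) (Fin 2) ℂ)
    (M : Matrix.GeneralLinearGroup J O → Y → Matrix J J ℂ) (Z : Y → Matrix J J ℂ)
    (hA : ∀ w, ∀ y ∈ s, PD (A w y)) (hM : ∀ l, ∀ y ∈ s, PD (M l y)) (hZ : ∀ y ∈ s, PD (Z y)) :
    {p : PM O J | ∃ c, Wt s c ∧ ∀ i < u + (2 + D.N),
      (∑ y ∈ s, c y • gen B D e ι p (V y) (A (D.innerW p) y) (M p.right.2 y) (Z y)) i =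
        0}.Finite := by
  have hsplit : ∀ (p : PM O J) (c : Y → ℝ), (∀ i < u + (2 + D.N),
      (∑ y ∈ s, c y • gen B D e ι p (V y) (A (D.innerW p) y) (M p.right.2 y) (Z y)) i = 0) →
      ((B.q * p.right.1.val).map ι * (∑ y ∈ s, c y • ((D.innerW p + V y).map ι * M p.right.2 y)) *
        ((D.q * p.right.2.val).map ι).conjTranspose = 0) ∧
      (∀ i < 2, entry 0 1 (cj ((B.q * p.right.1.val).map ι)
        (∑ y ∈ s, c y • A (D.innerW p) y)) i = 0) ∧
      ∀ i < D.N, D.Φ (cj ((D.q * p.right.2.val).map ι) (∑ y ∈ s, c y • Z y)) i = 0 := by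
    intro p c h0
    rw [sum_gen] at h0
    obtain ⟨h1, h2⟩ := app_eq_zero h0
    obtain ⟨h2, h3⟩ := app_eq_zero h2
    exact ⟨coords_eq_zero e h1, h2, h3⟩
  refine finite_of_fibers (fun p => p.right.2) (fun p => (D.innerW p, p.right.1)) ?_ ?_ ?_
  · refine (h.finite_diag s hZ D.toFrame.det_ne_zero).subset ?_
    rintro _ ⟨p, ⟨c, hc, h0⟩, rfl⟩
    exact ⟨c, hc, fun i j hij => D.sum_cj_eq_zero s hZ (hsplit p c h0).2.2 i j hij⟩
  · intro l2
    refine finite_of_fibers Prod.fst Prod.snd ?_ ?_ fun _ _ h h' => Prod.ext h h'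
    · refine (h.finite_cross s V (hM l2)).subset ?_
      rintro _ ⟨_, ⟨p, ⟨⟨c, hc, h0⟩, rfl⟩, rfl⟩, rfl⟩
      refine ⟨c, hc, ?_⟩
      have h1 := (hsplit p c h0).1
      have hu1 := isUnit_map_mul h.injective B.det_ne_zero p.right.1
      have hu2 := isUnit_map_mul h.injective D.toFrame.det_ne_zero p.right.2
      have hu3 : IsUnit ((D.q * p.right.2.val).map ι).conjTranspose.det := by
        rw [Matrix.det_conjTranspose]; exact hu2.star
      have h2 := congrArg (fun X => ((B.q * p.right.1.val).map ι)⁻¹ * X *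
        (((D.q * p.right.2.val).map ι).conjTranspose)⁻¹) h1
      simp only [Matrix.mul_zero, Matrix.zero_mul] at h2
      rw [← h2, Matrix.mul_assoc, Matrix.mul_assoc, Matrix.mul_assoc,
        Matrix.mul_nonsing_inv _ hu3, Matrix.mul_one, ← Matrix.mul_assoc,
        Matrix.nonsing_inv_mul _ hu1, Matrix.one_mul]
    · intro w
      refine (h.finite_re_im s (hA w) B.det_ne_zero).subset ?_
      rintro _ ⟨_, ⟨⟨p, ⟨⟨c, hc, h0⟩, rfl⟩, rfl⟩, rfl⟩, rfl⟩
      have h1 := (hsplit p c h0).2.1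
      exact ⟨⟨c, hc, h1 0 (by omega)⟩, c, hc, h1 1 (by omega)⟩
  · intro p p' h1 h2
    exact D.innerW_injective (Prod.ext (congrArg Prod.snd h2) h1) (congrArg Prod.fst h2)

end Datum

end ListCx

namespace ListCx

section

variable {m n : Type*} [Fintype m] [Fintype n] {O : Type*} [CommRing O]

theorem map_nat_smul (ι : O →+* ℂ) (k : ℕ) (M : Matrix m n O) :
    ((k : O) • M).map ι = (k : ℝ) • M.map ι := by
  ext i j
  simp

theorem cj_smul_left (a : ℝ) (Q : Matrix m n ℂ) (M : Matrix n n ℂ) :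
    cj (a • Q) M = a ^ 2 • cj Q M := by
  rw [cj_apply, Matrix.conjTranspose_smul, star_trivial, Matrix.smul_mul, Matrix.smul_mul,
    Matrix.mul_smul, smul_smul, pow_two, cj_apply]

theorem cj_fromBlocks (X : Matrix m m ℂ) (Y : Matrix m n ℂ) (Z : Matrix n n ℂ)
    (A : Matrix m m ℂ) (S : Matrix n n ℂ) :
    cj (Matrix.fromBlocks X Y 0 Z) (Matrix.fromBlocks A 0 0 S) =
    Matrix.fromBlocks (cj X A + cj Y S) (Y * S * Z.conjTranspose) (Z * S * Y.conjTranspose)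
      (cj Z S) := by
  simp [cj_apply, Matrix.fromBlocks_conjTranspose, Matrix.fromBlocks_multiply]

theorem qf_cj (Q : Matrix m n ℂ) (M : Matrix n n ℂ) (r : m → ℂ) :
    qf (cj Q M) r = qf M (Matrix.vecMul r Q) := by
  rw [qf, qf, cj_apply, Matrix.dotProduct_mulVec, Matrix.dotProduct_mulVec, ← Matrix.vecMul_vecMul,
    ← Matrix.vecMul_vecMul, ← Matrix.dotProduct_mulVec _ Q.conjTranspose, Matrix.star_vecMul]

theorem pd_bigS {A : Matrix m m ℂ} {S : Matrix n n ℂ} (hA : PD A) (hS : PD S) :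
    PD (Matrix.fromBlocks A 0 0 S) := by
  obtain ⟨h1, a, ha, hA⟩ := hA
  obtain ⟨h2, b, hb, hS⟩ := hS
  refine ⟨Matrix.IsHermitian.fromBlocks h1 (by simp) h2, min a b, lt_min ha hb, fun r => ?_⟩
  have e : qf (Matrix.fromBlocks A 0 0 S) r = qf A (r ∘ Sum.inl) + qf S (r ∘ Sum.inr) := by
    rw [qf, Matrix.fromBlocks_mulVec]
    simp only [dotProduct, Fintype.sum_sum_type, Sum.elim_inl, Sum.elim_inr, Matrix.zero_mulVec,
      add_zero, zero_add, Complex.add_re]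
    rfl
  have e' : nsq r = nsq (r ∘ Sum.inl) + nsq (r ∘ Sum.inr) := by
    simp [nsq, Fintype.sum_sum_type]
  rw [e, e']
  have h3 := mul_le_mul_of_nonneg_right (min_le_left a b) (nsq_nonneg (r ∘ Sum.inl))
  have h4 := mul_le_mul_of_nonneg_right (min_le_right a b) (nsq_nonneg (r ∘ Sum.inr))
  linarith [hA (r ∘ Sum.inl), hS (r ∘ Sum.inr)]

end

variable {O : Type*} [CommRing O] [IsDomain O] [CharZero O] {J : Type*} [Fintype J] [DecidableEq J]
  {ι : O →+* ℂ} {u : ℕ}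

namespace Datum

variable (B : Frame O (Fin 2)) (D : Datum O J) (e : (Fin 2 × J) × Fin 2 ≃ Fin u)

/-- The base form of the enlarged datum. -/
noncomputable def bigS (T : ℝ) (S₀ : Matrix (Fin 2) (Fin 2) ℂ) (S : Matrix J J ℂ) :
    Matrix (Fin 2 ⊕ J) (Fin 2 ⊕ J) ℂ := Matrix.fromBlocks (T • S₀) 0 0 S

theorem stepQ_mul_toG (p : PM O J) : Frame.stepQ B D.toFrame * (toG p).val =
    Matrix.fromBlocks ((D.μ : O) • (B.q * p.right.1.val))
      (B.q * (D.shiftW p * (D.q * p.right.2.val))) 0 ((B.μ : O) • (D.q * p.right.2.val)) := by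
  rw [toG_val, Frame.stepQ, Matrix.fromBlocks_multiply]
  congr 1
  · simp
  · rw [shiftW, Matrix.sub_mul, Matrix.mul_assoc p.left.toAdd, ← Matrix.mul_assoc D.E, D.E_mul_q,
      Matrix.mul_sub, Matrix.neg_mul, ← sub_eq_add_neg]
    simp [Matrix.mul_assoc]
  · simp
  · simp

theorem pos_mul_toG (T : ℝ) (S₀ : Matrix (Fin 2) (Fin 2) ℂ) (S : Matrix J J ℂ) (p x : PM O J) :
    (step B D e).pos ι (bigS T S₀ S) (toG (p * x)) =
    gen B D e ι p ((D.μ : O) • x.left.toAdd)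
      ((T * D.μ ^ 2) • tw ι S₀ x.right.1 +
        cj ((D.innerW p + (D.μ : O) • x.left.toAdd).map ι) (tw ι S x.right.2))
      ((B.μ : ℝ) • tw ι S x.right.2) ((B.μ : ℝ) ^ 2 • tw ι S x.right.2) := by
  have h1 : (step B D e).q = Frame.stepQ B D.toFrame := rfl
  have h2 : (step B D e).Φ = D.stepΦ e := rfl
  have h3 : B.q * (D.shiftW (p * x) * (D.q * (p * x).right.2.val)) =
      (B.q * p.right.1.val) * (D.innerW p + (D.μ : O) • x.left.toAdd) * x.right.2.val := by
    have : D.q * (p * x).right.2.val = (D.q * p.right.2.val) * x.right.2.val :=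
      (Matrix.mul_assoc _ _ _).symm
    rw [this, ← Matrix.mul_assoc (D.shiftW _), shiftW_mul_q]
    simp only [Matrix.mul_assoc]
  have h4 : B.q * (p * x).right.1.val = (B.q * p.right.1.val) * x.right.1.val :=
    (Matrix.mul_assoc _ _ _).symm
  have h5 : D.q * (p * x).right.2.val = (D.q * p.right.2.val) * x.right.2.val :=
    (Matrix.mul_assoc _ _ _).symm
  rw [pos, h1, h2, stepQ_mul_toG, Matrix.fromBlocks_map, bigS,
    Matrix.map_zero _ (map_zero ι), cj_fromBlocks, stepΦ_apply, Matrix.toBlocks_fromBlocks₁₁,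
    Matrix.toBlocks_fromBlocks₁₂, Matrix.toBlocks_fromBlocks₂₂, gen, h3, h4, h5]
  simp only [map_nat_smul, Matrix.map_mul, cj_smul_left, cj_mul, map_smul, map_add,
    Matrix.conjTranspose_smul, star_trivial, smul_smul, tw, Matrix.mul_smul, Matrix.smul_mul,
    Matrix.conjTranspose_mul, Matrix.mul_assoc, cj_apply (x.right.2.val.map ι)]

/-- The position of a parabolic element, split into its three parts. -/
noncomputable def psi (S₀ : Matrix (Fin 2) (Fin 2) ℂ) (S : Matrix J J ℂ) (ι : O →+* ℂ)
    (p : PM O J) : ℕ → ℝ :=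
  app u (coords e ((B.q * D.shiftW p).map ι))
    (app 2 (entry 0 1 (cj ((B.q * p.right.1.val).map ι) S₀)) (D.pos ι S p.right.2))

theorem psi_mul (S₀ : Matrix (Fin 2) (Fin 2) ℂ) (S : Matrix J J ℂ) (p x : PM O J)
    (hu : IsUnit ((D.q * p.right.2.val).map ι).det) :
    psi B D e S₀ S ι (p * x) = gen B D e ι p ((D.μ : O) • x.left.toAdd) (tw ι S₀ x.right.1)
      (cj (((D.q * p.right.2.val).map ι)⁻¹) 1) (tw ι S x.right.2) := by
  have h1 : D.pos ι S (p * x).right.2 =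
      D.Φ (cj ((D.q * p.right.2.val).map ι) (tw ι S x.right.2)) := pos_mul D S _ _
  have h2 : cj ((B.q * (p * x).right.1.val).map ι) S₀ =
      cj ((B.q * p.right.1.val).map ι) (tw ι S₀ x.right.1) := by
    rw [tw, ← cj_mul, ← Matrix.map_mul, Matrix.mul_assoc]; rfl
  have h3 : (B.q * D.shiftW (p * x)).map ι = (B.q * p.right.1.val).map ι *
      ((D.innerW p + (D.μ : O) • x.left.toAdd).map ι *
        cj (((D.q * p.right.2.val).map ι)⁻¹) 1) *
      ((D.q * p.right.2.val).map ι).conjTranspose := by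
    rw [cj_apply, Matrix.mul_one, Matrix.conjTranspose_nonsing_inv]
    have h4 : IsUnit ((D.q * p.right.2.val).map ι).conjTranspose.det := by
      rw [Matrix.det_conjTranspose]; exact hu.star
    rw [Matrix.mul_assoc, Matrix.mul_assoc, Matrix.mul_assoc, Matrix.nonsing_inv_mul _ h4,
      Matrix.mul_one, ← Matrix.mul_assoc, ← Matrix.map_mul, Matrix.mul_assoc, ← shiftW_mul_q,
      ← Matrix.mul_assoc, Matrix.map_mul (L := B.q * D.shiftW (p * x)), Matrix.mul_assoc,
      Matrix.mul_nonsing_inv _ hu, Matrix.mul_one]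
  rw [psi, h1, h2, h3, gen]

end Datum

end ListCx

namespace ListCx

theorem exists_cod_prism {X : Type*} (N : ℕ) (φ ψ : X → ℕ → ℝ) : ∃ h : List X → ℝ,
    ((fun l => tau N (l.map ψ)) - fun l => tau N (l.map φ)) = cod h ∧
    ∀ l, h l ≠ 0 → ∃ m : List (ℕ → ℝ), Hits N {x | x ∈ m} ∧
      ∀ y ∈ m, ∃ x ∈ l, y = φ x ∨ y = ψ x := by
  refine ⟨fun l => ev (tau N) (prismL φ ψ l), funext fun l => ?_, fun l hl => ?_⟩
  · have h1 := congrArg (ev (tau N)) (bd_prismL φ ψ l)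
    rw [map_add, ev_bd, cod_tau, map_sub, ev_single, ev_single, ev_zero, zero_add, one_mul,
      one_mul] at h1
    have h2 : ev (tau N) ∘ₗ prism φ ψ = ev fun l => ev (tau N) (prismL φ ψ l) :=
      ch_ext fun l => by simp
    exact h1.symm.trans (LinearMap.congr_fun h2 (bdL l))
  · obtain ⟨m, hm, hm'⟩ : ∃ m ∈ (prismL φ ψ l).support, tau N m ≠ 0 := by
      by_contra! hc
      apply hl
      exact (ev_congr (g := 0) fun m hm => hc m hm).trans (ev_zero _)
    exact ⟨m, hits_of_tau hm', (prismL_support φ ψ hm).2⟩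

variable {O : Type*} [CommRing O] [IsDomain O] [CharZero O] {J : Type*} [Fintype J] [DecidableEq J]
  {ι : O →+* ℂ} {u : ℕ} (B : Frame O (Fin 2)) (D : Datum O J) (e : (Fin 2 × J) × Fin 2 ≃ Fin u)

namespace Datum

theorem finite_prism (h : Disc ι) {T : ℝ} (hT : 0 < T) {S₀ : Matrix (Fin 2) (Fin 2) ℂ}
    (hS₀ : PD S₀) {S : Matrix J J ℂ} (hS : PD S) (l : List (PM O J)) :
    {p : PM O J | ∃ m : List (ℕ → ℝ), Hits (u + (2 + D.N)) {x | x ∈ m} ∧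
      ∀ y ∈ m, ∃ x ∈ l, y = (step B D e).pos ι (bigS T S₀ S) (toG (p * x)) ∨
        y = psi B D e S₀ S ι (p * x)}.Finite := by
  classical
  have hB : 0 < (B.μ : ℝ) := by exact_mod_cast B.μ_pos
  have hD : 0 < (D.μ : ℝ) := by exact_mod_cast D.μ_pos
  refine (finite_gen h B D e (l.toFinset ×ˢ (Finset.univ : Finset Bool))
    (fun y => (D.μ : O) • y.1.left.toAdd)
    (fun w y => bif y.2 then tw ι S₀ y.1.right.1 else (T * D.μ ^ 2) • tw ι S₀ y.1.right.1 +
        cj ((w + (D.μ : O) • y.1.left.toAdd).map ι) (tw ι S y.1.right.2))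
    (fun g y => bif y.2 then cj (((D.q * g.val).map ι)⁻¹) 1 else (B.μ : ℝ) • tw ι S y.1.right.2)
    (fun y => bif y.2 then tw ι S y.1.right.2 else (B.μ : ℝ) ^ 2 • tw ι S y.1.right.2)
    ?_ ?_ ?_).subset ?_
  · rintro w ⟨x, b⟩ -
    cases b
    · refine ((pd_tw hS₀ _).smul (by positivity)).add (cj_isHermitian _ (pd_tw hS _).1) fun r => ?_
      rw [qf_cj]
      exact (pd_tw hS _).qf_nonneg _
    · exact pd_tw hS₀ _
  · rintro g ⟨x, b⟩ -
    cases b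
    · exact (pd_tw hS _).smul hB
    · refine pd_one.conj ?_
      have := isUnit_map_mul h.injective D.toFrame.det_ne_zero g
      exact Matrix.isUnit_nonsing_inv_det _ this
  · rintro ⟨x, b⟩ -
    cases b
    · exact (pd_tw hS _).smul (by positivity)
    · exact pd_tw hS _
  · rintro p ⟨m, ⟨v, hv, h0⟩, hm⟩
    obtain ⟨c, hc, rfl⟩ := exists_wt (s := l.toFinset ×ˢ (Finset.univ : Finset Bool))
      (f := fun y => bif y.2 then psi B D e S₀ S ι (p * y.1) else
        (step B D e).pos ι (bigS T S₀ S) (toG (p * y.1))) hv (by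
      intro y hy
      obtain ⟨x, hx, hxy⟩ := hm y hy
      rcases hxy with rfl | rfl
      · exact ⟨(x, false), by simpa using hx, rfl⟩
      · exact ⟨(x, true), by simpa using hx, rfl⟩)
    refine ⟨c, hc, fun i hi => ?_⟩
    rw [← h0 i hi]
    refine congrFun (Finset.sum_congr rfl ?_) i
    rintro ⟨x, b⟩ -
    cases b
    · simp only [cond_false, pos_mul_toG]
    · simp only [cond_true, psi_mul B D e S₀ S p x
        (isUnit_map_mul h.injective D.toFrame.det_ne_zero _)]

theorem sum_psi (S₀ : Matrix (Fin 2) (Fin 2) ℂ) (S : Matrix J J ℂ) (p : PM O J)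
    (s : Finset (PM O J)) (c : PM O J → ℝ) :
    ∑ x ∈ s, c x • psi B D e S₀ S ι (p * x) =
    app u (coords e (∑ x ∈ s, c x • (B.q * D.shiftW (p * x)).map ι))
      (app 2 (entry 0 1 (cj ((B.q * p.right.1.val).map ι) (∑ x ∈ s, c x • tw ι S₀ x.right.1)))
        (D.Φ (cj ((D.q * p.right.2.val).map ι) (∑ x ∈ s, c x • tw ι S x.right.2)))) := by
  simp only [psi, sum_app, map_sum, map_smul, SemidirectProduct.mul_right, Prod.snd_mul,
    Prod.fst_mul, pos_mul, Units.val_mul, ← Matrix.mul_assoc]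
  simp only [Matrix.map_mul (f := ι) (L := B.q * p.right.1.val), cj_mul, tw]

theorem norm_le_of_reim {z : ℂ} {K : ℝ} (h : ∀ b : Fin 2, |reim z b| ≤ K) : ‖z‖ ≤ K + K :=
  (Complex.norm_le_abs_re_add_abs_im z).trans (add_le_add (h 0) (h 1))

theorem finite_peel (h : Disc ι) {S₀ : Matrix (Fin 2) (Fin 2) ℂ} (hS₀ : PD S₀)
    {S : Matrix J J ℂ} (hS : PD S) (l : List (PM O J)) :
    {p : PM O J | PeelHits (u + 2) D.N
      {x | x ∈ (l.map (p * ·)).map (psi B D e S₀ S ι)}}.Finite := by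
  classical
  refine finite_of_fibers (fun p => p.right) (fun p => B.q * D.shiftW p) ?_ ?_ ?_
  · refine ((h.finite_re_im l.toFinset (S := fun x => tw ι S₀ x.right.1)
      (fun y _ => pd_tw hS₀ _) B.det_ne_zero).prod (h.finite_diag l.toFinset
        (S := fun x => tw ι S x.right.2) (fun y _ => pd_tw hS _)
        D.toFrame.det_ne_zero)).subset ?_
    rintro _ ⟨p, ⟨h1, v, hv, h2⟩, rfl⟩
    rw [List.map_map] at hv
    refine ⟨⟨?_, ?_⟩, ?_⟩
    · obtain ⟨v, hv, h0⟩ := h1 u (by omega)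
      rw [List.map_map] at hv
      obtain ⟨c, hc, rfl⟩ := exists_wt_map hv
      simp only [Function.comp_apply, sum_psi] at h0
      exact ⟨c, hc, (app_add u _ _ 0).symm.trans h0⟩
    · obtain ⟨v, hv, h0⟩ := h1 (u + 1) (by omega)
      rw [List.map_map] at hv
      obtain ⟨c, hc, rfl⟩ := exists_wt_map hv
      simp only [Function.comp_apply, sum_psi] at h0
      exact ⟨c, hc, (app_add u _ _ 1).symm.trans h0⟩
    · obtain ⟨c, hc, rfl⟩ := exists_wt_map hv
      refine ⟨c, hc, fun i j hij => D.sum_cj_eq_zero _ (fun y _ => pd_tw hS _)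
        (fun k hk => ?_) i j hij⟩
      rw [← h2 k hk]
      simp only [Function.comp_apply, sum_psi, add_assoc, app_add]
  · rintro ⟨l1, l2⟩
    obtain ⟨K, hK, hb⟩ := Wt.norm_sum_apply_le l.toFinset fun x : PM O J =>
      (B.q * (l1.val * x.left.toAdd * (l2⁻¹).val * D.E)).map ι
    refine (h.finite_matrix (K + K)).subset ?_
    rintro _ ⟨p, ⟨⟨h1, -⟩, hp⟩, rfl⟩ i j
    refine norm_le_of_reim fun b => ?_
    obtain ⟨v, hv, h0⟩ := h1 (e ((i, j), b)) (by omega)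
    rw [List.map_map] at hv
    obtain ⟨c, hc, rfl⟩ := exists_wt_map hv
    have hp1 : p.right.1 = l1 := congrArg Prod.fst hp
    have hp2 : p.right.2 = l2 := congrArg Prod.snd hp
    have e1 : ∑ x ∈ l.toFinset, c x • (B.q * D.shiftW (p * x)).map ι = (B.q * D.shiftW p).map ι +
        ∑ x ∈ l.toFinset, c x •
          (B.q * (l1.val * x.left.toAdd * (l2⁻¹).val * D.E)).map ι := by
      have h3 : (B.q * D.shiftW p).map ι =
          ∑ x ∈ l.toFinset, c x • (B.q * D.shiftW p).map ι := by
        rw [← Finset.sum_smul, hc.2, one_smul]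
      rw [h3, ← Finset.sum_add_distrib]
      refine Finset.sum_congr rfl fun x _ => ?_
      rw [shiftW_mul, Matrix.mul_add, Matrix.map_add _ (map_add ι), smul_add, hp1, hp2]
    simp only [Function.comp_apply, sum_psi, e1] at h0
    rw [app_of_lt (Fin.is_lt _), coords_apply, Matrix.add_apply, map_add, Pi.add_apply,
      add_eq_zero_iff_eq_neg] at h0
    rw [Matrix.map_apply] at h0
    rw [h0, abs_neg]
    refine le_trans ?_ (hb c hc i j)
    fin_cases b
    · exact Complex.abs_re_le_norm _
    · exact Complex.abs_im_le_norm _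
  · intro p p' h1 h2
    refine SemidirectProduct.ext (D.shiftW_injective ?_) h1
    have h3 := congrArg (B.E * ·) h2
    simp only [← Matrix.mul_assoc, B.E_mul_q, Matrix.smul_mul, Matrix.one_mul] at h3
    have h4 : (B.μ : O) ≠ 0 := by exact_mod_cast B.μ_pos.ne'
    exact smul_right_injective _ h4 h3

theorem ev_sm_pos_toG (h : Disc ι) {T : ℝ} (hT : 0 < T) {S₀ : Matrix (Fin 2) (Fin 2) ℂ}
    (hS₀ : PD S₀) {S : Matrix J J ℂ} (hS : PD S) {χ : PM O J →* ℝ} {H : Subgroup (PM O J)}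
    (hH : H ≤ χ.ker) {z : Ch (PM O J)} (hz : bd z ∈ coin H) :
    ev (sm (MonoidHom.id _) χ fun l => tau (u + (2 + D.N))
      (l.map fun p => (step B D e).pos ι (bigS T S₀ S) (toG p))) z =
    ev (sm (MonoidHom.id _) χ fun l => nest (u + 2) D.N (l.map (psi B D e S₀ S ι))) z := by
  have hnest : LF (MonoidHom.id (PM O J))
      fun l => nest (u + 2) D.N (l.map (psi B D e S₀ S ι)) := fun l =>
    (finite_peel B D e h hS₀ hS l).subset fun p hp => nest_hits hp
  have htau : LF (MonoidHom.id (PM O J))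
      fun l => tau (u + (2 + D.N)) (l.map (psi B D e S₀ S ι)) := fun l =>
    (finite_prism B D e h hT hS₀ hS l).subset fun p hp => by
      refine ⟨_, hits_of_tau hp, fun y hy => ?_⟩
      rw [List.map_map] at hy
      obtain ⟨x, hx, rfl⟩ := List.mem_map.1 hy
      exact ⟨x, hx, .inr rfl⟩
  have hpos : LF (MonoidHom.id (PM O J)) fun l => tau (u + (2 + D.N))
      (l.map fun p => (step B D e).pos ι (bigS T S₀ S) (toG p)) := fun l =>
    (finite_prism B D e h hT hS₀ hS l).subset fun p hp => by
      refine ⟨_, hits_of_tau hp, fun y hy => ?_⟩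
      rw [List.map_map] at hy
      obtain ⟨x, hx, rfl⟩ := List.mem_map.1 hy
      exact ⟨x, hx, .inl rfl⟩
  obtain ⟨k, hk, hk'⟩ := exists_cod_prism (u + (2 + D.N))
    (fun p => (step B D e).pos ι (bigS T S₀ S) (toG p)) (psi B D e S₀ S ι)
  obtain ⟨k', -, hk2, hk3⟩ := exists_peel (u + 2) D.N
  rw [← ev_sm_eq_of_sub_eq_cod hpos (h := k) (fun l => ?_) hk hH hz]
  · refine ev_sm_eq_of_sub_eq_cod hnest (h := fun l => k' (l.map (psi B D e S₀ S ι)))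
      (fun l => (finite_peel B D e h hS₀ hS l).subset fun p hp => hk3 _ hp) ?_ hH hz
    rw [cod_comp_map, ← hk2, add_assoc]
    rfl
  · refine (finite_prism B D e h hT hS₀ hS l).subset fun p hp => ?_
    obtain ⟨m, hm, hm'⟩ := hk' _ hp
    refine ⟨m, hm, fun y hy => ?_⟩
    obtain ⟨_, hx, hxy⟩ := hm' y hy
    obtain ⟨x, hx', rfl⟩ := List.mem_map.1 hx
    exact ⟨x, hx', hxy⟩

end Datum

end ListCx

namespace ListCx

section

variable {J : Type*} [Fintype J] [DecidableEq J] {u : ℕ}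

/-- The map `X ↦ A X R`. -/
def sandwich (A : Matrix (Fin 2) (Fin 2) ℂ) (R : Matrix J J ℂ) :
    Matrix (Fin 2) J ℂ →ₗ[ℂ] Matrix (Fin 2) J ℂ where
  toFun X := A * X * R
  map_add' X Y := by rw [Matrix.mul_add, Matrix.add_mul]
  map_smul' c X := by simp

theorem det_sandwich (A : Matrix (Fin 2) (Fin 2) ℂ) (R : Matrix J J ℂ) :
    LinearMap.det (sandwich A R) = R.det ^ 2 * A.det ^ Fintype.card J := by
  let V : Matrix (Fin 2) J ℂ ≃ₗ[ℂ] (J × Fin 2 → ℂ) :=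
    LinearEquiv.ofBijective ⟨⟨Matrix.vec, Matrix.vec_add⟩, Matrix.vec_smul⟩ Matrix.vec_bijective
  have h1 : sandwich A R = V.symm.toLinearMap ∘ₗ
      (Matrix.toLin' (Matrix.kronecker R.transpose A)) ∘ₗ V.toLinearMap := by
    ext1 X
    apply V.injective
    have h2 : V (A * X * R) = (Matrix.kronecker R.transpose A).mulVec (V X) := by
      have := Matrix.kronecker_mulVec_vec A X R.transpose
      rw [Matrix.transpose_transpose] at this
      exact this.symm
    simp only [LinearMap.comp_apply, LinearEquiv.coe_coe, LinearEquiv.apply_symm_apply,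
      Matrix.toLin'_apply]
    exact h2
  have h3 := LinearMap.det_conj (Matrix.toLin' (Matrix.kronecker R.transpose A)) V.symm
  rw [LinearEquiv.symm_symm] at h3
  rw [h1, h3, LinearMap.det_toLin']
  refine (Matrix.det_kronecker _ _).trans ?_
  rw [Matrix.det_transpose, Fintype.card_fin]

theorem exists_coords_matrix (e : (Fin 2 × J) × Fin 2 ≃ Fin u) {A : Matrix (Fin 2) (Fin 2) ℂ}
    {R : Matrix J J ℂ} (hA : ‖A.det‖ = 1) (hR : ‖R.det‖ = 1) :
    ∃ C : Matrix (Fin u) (Fin u) ℝ, C.det = 1 ∧ ∀ X, ∀ b : Fin u,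
      coords e (A * X * R) b = ∑ k : Fin u, coords e X k * C k b := by
  let ψ₀ : Matrix (Fin 2) J ℂ →ₗ[ℝ] (Fin u → ℝ) := LinearMap.funLeft ℝ ℝ Fin.val ∘ₗ coords e
  have hinj : Function.Injective ψ₀ := (injective_iff_map_eq_zero ψ₀).2 fun X hX =>
    coords_eq_zero e fun i hi => congrFun hX ⟨i, hi⟩
  have hsurj : Function.Surjective ψ₀ := by
    intro v
    refine ⟨Matrix.of fun i j => ⟨v (e ((i, j), 0)), v (e ((i, j), 1))⟩, funext fun k => ?_⟩
    obtain ⟨⟨⟨i, j⟩, b⟩, rfl⟩ := e.surjective k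
    change coords e _ _ = _
    rw [coords_apply]
    fin_cases b <;> rfl
  let bs := Module.Basis.ofEquivFun (LinearEquiv.ofBijective ψ₀ ⟨hinj, hsurj⟩)
  refine ⟨(LinearMap.toMatrix bs bs ((sandwich A R).restrictScalars ℝ)).transpose, ?_, ?_⟩
  · rw [Matrix.det_transpose, LinearMap.det_toMatrix, LinearMap.det_restrictScalars,
      Algebra.norm_complex_apply, det_sandwich, Complex.normSq_eq_norm_sq, norm_mul, norm_pow,
      norm_pow, hA, hR]
    norm_num
  · intro X b
    have h := congrFun (LinearMap.toMatrix_mulVec_repr bs bs ((sandwich A R).restrictScalars ℝ) X) b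
    refine Eq.trans h.symm ?_
    rw [Matrix.mulVec]
    simp only [dotProduct, Matrix.transpose_apply]
    exact Finset.sum_congr rfl fun k _ => mul_comm _ _

end

variable {O : Type*} [CommRing O] [IsDomain O] [CharZero O] {J : Type*} [Fintype J] [DecidableEq J]
  {ι : O →+* ℂ} {u : ℕ} (B : Frame O (Fin 2)) (D : Datum O J) (e : (Fin 2 × J) × Fin 2 ≃ Fin u)

theorem Disc.norm_det_map (h : Disc ι) {m : Type*} [Fintype m] [DecidableEq m]
    (x : Matrix.GeneralLinearGroup m O) : ‖(x.val.map ι).det‖ = 1 := by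
  rw [← RingHom.mapMatrix_apply, ← RingHom.map_det]
  exact h.norm_unit (Matrix.GeneralLinearGroup.det x)

namespace Datum

/-- The off-diagonal coordinates of a parabolic element. -/
noncomputable def yc (ι : O →+* ℂ) (p : PM O J) : ℕ → ℝ := coords e ((B.q * D.shiftW p).map ι)

/-- The displacement of `yc` under a translation. -/
noncomputable def yl (ι : O →+* ℂ) (a : UM O J) : ℕ → ℝ :=
  coords e ((B.q * (a.toAdd * D.E)).map ι)

theorem yc_inl (a : UM O J) (p : PM O J) :
    yc B D e ι (SemidirectProduct.inl a * p) = yc B D e ι p + yl B D e ι a := by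
  have h : D.shiftW (SemidirectProduct.inl a * p) = D.shiftW p + a.toAdd * D.E := by
    simp only [shiftW, left_mul, SemidirectProduct.left_inl, SemidirectProduct.right_inl,
      Prod.fst_one, Prod.snd_one, inv_one, Units.val_one, Matrix.one_mul, Matrix.mul_one,
      Matrix.add_mul]
    abel
  rw [yc, h, Matrix.mul_add, Matrix.map_add _ (map_add ι), map_add]
  rfl

theorem volL_inl (a : UM O J) (l : List (PM O J)) :
    volL u ((l.map (SemidirectProduct.inl a * ·)).map (yc B D e ι)) =
      volL u (l.map (yc B D e ι)) := by
  rw [List.map_map]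
  refine volL_map _ _ 1 Matrix.det_one (fun v w b => ?_) l
  simp [yc_inl, Matrix.one_apply]

theorem volL_inr (h : Disc ι) (b : LM O J) (l : List (PM O J)) :
    volL u ((l.map (SemidirectProduct.inr b * ·)).map (yc B D e ι)) =
      volL u (l.map (yc B D e ι)) := by
  have hq : IsUnit (B.q.map ι).det := by
    rw [← RingHom.mapMatrix_apply, ← RingHom.map_det, isUnit_iff_ne_zero]
    exact (map_ne_zero_iff ι h.injective).2 B.det_ne_zero
  have hE : IsUnit (D.E.map ι).det := by
    have h1 := congrArg (fun M : Matrix J J O => (M.map ι).det) D.E_mul_q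
    simp only [Matrix.map_mul, Matrix.det_mul] at h1
    refine isUnit_of_mul_isUnit_left (y := (D.q.map ι).det) ?_
    rw [h1, map_nat_smul, Matrix.map_one _ (map_zero ι) (map_one ι), isUnit_iff_ne_zero]
    have h2 : ((D.μ : ℝ) • (1 : Matrix J J ℂ)) = (D.μ : ℂ) • 1 := by ext; simp
    rw [h2, Matrix.det_smul, Matrix.det_one, mul_one]
    exact pow_ne_zero _ (by exact_mod_cast D.μ_pos.ne')
  obtain ⟨C, hC, hC'⟩ := exists_coords_matrix e
    (A := B.q.map ι * b.1.val.map ι * (B.q.map ι)⁻¹)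
    (R := (D.E.map ι)⁻¹ * (b.2⁻¹).val.map ι * D.E.map ι)
    (by
      rw [Matrix.det_conj ((Matrix.isUnit_iff_isUnit_det _).2 hq), h.norm_det_map])
    (by
      rw [Matrix.det_conj' ((Matrix.isUnit_iff_isUnit_det _).2 hE), h.norm_det_map])
  rw [List.map_map]
  refine volL_map _ _ C hC (fun v w k => ?_) l
  have hs : ∀ v : PM O J, D.shiftW (SemidirectProduct.inr b * v) =
      b.1.val * v.left.toAdd * (b.2⁻¹).val * D.E - D.St := by
    intro v
    simp only [shiftW, left_mul, SemidirectProduct.left_inr, SemidirectProduct.right_inr, toAdd_one,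
      zero_add]
  have e1 : coords e ((B.q * D.shiftW (SemidirectProduct.inr b * v)).map ι) -
      coords e ((B.q * D.shiftW (SemidirectProduct.inr b * w)).map ι) =
      coords e ((B.q.map ι * b.1.val.map ι * (B.q.map ι)⁻¹) *
        ((B.q * D.shiftW v).map ι - (B.q * D.shiftW w).map ι) *
        ((D.E.map ι)⁻¹ * (b.2⁻¹).val.map ι * D.E.map ι)) := by
    rw [← map_sub, ← Matrix.map_sub _ (map_sub ι), ← Matrix.map_sub _ (map_sub ι), ← Matrix.mul_sub,
      ← Matrix.mul_sub, hs, hs, shiftW, shiftW, sub_sub_sub_cancel_right, sub_sub_sub_cancel_right,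
      ← Matrix.sub_mul, ← Matrix.sub_mul, ← Matrix.sub_mul, ← Matrix.mul_sub]
    congr 1
    generalize v.left.toAdd - w.left.toAdd = X
    simp only [Matrix.map_mul, Matrix.mul_assoc]
    rw [← Matrix.mul_assoc (B.q.map ι)⁻¹, Matrix.nonsing_inv_mul _ hq, Matrix.one_mul,
      ← Matrix.mul_assoc (D.E.map ι) (D.E.map ι)⁻¹, Matrix.mul_nonsing_inv _ hE, Matrix.one_mul]
  have e2 := congrFun e1 k
  rw [Pi.sub_apply, hC', map_sub] at e2
  exact e2

/-- A translation in the direction of a coordinate. -/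
noncomputable def ygen (s : O) (n : Fin u → ℤ) : UM O J :=
  .ofAdd (B.E * latMat e s n * D.q)

theorem yl_ygen (s : O) (n : Fin u → ℤ) : yl B D e ι (ygen B D e s n) =
    coords e (((B.μ * D.μ : ℕ) : ℝ) • (latMat e s n).map ι) := by
  rw [yl, ygen, toAdd_ofAdd, ← map_nat_smul]
  congr 2
  rw [Matrix.mul_assoc _ D.q, D.q_mul_E, Matrix.mul_smul, Matrix.mul_one, Matrix.mul_smul,
    ← Matrix.mul_assoc, B.q_mul_E, Matrix.smul_mul, Matrix.one_mul, smul_smul]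
  push_cast
  rw [mul_comm]

end Datum

end ListCx

namespace ListCx

variable {O : Type*} [CommRing O] [IsDomain O] [CharZero O] {J : Type*} [Fintype J] [DecidableEq J]
  {ι : O →+* ℂ} {u : ℕ} (B : Frame O (Fin 2)) (D : Datum O J) (e : (Fin 2 × J) × Fin 2 ≃ Fin u)

namespace Datum

/-- The length of the translation in the direction of the `i`-th coordinate. -/
noncomputable def stepLen (r : ℝ) (i : ℕ) : ℝ :=
  if h : i < u then ((B.μ * D.μ : ℕ) : ℝ) * (if (e.symm ⟨i, h⟩).2 = 0 then 1 else r) else 1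

theorem stepLen_pos {r : ℝ} (hr : 0 < r) (i : ℕ) : 0 < stepLen B D e r i := by
  have h : (0 : ℝ) < ((B.μ * D.μ : ℕ) : ℝ) := by
    exact_mod_cast Nat.mul_pos B.μ_pos D.μ_pos
  rw [stepLen]
  split_ifs <;> positivity

theorem yl_ygen_apply {s : O} {r : ℝ} (hs : ι s = r * Complex.I) (n : Fin u → ℤ) {i : ℕ}
    (hi : i < u) : yl B D e ι (ygen B D e s n) i = n ⟨i, hi⟩ * stepLen B D e r i := by
  rw [yl_ygen, map_smul, Pi.smul_apply, stepLen, dif_pos hi]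
  obtain ⟨⟨⟨a, j⟩, b⟩, h⟩ := e.surjective ⟨i, hi⟩
  have h' : i = e ((a, j), b) := by rw [h]
  have : coords e ((latMat e s n).map ι) i = n ⟨i, hi⟩ * (if b = 0 then 1 else r) := by
    rw [← h, h', coords_apply, Matrix.map_apply, latMat, Matrix.of_apply]
    fin_cases b <;> simp [hs]
  rw [this, ← h, Equiv.symm_apply_apply, smul_eq_mul]
  ring

theorem lf_yc (h : Disc ι) : LF (SemidirectProduct.inl : UM O J →* PM O J)
    fun l => nest u 0 (l.map (yc B D e ι)) := by
  classical
  intro l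
  obtain ⟨K, hK, hb⟩ := Wt.norm_sum_apply_le l.toFinset fun x : PM O J => (B.q * D.shiftW x).map ι
  refine Set.Finite.of_finite_image (f := fun a : UM O J => B.q * (a.toAdd * D.E))
    ((h.finite_matrix (K + K)).subset ?_) ?_
  · rintro _ ⟨a, ha, rfl⟩ i j
    refine norm_le_of_reim fun b => ?_
    obtain ⟨v, hv, h0⟩ := (nest_hits ha).1 (e ((i, j), b)) (Fin.is_lt _)
    rw [List.map_map] at hv
    obtain ⟨c, hc, rfl⟩ := exists_wt_map hv
    simp only [Function.comp_apply, yc_inl, smul_add, Finset.sum_add_distrib] at h0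
    rw [← Finset.sum_smul, hc.2, one_smul] at h0
    simp only [yc, yl, ← map_smul] at h0
    rw [← map_sum, Pi.add_apply, coords_apply, coords_apply, Matrix.map_apply,
      add_comm, add_eq_zero_iff_eq_neg] at h0
    rw [h0, abs_neg]
    refine le_trans ?_ (hb c hc i j)
    fin_cases b
    · exact Complex.abs_re_le_norm _
    · exact Complex.abs_im_le_norm _
  · intro a _ a' _ h2
    have h3 := congrArg (fun X => B.E * X * D.q) h2
    simp only [← Matrix.mul_assoc, B.E_mul_q] at h3
    simp only [Matrix.mul_assoc, D.E_mul_q, Matrix.smul_mul, Matrix.one_mul, Matrix.mul_smul,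
      Matrix.mul_one, smul_smul] at h3
    have h4 : (D.μ : O) * B.μ ≠ 0 ∧ (B.μ : O) * D.μ ≠ 0 := by
      constructor <;> exact mul_ne_zero (Nat.cast_ne_zero.2 (Frame.μ_pos _).ne')
        (Nat.cast_ne_zero.2 (Frame.μ_pos _).ne')
    exact Multiplicative.toAdd.injective (smul_right_injective _ (by tauto) h3)

theorem exists_fibre_lift {ω : O} {N : ℕ} (h : QuadRing ι ω N) (hu : 0 < u) :
    ∃ (z : Ch (PM O J)) (T : Lift (SemidirectProduct.inl : UM O J →* PM O J).range
      SemidirectProduct.inr u z) (κ : ℝ), κ ≠ 0 ∧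
      ∀ {c : List (LM O J) → ℝ} {χ : LM O J →* ℝ} {H : Subgroup (LM O J)} {m : ℕ} {x : Ch (LM O J)},
      LF (MonoidHom.id _) c → c [] = 0 → cod c = 0 → H ≤ χ.ker → x ∈ chn _ (m + 1) →
      bd x ∈ coin H →
      ev (sm (MonoidHom.id _) (χ.comp SemidirectProduct.rightHom)
        (cup u (fun l => nest u 0 (l.map (yc B D e ι)))
          fun l => c (l.map SemidirectProduct.rightHom))) (T.Θ x) =
        κ * ev (sm (MonoidHom.id _) χ c) x := by
  obtain ⟨v, rfl⟩ : ∃ v, u = v + 1 := ⟨u - 1, by omega⟩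
  let s : O := 2 * ω - 1
  let r : ℝ := √(4 * N + 3)
  have hr : 0 < r := Real.sqrt_pos.2 (by positivity)
  have hs : ι s = r * Complex.I := h.map_sqrt
  have hlf := lf_yc B D e h.disc
  let g : ℕ → UM O J := fun j => ygen B D e s fun i => if (i : ℕ) = j then 1 else 0
  have hg : ∀ j < v + 1, ∀ p, yc B D e ι (SemidirectProduct.inl (g j) * p) =
      shiftAt j (stepLen B D e r j) (yc B D e ι p) := by
    intro j hj p
    rw [yc_inl, shiftAt]
    congr 1
    ext i
    by_cases hi : i < v + 1
    · rw [yl_ygen_apply B D e hs _ hi]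
      by_cases hij : i = j
      · subst hij; simp
      · simp [hij]
    · rw [yl, coords_of_le e _ (by omega), Pi.single_eq_of_ne (by omega)]
  have hz := cycP_mem_chn (inl := (SemidirectProduct.inl : UM O J →* PM O J)) g (v + 1)
  have hbz := bd_cycP_mem (inl := (SemidirectProduct.inl : UM O J →* PM O J)) g (v + 1) (by omega)
  have hne := ev_volL_cycP_ne (inl := (SemidirectProduct.inl : UM O J →* PM O J)) hg
    fun j _ => stepLen_pos B D e hr j
  have hcvol : cod (fun l : List (PM O J) => volL (v + 1) (l.map (yc B D e ι))) = 0 := by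
    rw [cod_comp_map, volL, cod_cod]; rfl
  have hinl : ∀ a (l : List (PM O J)), volL (v + 1)
      ((l.map (SemidirectProduct.inl a * ·)).map (yc B D e ι)) =
      volL (v + 1) (l.map (yc B D e ι)) := volL_inl B D e
  obtain ⟨T⟩ := exists_lift (polyZ_inl h e) SemidirectProduct.inr
    (by
      rintro l _ ⟨a, rfl⟩
      exact ⟨act l a, by rw [SemidirectProduct.inl_aut, map_inv]⟩) hz hbz hcvol
    (by rintro _ ⟨a, rfl⟩ l; exact hinl a l) (volL_inr B D e h.disc) hne
  refine ⟨_, T, _, ev_sm_nest_cycP_ne (ℓ := yl B D e ι) (yc_inl B D e) hg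
    (fun j _ => stepLen_pos B D e hr j) (fun n => ⟨ygen B D e s fun i => n i, fun j hj => ?_⟩)
    hlf, ?_⟩
  · rw [yl_ygen_apply B D e hs _ hj]
  · intro c χ H m x hc hc0 hcc hH hx hbx
    exact ev_fibre (π := SemidirectProduct.rightHom) (fun _ => rfl) (fun _ => rfl)
      bijective_inl_inr (polyZ_inl h e) hz hbz T
      (fun l hl => homog_volL _ _ (by simpa using hl)) hcvol hinl (volL_inr B D e h.disc) hne hlf
      (fun l hl => homog_nest (v + 1) 0 _ (by simpa using hl))
      (by rw [cod_comp_map, cod_nest]; rfl) hc hc0 hcc hH hx hbx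

end Datum

end ListCx

namespace ListCx

theorem nest_zero_congr {X : Type*} {u : ℕ} {f g : X → ℕ → ℝ} (h : ∀ x, ∀ i < u, f x i = g x i)
    (l : List X) : nest u 0 (l.map f) = nest u 0 (l.map g) := by
  by_cases hl : l.length = u + 1
  · rw [nest_zero_apply (by simpa using hl), nest_zero_apply (by simpa using hl)]
    have key : ∀ (z : X → ℕ → ℝ) (i : ℕ) (hi : i < u + 1),
        (l.map z).getD i 0 = z (l[i]'(hl ▸ hi)) := by
      intro z i hi
      rw [List.getD_eq_getElem _ _ (by simp; omega), List.getElem_map]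
    refine Finset.prod_congr rfl fun i hi => ?_
    have hi := Finset.mem_range.1 hi
    simp only [key _ i (by omega), key _ (i + 1) (by omega), h _ i hi]
  · rw [homog_nest u 0 _ (by simpa using hl), homog_nest u 0 _ (by simpa using hl)]

variable {O : Type*} [CommRing O] [IsDomain O] [CharZero O] {J : Type*} [Fintype J] [DecidableEq J]
  {ι : O →+* ℂ} {u : ℕ} (B : Frame O (Fin 2)) (D : Datum O J) (e : (Fin 2 × J) × Fin 2 ≃ Fin u)

theorem Frame.lf_nest (h : Disc ι) {S₀ : Matrix (Fin 2) (Fin 2) ℂ} (hS₀ : PD S₀)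
    {F : List (ℕ → ℝ) → ℝ} (hF : ∀ l, F l ≠ 0 → PeelHits 2 0 {x | x ∈ l}) :
    LF (MonoidHom.id (Matrix.GeneralLinearGroup (Fin 2) O))
      fun l => F (l.map (B.baseDatum.pos ι S₀)) := by
  classical
  intro l
  refine (h.finite_re_im l.toFinset (S := tw ι S₀) (fun y _ => pd_tw hS₀ y)
    B.det_ne_zero).subset fun γ hγ => ?_
  have h1 := (hF _ hγ).1
  have h2 : ∀ w : Matrix.GeneralLinearGroup (Fin 2) O → ℝ, ∑ y ∈ l.toFinset,
      w y • B.baseDatum.pos ι S₀ (γ * y) =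
      entry 0 1 (cj ((B.q * γ.val).map ι) (∑ y ∈ l.toFinset, w y • tw ι S₀ y)) := by
    intro w
    simp only [map_sum, map_smul]
    exact Finset.sum_congr rfl fun y _ => by rw [Datum.pos_mul]; rfl
  constructor
  · obtain ⟨v, hv, h0⟩ := h1 0 (by omega)
    rw [List.map_map] at hv
    obtain ⟨c, hc, rfl⟩ := exists_wt_map hv
    simp only [Function.comp_apply, MonoidHom.id_apply, h2] at h0
    exact ⟨c, hc, h0⟩
  · obtain ⟨v, hv, h0⟩ := h1 1 (by omega)
    rw [List.map_map] at hv
    obtain ⟨c, hc, rfl⟩ := exists_wt_map hv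
    simp only [Function.comp_apply, MonoidHom.id_apply, h2] at h0
    exact ⟨c, hc, h0⟩

theorem Frame.ev_sm_nest (h : Disc ι) {S₀ : Matrix (Fin 2) (Fin 2) ℂ} (hS₀ : PD S₀)
    {χ : Matrix.GeneralLinearGroup (Fin 2) O →* ℝ} {H : Subgroup (Matrix.GeneralLinearGroup (Fin 2) O)}
    (hH : H ≤ χ.ker) {z : Ch (Matrix.GeneralLinearGroup (Fin 2) O)} (hz : bd z ∈ coin H) :
    ev (sm (MonoidHom.id _) χ fun l => nest 2 0 (l.map (B.baseDatum.pos ι S₀))) z =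
    ev (sm (MonoidHom.id _) χ fun l => tau 2 (l.map (B.baseDatum.pos ι S₀))) z := by
  obtain ⟨k, -, hk, hk'⟩ := exists_peel 2 0
  refine (ev_sm_eq_of_sub_eq_cod (B.lf_nest h hS₀ fun l => nest_hits)
    (h := fun l => k (l.map (B.baseDatum.pos ι S₀))) (B.lf_nest h hS₀ hk') ?_ hH hz).symm
  rw [cod_comp_map, ← hk]
  rfl

namespace Datum

theorem nest_psi (S₀ : Matrix (Fin 2) (Fin 2) ℂ) (S : Matrix J J ℂ) :
    (fun l : List (PM O J) => nest (u + 2) D.N (l.map (psi B D e S₀ S ι))) =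
    cup u (fun l => nest u 0 (l.map (yc B D e ι))) fun l =>
      cup 2 (fun l => nest 2 0 ((l.map Prod.fst).map (B.baseDatum.pos ι S₀)))
        (fun l => tau D.N ((l.map Prod.snd).map (D.pos ι S)))
        (l.map (SemidirectProduct.rightHom : PM O J →* LM O J)) := by
  ext l
  rw [nest_add u 2]
  simp only [cup]
  congr 1
  · rw [← List.map_take]
    exact nest_zero_congr (fun x i hi => app_of_lt hi) _
  · rw [← List.map_drop, List.map_map]
    have h1 : tl^[u] ∘ psi B D e S₀ S ι = fun p =>
        app 2 (B.baseDatum.pos ι S₀ p.right.1) (D.pos ι S p.right.2) := by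
      ext1 p
      exact tl_app u _ _
    have h2 := congrFun (nest_add 2 0 D.N) ((l.drop u).map fun p =>
        app 2 (B.baseDatum.pos ι S₀ p.right.1) (D.pos ι S p.right.2))
    rw [h1]
    refine h2.trans ?_
    simp only [cup, ← List.map_take, ← List.map_drop, List.map_map]
    congr 1
    exact nest_zero_congr (fun x i hi => app_of_lt hi) _

theorem exists_parabolic_cycle {ω : O} {N : ℕ} (h : QuadRing ι ω N) (hu : 0 < u)
    {S₀ : Matrix (Fin 2) (Fin 2) ℂ} (hS₀ : PD S₀) {S : Matrix J J ℂ} (hS : PD S)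
    {χ : Matrix.GeneralLinearGroup (Fin 2) O →* ℝ} {ψ : Matrix.GeneralLinearGroup J O →* ℝ}
    {H : Subgroup (Matrix.GeneralLinearGroup (Fin 2) O)}
    {K : Subgroup (Matrix.GeneralLinearGroup J O)} (hH : H ≤ χ.ker) (hK : K ≤ ψ.ker)
    {z : Ch (Matrix.GeneralLinearGroup (Fin 2) O)} (hz : z ∈ chn _ 3) (hbz : bd z ∈ coin H)
    (hne : ev (sm (MonoidHom.id _) χ fun l => tau 2 (l.map (B.baseDatum.pos ι S₀))) z ≠ 0)
    {y : Ch (Matrix.GeneralLinearGroup J O)} (hy : y ∈ chn _ (D.N + 1)) (hby : bd y ∈ coin K)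
    (hney : ev (sm (MonoidHom.id _) ψ fun l => tau D.N (l.map (D.pos ι S))) y ≠ 0) :
    ∃ x ∈ chn (PM O J) (u + (2 + D.N) + 1),
      bd x ∈ coin ((H.prod K).comap (SemidirectProduct.rightHom : PM O J →* LM O J)) ∧
      ev (sm (MonoidHom.id _) ((χ.coprod ψ).comp SemidirectProduct.rightHom)
        fun l => nest (u + 2) D.N (l.map (psi B D e S₀ S ι))) x ≠ 0 := by
  obtain ⟨zU, T, κ, hκ, hT⟩ := exists_fibre_lift B D e h hu
  let T' : Lift (H.map (MonoidHom.inl _ (Matrix.GeneralLinearGroup J O))) (MonoidHom.inr _ _) 2 _ :=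
    shuffleLift hz hbz
  have hf := B.lf_nest h.disc hS₀ (F := nest 2 0) fun l => nest_hits
  have hc := D.lf_pos h.disc hS
  have hcf : cod (fun l => nest 2 0 (l.map (B.baseDatum.pos ι S₀))) = 0 := by
    rw [cod_comp_map, cod_nest]; rfl
  have hcc : cod (fun l => tau D.N (l.map (D.pos ι S))) = 0 := by
    rw [cod_comp_map, cod_tau]; rfl
  have hfH : Homog 3 fun l => nest 2 0 (l.map (B.baseDatum.pos ι S₀)) := fun l hl =>
    homog_nest 2 0 _ (by simpa using hl)
  have hcH : Homog (D.N + 1) fun l => tau D.N (l.map (D.pos ι S)) := fun l hl =>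
    homog_tau D.N _ (by simpa using hl)
  have hprod := ev_product hf hfH hcf hc hcc hH hK hz hbz hy hby
  have hx : T'.Θ y ∈ chn (LM O J) (D.N + 1 + 2) := T'.mem _ _ hy
  have hbx : bd (T'.Θ y) ∈ coin (H.prod K) := by
    refine bd_lift_mem T' (H' := H.prod K) (fun k hk => ⟨one_mem _, hk⟩) ?_ hby
    rintro _ ⟨k, hk, rfl⟩
    exact ⟨hk, one_mem _⟩
  have hHK : H.prod K ≤ (χ.coprod ψ).ker := by
    rintro ⟨a, b⟩ ⟨ha, hb⟩
    rw [MonoidHom.mem_ker, MonoidHom.coprod_apply, MonoidHom.mem_ker.1 (hH ha),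
      MonoidHom.mem_ker.1 (hK hb), one_mul]
  refine ⟨T.Θ (T'.Θ y), ?_, ?_, ?_⟩
  · convert T.mem _ _ hx using 2
    omega
  · refine bd_lift_mem T (fun l hl => hl) ?_ hbx
    rintro _ ⟨a, rfl⟩
    exact one_mem (H.prod K)
  · rw [nest_psi, hT (LF.cup_prod hf hc) ?_ ?_ hHK hx hbx, hprod, B.ev_sm_nest h.disc hS₀ hH hbz]
    · exact mul_ne_zero hκ (mul_ne_zero hne hney)
    · simp [cup, nest_nil]
    · rw [cod_cup 2 (α := fun l => nest 2 0 ((l.map Prod.fst).map (B.baseDatum.pos ι S₀)))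
        (β := fun l => tau D.N ((l.map Prod.snd).map (D.pos ι S)))
        (fun l hl => hfH _ (by simpa using hl)) (homog_tau _ _ (by simp)),
        cod_comp_map (fun l => nest 2 0 (l.map (B.baseDatum.pos ι S₀))) Prod.fst, hcf,
        cod_comp_map (fun l => tau D.N (l.map (D.pos ι S))) Prod.snd, hcc]
      ext l
      simp [cup]

end Datum

end ListCx

namespace ListCx

section

variable {J : Type*} [Fintype J] [DecidableEq J]

theorem schur_rows {P : Matrix (Fin 2) (Fin 2) ℂ} {Y : Matrix (Fin 2) J ℂ} {Z : Matrix J (Fin 2) ℂ}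
    {M : Matrix J J ℂ} (hM : M.det ≠ 0) {Q : Matrix (Fin 2 ⊕ J) (Fin 2 ⊕ J) ℂ}
    {d : Fin 2 ⊕ J → ℂ} (hd : ∀ i, d i ≠ 0)
    (hQ : Q * Matrix.fromBlocks P Y Z M * Q.conjTranspose = Matrix.diagonal d)
    {p : Fin 2 → Fin 2 ⊕ J} (hp : Function.Injective p)
    (h0 : ∀ i, i ∉ Set.range p → ∀ a, Q i (.inl a) = 0) :
    Q.submatrix p Sum.inl * (P - Y * M⁻¹ * Z) * (Q.submatrix p Sum.inl).conjTranspose =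
      Matrix.diagonal (d ∘ p) := by
  have hdd : Matrix.diagonal d * Matrix.diagonal (fun i => (d i)⁻¹) = 1 := by
    rw [Matrix.diagonal_mul_diagonal, ← Matrix.diagonal_one]
    congr 1
    ext i
    exact mul_inv_cancel₀ (hd i)
  have h1 : Matrix.fromBlocks P Y Z M * Q.conjTranspose * Matrix.diagonal (fun i => (d i)⁻¹) * Q =
      1 := by
    rw [mul_eq_one_comm, ← hdd, ← hQ]
    simp only [Matrix.mul_assoc]
  set K : Matrix (Fin 2) (Fin 2 ⊕ J) ℂ := Matrix.fromCols 1 (-(Y * M⁻¹)) with hKdef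
  have hK : K * Matrix.fromBlocks P Y Z M = Matrix.fromCols (P - Y * M⁻¹ * Z) 0 := by
    rw [hKdef, Matrix.fromCols_mul_fromBlocks]
    congr 1
    · simp [sub_eq_add_neg]
    · rw [Matrix.one_mul, Matrix.neg_mul, Matrix.mul_assoc,
        Matrix.nonsing_inv_mul _ (isUnit_iff_ne_zero.2 hM), Matrix.mul_one, add_neg_cancel]
  have hcut : (Matrix.fromCols (P - Y * M⁻¹ * Z) 0 : Matrix (Fin 2) (Fin 2 ⊕ J) ℂ) *
      Q.conjTranspose = (P - Y * M⁻¹ * Z) * (Q.submatrix id Sum.inl).conjTranspose := by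
    ext a b
    simp [Matrix.mul_apply, Fintype.sum_sum_type]
  have hsum : (Q.submatrix id Sum.inl).conjTranspose * Matrix.diagonal (fun i => (d i)⁻¹) *
      Q.submatrix id Sum.inl = (Q.submatrix p Sum.inl).conjTranspose *
        Matrix.diagonal (fun i => (d (p i))⁻¹) * Q.submatrix p Sum.inl := by
    ext a b
    rw [Matrix.mul_apply, Matrix.mul_apply]
    simp only [Matrix.mul_diagonal, Matrix.conjTranspose_apply, Matrix.submatrix_apply, id]
    rw [← Finset.sum_subset (Finset.subset_univ (Finset.univ.image p)),
      Finset.sum_image fun _ _ _ _ h => hp h]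
    intro i _ hi
    rw [h0 i (by simpa using hi) b, mul_zero]
  have h2 : (P - Y * M⁻¹ * Z) * ((Q.submatrix p Sum.inl).conjTranspose *
        Matrix.diagonal (fun i => (d (p i))⁻¹) * Q.submatrix p Sum.inl) = 1 := by
    rw [← hsum]
    have h3 := congrArg (fun X => (K * X).submatrix id Sum.inl) h1
    simp only [← Matrix.mul_assoc, hK, hcut, Matrix.mul_one] at h3
    have e1 : K.submatrix id Sum.inl = 1 := by ext a b; simp [hKdef]
    rw [e1] at h3
    rw [← h3]
    simp only [Matrix.mul_assoc]
    rfl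
  have hdp : Matrix.diagonal (fun i => (d (p i))⁻¹) * Matrix.diagonal (d ∘ p) = 1 := by
    rw [Matrix.diagonal_mul_diagonal, ← Matrix.diagonal_one]
    congr 1
    ext i
    exact inv_mul_cancel₀ (hd _)
  rw [← Matrix.mul_assoc, mul_eq_one_comm] at h2
  calc _ = Q.submatrix p Sum.inl * (P - Y * M⁻¹ * Z) * (Q.submatrix p Sum.inl).conjTranspose *
        (Matrix.diagonal (fun i => (d (p i))⁻¹) * Matrix.diagonal (d ∘ p)) := by
        rw [hdp, Matrix.mul_one]
    _ = (Q.submatrix p Sum.inl * ((P - Y * M⁻¹ * Z) * ((Q.submatrix p Sum.inl).conjTranspose *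
        Matrix.diagonal (fun i => (d (p i))⁻¹)))) * Matrix.diagonal (d ∘ p) := by
        simp only [Matrix.mul_assoc]
    _ = _ := by rw [h2, Matrix.one_mul]

/-- The rows whose first component does not vanish are few, if the determinant of a form grows
at most quadratically. -/
theorem card_rows_le {n : Type*} [Fintype n] [DecidableEq n] {c t K : ℝ} (hc : 0 < c)
    (ht : 1 ≤ t) {d : n → ℝ} {s : Finset n} (h1 : ∀ i, c ≤ d i) (h2 : ∀ i ∈ s, c * t ≤ d i)
    (hK : ∏ i, d i ≤ K * t ^ 2) (hKt : K / c ^ Fintype.card n < t) : s.card ≤ 2 := by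
  by_contra hs
  have h3 : c ^ Fintype.card n * t ^ s.card ≤ ∏ i, d i := by
    have : c ^ Fintype.card n * t ^ s.card = ∏ i, (c * if i ∈ s then t else 1) := by
      rw [Finset.prod_mul_distrib, Finset.prod_const, Finset.card_univ, Finset.prod_ite_mem,
        Finset.univ_inter, Finset.prod_const]
    rw [this]
    refine Finset.prod_le_prod (fun i _ => ?_) fun i _ => ?_
    · split_ifs <;> positivity
    · split_ifs with h
      · exact h2 i h
      · simpa using h1 i
  have h4 : t ^ 3 ≤ t ^ s.card := pow_le_pow_right₀ ht (by omega)
  have hcn : 0 < c ^ Fintype.card n := by positivity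
  rw [div_lt_iff₀ hcn] at hKt
  have h5 : c ^ Fintype.card n * t ^ 3 ≤ K * t ^ 2 :=
    (mul_le_mul_of_nonneg_left h4 hcn.le).trans (h3.trans hK)
  have h6 : 0 < t ^ 2 := by positivity
  nlinarith [mul_lt_mul_of_pos_right hKt h6]

theorem norm_det_fromBlocks_le {C T : ℝ} (hT : 1 ≤ T) {A X : Matrix (Fin 2) (Fin 2) ℂ}
    {Y : Matrix (Fin 2) J ℂ} {Z : Matrix J (Fin 2) ℂ} {M : Matrix J J ℂ}
    (hA : ∀ i j, ‖A i j‖ ≤ C) (hX : ∀ i j, ‖X i j‖ ≤ C) (hY : ∀ i j, ‖Y i j‖ ≤ C)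
    (hZ : ∀ i j, ‖Z i j‖ ≤ C) (hM : ∀ i j, ‖M i j‖ ≤ C) :
    ‖(Matrix.fromBlocks (T • A + X) Y Z M).det‖ ≤
      (Fintype.card (Fin 2 ⊕ J)).factorial * (2 * C) ^ Fintype.card (Fin 2 ⊕ J) * T ^ 2 := by
  have hC : 0 ≤ C := (norm_nonneg _).trans (hA 0 0)
  set s := Real.sqrt T with hs
  have hss : s * s = T := Real.mul_self_sqrt (by linarith)
  have hs1 : 1 ≤ s := by rw [hs, Real.one_le_sqrt]; exact hT
  have hs0 : s ≠ 0 := by linarith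
  have hinv : s⁻¹ ≤ 1 := inv_le_one_of_one_le₀ hs1
  have hinv0 : 0 ≤ s⁻¹ := inv_nonneg.2 (by linarith)
  set U : Matrix (Fin 2 ⊕ J) (Fin 2 ⊕ J) ℂ := Matrix.fromBlocks (s • 1) 0 0 1 with hU
  set W : Matrix (Fin 2 ⊕ J) (Fin 2 ⊕ J) ℂ :=
    Matrix.fromBlocks (A + (s⁻¹ * s⁻¹) • X) (s⁻¹ • Y) (s⁻¹ • Z) M with hW
  have e : Matrix.fromBlocks (T • A + X) Y Z M = U * W * U := by
    rw [hU, hW, Matrix.fromBlocks_multiply, Matrix.fromBlocks_multiply]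
    congr 1
    · simp [smul_smul, hs0, hss]
    · simp [smul_smul, hs0]
    · simp [smul_smul, hs0]
    · simp
  have hUd : ‖U.det‖ = T := by
    rw [hU, Matrix.det_fromBlocks_zero₂₁, Matrix.det_one, mul_one]
    simp only [Matrix.det_fin_two, Matrix.smul_apply, Matrix.one_apply_eq]
    simp
    rw [← hss]
  have hWb : ∀ i j, ‖W i j‖ ≤ 2 * C := by
    have hscale : ∀ (a : ℝ) (x : ℂ), 0 ≤ a → a ≤ 1 → ‖x‖ ≤ C → ‖a • x‖ ≤ C := by
      intro a x h0 h1 hx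
      rw [norm_smul, Real.norm_eq_abs, abs_of_nonneg h0]
      nlinarith [norm_nonneg x]
    have hle : C ≤ 2 * C := by linarith
    rintro (i | i) (j | j)
    · refine (norm_add_le (A i j) ((s⁻¹ * s⁻¹) • X i j)).trans ?_
      have := hscale (s⁻¹ * s⁻¹) (X i j) (mul_nonneg hinv0 hinv0) (mul_le_one₀ hinv hinv0 hinv)
        (hX i j)
      have := hA i j
      rw [two_mul]
      exact add_le_add this (by assumption)
    · exact (hscale _ _ hinv0 hinv (hY i j)).trans hle
    · exact (hscale _ _ hinv0 hinv (hZ i j)).trans hle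
    · exact (hM i j).trans hle
  have hb := Matrix.det_le (abv := NormedField.toAbsoluteValue ℂ) hWb
  have hb' : ‖W.det‖ ≤ (Fintype.card (Fin 2 ⊕ J)).factorial *
      (2 * C) ^ Fintype.card (Fin 2 ⊕ J) := by
    rw [nsmul_eq_mul] at hb
    exact hb
  rw [e, Matrix.det_mul, Matrix.det_mul, norm_mul, norm_mul, hUd]
  nlinarith [mul_le_mul_of_nonneg_left hb' (sq_nonneg T)]

end

section

variable {O : Type*} [CommRing O] [IsDomain O] [CharZero O] {J : Type*} [Fintype J] [DecidableEq J]

/-- A group element such that only two rows of `q γ` are visible in the first block is parabolic,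
or the visible part comes from an invertible matrix. -/
theorem Frame.visible_rows (B : Frame O (Fin 2)) (D : Frame O J)
    (γ : Matrix.GeneralLinearGroup (Fin 2 ⊕ J) O) {p : Fin 2 → Fin 2 ⊕ J}
    (hp : Function.Injective p)
    (h0 : ∀ i, i ∉ Set.range p → ∀ a, ((step B D).q * γ.val) i (.inl a) = 0) :
    γ.val.toBlocks₂₁ = 0 ∨ ∃ g : Matrix.GeneralLinearGroup (Fin 2) O,
      ((step B D).q * γ.val).submatrix p Sum.inl = ((step B D).μ : O) • g.val := by
  have hμ : ((step B D).μ : O) ≠ 0 := by exact_mod_cast (step B D).μ_pos.ne'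
  have hE : (step B D).E * ((step B D).q * γ.val) = ((step B D).μ : O) • γ.val := by
    rw [← Matrix.mul_assoc, (step B D).E_mul_q, Matrix.smul_mul, Matrix.one_mul]
  by_cases hs : ∃ a, p a ∉ Set.range (Sum.inl : Fin 2 → Fin 2 ⊕ J)
  · right
    obtain ⟨R, hR⟩ := (step B D).unimod p hp hs
    have h1 : ((step B D).μ : O) • γ.val.submatrix id Sum.inl =
        (step B D).E.submatrix id p * ((step B D).q * γ.val).submatrix p Sum.inl := by
      ext i a
      have h2 := congrFun (congrFun hE i) (.inl a)
      rw [Matrix.mul_apply] at h2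
      rw [Matrix.mul_apply, Matrix.smul_apply, Matrix.submatrix_apply, id, ← Matrix.smul_apply,
        ← h2, ← Finset.sum_subset (Finset.subset_univ (Finset.univ.image p)),
        Finset.sum_image fun _ _ _ _ h => hp h]
      · rfl
      · intro k _ hk
        rw [h0 k (by simpa using hk) a, mul_zero]
    set g := R * γ.val.submatrix id Sum.inl with hg
    have h2 : ((step B D).q * γ.val).submatrix p Sum.inl = ((step B D).μ : O) • g := by
      rw [hg, ← Matrix.mul_smul, h1, ← Matrix.mul_assoc, hR, Matrix.one_mul]
    have h3 : γ.val.submatrix id Sum.inl = (step B D).E.submatrix id p * g := by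
      rw [h2, Matrix.mul_smul] at h1
      ext i a
      exact mul_left_cancel₀ hμ (congrFun (congrFun h1 i) a)
    have h4 : (γ⁻¹.val.submatrix Sum.inl id * (step B D).E.submatrix id p) * g = 1 := by
      rw [Matrix.mul_assoc, ← h3]
      have h5 : γ⁻¹.val * γ.val = 1 := by rw [← Units.val_mul, inv_mul_cancel, Units.val_one]
      ext a b
      have := congrFun (congrFun h5 (.inl a)) (.inl b)
      rw [Matrix.mul_apply] at this ⊢
      simpa [Matrix.one_apply] using this
    exact ⟨⟨g, _, mul_eq_one_comm.1 h4, h4⟩, h2⟩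
  · left
    push Not at hs
    choose τ hτ using hs
    ext j a
    have h2 := congrFun (congrFun hE (.inr j)) (.inl a)
    rw [Matrix.mul_apply, Fintype.sum_sum_type, Matrix.smul_apply] at h2
    have h3 : ∀ k, (step B D).E (.inr j) (.inl k) = 0 := fun k => rfl
    have h4 : ∀ k, ((step B D).q * γ.val) (.inr k) (.inl a) = 0 := fun k =>
      h0 _ (by rintro ⟨b, hb⟩; rw [← hτ b] at hb; simp at hb) a
    simp only [h3, h4, zero_mul, mul_zero, Finset.sum_const_zero, add_zero, smul_eq_mul] at h2
    exact (mul_eq_zero.1 h2.symm).resolve_left hμ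

end

end ListCx

namespace ListCx

section

variable {J : Type*} [Fintype J] [DecidableEq J]

theorem conj_eq_diagonal {n : Type*} [Fintype n] [DecidableEq n] {M Q : Matrix n n ℂ}
    (hM : M.IsHermitian) (hd : ∀ i j, i ≠ j → (Q * M * Q.conjTranspose) i j = 0) :
    Q * M * Q.conjTranspose = Matrix.diagonal fun i => ((qf M (Q i) : ℝ) : ℂ) := by
  ext i j
  by_cases h : i = j
  · subst h
    rw [Matrix.diagonal_apply_eq, ← qf_row]
    have h2 := (Matrix.isHermitian_mul_mul_conjTranspose Q hM).apply i i
    exact (Complex.conj_eq_iff_re.1 h2).symm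
  · rw [hd i j h, Matrix.diagonal_apply_ne _ h]

theorem qf_fromBlocks_corner (A : Matrix (Fin 2) (Fin 2) ℂ) (r : Fin 2 ⊕ J → ℂ) :
    qf (Matrix.fromBlocks A 0 0 0) r = qf A (r ∘ Sum.inl) := by
  rw [qf, Matrix.fromBlocks_mulVec]
  simp only [dotProduct, Fintype.sum_sum_type, Sum.elim_inl, Sum.elim_inr, Matrix.zero_mulVec,
    add_zero, Pi.zero_apply, mul_zero, Finset.sum_const_zero]
  rfl

theorem sum_fromBlocks {Y m n : Type*} (s : Finset Y) (w : Y → ℝ) (A : Y → Matrix m m ℂ)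
    (B : Y → Matrix m n ℂ) (C : Y → Matrix n m ℂ) (D : Y → Matrix n n ℂ) :
    ∑ y ∈ s, w y • Matrix.fromBlocks (A y) (B y) (C y) (D y) =
      Matrix.fromBlocks (∑ y ∈ s, w y • A y) (∑ y ∈ s, w y • B y) (∑ y ∈ s, w y • C y)
        (∑ y ∈ s, w y • D y) := by
  ext (i | i) (j | j) <;> simp [Matrix.sum_apply]

theorem trace_mul_eq {g g' L M : Matrix (Fin 2) (Fin 2) ℂ} (hg : g' * g = 1) {μ : ℝ}
    {d : Fin 2 → ℂ} (e : (μ • g) * M * (μ • g).conjTranspose = Matrix.diagonal d) :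
    (μ : ℂ) ^ 2 * (L * M).trace =
      (g'.conjTranspose * L * g') 0 0 * d 0 + (g'.conjTranspose * L * g') 1 1 * d 1 := by
  have h1 : μ ^ 2 • M = g' * Matrix.diagonal d * g'.conjTranspose := by
    have h2 : g.conjTranspose * g'.conjTranspose = 1 := by
      rw [← Matrix.conjTranspose_mul, hg, Matrix.conjTranspose_one]
    calc μ ^ 2 • M = μ ^ 2 • ((g' * g) * M * (g.conjTranspose * g'.conjTranspose)) := by
          rw [hg, h2, Matrix.one_mul, Matrix.mul_one]
      _ = g' * ((μ • g) * M * (μ • g).conjTranspose) * g'.conjTranspose := by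
          rw [Matrix.conjTranspose_smul, star_trivial]
          simp only [Matrix.smul_mul, Matrix.mul_smul, smul_smul, Matrix.mul_assoc, sq]
      _ = _ := by rw [e]
  have h3 : (μ : ℂ) ^ 2 * (L * M).trace = (L * (μ ^ 2 • M)).trace := by
    rw [Matrix.mul_smul, Matrix.trace_smul, Complex.real_smul, Complex.ofReal_pow]
  rw [h3, h1, ← Matrix.mul_assoc, Matrix.trace_mul_comm, ← Matrix.mul_assoc, ← Matrix.mul_assoc,
    Matrix.trace_fin_two, Matrix.mul_diagonal, Matrix.mul_diagonal]

theorem norm_trace_le {L G : Matrix (Fin 2) (Fin 2) ℂ} {a b : ℝ} (ha : 0 ≤ a)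
    (hL : ∀ i j, ‖L i j‖ ≤ a) (hG : ∀ i j, ‖G i j‖ ≤ b) : ‖(L * G).trace‖ ≤ 4 * (a * b) := by
  rw [Matrix.trace_fin_two]
  have h0 := norm_mul_le ha hL hG 0 0
  have h1 := norm_mul_le ha hL hG 1 1
  rw [Fintype.card_fin] at h0 h1
  refine (norm_add_le _ _).trans ?_
  push_cast at h0 h1
  linarith

end

variable {O : Type*} [CommRing O] [IsDomain O] [CharZero O] {J : Type*} [Fintype J] [DecidableEq J]
  {ι : O →+* ℂ}

theorem tw_bigS (T : ℝ) (S₀ : Matrix (Fin 2) (Fin 2) ℂ) (S : Matrix J J ℂ) (y : PM O J) :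
    tw ι (Datum.bigS T S₀ S) (toG y) = Matrix.fromBlocks
      (T • tw ι S₀ y.right.1 + cj ((y.left.toAdd * y.right.2.val).map ι) S)
      ((y.left.toAdd * y.right.2.val).map ι * S * (y.right.2.val.map ι).conjTranspose)
      (y.right.2.val.map ι * S * ((y.left.toAdd * y.right.2.val).map ι).conjTranspose)
      (tw ι S y.right.2) := by
  rw [tw, toG_val, Matrix.fromBlocks_map, Matrix.map_zero _ (map_zero ι), Datum.bigS,
    cj_fromBlocks, map_smul, tw, tw]

set_option maxHeartbeats 1000000 in
/-- The finitely many forms spanned by `s` are diagonalised by parabolic elements only, provided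
the first form is stretched far enough. -/
theorem exists_parabolic_bound (h : Disc ι) (B : Frame O (Fin 2)) (D : Frame O J)
    {S₀ : Matrix (Fin 2) (Fin 2) ℂ} (hS₀ : PD S₀) {S : Matrix J J ℂ} (hS : PD S)
    (s : Finset (PM O J)) {L : Matrix (Fin 2) (Fin 2) ℂ}
    (hs : ∀ y ∈ s, (L * tw ι S₀ y.right.1).trace = 0)
    (hL : ∀ g : Matrix.GeneralLinearGroup (Fin 2) O,
      let M := (g.val.map ι).conjTranspose * L * g.val.map ι
      (1 ≤ (M 0 0).re ∧ 1 ≤ (M 1 1).re) ∨ ((M 0 0).re ≤ -1 ∧ (M 1 1).re ≤ -1)) :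
    ∃ T₀ : ℝ, ∀ T ≥ T₀, ∀ γ : Matrix.GeneralLinearGroup (Fin 2 ⊕ J) O, ∀ w, Wt s w →
      (∀ i j, i ≠ j → ((((Frame.step B D).q * γ.val).map ι) *
        (∑ y ∈ s, w y • tw ι (Datum.bigS T S₀ S) (toG y)) *
        (((Frame.step B D).q * γ.val).map ι).conjTranspose) i j = 0) →
      γ ∈ (toG (O := O) (J := J)).range := by
  obtain ⟨c₁, hc₁, C₁, hC₁, hb₁⟩ := exists_bd s (S := fun y => tw ι S₀ y.right.1)
    fun y _ => pd_tw hS₀ _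
  obtain ⟨c₂, hc₂, C₂, hC₂, hb₂⟩ := exists_bd s
    (S := fun y => tw ι (Datum.bigS 1 S₀ S) (toG y))
    fun y _ => pd_tw (pd_bigS (by rwa [one_smul]) hS) _
  obtain ⟨c₃, hc₃, C₃, hC₃, hb₃⟩ := exists_bd s (S := fun y => tw ι S y.right.2)
    fun y _ => pd_tw hS _
  obtain ⟨K₁, hK₁, hX⟩ := Wt.norm_sum_apply_le s
    fun y : PM O J => cj ((y.left.toAdd * y.right.2.val).map ι) S
  obtain ⟨K₂, hK₂, hY⟩ := Wt.norm_sum_apply_le s fun y : PM O J =>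
    (y.left.toAdd * y.right.2.val).map ι * S * (y.right.2.val.map ι).conjTranspose
  obtain ⟨K₃, hK₃, hZ⟩ := Wt.norm_sum_apply_le s fun y : PM O J =>
    y.right.2.val.map ι * S * ((y.left.toAdd * y.right.2.val).map ι).conjTranspose
  obtain ⟨l, hl, hLl⟩ := exists_norm_le L
  set c := min c₁ c₂ with hc
  have hc0 : 0 < c := lt_min hc₁ hc₂
  set C := C₁ + C₃ + K₁ + K₂ + K₃ with hC
  set CG := K₁ + Fintype.card J * (Fintype.card J * (K₂ * (1 / c₃)) * K₃) with hCG
  set q := (Frame.step B D).q with hq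
  set μ := (Frame.step B D).μ with hμ
  set K := ‖ι q.det‖ ^ 2 * ((Fintype.card (Fin 2 ⊕ J)).factorial *
    (2 * C) ^ Fintype.card (Fin 2 ⊕ J) * 4) with hK
  set t₀ := |K / c ^ Fintype.card (Fin 2 ⊕ J)| + μ ^ 2 * (4 * (l * CG)) / c + 1 with ht₀
  have hCG0 : 0 ≤ CG := by positivity
  refine ⟨2 + t₀, fun T hT γ w hw h0 => ?_⟩
  set t := T - 1 with htT
  have ht' : t₀ < t := by linarith
  have hp1 : 0 ≤ μ ^ 2 * (4 * (l * CG)) / c := by positivity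
  have ht1 : 1 ≤ t := by
    have := abs_nonneg (K / c ^ Fintype.card (Fin 2 ⊕ J))
    linarith
  have htK : K / c ^ Fintype.card (Fin 2 ⊕ J) < t := by
    have := le_abs_self (K / c ^ Fintype.card (Fin 2 ⊕ J))
    linarith
  have htG : μ ^ 2 * (4 * (l * CG)) < c * t := by
    rw [← div_lt_iff₀' hc0]
    have := abs_nonneg (K / c ^ Fintype.card (Fin 2 ⊕ J))
    linarith
  have hne : (q * γ.val).det ≠ 0 := h.det_mul_ne_zero (Frame.det_ne_zero _) γ
  have hdet := h.norm_det_mul q γ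
  set Q := (q * γ.val).map ι with hQ
  have hA := hb₁ w hw
  have hM₁ := hb₂ w hw
  have hM := hb₃ w hw
  replace hX := hX w hw
  replace hY := hY w hw
  replace hZ := hZ w hw
  have hLA : (L * ∑ y ∈ s, w y • tw ι S₀ y.right.1).trace = 0 := by
    rw [Matrix.mul_sum, Matrix.trace_sum]
    refine Finset.sum_eq_zero fun y hy => ?_
    rw [Matrix.mul_smul, Matrix.trace_smul, hs y hy, smul_zero]
  have hform : ∀ T : ℝ, ∑ y ∈ s, w y • tw ι (Datum.bigS T S₀ S) (toG y) =
      Matrix.fromBlocks (T • (∑ y ∈ s, w y • tw ι S₀ y.right.1) +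
        ∑ y ∈ s, w y • cj ((y.left.toAdd * y.right.2.val).map ι) S)
        (∑ y ∈ s, w y • ((y.left.toAdd * y.right.2.val).map ι * S *
          (y.right.2.val.map ι).conjTranspose))
        (∑ y ∈ s, w y • (y.right.2.val.map ι * S *
          ((y.left.toAdd * y.right.2.val).map ι).conjTranspose))
        (∑ y ∈ s, w y • tw ι S y.right.2) := by
    intro T
    simp only [tw_bigS]
    rw [sum_fromBlocks]
    congr 1
    rw [Finset.smul_sum, ← Finset.sum_add_distrib]
    exact Finset.sum_congr rfl fun y _ => by rw [smul_add, smul_comm]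
  have hMT := isHermitian_sum (s := s) (w := w)
    (S := fun y => tw ι (Datum.bigS T S₀ S) (toG y))
    fun y _ => (pd_tw (pd_bigS (hS₀.smul (by linarith : (0 : ℝ) < T)) hS) _).1
  rw [hform 1] at hM₁
  rw [hform T] at h0 hMT
  set A := ∑ y ∈ s, w y • tw ι S₀ y.right.1
  set X := ∑ y ∈ s, w y • cj ((y.left.toAdd * y.right.2.val).map ι) S
  set Y := ∑ y ∈ s, w y • ((y.left.toAdd * y.right.2.val).map ι * S *
    (y.right.2.val.map ι).conjTranspose)
  set Z := ∑ y ∈ s, w y • (y.right.2.val.map ι * S *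
    ((y.left.toAdd * y.right.2.val).map ι).conjTranspose)
  set M := ∑ y ∈ s, w y • tw ι S y.right.2
  set MT := Matrix.fromBlocks (T • A + X) Y Z M with hMTdef
  have hqf : ∀ r, qf MT r = t * qf A (r ∘ Sum.inl) +
      qf (Matrix.fromBlocks ((1 : ℝ) • A + X) Y Z M) r := by
    intro r
    have e : MT = Matrix.fromBlocks (t • A) 0 0 0 +
        Matrix.fromBlocks ((1 : ℝ) • A + X) Y Z M := by
      rw [Matrix.fromBlocks_add, ← add_assoc, ← add_smul, htT, sub_add_cancel]
      simp only [zero_add, hMTdef]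
    rw [e, qf_add, qf_fromBlocks_corner, qf, Matrix.smul_mulVec, dotProduct_smul,
      Complex.real_smul, Complex.re_ofReal_mul, ← qf]
  have hrow : ∀ i, c ≤ qf MT (Q i) := by
    intro i
    have h1 := h.le_qf hc₂ hM₁ hne i
    have h2 := hA.2.1 (Q i ∘ Sum.inl)
    have h3 := nsq_nonneg (Q i ∘ Sum.inl)
    rw [hqf]
    have h4 : 0 ≤ t * qf A (Q i ∘ Sum.inl) :=
      mul_nonneg (by linarith) ((mul_nonneg hc₁.le h3).trans h2)
    linarith [min_le_right c₁ c₂]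
  have hrow' : ∀ i, (fun a => (q * γ.val) i (.inl a)) ≠ 0 → c * t ≤ qf MT (Q i) := by
    intro i hi
    have h1 := h.le_qf hc₂ hM₁ hne i
    have h2 := hA.2.1 (Q i ∘ Sum.inl)
    have h3 : 1 ≤ nsq (Q i ∘ Sum.inl) := h.one_le_nsq hi
    rw [hqf]
    have h4 : c ≤ qf A (Q i ∘ Sum.inl) := by nlinarith [min_le_left c₁ c₂]
    nlinarith
  have hprod := diag_le hc0 hMT hrow h0
  classical
  set s₂ := Finset.univ.filter fun i => (fun a : Fin 2 => (q * γ.val) i (.inl a)) ≠ 0 with hs₂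
  have hcard : s₂.card ≤ 2 := by
    refine card_rows_le hc0 ht1 hrow (fun i hi => hrow' i (Finset.mem_filter.1 hi).2) ?_ htK
    rw [hprod, hdet, hK, mul_assoc, mul_assoc]
    refine mul_le_mul_of_nonneg_left ?_ (sq_nonneg _)
    have hle := norm_det_fromBlocks_le (C := C) (by linarith : (1 : ℝ) ≤ T)
      (fun i j => (hA.2.2 i j).trans (by rw [hC]; linarith))
      (fun i j => (hX i j).trans (by rw [hC]; linarith))
      (fun i j => (hY i j).trans (by rw [hC]; linarith))
      (fun i j => (hZ i j).trans (by rw [hC]; linarith))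
      (fun i j => (hM.2.2 i j).trans (by rw [hC]; linarith))
    refine hle.trans ?_
    refine mul_le_mul_of_nonneg_left ?_ (by positivity)
    nlinarith
  obtain ⟨s₃, hs₃, hs₃c⟩ := Finset.exists_superset_card_eq hcard (by simp)
  let p : Fin 2 → Fin 2 ⊕ J := fun a => (s₃.equivFinOfCardEq hs₃c).symm a
  have hp : Function.Injective p :=
    Subtype.val_injective.comp (s₃.equivFinOfCardEq hs₃c).symm.injective
  have hp0 : ∀ i, i ∉ Set.range p → ∀ a, (q * γ.val) i (.inl a) = 0 := by
    intro i hi a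
    by_contra ha
    refine hi ⟨s₃.equivFinOfCardEq hs₃c ⟨i, hs₃ ?_⟩, by simp [p]⟩
    exact Finset.mem_filter.2 ⟨Finset.mem_univ _, fun e => ha (congrFun e a)⟩
  rcases Frame.visible_rows B D γ hp hp0 with h21 | ⟨g, hg⟩
  · exact mem_range_toG h21
  exfalso
  have hd := conj_eq_diagonal hMT h0
  have hsch := schur_rows (hM.det_ne_zero hc₃)
    (fun i => by exact_mod_cast (hc0.trans_le (hrow i)).ne') hd hp (fun i hi a => by
      rw [hQ, Matrix.map_apply, hp0 i hi a, map_zero])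
  have hQs : Q.submatrix p Sum.inl = (μ : ℝ) • g.val.map ι := by
    rw [← map_nat_smul, ← hg]
    rfl
  rw [hQs, add_sub_assoc] at hsch
  have hinv : g⁻¹.val.map ι * g.val.map ι = 1 := by
    rw [← Matrix.map_mul, ← Units.val_mul, inv_mul_cancel, Units.val_one,
      Matrix.map_one _ (map_zero ι) (map_one ι)]
  have htr := trace_mul_eq (L := L) hinv hsch
  rw [Matrix.mul_add, Matrix.trace_add, Matrix.mul_smul, Matrix.trace_smul, hLA, smul_zero,
    zero_add] at htr
  have hG : ∀ i j, ‖(X - Y * M⁻¹ * Z) i j‖ ≤ CG := fun i j =>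
    (norm_sub_le (X i j) ((Y * M⁻¹ * Z) i j)).trans (add_le_add (hX i j)
      (norm_mul_le (by positivity) (norm_mul_le hK₂ hY (hM.norm_inv_le hc₃)) hZ i j))
  have htr' := norm_trace_le hl hLl hG
  have hre := congrArg Complex.re htr
  simp only [Function.comp_apply, Complex.add_re, Complex.re_mul_ofReal] at hre
  have hμt : |((((μ : ℝ) : ℂ) ^ 2 * (L * (X - Y * M⁻¹ * Z)).trace).re)| ≤
      μ ^ 2 * (4 * (l * CG)) := by
    refine (Complex.abs_re_le_norm _).trans ?_
    rw [norm_mul, norm_pow, Complex.norm_real, Real.norm_natCast]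
    exact mul_le_mul_of_nonneg_left htr' (by positivity)
  rw [hre, abs_le] at hμt
  have hgr : ∀ a, c * t ≤ qf MT (Q (p a)) := by
    intro a
    refine hrow' _ fun e => ?_
    refine Disc.row_ne_zero (Matrix.isUnits_det_units g).ne_zero a (funext fun b => ?_)
    have h1 := congrFun (congrFun hg a) b
    rw [Matrix.submatrix_apply, Matrix.smul_apply, smul_eq_mul] at h1
    have h2 : (q * γ.val) (p a) (.inl b) = 0 := congrFun e b
    rw [h2] at h1
    exact (mul_eq_zero.1 h1.symm).resolve_left (by exact_mod_cast (Frame.step B D).μ_pos.ne')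
  have h5 := hgr 0
  have h6 := hgr 1
  have h7 : 0 < c * t := by positivity
  rcases hL g⁻¹ with ⟨h3, h4⟩ | ⟨h3, h4⟩
  · have h8 := mul_le_mul_of_nonneg_right h3 (h7.le.trans h5)
    have h9 := mul_le_mul_of_nonneg_right h4 (h7.le.trans h6)
    linarith only [h5, h6, h7, h8, h9, hμt.2, htG]
  · have h8 := mul_le_mul_of_nonneg_right h3 (h7.le.trans h5)
    have h9 := mul_le_mul_of_nonneg_right h4 (h7.le.trans h6)
    linarith only [h5, h6, h7, h8, h9, hμt.1, htG]

theorem mem_of_mem_support_mp {X Y : Type*} {φ : X → Y} {x : Ch X} {l : List Y}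
    (hl : l ∈ (mp φ x).support) : ∃ l', l = List.map φ l' := by
  classical
  obtain ⟨l', -, rfl⟩ := Finset.mem_image.1 (Finsupp.mapDomain_support hl)
  exact ⟨l', rfl⟩

/-- A chain may be moved into a subgroup containing its boundary relations. -/
theorem exists_chain_in_subgroup {Γ : Type*} [Group Γ] {H : Subgroup Γ} {f : List Γ → ℝ}
    (hf : cod f = 0) (hinv : ∀ h ∈ H, ∀ l, f (l.map (h * ·)) = f l) {m : ℕ} {z : Ch Γ}
    (hz : z ∈ chn Γ m) (hbz : bd z ∈ coin H) :
    ∃ x ∈ chn H m, bd x ∈ coin (⊤ : Subgroup H) ∧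
      ev (fun l => f (l.map Subtype.val)) x = ev f z := by
  obtain ⟨ρ, hρ⟩ := exists_retraction H
  exact ⟨mp ρ z, mp_mem_chn ρ hz, bd_retraction hρ hbz, ev_retraction hρ hf hinv hbz⟩

theorem sm_comp_map_of_injective {Γ G : Type*} [Group Γ] [Group G] {σ : Γ →* G}
    (hσ : Function.Injective σ) (χ : G →* ℝ) (f : List G → ℝ) {l : List Γ}
    (h : ∀ g, f ((l.map σ).map (g * ·)) ≠ 0 → g ∈ σ.range) :
    sm (MonoidHom.id G) χ f (l.map σ) =
      sm (MonoidHom.id Γ) (χ.comp σ) (fun l => f (l.map σ)) l := by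
  rw [sm, sm]
  have h1 : ∀ g : Γ, (List.map σ (List.map (MonoidHom.id Γ g * ·) l)) =
      (l.map σ).map (MonoidHom.id G (σ g) * ·) := by
    intro g
    simp [Function.comp_def]
  simp only [h1, MonoidHom.comp_apply]
  refine Eq.trans ?_ (finsum_mem_range (f := fun g => χ g *
    f ((l.map σ).map (MonoidHom.id G g * ·))) hσ)
  rw [finsum_mem_def, Set.indicator_eq_self.2]
  intro g hg
  exact h g (right_ne_zero_of_mul hg)

/-- A datum is good if it detects a cycle for the character `χ`. -/
def Good (ι : O →+* ℂ) (χ : Matrix.GeneralLinearGroup J O →* ℝ) (D : Datum O J) : Prop :=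
  ∃ S, PD S ∧ ∃ z ∈ chn (Matrix.GeneralLinearGroup J O) (D.N + 1), bd z ∈ coin χ.ker ∧
    ev (sm (MonoidHom.id _) χ fun l => tau D.N (l.map (D.pos ι S))) z ≠ 0

/-- The input in dimension two: a cycle for the stabiliser of an indefinite form `L`. -/
structure Base (ι : O →+* ℂ) (χ : Matrix.GeneralLinearGroup (Fin 2) O →* ℝ)
    (B : Frame O (Fin 2)) where
  S : Matrix (Fin 2) (Fin 2) ℂ
  pd : PD S
  L : Matrix (Fin 2) (Fin 2) ℂ
  definite : ∀ g : Matrix.GeneralLinearGroup (Fin 2) O,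
    let M := (g.val.map ι).conjTranspose * L * g.val.map ι
    (1 ≤ (M 0 0).re ∧ 1 ≤ (M 1 1).re) ∨ ((M 0 0).re ≤ -1 ∧ (M 1 1).re ≤ -1)
  Δ : Subgroup (Matrix.GeneralLinearGroup (Fin 2) O)
  le_ker : Δ ≤ χ.ker
  trace_eq_zero : ∀ x ∈ Δ, (L * tw ι S x).trace = 0
  z : Ch (Matrix.GeneralLinearGroup (Fin 2) O)
  mem : z ∈ chn _ 3
  bd_mem : bd z ∈ coin Δ
  ev_ne_zero : ev (sm (MonoidHom.id _) χ fun l => tau 2 (l.map (B.baseDatum.pos ι S))) z ≠ 0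

theorem Base.good {χ : Matrix.GeneralLinearGroup (Fin 2) O →* ℝ} {B : Frame O (Fin 2)}
    (b : Base ι χ B) : Good ι χ B.baseDatum :=
  ⟨b.S, b.pd, b.z, b.mem, coin_mono b.le_ker b.bd_mem, b.ev_ne_zero⟩

theorem Base.good_step {ω : O} {N : ℕ} (h : QuadRing ι ω N)
    {χ : Matrix.GeneralLinearGroup (Fin 2) O →* ℝ} {B : Frame O (Fin 2)} (b : Base ι χ B)
    {ψ : Matrix.GeneralLinearGroup J O →* ℝ} {D : Datum O J} (hD : Good ι ψ D)
    {χ' : Matrix.GeneralLinearGroup (Fin 2 ⊕ J) O →* ℝ}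
    (hχ : χ'.comp toG = (χ.coprod ψ).comp SemidirectProduct.rightHom)
    {u : ℕ} (hu : 0 < u) (e : (Fin 2 × J) × Fin 2 ≃ Fin u) : Good ι χ' (D.step B e) := by
  classical
  obtain ⟨S, hS, y, hy, hby, hney⟩ := hD
  obtain ⟨x, hx, hbx, hnex⟩ := Datum.exists_parabolic_cycle B D e h hu b.pd hS b.le_ker
    (le_refl ψ.ker) b.mem b.bd_mem b.ev_ne_zero hy hby hney
  set H := (b.Δ.prod ψ.ker).comap (SemidirectProduct.rightHom : PM O J →* LM O J) with hH
  have hHχ : H ≤ (χ'.comp (toG (O := O) (J := J))).ker := by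
    intro p hp
    obtain ⟨h1, h2⟩ := Subgroup.mem_prod.1 (Subgroup.mem_comap.1 hp)
    rw [hχ, MonoidHom.mem_ker, MonoidHom.comp_apply, MonoidHom.coprod_apply,
      MonoidHom.mem_ker.1 (b.le_ker h1), MonoidHom.mem_ker.1 h2, one_mul]
  rw [← hχ] at hnex
  have hlf : LF (MonoidHom.id (PM O J))
      fun l => nest (u + 2) D.N (l.map (Datum.psi B D e b.S S ι)) := fun l =>
    (Datum.finite_peel B D e h.disc b.pd hS l).subset fun p hp => nest_hits hp
  obtain ⟨x', hx', hbx', hx'e⟩ := exists_chain_in_subgroup (H := H)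
    (by rw [cod_sm _ hlf, cod_comp_map, cod_nest]; exact sm_zero _ _)
    (fun g hg l => sm_translate_of_le_ker hHχ _ g hg l) hx hbx
  rw [← hx'e] at hnex
  set v := mp (Subtype.val : H → PM O J) x' with hv
  have hbv : bd v ∈ coin H := by
    rw [hv, bd_mp]
    exact mp_mem_coin H.subtype (fun g _ => g.2) hbx'
  have hvs : ∀ l ∈ v.support, ∀ p ∈ l, p ∈ H := by
    intro l hl p hp
    obtain ⟨l', rfl⟩ := mem_of_mem_support_mp hl
    obtain ⟨q, -, rfl⟩ := List.mem_map.1 hp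
    exact q.2
  have hbound : ∀ l : List (PM O J), ∃ T₀ : ℝ, l ∈ v.support → ∀ T ≥ T₀, 0 < T →
      ∀ γ, tau (D.step B e).N
        (((l.map toG).map (γ * ·)).map ((D.step B e).pos ι (Datum.bigS T b.S S))) ≠ 0 →
      γ ∈ (toG (O := O) (J := J)).range := by
    intro l
    by_cases hl : l ∈ v.support
    · obtain ⟨T₀, hT₀⟩ := exists_parabolic_bound h.disc B D.toFrame b.pd hS l.toFinset
        (fun p hp => b.trace_eq_zero _ (Subgroup.mem_prod.1 (Subgroup.mem_comap.1
          (hvs l hl p (List.mem_toFinset.1 hp)))).1) b.definite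
      refine ⟨T₀, fun _ T hT hT0 γ hγ => ?_⟩
      obtain ⟨a, ha, ha0⟩ := hits_of_tau hγ
      rw [List.map_map, List.map_map] at ha
      obtain ⟨w, hw, rfl⟩ := exists_wt_map ha
      refine hT₀ T hT γ w hw fun i j hij => (D.step B e).sum_cj_eq_zero _ (fun p _ =>
        pd_tw (pd_bigS (b.pd.smul hT0) hS) _) (fun k hk => ?_) i j hij
      rw [← ha0 k hk]
      simp only [map_sum, map_smul, Function.comp_apply, Datum.pos_mul]
      rfl
    · exact ⟨0, fun h => absurd h hl⟩
  choose T₀ hT₀ using hbound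
  obtain ⟨T₁, hT₁⟩ := (v.support.image T₀).exists_le
  set T := max T₁ 1
  have hT0 : 0 < T := lt_max_of_lt_right one_pos
  refine ⟨Datum.bigS T b.S S, pd_bigS (b.pd.smul hT0) hS, mp toG v, mp_mem_chn _
    (mp_mem_chn _ hx'), ?_, ?_⟩
  · rw [bd_mp]
    exact mp_mem_coin toG (fun g hg => hHχ hg) hbv
  · have h1 : ev (sm (MonoidHom.id _) χ' fun l => tau (D.step B e).N
        (l.map ((D.step B e).pos ι (Datum.bigS T b.S S)))) (mp toG v) =
        ev (sm (MonoidHom.id _) (χ'.comp toG) fun l => tau (u + (2 + D.N))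
          (l.map fun p => (D.step B e).pos ι (Datum.bigS T b.S S) (toG p))) v := by
      rw [ev_mp]
      refine ev_congr fun l hl => ?_
      rw [sm_comp_map_of_injective toG_injective χ' _ (hT₀ l hl T
        ((hT₁ _ (Finset.mem_image_of_mem _ hl)).trans (le_max_left _ _)) hT0)]
      simp only [List.map_map]
      rfl
    rw [h1, Datum.ev_sm_pos_toG B D e h.disc hT0 b.pd hS hHχ hbv, hv, ev_mp]
    exact hnex

end ListCx

namespace ListCx

/-! ### Triangles in the plane orthogonal to an indefinite form -/

theorem det2_mul_tau_two_nonneg {w : Fin 3 → ℕ → ℝ} {a h : Fin 3 → ℝ} (ha : ∀ i, 0 ≤ a i)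
    (h0 : ∀ k < 2, ∑ i, a i * w i k = 0) (hh : 0 < ∑ i, a i * h i) :
    0 ≤ (h 0 * det2 (w 1) (w 2) + h 1 * det2 (w 2) (w 0) + h 2 * det2 (w 0) (w 1)) *
      tau 2 [w 0, w 1, w 2] := by
  set Δ := h 0 * det2 (w 1) (w 2) + h 1 * det2 (w 2) (w 0) + h 2 * det2 (w 0) (w 1) with hΔ
  have e0 := h0 0 (by omega)
  have e1 := h0 1 (by omega)
  rw [Fin.sum_univ_three] at e0 e1
  rw [Fin.sum_univ_three] at hh
  have k0 : a 0 * Δ = (a 0 * h 0 + a 1 * h 1 + a 2 * h 2) * det2 (w 1) (w 2) := by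
    simp only [hΔ, det2]
    linear_combination (h 1 * w 2 0 - h 2 * w 1 0) * e1 + (h 2 * w 1 1 - h 1 * w 2 1) * e0
  have k1 : a 1 * Δ = (a 0 * h 0 + a 1 * h 1 + a 2 * h 2) * det2 (w 2) (w 0) := by
    simp only [hΔ, det2]
    linear_combination (h 2 * w 0 0 - h 0 * w 2 0) * e1 + (h 0 * w 2 1 - h 2 * w 0 1) * e0
  have k2 : a 2 * Δ = (a 0 * h 0 + a 1 * h 1 + a 2 * h 2) * det2 (w 0) (w 1) := by
    simp only [hΔ, det2]
    linear_combination (h 0 * w 1 0 - h 1 * w 0 0) * e1 + (h 1 * w 0 1 - h 0 * w 1 1) * e0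
  rcases le_total 0 Δ with hd | hd
  · have p : ∀ {i : Fin 3} {x : ℝ},
        a i * Δ = (a 0 * h 0 + a 1 * h 1 + a 2 * h 2) * x → 0 ≤ x := fun {i x} e =>
      nonneg_of_mul_nonneg_right (e ▸ mul_nonneg (ha i) hd) hh
    exact mul_nonneg hd (tau_two_nonneg (p k0) (p k1) (p k2))
  · have p : ∀ {i : Fin 3} {x y : ℕ → ℝ},
        a i * Δ = (a 0 * h 0 + a 1 * h 1 + a 2 * h 2) * det2 x y → 0 ≤ det2 y x := fun {i x y} e =>
      nonneg_of_mul_nonneg_right (b := det2 y x) (by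
        rw [show det2 y x = - det2 x y by simp [det2]; ring, mul_neg, ← e]
        exact neg_nonneg.2 (mul_nonpos_of_nonneg_of_nonpos (ha i) hd)) hh
    have := tau_two_nonneg (w := ![w 0, w 2, w 1]) (p k0) (p k2) (p k1)
    simp only [Matrix.cons_val] at this
    rw [tau_two_swap] at this
    nlinarith

/-- The coordinates of a Hermitian matrix of size two which determine it modulo scalars. -/
def planeCoords (S : Matrix (Fin 2) (Fin 2) ℂ) : Fin 3 → ℝ :=
  ![(S 0 1).re, (S 0 1).im, (S 0 0).re - (S 1 1).re]

/-- The orientation of a triangle. -/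
noncomputable def orient (S : Fin 3 → Matrix (Fin 2) (Fin 2) ℂ) : ℝ :=
  (Matrix.of fun i => planeCoords (S i)).det

theorem det_corner (Q : Matrix (Fin 2) (Fin 2) ℂ) {B : ℂ} {S : Fin 3 → Matrix (Fin 2) (Fin 2) ℂ}
    (hS : ∀ i, (S i).IsHermitian) (h0 : ∀ i, (!![1, B; star B, 1] * S i).trace = 0) :
    let w := fun i => entry 0 1 (cj Q (S i))
    let h := fun i => (cj Q (S i) 1 1).re
    h 0 * det2 (w 1) (w 2) + h 1 * det2 (w 2) (w 0) + h 2 * det2 (w 0) (w 1) =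
      -(1 / 2) * ‖Q.det‖ ^ 2 * ((Q.adjugate.conjTranspose * !![1, B; star B, 1] *
        Q.adjugate) 0 0).re * orient S := by
  intro w h
  set p := Q 1 0 with hp
  set q := Q 1 1 with hq
  set u := Q 0 0 with hu
  set v := Q 0 1 with hv
  set cx : ℂ := -(u * star p + v * star q) * B.re + (u * star q + v * star p) with hcx
  set cy : ℂ := -(u * star p + v * star q) * B.im + Complex.I * (u * star q - v * star p) with hcy
  set cm : ℂ := (u * star p - v * star q) / 2 with hcm
  set tx : ℝ := -(p.re ^ 2 + p.im ^ 2 + (q.re ^ 2 + q.im ^ 2)) * B.re +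
    2 * (p.re * q.re + p.im * q.im) with htx
  set ty : ℝ := -(p.re ^ 2 + p.im ^ 2 + (q.re ^ 2 + q.im ^ 2)) * B.im -
    2 * (p.im * q.re - p.re * q.im) with hty
  set tm : ℝ := (p.re ^ 2 + p.im ^ 2 - (q.re ^ 2 + q.im ^ 2)) / 2 with htm
  have key : ∀ i, h i = tx * (S i 0 1).re + ty * (S i 0 1).im + tm * ((S i 0 0).re - (S i 1 1).re) ∧
      w i 0 = cx.re * (S i 0 1).re + cy.re * (S i 0 1).im +
        cm.re * ((S i 0 0).re - (S i 1 1).re) ∧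
      w i 1 = cx.im * (S i 0 1).re + cy.im * (S i 0 1).im +
        cm.im * ((S i 0 0).re - (S i 1 1).re) := by
    intro i
    have g1 := (hS i).apply 0 1
    have g2 := congrArg Complex.im ((hS i).apply 0 0)
    have g3 := congrArg Complex.im ((hS i).apply 1 1)
    have g4 := congrArg Complex.re (h0 i)
    simp only [Complex.star_def, Complex.conj_im] at g2 g3
    have g2 : (S i 0 0).im = 0 := by linarith
    have g3 : (S i 1 1).im = 0 := by linarith
    simp only [Matrix.trace_fin_two, Matrix.mul_apply, Fin.sum_univ_two, Matrix.of_apply,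
      Matrix.cons_val', Matrix.cons_val_zero, Matrix.cons_val_one, Matrix.cons_val_fin_one,
      Complex.add_re, Complex.mul_re, Complex.one_re, Complex.one_im, ← g1, Complex.star_def,
      Complex.conj_re, Complex.conj_im, Complex.zero_re] at g4
    refine ⟨?_, ?_, ?_⟩
    all_goals
      simp only [h, w, entry_apply, reim_zero, reim_one, cj_apply, Matrix.mul_apply,
        Fin.sum_univ_two, Matrix.conjTranspose_apply, ← g1, ← hp, ← hq, ← hu, ← hv, hcx, hcy, hcm,
        htx, hty, htm]
      simp [g2, g3]
    · linear_combination (1 / 2) * (p.re ^ 2 + p.im ^ 2 + (q.re ^ 2 + q.im ^ 2)) * g4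
    · linear_combination (1 / 2) * (u.re * p.re + u.im * p.im + v.re * q.re + v.im * q.im) * g4
    · linear_combination (1 / 2) * (u.im * p.re - u.re * p.im + v.im * q.re - v.re * q.im) * g4
  have e1 : h 0 * det2 (w 1) (w 2) + h 1 * det2 (w 2) (w 0) + h 2 * det2 (w 0) (w 1) =
      (tx * (cy.re * cm.im - cm.re * cy.im) - ty * (cx.re * cm.im - cm.re * cx.im) +
        tm * (cx.re * cy.im - cy.re * cx.im)) * orient S := by
    simp only [det2, (key _).1, (key _).2.1, (key _).2.2, orient, Matrix.det_fin_three,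
      Matrix.of_apply, planeCoords, Matrix.cons_val]
    ring
  rw [e1]
  congr 1
  rw [← Complex.normSq_eq_norm_sq, Complex.normSq_apply, Matrix.det_fin_two,
    Matrix.adjugate_fin_two]
  simp only [hcx, hcy, hcm, htx, hty, htm, ← hp, ← hq, ← hu, ← hv, Matrix.mul_apply,
    Fin.sum_univ_two, Matrix.conjTranspose_apply, Matrix.of_apply,
      Matrix.cons_val', Matrix.cons_val_zero, Matrix.cons_val_one, Matrix.cons_val_fin_one]
  simp
  ring

theorem trace_adjugate_mul_cj (Q L S : Matrix (Fin 2) (Fin 2) ℂ) (h : (L * S).trace = 0) :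
    (Q.adjugate.conjTranspose * L * Q.adjugate * cj Q S).trace = 0 := by
  have h1 : Q.adjugate.conjTranspose * L * Q.adjugate * cj Q S =
      Q.adjugate.conjTranspose * (L * ((Q.adjugate * Q) * S * Q.conjTranspose)) := by
    simp only [cj_apply, Matrix.mul_assoc]
  have h2 : Q.conjTranspose * Q.adjugate.conjTranspose = star Q.det • 1 := by
    rw [← Matrix.conjTranspose_mul, Matrix.adjugate_mul, Matrix.conjTranspose_smul,
      Matrix.conjTranspose_one]
  rw [h1, Matrix.adjugate_mul, Matrix.trace_mul_comm]
  simp only [Matrix.mul_assoc, h2, Matrix.smul_mul, Matrix.mul_smul, Matrix.one_mul,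
    Matrix.mul_one, Matrix.trace_smul, h, smul_zero]

/-- A triangle around the origin is oriented like the form at the first vector. -/
theorem plane_sign {Q : Matrix (Fin 2) (Fin 2) ℂ} {B : ℂ} {S : Fin 3 → Matrix (Fin 2) (Fin 2) ℂ}
    (hQ : IsUnit Q.det) (hS : ∀ i, PD (S i)) (h0 : ∀ i, (!![1, B; star B, 1] * S i).trace = 0)
    (ht : tau 2 [entry 0 1 (cj Q (S 0)), entry 0 1 (cj Q (S 1)), entry 0 1 (cj Q (S 2))] ≠ 0) :
    let M := Q.adjugate.conjTranspose * !![1, B; star B, 1] * Q.adjugate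
    0 ≤ -(M 0 0).re * orient S *
      tau 2 [entry 0 1 (cj Q (S 0)), entry 0 1 (cj Q (S 1)), entry 0 1 (cj Q (S 2))] ∧
    ∃ h₀ > 0, ∃ h₁ > 0, (M 0 0).re * h₀ + (M 1 1).re * h₁ = 0 := by
  intro M
  obtain ⟨v, hv, hv0⟩ := hits_of_tau ht
  obtain ⟨a, ha, hav⟩ := exists_wt (s := Finset.univ) (f := fun i => entry 0 1 (cj Q (S i))) hv
    (by simp [Fin.exists_fin_succ, eq_comm])
  have hpd : ∀ i, PD (cj Q (S i)) := fun i => (hS i).conj hQ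
  obtain ⟨c, hc, C, -, hbd⟩ := exists_bd Finset.univ fun i _ => hpd i
  obtain ⟨hH, hlow, -⟩ := hbd a ha
  set H := ∑ i, a i • cj Q (S i) with hHdef
  have hdiag : ∀ i, 0 < (H i i).re := by
    intro i
    have h1 := hlow (Pi.single i 1)
    have h2 : qf H (Pi.single i 1) = (H i i).re := by
      simp [qf]
    have h3 : 1 ≤ nsq (Pi.single i 1 : Fin 2 → ℂ) := by
      simpa using sq_le_nsq (Pi.single i 1 : Fin 2 → ℂ) i
    rw [h2] at h1
    nlinarith
  have hent : entry 0 1 H = v := by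
    rw [hHdef, map_sum, ← hav]
    simp only [map_smul]
  have h01 : H 0 1 = 0 := entry_eq_zero fun k hk => by rw [hent, hv0 k hk]
  have h10 := isHermitian_apply_eq_zero hH h01
  refine ⟨?_, _, hdiag 0, _, hdiag 1, ?_⟩
  · have h2 := det2_mul_tau_two_nonneg (w := fun i => entry 0 1 (cj Q (S i)))
      (h := fun i => (cj Q (S i) 1 1).re) (fun i => ha.1 i (Finset.mem_univ i))
      (fun k hk => by
        have := congrFun hav k
        rw [hv0 k hk, Finset.sum_apply] at this
        exact this)
      (by simpa [hHdef, Matrix.sum_apply] using hdiag 1)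
    rw [det_corner Q (fun i => (hS i).1) h0] at h2
    have h3 : 0 < ‖Q.det‖ ^ 2 := by
      have := hQ.ne_zero
      positivity
    refine nonneg_of_mul_nonneg_right (a := ‖Q.det‖ ^ 2) ?_ h3
    linarith
  · have htr : (M * H).trace = 0 := by
      rw [hHdef, Finset.mul_sum, Matrix.trace_sum]
      refine Finset.sum_eq_zero fun i _ => ?_
      rw [Matrix.mul_smul, Matrix.trace_smul, trace_adjugate_mul_cj Q _ _ (h0 i), smul_zero]
    rw [Matrix.trace_fin_two, Matrix.mul_apply, Matrix.mul_apply, Fin.sum_univ_two,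
      Fin.sum_univ_two, h01, h10] at htr
    have i0 := congrArg Complex.im (hH.apply 0 0)
    have i1 := congrArg Complex.im (hH.apply 1 1)
    simp only [Complex.star_def, Complex.conj_im] at i0 i1
    have h5 := congrArg Complex.re htr
    simp only [mul_zero, add_zero, zero_add, Complex.add_re, Complex.mul_re, Complex.zero_re,
      show (H 0 0).im = 0 by linarith, show (H 1 1).im = 0 by linarith, sub_zero] at h5
    exact h5

/-! ### Skew-Hermitian forms over imaginary quadratic rings -/

/-- The ring `ℤ[(1 + √-(4 N + 3)) / 2]`. -/
abbrev IQ (N : ℕ) := QuadraticAlgebra ℤ (-(N + 1)) 1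

namespace IQ

variable {N : ℕ}

/-- The square root of `-(4 N + 3)`. -/
def sqrtD (N : ℕ) : IQ N := ⟨-1, 2⟩

/-- The skew-Hermitian form with off-diagonal entry `β`. -/
def skew (β : IQ N) : Matrix (Fin 2) (Fin 2) (IQ N) := !![sqrtD N, β; -star β, sqrtD N]

theorem star_sqrtD : star (sqrtD N) = -sqrtD N := by
  ext <;> simp [sqrtD]

theorem sub_star_eq (x : IQ N) : x - star x = x.im * sqrtD N := by
  ext <;> simp [sqrtD]
  ring

theorem sqrtD_mul_self : sqrtD N * sqrtD N = ((-(4 * N + 3) : ℤ) : IQ N) := by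
  apply QuadraticAlgebra.ext
  · rw [QuadraticAlgebra.re_intCast]
    simp [sqrtD]
    ring
  · rw [QuadraticAlgebra.im_intCast]
    simp [sqrtD]

theorem skew_conjTranspose (β : IQ N) : (skew β).conjTranspose = -skew β := by
  ext i j : 1
  fin_cases i <;> fin_cases j <;> simp [skew] <;> exact star_sqrtD

theorem exists_eq_mul_sqrtD {x : IQ N} (h : star x = -x) : ∃ a : ℤ, x = a * sqrtD N := by
  refine ⟨-x.re, ?_⟩
  have h1 := congrArg QuadraticAlgebra.re h
  simp at h1
  ext <;> simp [sqrtD]; linarith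

theorem norm_eq (x : IQ N) : x.norm = x.re ^ 2 + x.re * x.im + (N + 1) * x.im ^ 2 := by
  rw [QuadraticAlgebra.norm_def]; ring

theorem norm_nonneg (x : IQ N) : 0 ≤ x.norm := by
  rw [norm_eq]
  nlinarith [sq_nonneg (2 * x.re + x.im), sq_nonneg x.im, mul_nonneg (Int.natCast_nonneg N) (sq_nonneg x.im)]

/-- A skew form in an arbitrary basis. -/
theorem exists_skew_conj {β : IQ N} (hβ : β.norm = 4 * N + 9) (G : Matrix (Fin 2) (Fin 2) (IQ N)) :
    ∃ A C : ℤ, (G.conjTranspose * skew β * G) 0 0 = A * sqrtD N ∧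
      (G.conjTranspose * skew β * G) 1 1 = C * sqrtD N ∧
      ((G.conjTranspose * skew β * G) 0 1).norm = (4 * N + 3) * A * C + 6 * G.det.norm ∧
      sqrtD N ∣ (G.conjTranspose * skew β * G) 0 1 - β * G.det := by
  set M := G.conjTranspose * skew β * G with hM
  have hskew : M.conjTranspose = -M := by
    simp [hM, Matrix.conjTranspose_mul, skew_conjTranspose, Matrix.mul_assoc]
  have hs : ∀ i j, star (M j i) = - M i j := fun i j => congrFun (congrFun hskew i) j
  obtain ⟨A, hA⟩ := exists_eq_mul_sqrtD (hs 0 0)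
  obtain ⟨C, hC⟩ := exists_eq_mul_sqrtD (hs 1 1)
  have hmul : ∀ x : IQ N, x * star x = (x.norm : ℤ) := fun x =>
    (QuadraticAlgebra.algebraMap_norm_eq_mul_star x).symm
  refine ⟨A, C, hA, hC, ?_, ?_⟩
  · have h1 : M.det = 6 * (G.det.norm : ℤ) := by
      have h2 : (skew β).det = 6 := by
        rw [skew, Matrix.det_fin_two_of, sqrtD_mul_self, mul_neg, hmul, hβ]
        push_cast; ring
      rw [hM, Matrix.det_mul, Matrix.det_mul, h2, Matrix.det_conjTranspose, ← hmul]
      ring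
    rw [Matrix.det_fin_two, hA, hC, show M 1 0 = - star (M 0 1) by rw [hs, neg_neg], mul_neg,
      hmul] at h1
    have h3 : (((M 0 1).norm : ℤ) : IQ N) = (((4 * N + 3) * A * C + 6 * G.det.norm : ℤ) : IQ N) := by
      push_cast
      have h4 := sqrtD_mul_self (N := N)
      push_cast at h4
      linear_combination h1 - A * C * h4
    exact_mod_cast h3
  · have e : ∀ x : IQ N, star x = x - x.im * sqrtD N := fun x => by rw [← sub_star_eq]; ring
    refine ⟨star (G 0 0) * G 0 1 + star (G 1 0) * G 1 1 - (G 0 0).im * β * G 1 1 +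
      (G 1 0).im * β * G 0 1 + star (G 1 0) * β.im * G 0 1, ?_⟩
    rw [hM]
    simp only [Matrix.mul_apply, Fin.sum_univ_two, Matrix.conjTranspose_apply, skew,
      Matrix.of_apply, Matrix.cons_val', Matrix.cons_val_zero, Matrix.cons_val_one,
      Matrix.cons_val_fin_one, Matrix.det_fin_two]
    rw [e (G 0 0), e (G 1 0), e β]
    ring

theorem dvd_of_sqrtD_dvd {x : IQ N} (h : sqrtD N ∣ x) : (4 * N + 3 : ℤ) ∣ 2 * x.re + x.im := by
  obtain ⟨y, rfl⟩ := h
  refine ⟨-y.im, ?_⟩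
  simp [sqrtD]
  ring

theorem of_box {m : ℤ} {P : IQ N → Prop} (X Y : ℤ) (hX : 4 * (N + 1) * m < (4 * N + 3) * (X + 1) ^ 2)
    (hY : 4 * m < (4 * N + 3) * (Y + 1) ^ 2) (hX0 : 0 ≤ X) (hY0 : 0 ≤ Y)
    (h : ∀ x ∈ Finset.Icc (-X) X, ∀ y ∈ Finset.Icc (-Y) Y, x ^ 2 + x * y + (N + 1) * y ^ 2 = m →
      P ⟨x, y⟩) (b : IQ N) (hb : b.norm = m) : P b := by
  rw [norm_eq] at hb
  have hN : (0 : ℤ) ≤ N := Int.natCast_nonneg N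
  have aux : ∀ {x Z : ℤ}, 0 ≤ Z → (4 * N + 3 : ℤ) * x ^ 2 < (4 * N + 3) * (Z + 1) ^ 2 →
      x ∈ Finset.Icc (-Z) Z := fun {x Z} hZ hx => by
    have h1 := abs_lt_of_sq_lt_sq (lt_of_mul_lt_mul_left hx (by omega)) (by omega)
    rw [abs_lt] at h1
    rw [Finset.mem_Icc]
    omega
  refine h b.re (aux hX0 ?_) b.im (aux hY0 ?_) hb
  · nlinarith [sq_nonneg (2 * (N + 1) * b.im + b.re)]
  · nlinarith [sq_nonneg (2 * b.re + b.im)]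

theorem norm_ne_six (hN : 6 ≤ N) (x : IQ N) : x.norm ≠ 6 := by
  intro h
  rw [norm_eq] at h
  have hN' : (6 : ℤ) ≤ N := by exact_mod_cast hN
  have h1 : x.im ^ 2 < 1 := by nlinarith [sq_nonneg (2 * x.re + x.im)]
  have h2 : x.im = 0 := by
    by_contra h2
    linarith [sq_pos_of_ne_zero h2]
  rw [h2] at h
  have h3 : x.re ^ 2 = 6 := by linarith
  have h4 : x.re < 3 := by nlinarith
  have h5 : -3 < x.re := by nlinarith
  interval_cases x.re <;> omega

theorem norm_det (g : Matrix.GeneralLinearGroup (Fin 2) (IQ N)) : g.val.det.norm = 1 := by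
  have h1 : IsUnit g.val.det.norm := (Matrix.isUnits_det_units g).map QuadraticAlgebra.norm
  rcases Int.isUnit_iff.1 h1 with h | h
  · exact h
  · linarith [norm_nonneg g.val.det]

/-- The Hermitian matrix with the given entries. -/
def herm (s : ℤ) (σ : IQ N) (t : ℤ) : Matrix (Fin 2) (Fin 2) (IQ N) := !![(s : IQ N), σ; star σ, t]

/-- The orientation of a triangle of Hermitian matrices. -/
def orientZ (a b c : Matrix (Fin 2) (Fin 2) (IQ N)) : ℤ :=
  let u := fun m : Matrix (Fin 2) (Fin 2) (IQ N) => 2 * (m 0 0 - m 1 1).re + (m 0 0 - m 1 1).im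
  (a 0 1).re * ((b 0 1).im * u c - u b * (c 0 1).im) -
  (a 0 1).im * ((b 0 1).re * u c - u b * (c 0 1).re) +
  u a * ((b 0 1).re * (c 0 1).im - (b 0 1).im * (c 0 1).re)

/-- The determinant of two elements in the basis `1, ω`. -/
def detZ (x y : IQ N) : ℤ := x.re * y.im - x.im * y.re

/-- The configuration used in dimension two: the lattice spanned by `(δ, -p)` and `(0, 1)`, the
form `skew β`, three isometries and a positive Hermitian matrix. -/
structure Conf (N : ℕ) where
  δ : ℕ
  p : IQ N
  β : IQ N
  x₁ : Matrix.SpecialLinearGroup (Fin 2) (IQ N)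
  x₂ : Matrix.SpecialLinearGroup (Fin 2) (IQ N)
  x₃ : Matrix.SpecialLinearGroup (Fin 2) (IQ N)
  s : ℤ
  σ : IQ N
  t : ℤ
  six_le : 6 ≤ N
  δ_pos : 0 < δ
  δ_le : 3 * δ ^ 2 < 4 * N + 3
  norm_β : β.norm = 4 * N + 9
  unimod : ∃ a b, a * δ + b * p = 1
  norm_ne : ∀ b : IQ N, b.norm ≠ 6 * δ ^ 2
  no_crossing : ∀ b : IQ N, b.norm = 6 * δ ^ 2 - (4 * N + 3) →
    ¬ ((4 * N + 3 : ℤ) ∣ 2 * (b - β * δ).re + (b - β * δ).im ∧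
      (δ : ℤ) ∣ (b - star p * sqrtD N).re ∧ (δ : ℤ) ∣ (b - star p * sqrtD N).im)
  isom₁ : x₁.val.conjTranspose * skew β * x₁.val = skew β
  isom₂ : x₂.val.conjTranspose * skew β * x₂.val = skew β
  isom₃ : x₃.val.conjTranspose * skew β * x₃.val = skew β
  pow₁ : x₁.val * x₁.val = -1
  pow₂ : x₂.val * x₂.val * x₂.val = 1
  pow₃ : x₃.val * x₃.val = -1
  pow₄ : (x₁.val * x₂.val * x₃.val) * (x₁.val * x₂.val * x₃.val) * (x₁.val * x₂.val * x₃.val) = 1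
  s_pos : 0 < s
  norm_lt : σ.norm < s * t
  trace : (skew β * herm s σ t).trace = 0
  fixed : let y := x₁.val * x₂.val * x₃.val
    y * herm s σ t * y.conjTranspose = herm s σ t
  orient_neg : let H := herm s σ t
    let a := fun x : Matrix (Fin 2) (Fin 2) (IQ N) => x * H * x.conjTranspose
    orientZ H (a x₁.val) (a (x₁.val * x₂.val)) * orientZ H (a x₂.val) (a (x₂.val * x₂.val)) < 0
  dets : let H := herm s σ t
    let w := fun x : Matrix (Fin 2) (Fin 2) (IQ N) =>
      (!![1, 0; p, (δ : IQ N)] * x * H * (!![1, 0; p, (δ : IQ N)] * x).conjTranspose) 0 1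
    0 < detZ (w 1) (w x₁.val) * detZ (w x₁.val) (w (x₁.val * x₂.val)) ∧
    0 < detZ (w 1) (w x₁.val) * detZ (w (x₁.val * x₂.val)) (w 1)

namespace Conf

variable (c : Conf N)

/-- The frame of a configuration. -/
def frame : Frame (IQ N) (Fin 2) where
  sp := id
  sp_injective := Function.injective_id
  q := !![1, 0; c.p, c.δ]
  E := !![c.δ, 0; -c.p, 1]
  μ := c.δ
  μ_pos := c.δ_pos
  q_mul_E := by
    ext i j : 1
    fin_cases i <;> fin_cases j <;> simp [mul_comm]
  E_mul_q := by
    ext i j : 1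
    fin_cases i <;> fin_cases j <;> simp
  prim := by
    obtain ⟨a, b, hab⟩ := c.unimod
    intro j
    fin_cases j
    · exact ⟨![a, -b], by simpa using hab⟩
    · exact ⟨![0, 1], by simp⟩
  unimod := fun p _ h => absurd (Set.mem_range_self _) h.choose_spec

theorem frame_adjugate : c.frame.q.adjugate = c.frame.E := by
  simp [frame, Matrix.adjugate_fin_two_of]

/-- The form does not change sign the wrong way. -/
theorem sign_of_form {ε : ℤ} (g : Matrix.GeneralLinearGroup (Fin 2) (IQ N))
    (hε : g.val.det = (ε : IQ N)) :
    let G := (c.frame.q * g.val).adjugate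
    ∃ A C : ℤ, (G.conjTranspose * skew c.β * G) 0 0 = A * sqrtD N ∧
      (G.conjTranspose * skew c.β * G) 1 1 = C * sqrtD N ∧ A ≠ 0 ∧ ¬ (0 < ε * A ∧ ε * C < 0) := by
  intro G
  have hε2 : ε * ε = 1 := by
    have := norm_det g
    rw [hε, QuadraticAlgebra.norm_intCast, Int.cast_id] at this
    linarith
  obtain ⟨A, C, hA, hC, hn, hd⟩ := exists_skew_conj c.norm_β G
  have hG : G = g.val.adjugate * c.frame.E := by
    rw [← frame_adjugate, ← Matrix.adjugate_mul_distrib]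
  have hdet : G.det = (ε : IQ N) * c.δ := by
    rw [hG, Matrix.det_mul, Matrix.det_adjugate, hε]
    simp [frame]
  have hdn : G.det.norm = c.δ ^ 2 := by
    rw [hdet, map_mul, QuadraticAlgebra.norm_intCast, QuadraticAlgebra.norm_natCast, pow_two,
      Int.cast_id, hε2, one_mul]
  rw [hdn] at hn
  refine ⟨A, C, hA, hC, ?_, ?_⟩
  · rintro rfl
    exact c.norm_ne _ (by rw [hn]; ring)
  · rintro ⟨h1, h2⟩
    have hδ : (3 * c.δ ^ 2 : ℤ) < 4 * N + 3 := by exact_mod_cast c.δ_le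
    have hpos := norm_nonneg ((G.conjTranspose * skew c.β * G) 0 1)
    have hAC : A * C = (ε * A) * (ε * C) := by linear_combination -(A * C) * hε2
    have h3 : ε * A = 1 ∧ ε * C = -1 := by
      rw [hn, mul_assoc, hAC] at hpos
      generalize ε * A = a at *
      generalize ε * C = b at *
      have h4 : -2 < a * b := by nlinarith
      constructor
      · nlinarith
      · nlinarith
    have eA : A = ε := by linear_combination ε * h3.1 - A * hε2
    have eC : C = -ε := by linear_combination ε * h3.2 - C * hε2
    have hεn : (ε : IQ N) * ε = 1 := by exact_mod_cast congrArg (Int.cast : ℤ → IQ N) hε2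
    have hdvd : ∀ x : IQ N, (c.δ : IQ N) ∣ x → (c.δ : ℤ) ∣ x.re ∧ (c.δ : ℤ) ∣ x.im := by
      rintro _ ⟨y, rfl⟩
      exact ⟨⟨y.re, by simp⟩, ⟨y.im, by simp⟩⟩
    refine c.no_crossing (ε * (G.conjTranspose * skew c.β * G) 0 1) ?_
      ⟨dvd_of_sqrtD_dvd ?_, hdvd _ ?_⟩
    · rw [map_mul, QuadraticAlgebra.norm_intCast, Int.cast_id, hn, eA, eC]
      linear_combination (6 * (c.δ : ℤ) ^ 2 - (4 * N + 3) * (ε * ε + 1)) * hε2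
    · obtain ⟨k, hk⟩ := hd
      refine ⟨ε * k, ?_⟩
      rw [hdet] at hk
      linear_combination (ε : IQ N) * hk + c.β * c.δ * hεn
    · obtain ⟨A', C', hA', hC', -, -⟩ := exists_skew_conj c.norm_β g.val.adjugate
      have hM : G.conjTranspose * skew c.β * G = c.frame.E.conjTranspose *
          (g.val.adjugate.conjTranspose * skew c.β * g.val.adjugate) * c.frame.E := by
        rw [hG, Matrix.conjTranspose_mul]
        simp only [Matrix.mul_assoc]
      set M' := g.val.adjugate.conjTranspose * skew c.β * g.val.adjugate
      have h11 : (G.conjTranspose * skew c.β * G) 1 1 = M' 1 1 := by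
        rw [hM]
        simp [Matrix.mul_apply, Fin.sum_univ_two, frame]
      have h01 : (G.conjTranspose * skew c.β * G) 0 1 = c.δ * M' 0 1 - star c.p * M' 1 1 := by
        rw [hM]
        simp [Matrix.mul_apply, Fin.sum_univ_two, frame]
        ring
      rw [h01, ← h11, hC, eC]
      refine ⟨ε * M' 0 1, ?_⟩
      push_cast
      linear_combination (star c.p * sqrtD N) * hεn

end Conf

end IQ
end ListCx

namespace ListCx
namespace IQ

/-! ### The base case -/

variable {N : ℕ} {ι : IQ N →+* ℂ} (h : QuadRing ι ⟨0, 1⟩ N)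

include h

theorem map_eq (x : IQ N) : ι x = ⟨x.re + x.im / 2, x.im * (√(4 * N + 3) / 2)⟩ := by
  have e : x = (x.re : IQ N) + x.im * ⟨0, 1⟩ := by ext <;> simp
  conv_lhs => rw [e]
  exact Complex.ext (h.re_apply _ _) (by rw [h.im_apply, h.im])

theorem map_star (x : IQ N) : ι (star x) = star (ι x) := by
  rw [map_eq h, map_eq h]
  apply Complex.ext <;> simp
  ring

theorem map_sqrtD : ι (sqrtD N) = (√(4 * N + 3) : ℝ) * Complex.I := by
  rw [map_eq h]
  apply Complex.ext <;> simp [sqrtD]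
  ring

theorem map_sqrtD_ne_zero : ι (sqrtD N) ≠ 0 := by
  rw [map_sqrtD h]
  have : (0 : ℝ) < √(4 * N + 3) := by positivity
  simp [this.ne']

theorem map_conjTranspose {m : Type*} (M : Matrix m m (IQ N)) :
    M.conjTranspose.map ι = (M.map ι).conjTranspose := by
  ext i j : 1
  simp [map_star h]

theorem map_skew (β : IQ N) : (skew β).map ι =
    ι (sqrtD N) • !![1, ι β / ι (sqrtD N); star (ι β / ι (sqrtD N)), 1] := by
  have h1 := map_sqrtD_ne_zero h
  have h2 : star (ι (sqrtD N)) = -ι (sqrtD N) := by rw [← map_star h, star_sqrtD, map_neg]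
  ext i j : 1
  fin_cases i <;> fin_cases j <;> simp [skew, map_star h] <;> field_simp
  simp only [Complex.star_def] at h2
  rw [h2]
  field_simp

/-- The Hermitian form proportional to a skew-Hermitian one. -/
theorem form_apply {β : IQ N} {G : Matrix (Fin 2) (Fin 2) (IQ N)} {i : Fin 2} {A : ℤ}
    (hA : (G.conjTranspose * skew β * G) i i = A * sqrtD N) :
    (((G.map ι).conjTranspose * !![1, ι β / ι (sqrtD N); star (ι β / ι (sqrtD N)), 1] *
      G.map ι) i i).re = A := by
  have h1 := congrArg ι hA
  have h2 : ι ((G.conjTranspose * skew β * G) i i) = ι (sqrtD N) *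
      ((G.map ι).conjTranspose * !![1, ι β / ι (sqrtD N); star (ι β / ι (sqrtD N)), 1] *
        G.map ι) i i := by
    rw [← smul_eq_mul (ι (sqrtD N)), ← Matrix.smul_apply, ← Matrix.smul_mul, ← Matrix.mul_smul, ← map_skew h,
      ← map_conjTranspose h, ← Matrix.map_mul, ← Matrix.map_mul, Matrix.map_apply]
  rw [h2, map_mul, mul_comm, mul_left_inj' (map_sqrtD_ne_zero h)] at h1
  rw [h1]
  simp

theorem form_definite (hN : 6 ≤ N) {β : IQ N} (hβ : β.norm = 4 * N + 9)
    (g : Matrix.GeneralLinearGroup (Fin 2) (IQ N)) :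
    let M := (g.val.map ι).conjTranspose *
      !![1, ι β / ι (sqrtD N); star (ι β / ι (sqrtD N)), 1] * g.val.map ι
    (1 ≤ (M 0 0).re ∧ 1 ≤ (M 1 1).re) ∨ ((M 0 0).re ≤ -1 ∧ (M 1 1).re ≤ -1) := by
  intro M
  obtain ⟨A, C, hA, hC, hn, -⟩ := exists_skew_conj hβ g.val
  rw [form_apply h hA, form_apply h hC]
  have h1 := norm_nonneg ((g.val.conjTranspose * skew β * g.val) 0 1)
  have h2 := norm_ne_six hN ((g.val.conjTranspose * skew β * g.val) 0 1)
  rw [hn, norm_det, mul_one, mul_assoc] at h1 h2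
  have hN' : (6 : ℤ) ≤ N := by exact_mod_cast hN
  have h3 : 0 < A * C := by
    rcases lt_trichotomy (A * C) 0 with h4 | h4 | h4
    · nlinarith
    · rw [h4] at h2; simp at h2
    · exact h4
  rcases pos_and_pos_or_neg_and_neg_of_mul_pos h3 with ⟨h4, h5⟩ | ⟨h4, h5⟩
  · left; constructor <;> exact_mod_cast (by omega)
  · right; constructor <;> exact_mod_cast (by omega)

theorem planeCoords_det (a b c : Matrix (Fin 2) (Fin 2) (IQ N)) :
    orient ![a.map ι, b.map ι, c.map ι] = √(4 * N + 3) / 4 * orientZ a b c := by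
  simp only [orient, Matrix.det_fin_three, planeCoords, map_eq h, orientZ, Matrix.of_apply,
    Matrix.map_apply, Matrix.cons_val]
  simp
  ring

theorem det2_map (x y : IQ N) : det2 (reim (ι x)) (reim (ι y)) = √(4 * N + 3) / 2 * detZ x y := by
  simp [det2, reim_zero, reim_one, map_eq h, detZ]
  ring

end IQ

end ListCx

namespace ListCx

/-! ### Chains of rotations -/

section Rotor

variable {Γ : Type*} [Group Γ]

/-- A chain exhibiting a multiple of `[1, x]` as a boundary when `x ^ n = 1`. -/
noncomputable def rotor (n : ℕ) (x : Γ) : Ch Γ :=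
  ∑ j ∈ Finset.range n, Finsupp.single [1, x ^ j, x ^ (j + 1)] (1 / n : ℝ)

theorem rotor_mem_chn (n : ℕ) (x : Γ) : rotor n x ∈ chn Γ 3 :=
  Submodule.sum_mem _ fun _ _ => single_mem_chn rfl _

theorem bd_triangle_sub_mem_coin {H : Subgroup Γ} {a b : Γ} (ha : a ∈ H) :
    bd (Finsupp.single [1, a, b] 1) - (Finsupp.single [1, a⁻¹ * b] 1 - Finsupp.single [1, b] 1 +
      Finsupp.single [1, a] 1) ∈ coin H := by
  have h1 := lsm_sub_mem_coin ha (Finsupp.single [1, a⁻¹ * b] (1 : ℝ))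
  convert h1 using 1
  rw [lsm_single, bd_single]
  simp [bdL_cons]
  abel

theorem bd_rotor_sub_mem_coin {H : Subgroup Γ} {x : Γ} (hx : x ∈ H) {n : ℕ} (hn : n ≠ 0)
    (h : x ^ n = 1) : bd (rotor n x) - Finsupp.single [1, x] 1 ∈ coin H := by
  have h1 : ∑ j ∈ Finset.range n, ((Finsupp.single [1, x] 1 - Finsupp.single [1, x ^ (j + 1)] 1 +
      Finsupp.single [1, x ^ j] 1 : Ch Γ)) = (n : ℝ) • Finsupp.single [1, x] 1 := by
    have h2 := Finset.sum_range_sub (fun j => (Finsupp.single [1, x ^ j] 1 : Ch Γ)) n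
    rw [h, pow_zero, sub_self] at h2
    have h3 : ∀ j, (Finsupp.single [1, x] 1 - Finsupp.single [1, x ^ (j + 1)] 1 +
      Finsupp.single [1, x ^ j] 1 : Ch Γ) = Finsupp.single [1, x] 1 -
      (Finsupp.single [1, x ^ (j + 1)] 1 - Finsupp.single [1, x ^ j] 1) := fun j => by abel
    rw [Finset.sum_congr rfl fun j _ => h3 j, Finset.sum_sub_distrib, h2, sub_zero,
      Finset.sum_const, Finset.card_range, Nat.cast_smul_eq_nsmul]
  have hn' : (n : ℝ) ≠ 0 := by exact_mod_cast hn
  have h4 : bd (rotor n x) - Finsupp.single [1, x] 1 = (1 / n : ℝ) • ∑ j ∈ Finset.range n,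
      (bd (Finsupp.single [1, x ^ j, x ^ (j + 1)] 1) - (Finsupp.single [1, x] 1 -
        Finsupp.single [1, x ^ (j + 1)] 1 + Finsupp.single [1, x ^ j] 1)) := by
    rw [Finset.sum_sub_distrib, h1, smul_sub, smul_smul, one_div_mul_cancel hn', one_smul, rotor,
      map_sum, Finset.smul_sum]
    simp
  rw [h4]
  refine Submodule.smul_mem _ _ (Submodule.sum_mem _ fun j _ => ?_)
  have h5 := bd_triangle_sub_mem_coin (b := x ^ (j + 1)) (pow_mem hx j)
  rwa [show (x ^ j)⁻¹ * x ^ (j + 1) = x by group] at h5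

/-- The cycle attached to a quadrangle group. -/
noncomputable def quadCycle (x₁ x₂ x₃ : Γ) : Ch Γ :=
  Finsupp.single [1, x₁, x₁ * x₂] 1 + Finsupp.single [1, x₁ * x₂, x₁ * x₂ * x₃] 1 - rotor 4 x₁ -
    rotor 3 x₂ - rotor 4 x₃ + rotor 3 (x₁ * x₂ * x₃)

theorem quadCycle_mem_chn (x₁ x₂ x₃ : Γ) : quadCycle x₁ x₂ x₃ ∈ chn Γ 3 :=
  add_mem (sub_mem (sub_mem (sub_mem (add_mem (single_mem_chn rfl _) (single_mem_chn rfl _))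
    (rotor_mem_chn _ _)) (rotor_mem_chn _ _)) (rotor_mem_chn _ _)) (rotor_mem_chn _ _)

theorem bd_quadCycle {H : Subgroup Γ} {x₁ x₂ x₃ : Γ} (h₁ : x₁ ∈ H) (h₂ : x₂ ∈ H) (h₃ : x₃ ∈ H)
    (e₁ : x₁ ^ 4 = 1) (e₂ : x₂ ^ 3 = 1) (e₃ : x₃ ^ 4 = 1) (e₄ : (x₁ * x₂ * x₃) ^ 3 = 1) :
    bd (quadCycle x₁ x₂ x₃) ∈ coin H := by
  have t₁ := bd_triangle_sub_mem_coin (b := x₁ * x₂) h₁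
  have t₂ := bd_triangle_sub_mem_coin (b := x₁ * x₂ * x₃) (mul_mem h₁ h₂)
  rw [inv_mul_cancel_left] at t₁ t₂
  have r₁ := bd_rotor_sub_mem_coin h₁ (by decide) e₁
  have r₂ := bd_rotor_sub_mem_coin h₂ (by decide) e₂
  have r₃ := bd_rotor_sub_mem_coin h₃ (by decide) e₃
  have r₄ := bd_rotor_sub_mem_coin (mul_mem (mul_mem h₁ h₂) h₃) (by decide) e₄
  convert add_mem (sub_mem (sub_mem (sub_mem (add_mem t₁ t₂) r₁) r₂) r₃) r₄ using 1
  simp only [quadCycle, map_add, map_sub]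
  abel

/-- The value of a cochain on the cycle, when it vanishes on degenerate triangles. -/
theorem ev_quadCycle {Z : Type*} {f : List Γ → ℝ} (t : Γ → Z) (x₁ x₂ x₃ : Γ)
    (hl : ∀ a b c, t a = t b → f [a, b, c] = 0)
    (ho : ∀ a b c, t a = t c → f [a, b, c] = 0)
    (e₁ : t (x₁ ^ 2) = t 1) (e₁' : t (x₁ ^ 3) = t x₁) (e₂ : x₂ ^ 3 = 1) (e₃ : t (x₃ ^ 2) = t 1)
    (e₃' : t (x₃ ^ 3) = t x₃) (h₁ : x₁ ^ 4 = 1) (h₃ : x₃ ^ 4 = 1)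
    (e₄ : t (x₁ * x₂ * x₃) = t 1) (e₄' : (x₁ * x₂ * x₃) ^ 3 = 1) :
    ev f (quadCycle x₁ x₂ x₃) = f [1, x₁, x₁ * x₂] - 1 / 3 * f [1, x₂, x₂ ^ 2] := by
  have r4 : ∀ x : Γ, t (x ^ 2) = t 1 → t (x ^ 3) = t x → x ^ 4 = 1 → ev f (rotor 4 x) = 0 := by
    intro x h2 h3 h4
    simp only [rotor, Finset.sum_range_succ, Finset.sum_range_zero, map_add, ev_single, zero_add,
      pow_zero, pow_one, Nat.reduceAdd, h4]
    rw [hl _ _ _ rfl, ho _ _ _ h2.symm, hl _ _ _ h2.symm, ho _ _ _ rfl]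
    simp
  have r3 : ∀ x : Γ, x ^ 3 = 1 → ev f (rotor 3 x) = 1 / 3 * f [1, x, x ^ 2] := by
    intro x h3
    simp only [rotor, Finset.sum_range_succ, Finset.sum_range_zero, map_add, ev_single, zero_add,
      pow_zero, pow_one, Nat.reduceAdd, h3]
    rw [hl 1 1 _ rfl, ho 1 _ 1 rfl]
    simp
  simp only [quadCycle, map_add, map_sub, r4 x₁ e₁ e₁' h₁, r4 x₃ e₃ e₃' h₃, r3 _ e₂, r3 _ e₄',
    ev_single, ho _ _ _ e₄.symm, hl _ _ _ e₄.symm]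
  ring

end Rotor

end ListCx

namespace ListCx
namespace IQ

variable {N : ℕ} {ι : IQ N →+* ℂ}

/-- The isometries of a skew form. -/
def isom (β : IQ N) : Subgroup (Matrix.GeneralLinearGroup (Fin 2) (IQ N)) where
  carrier := {x | x.val.det = 1 ∧ x.val.conjTranspose * skew β * x.val = skew β}
  one_mem' := by simp
  mul_mem' := by
    rintro x y ⟨hx, hx'⟩ ⟨hy, hy'⟩
    refine ⟨by simp [hx, hy], ?_⟩
    calc _ = y.val.conjTranspose * (x.val.conjTranspose * skew β * x.val) * y.val := by
          rw [Units.val_mul, Matrix.conjTranspose_mul]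
          simp only [Matrix.mul_assoc]
      _ = _ := by rw [hx', hy']
  inv_mem' := by
    rintro x ⟨hx, hx'⟩
    have h1 : x.val * x⁻¹.val = 1 := x.mul_inv
    refine ⟨?_, ?_⟩
    · have := congrArg Matrix.det h1
      rwa [Matrix.det_mul, hx, one_mul, Matrix.det_one] at this
    · have h2 : x⁻¹.val.conjTranspose * x.val.conjTranspose = 1 := by
        rw [← Matrix.conjTranspose_mul, h1, Matrix.conjTranspose_one]
      conv_lhs => rw [← hx']
      calc _ = (x⁻¹.val.conjTranspose * x.val.conjTranspose) * skew β * (x.val * x⁻¹.val) := by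
            simp only [Matrix.mul_assoc]
        _ = _ := by rw [h1, h2, one_mul, mul_one]

theorem pd_herm (h : QuadRing ι ⟨0, 1⟩ N) {s t : ℤ} {σ : IQ N} (hs : 0 < s) (hst : σ.norm < s * t) :
    PD ((herm s σ t).map ι) := by
  have hs' : (0 : ℝ) < s := by exact_mod_cast hs
  have hn : ‖ι σ‖ ^ 2 = (σ.norm : ℤ) := by
    have e : σ = (σ.re : IQ N) + σ.im * ⟨0, 1⟩ := by ext <;> simp
    conv_lhs => rw [e]
    rw [h.norm_sq, norm_eq]
  have hst' : ‖ι σ‖ ^ 2 < s * t := by rw [hn]; exact_mod_cast hst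
  have hp : 0 < t - ‖ι σ‖ ^ 2 / s := by
    rw [sub_pos, div_lt_iff₀ hs']
    linarith
  set a : ℝ := √(s : ℝ) with ha
  set b : ℝ := √(t - ‖ι σ‖ ^ 2 / s) with hb
  have ha0 : 0 < a := Real.sqrt_pos.2 hs'
  have hb0 : 0 < b := Real.sqrt_pos.2 hp
  have haa : (a : ℂ) * a = s := by
    rw [← Complex.ofReal_mul, ha, Real.mul_self_sqrt hs'.le, Complex.ofReal_intCast]
  have hbb : (b : ℂ) * b = t - ι σ * star (ι σ) / s := by
    rw [← Complex.ofReal_mul, hb, Real.mul_self_sqrt hp.le, Complex.star_def, Complex.mul_conj,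
      Complex.normSq_eq_norm_sq]
    push_cast
    rfl
  have hac : (a : ℂ) ≠ 0 := by exact_mod_cast ha0.ne'
  have hbc : (b : ℂ) ≠ 0 := by exact_mod_cast hb0.ne'
  have hsc : (s : ℂ) ≠ 0 := by exact_mod_cast hs.ne'
  have := (pd_one (m := Fin 2)).conj (Q := !![(a : ℂ), 0; star (ι σ) / a, b])
    (by rw [Matrix.det_fin_two_of]; simp [hac, hbc])
  convert this using 1
  ext i j : 1
  have h3 : star (ι σ) / a * (ι σ / a) + b * b = t := by
    rw [hbb, div_mul_div_comm, haa]
    ring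
  simp only [Complex.star_def] at h3
  fin_cases i <;> fin_cases j <;>
    simp [herm, Matrix.mul_apply, Fin.sum_univ_two, Matrix.conjTranspose_apply, haa, h3, map_star h]
  · field_simp
  · field_simp

theorem tw_map (h : QuadRing ι ⟨0, 1⟩ N) (H : Matrix (Fin 2) (Fin 2) (IQ N))
    (x : Matrix.GeneralLinearGroup (Fin 2) (IQ N)) :
    tw ι (H.map ι) x = (x.val * H * x.val.conjTranspose).map ι := by
  rw [tw, cj_apply, Matrix.map_mul, Matrix.map_mul, map_conjTranspose h]

theorem trace_form (h : QuadRing ι ⟨0, 1⟩ N) {β : IQ N} {H : Matrix (Fin 2) (Fin 2) (IQ N)}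
    (ht : (skew β * H).trace = 0) {x : Matrix.GeneralLinearGroup (Fin 2) (IQ N)} (hx : x ∈ isom β) :
    (!![1, ι β / ι (sqrtD N); star (ι β / ι (sqrtD N)), 1] * tw ι (H.map ι) x).trace = 0 := by
  have h1 : (skew β * (x.val * H * x.val.conjTranspose)).trace = 0 := by
    rw [← ht]
    conv_rhs => rw [← hx.2]
    rw [Matrix.trace_mul_comm, Matrix.trace_mul_comm (_ * _) H]
    rw [Matrix.mul_assoc, Matrix.mul_assoc, Matrix.trace_mul_comm]
    simp only [Matrix.mul_assoc]
  have h2 := congrArg ι h1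
  rw [map_zero, AddMonoidHom.map_trace] at h2
  change ((skew β * (x.val * H * x.val.conjTranspose)).map ι).trace = 0 at h2
  rw [Matrix.map_mul, map_skew h, Matrix.smul_mul, Matrix.trace_smul, ← tw_map h, smul_eq_mul] at h2
  exact (mul_eq_zero.1 h2).resolve_left (map_sqrtD_ne_zero h)

/-- The sign character. -/
noncomputable def detSign {O J : Type*} [CommRing O] [Fintype J] [DecidableEq J] {ι : O →+* ℂ} {ω : O}
    (h : QuadRing ι ω N) (hN : 1 ≤ N) : Matrix.GeneralLinearGroup J O →* ℝ :=
  (unitSign h hN).comp Matrix.GeneralLinearGroup.det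

theorem detSign_spec {O J : Type*} [CommRing O] [Fintype J] [DecidableEq J] {ι : O →+* ℂ} {ω : O}
    (h : QuadRing ι ω N) (hN : 1 ≤ N) (g : Matrix.GeneralLinearGroup J O) :
    ∃ ε : ℤ, g.val.det = (ε : O) ∧ detSign h hN g = ε ∧ (ε = 1 ∨ ε = -1) := by
  have h1 : detSign h hN g = (ι g.val.det).re := rfl
  have h2 : g.val.det = ((Matrix.GeneralLinearGroup.det g : Oˣ) : O) := rfl
  rcases h.units hN (Matrix.GeneralLinearGroup.det g) with h3 | h3
  · exact ⟨1, by rw [h2, h3]; simp, by rw [h1, h2, h3]; simp, Or.inl rfl⟩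
  · exact ⟨-1, by rw [h2, h3]; simp, by rw [h1, h2, h3]; simp, Or.inr rfl⟩

namespace Conf

variable (c : Conf N)

/-- The image of the base point under a matrix. -/
def orbit (x : Matrix (Fin 2) (Fin 2) (IQ N)) : Matrix (Fin 2) (Fin 2) (IQ N) :=
  x * herm c.s c.σ c.t * x.conjTranspose

theorem one_le (c : Conf N) : 1 ≤ N := le_trans (by decide) c.six_le

/-- The contribution of every group element has the same sign. -/
theorem triangle_sign (h : QuadRing ι ⟨0, 1⟩ N) (γ : Matrix.GeneralLinearGroup (Fin 2) (IQ N))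
    {x y z : Matrix.GeneralLinearGroup (Fin 2) (IQ N)} (hx : x ∈ isom c.β) (hy : y ∈ isom c.β)
    (hz : z ∈ isom c.β) :
    0 ≤ detSign h c.one_le γ * tau 2 ([x, y, z].map (fun g =>
      c.frame.baseDatum.pos ι ((herm c.s c.σ c.t).map ι) (γ * g))) *
      orientZ (c.orbit x.val) (c.orbit y.val) (c.orbit z.val) := by
  set S : Fin 3 → Matrix (Fin 2) (Fin 2) ℂ := fun i => tw ι ((herm c.s c.σ c.t).map ι) (![x, y, z] i)
    with hS
  set Q := (c.frame.q * γ.val).map ι with hQdef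
  have hpos : ∀ g, c.frame.baseDatum.pos ι ((herm c.s c.σ c.t).map ι) (γ * g) =
      entry 0 1 (cj Q (tw ι ((herm c.s c.σ c.t).map ι) g)) := fun g =>
    Datum.pos_mul c.frame.baseDatum _ _ _
  by_cases ht : tau 2 [entry 0 1 (cj Q (S 0)), entry 0 1 (cj Q (S 1)), entry 0 1 (cj Q (S 2))] = 0
  · simp only [List.map_cons, List.map_nil, hpos]
    simp only [hS, Matrix.cons_val] at ht
    rw [ht]
    simp
  obtain ⟨ε, hε, hχ, hε1⟩ := detSign_spec h c.one_le γ
  have hmem : ∀ i, ![x, y, z] i ∈ isom c.β := by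
    intro i
    fin_cases i
    exacts [hx, hy, hz]
  have hdet : IsUnit Q.det := by
    rw [hQdef, Matrix.map_mul, Matrix.det_mul]
    refine (IsUnit.mk0 _ ?_).mul (isUnit_det_map γ)
    rw [← RingHom.mapMatrix_apply, ← RingHom.map_det]
    refine (map_ne_zero_iff ι h.injective).2 ?_
    have hδ := c.δ_pos.ne'
    simpa [frame] using hδ
  have hadj : Q.adjugate = (c.frame.q * γ.val).adjugate.map ι := by
    rw [hQdef, ← RingHom.mapMatrix_apply, ← RingHom.mapMatrix_apply, RingHom.map_adjugate]
  obtain ⟨h1, h₀, hh₀, h₁, hh₁, h2⟩ := plane_sign hdet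
    (fun i => pd_tw (pd_herm h c.s_pos c.norm_lt) _) (fun i => trace_form h c.trace (hmem i)) ht
  obtain ⟨A, C, hA, hC, hA0, hAC⟩ := c.sign_of_form γ hε
  rw [hadj, form_apply h hA] at h1 h2
  rw [form_apply h hC] at h2
  have ho : orient S = √(4 * N + 3) / 4 * orientZ (c.orbit x.val) (c.orbit y.val) (c.orbit z.val) := by
    rw [← planeCoords_det h]
    congr 1
    ext i : 1
    fin_cases i <;> exact tw_map h _ _
  rw [ho] at h1
  simp only [List.map_cons, List.map_nil, hpos, hχ]
  simp only [Matrix.cons_val] at h1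
  generalize tau 2 [entry 0 1 (cj Q (tw ι ((herm c.s c.σ c.t).map ι) x)),
    entry 0 1 (cj Q (tw ι ((herm c.s c.σ c.t).map ι) y)),
    entry 0 1 (cj Q (tw ι ((herm c.s c.σ c.t).map ι) z))] = T at h1 ⊢
  generalize orientZ _ _ _ = K at h1 ⊢
  have hd : 0 < √(4 * (N : ℝ) + 3) / 4 := by positivity
  have hεA : ε * A < 0 := by
    rcases lt_trichotomy (ε * A) 0 with h3 | h3 | h3
    · exact h3
    · rcases hε1 with rfl | rfl <;> simp [hA0] at h3
    · exfalso
      refine hAC ⟨h3, ?_⟩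
      have h4 : (0 : ℝ) < ε * A := by exact_mod_cast h3
      have h5 : (ε * C : ℝ) < 0 := by
        by_contra! h5
        have : (ε * A : ℝ) * h₀ + ε * C * h₁ = 0 := by linear_combination (ε : ℝ) * h2
        have := mul_pos h4 hh₀
        have := mul_nonneg h5 hh₁.le
        linarith
      exact_mod_cast h5
  have h6 : (0 : ℝ) < -(ε * A) := by
    have : (ε * A : ℝ) < 0 := by exact_mod_cast hεA
    linarith
  have h7 : 0 ≤ (-(ε * A) * (√(4 * (N : ℝ) + 3) / 4)) * (ε * T * K) := by
    have hεε : (ε * ε : ℝ) = 1 := by rcases hε1 with rfl | rfl <;> simp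
    have : (-(ε * A) * (√(4 * (N : ℝ) + 3) / 4)) * (ε * T * K) =
      (ε * ε) * (-A * (√(4 * (N : ℝ) + 3) / 4 * K) * T) := by ring
    rw [this, hεε, one_mul]
    exact h1
  exact nonneg_of_mul_nonneg_right h7 (mul_pos h6 hd)

theorem disc_lf (h : QuadRing ι ⟨0, 1⟩ N) :
    LF (MonoidHom.id (Matrix.GeneralLinearGroup (Fin 2) (IQ N))) fun l =>
      tau 2 (l.map (c.frame.baseDatum.pos ι ((herm c.s c.σ c.t).map ι))) :=
  haveI := h.isDomain
  haveI : CharZero (IQ N) := ⟨fun a b hab => by simpa using congrArg QuadraticAlgebra.re hab⟩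
  Datum.lf_pos c.frame.baseDatum h.disc (pd_herm h c.s_pos c.norm_lt)

/-- The cochain of the configuration. -/
noncomputable def cochain (h : QuadRing ι ⟨0, 1⟩ N) :
    List (Matrix.GeneralLinearGroup (Fin 2) (IQ N)) → ℝ :=
  sm (MonoidHom.id _) (detSign h c.one_le) fun l =>
    tau 2 (l.map (c.frame.baseDatum.pos ι ((herm c.s c.σ c.t).map ι)))

theorem cochain_eq_zero (h : QuadRing ι ⟨0, 1⟩ N) {l : List (Matrix.GeneralLinearGroup (Fin 2) (IQ N))}
    (hl : ∀ f : Matrix.GeneralLinearGroup (Fin 2) (IQ N) → ℕ → ℝ,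
      (∀ a b, c.orbit a.val = c.orbit b.val → f a = f b) → tau 2 (l.map f) = 0) :
    c.cochain h l = 0 := by
  refine finsum_eq_zero_of_forall_eq_zero fun γ => ?_
  beta_reduce
  rw [List.map_map, hl, mul_zero]
  intro a b hab
  simp only [Function.comp_apply, MonoidHom.id_apply, Datum.pos_mul, tw_map h]
  rw [show a.val * herm c.s c.σ c.t * a.val.conjTranspose = c.orbit a.val from rfl, hab, orbit]

theorem cochain_nonneg (h : QuadRing ι ⟨0, 1⟩ N)
    {x y z : Matrix.GeneralLinearGroup (Fin 2) (IQ N)} (hx : x ∈ isom c.β) (hy : y ∈ isom c.β)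
    (hz : z ∈ isom c.β) :
    0 ≤ c.cochain h [x, y, z] * orientZ (c.orbit x.val) (c.orbit y.val) (c.orbit z.val) := by
  rw [cochain, sm, finsum_mul]
  refine finsum_nonneg fun γ => ?_
  rw [List.map_map]
  exact c.triangle_sign h γ hx hy hz

theorem cochain_pos (h : QuadRing ι ⟨0, 1⟩ N)
    {x y z : Matrix.GeneralLinearGroup (Fin 2) (IQ N)} (hx : x ∈ isom c.β) (hy : y ∈ isom c.β)
    (hz : z ∈ isom c.β)
    (ht : tau 2 ([x, y, z].map (c.frame.baseDatum.pos ι ((herm c.s c.σ c.t).map ι))) ≠ 0)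
    (ho : orientZ (c.orbit x.val) (c.orbit y.val) (c.orbit z.val) ≠ 0) :
    0 < c.cochain h [x, y, z] * orientZ (c.orbit x.val) (c.orbit y.val) (c.orbit z.val) := by
  rw [cochain, sm, finsum_mul]
  have hnn := fun γ => c.triangle_sign h γ hx hy hz
  refine finsum_pos (fun γ => ?_) ⟨1, ?_⟩ ?_
  · rw [List.map_map]
    exact hnn γ
  · refine lt_of_le_of_ne ?_ (Ne.symm ?_)
    · rw [List.map_map]
      exact hnn 1
    · rw [map_one, one_mul]
      refine mul_ne_zero ?_ (by exact_mod_cast ho)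
      simpa using ht
  · refine (support_finite (χ := detSign h c.one_le) (c.disc_lf h [x, y, z])).subset fun γ hγ => ?_
    exact left_ne_zero_of_mul hγ

theorem mem_isom₁ : (c.x₁ : Matrix.GeneralLinearGroup (Fin 2) (IQ N)) ∈ isom c.β :=
  ⟨c.x₁.det_coe, c.isom₁⟩

theorem mem_isom₂ : (c.x₂ : Matrix.GeneralLinearGroup (Fin 2) (IQ N)) ∈ isom c.β :=
  ⟨c.x₂.det_coe, c.isom₂⟩

theorem mem_isom₃ : (c.x₃ : Matrix.GeneralLinearGroup (Fin 2) (IQ N)) ∈ isom c.β :=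
  ⟨c.x₃.det_coe, c.isom₃⟩

theorem tau_ne_zero (h : QuadRing ι ⟨0, 1⟩ N) :
    tau 2 ([1, (c.x₁ : Matrix.GeneralLinearGroup (Fin 2) (IQ N)), c.x₁ * c.x₂].map
      (c.frame.baseDatum.pos ι ((herm c.s c.σ c.t).map ι))) ≠ 0 := by
  have hp : ∀ g : Matrix.GeneralLinearGroup (Fin 2) (IQ N),
      c.frame.baseDatum.pos ι ((herm c.s c.σ c.t).map ι) g =
      reim (ι ((c.frame.q * g.val * herm c.s c.σ c.t * (c.frame.q * g.val).conjTranspose) 0 1)) :=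
    fun g => by
      rw [← Matrix.map_apply (f := ι), Matrix.map_mul, Matrix.map_mul, map_conjTranspose h]
      rfl
  have hd : 0 < √(4 * (N : ℝ) + 3) / 2 := by positivity
  have key : ∀ a b d : IQ N, 0 < detZ a b * detZ b d → 0 < detZ a b * detZ d a →
      tau 2 [reim (ι a), reim (ι b), reim (ι d)] ≠ 0 := by
    intro a b d h1 h2
    have sw : ∀ x y : IQ N, detZ x y = -detZ y x := fun x y => by simp only [detZ]; ring
    have hpos : ∀ x y : IQ N, 0 < detZ x y → 0 < det2 (reim (ι x)) (reim (ι y)) := fun x y hxy => by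
      rw [det2_map h]
      exact mul_pos hd (by exact_mod_cast hxy)
    rcases pos_and_pos_or_neg_and_neg_of_mul_pos h1 with ⟨h3, h4⟩ | ⟨h3, h4⟩
    · have h5 := pos_of_mul_pos_right h2 h3.le
      exact (tau_two_pos (w := ![reim (ι a), reim (ι b), reim (ι d)]) (hpos _ _ h4) (hpos _ _ h5)
        (hpos _ _ h3)).ne'
    · have h5 := neg_of_mul_pos_right h2 h3.le
      rw [← neg_ne_zero, ← tau_two_swap]
      exact (tau_two_pos (w := ![reim (ι a), reim (ι d), reim (ι b)])
        (hpos _ _ (by rw [sw]; omega)) (hpos _ _ (by rw [sw]; omega))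
        (hpos _ _ (by rw [sw]; omega))).ne'
  simp only [List.map_cons, List.map_nil, hp]
  exact key _ _ _ c.dets.1 c.dets.2

theorem pow_x₁ : (c.x₁ : Matrix.GeneralLinearGroup (Fin 2) (IQ N)) ^ 4 = 1 :=
  Units.ext <| show c.x₁.val ^ 4 = 1 by
    rw [show 4 = 2 * 2 from rfl, pow_mul, pow_two c.x₁.val, c.pow₁, neg_one_sq]

theorem pow_x₂ : (c.x₂ : Matrix.GeneralLinearGroup (Fin 2) (IQ N)) ^ 3 = 1 :=
  Units.ext <| show c.x₂.val ^ 3 = 1 by rw [pow_three', c.pow₂]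

theorem pow_x₃ : (c.x₃ : Matrix.GeneralLinearGroup (Fin 2) (IQ N)) ^ 4 = 1 :=
  Units.ext <| show c.x₃.val ^ 4 = 1 by
    rw [show 4 = 2 * 2 from rfl, pow_mul, pow_two c.x₃.val, c.pow₃, neg_one_sq]

theorem pow_x₄ : (c.x₁ * c.x₂ * c.x₃ : Matrix.GeneralLinearGroup (Fin 2) (IQ N)) ^ 3 = 1 :=
  Units.ext <| show (c.x₁.val * c.x₂.val * c.x₃.val) ^ 3 = 1 by rw [pow_three', c.pow₄]

theorem orbit_neg (x : Matrix (Fin 2) (Fin 2) (IQ N)) : c.orbit (-x) = c.orbit x := by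
  simp [orbit]

theorem ev_cochain_ne_zero (h : QuadRing ι ⟨0, 1⟩ N) :
    ev (c.cochain h) (quadCycle (c.x₁ : Matrix.GeneralLinearGroup (Fin 2) (IQ N)) c.x₂ c.x₃) ≠ 0 := by
  have hsq : ∀ x : Matrix.SpecialLinearGroup (Fin 2) (IQ N), x.val * x.val = -1 →
      c.orbit (x.val ^ 2) = c.orbit 1 := fun x hx => by rw [pow_two, hx, orbit_neg]
  have hcb : ∀ x : Matrix.SpecialLinearGroup (Fin 2) (IQ N), x.val * x.val = -1 →
      c.orbit (x.val ^ 3) = c.orbit x.val := fun x hx => by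
    rw [pow_three', hx, neg_one_mul, orbit_neg]
  rw [ev_quadCycle (fun g : Matrix.GeneralLinearGroup (Fin 2) (IQ N) => c.orbit g.val)
    c.x₁ c.x₂ c.x₃ ?_ ?_ ?_ ?_ c.pow_x₂ ?_ ?_ c.pow_x₁ c.pow_x₃ ?_ c.pow_x₄]
  · have h1 := c.cochain_pos h (one_mem _) c.mem_isom₁ (mul_mem c.mem_isom₁ c.mem_isom₂)
      (c.tau_ne_zero h) (left_ne_zero_of_mul (b := orientZ (c.orbit 1) (c.orbit c.x₂.val)
        (c.orbit (c.x₂.val * c.x₂.val))) (by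
          have := c.orient_neg.ne
          simpa [orbit] using this))
    have h2 := c.cochain_nonneg h (one_mem _) c.mem_isom₂ (pow_mem c.mem_isom₂ 2)
    have h3 : orientZ (c.orbit 1) (c.orbit c.x₁.val) (c.orbit (c.x₁.val * c.x₂.val)) *
        orientZ (c.orbit 1) (c.orbit c.x₂.val) (c.orbit (c.x₂.val ^ 2)) < 0 := by
      have := c.orient_neg
      simpa [orbit, pow_two] using this
    have e1 : (↑(c.x₁ : Matrix.GeneralLinearGroup (Fin 2) (IQ N)) :
      Matrix (Fin 2) (Fin 2) (IQ N)) = c.x₁.val := rfl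
    have e2 : (↑(c.x₂ : Matrix.GeneralLinearGroup (Fin 2) (IQ N)) :
      Matrix (Fin 2) (Fin 2) (IQ N)) = c.x₂.val := rfl
    simp only [Units.val_one, Units.val_mul, Units.val_pow_eq_pow_val, e1, e2] at h1 h2
    generalize c.cochain h [1, _, _] = a at h1 ⊢
    generalize c.cochain h [1, _, _] = b at h2 ⊢
    intro h4
    generalize orientZ (c.orbit 1) (c.orbit _) (c.orbit _) = k₀ at h1 h3
    generalize orientZ (c.orbit 1) (c.orbit _) (c.orbit _) = k₂ at h2 h3
    have h5 : (k₀ * k₂ : ℝ) < 0 := by exact_mod_cast h3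
    have h6 : b = 3 * a := by linarith
    have h7 : 0 ≤ a * k₂ := by rw [h6] at h2; linarith
    have h8 : 0 ≤ (a * a) * (k₀ * k₂) := by linarith [mul_nonneg h1.le h7]
    have h9 : 0 < a * a := mul_self_pos.2 (left_ne_zero_of_mul h1.ne')
    exact absurd (mul_neg_of_pos_of_neg h9 h5) h8.not_gt
  · exact fun a b d hab => c.cochain_eq_zero h fun f hf => by
      simp only [List.map_cons, List.map_nil, hf a b hab, tau_two_left]
  · exact fun a b d hab => c.cochain_eq_zero h fun f hf => by
      simp only [List.map_cons, List.map_nil, hf a d hab, tau_two_outer]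
  · exact hsq _ c.pow₁
  · exact hcb _ c.pow₁
  · exact hsq _ c.pow₃
  · exact hcb _ c.pow₃
  · have := c.fixed
    simpa [orbit] using this

/-- The base case. -/
noncomputable def base (h : QuadRing ι ⟨0, 1⟩ N) : Base ι (detSign h c.one_le) c.frame where
  S := (herm c.s c.σ c.t).map ι
  pd := pd_herm h c.s_pos c.norm_lt
  L := !![1, ι c.β / ι (sqrtD N); star (ι c.β / ι (sqrtD N)), 1]
  definite := form_definite h c.six_le c.norm_β
  Δ := isom c.β
  le_ker := fun x hx => by
    have h1 : detSign h c.one_le x = (ι x.val.det).re := rfl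
    rw [MonoidHom.mem_ker, h1, hx.1]
    simp
  trace_eq_zero := fun x hx => trace_form h c.trace hx
  z := quadCycle (c.x₁ : Matrix.GeneralLinearGroup (Fin 2) (IQ N)) c.x₂ c.x₃
  mem := quadCycle_mem_chn _ _ _
  bd_mem := bd_quadCycle c.mem_isom₁ c.mem_isom₂ c.mem_isom₃ c.pow_x₁ c.pow_x₂ c.pow_x₃ c.pow_x₄
  ev_ne_zero := c.ev_cochain_ne_zero h

end Conf

end IQ
end ListCx

namespace ListCx
namespace IQ

set_option maxRecDepth 4000 in
def conf43 : Conf 10 where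
  δ := 3
  p := ⟨0, 1⟩
  β := ⟨7, 0⟩
  x₁ := ⟨!![⟨0, 0⟩, ⟨1, 0⟩; ⟨-1, 0⟩, ⟨0, 0⟩], by rw [Matrix.det_fin_two]; decide⟩
  x₂ := ⟨!![⟨-4, 0⟩, ⟨1, 1⟩; ⟨-2, 1⟩, ⟨3, 0⟩], by rw [Matrix.det_fin_two]; decide⟩
  x₃ := ⟨!![⟨-3, -1⟩, ⟨-2, 1⟩; ⟨-6, 1⟩, ⟨3, 1⟩], by rw [Matrix.det_fin_two]; decide⟩
  s := 5
  σ := ⟨-1, 2⟩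
  t := 9
  six_le := by decide
  δ_pos := by decide
  δ_le := by decide
  norm_β := by decide
  unimod := ⟨⟨4, 0⟩, ⟨-1, 1⟩, by decide⟩
  norm_ne := of_box 7 2 (by decide) (by decide) (by decide) (by decide) (by decide +kernel)
  no_crossing := of_box 3 1 (by decide) (by decide) (by decide) (by decide) (by decide +kernel)
  isom₁ := by decide
  isom₂ := by decide
  isom₃ := by decide
  pow₁ := by decide
  pow₂ := by decide
  pow₃ := by decide
  pow₄ := by decide
  s_pos := by decide
  norm_lt := by decide
  trace := by decide
  fixed := by decide
  orient_neg := by decide +kernel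
  dets := by decide +kernel

set_option maxRecDepth 4000 in
def conf67 : Conf 16 where
  δ := 4
  p := ⟨1, 1⟩
  β := ⟨7, 1⟩
  x₁ := ⟨!![⟨-4, 0⟩, ⟨-1, 1⟩; ⟨0, 1⟩, ⟨4, 0⟩], by rw [Matrix.det_fin_two]; decide⟩
  x₂ := ⟨!![⟨6, -1⟩, ⟨-2, -2⟩; ⟨-4, -1⟩, ⟨-7, 1⟩], by rw [Matrix.det_fin_two]; decide⟩
  x₃ := ⟨!![⟨-2, 1⟩, ⟨4, 1⟩; ⟨3, 0⟩, ⟨2, -1⟩], by rw [Matrix.det_fin_two]; decide⟩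
  s := 5
  σ := ⟨-3, 1⟩
  t := 5
  six_le := by decide
  δ_pos := by decide
  δ_le := by decide
  norm_β := by decide
  unimod := ⟨⟨5, 0⟩, ⟨-2, 1⟩, by decide⟩
  norm_ne := of_box 9 2 (by decide) (by decide) (by decide) (by decide) (by decide +kernel)
  no_crossing := of_box 5 1 (by decide) (by decide) (by decide) (by decide) (by decide +kernel)
  isom₁ := by decide
  isom₂ := by decide
  isom₃ := by decide
  pow₁ := by decide
  pow₂ := by decide
  pow₃ := by decide
  pow₄ := by decide
  s_pos := by decide
  norm_lt := by decide
  trace := by decide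
  fixed := by decide
  orient_neg := by decide +kernel
  dets := by decide +kernel

set_option maxRecDepth 4000 in
def conf163 : Conf 40 where
  δ := 6
  p := ⟨0, 1⟩
  β := ⟨13, 0⟩
  x₁ := ⟨!![⟨0, 0⟩, ⟨1, 0⟩; ⟨-1, 0⟩, ⟨0, 0⟩], by rw [Matrix.det_fin_two]; decide⟩
  x₂ := ⟨!![⟨-7, 0⟩, ⟨1, 1⟩; ⟨-2, 1⟩, ⟨6, 0⟩], by rw [Matrix.det_fin_two]; decide⟩
  x₃ := ⟨!![⟨-6, -1⟩, ⟨-5, 1⟩; ⟨-9, 1⟩, ⟨6, 1⟩], by rw [Matrix.det_fin_two]; decide⟩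
  s := 11
  σ := ⟨-1, 2⟩
  t := 15
  six_le := by decide
  δ_pos := by decide
  δ_le := by decide
  norm_β := by decide
  unimod := ⟨⟨7, 0⟩, ⟨-1, 1⟩, by decide⟩
  norm_ne := of_box 14 2 (by decide) (by decide) (by decide) (by decide) (by decide +kernel)
  no_crossing := of_box 7 1 (by decide) (by decide) (by decide) (by decide) (by decide +kernel)
  isom₁ := by decide
  isom₂ := by decide
  isom₃ := by decide
  pow₁ := by decide
  pow₂ := by decide
  pow₃ := by decide
  pow₄ := by decide
  s_pos := by decide
  norm_lt := by decide
  trace := by decide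
  fixed := by decide
  orient_neg := by decide +kernel
  dets := by decide +kernel

end IQ

/-! ### Comparison with inhomogeneous cochains -/

section Inhomogeneous

variable {G : Type} [Group G]

theorem ofFn_eq_map_partialProd {n : ℕ} (v : Fin (n + 1) → G) :
    List.ofFn v = (List.ofFn (Fin.partialProd fun i : Fin n =>
      (v i.castSucc)⁻¹ * v i.succ)).map (v 0 * ·) := by
  conv_lhs => rw [← Fin.partialProd_left_inv v]
  rw [List.map_ofFn]
  rfl

theorem d_partialProd {B : List G → ℚ} (hB : ∀ g l, B (l.map (g * ·)) = B l) (n : ℕ)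
    (g : Fin (n + 1) → G) :
    ((inhomogeneousCochains.d (Rep.trivial ℚ G ℚ) n
      (fun v : Fin n → G => B (List.ofFn (Fin.partialProd v))) g : ℚ) : ℝ) =
    cod (fun l => (B l : ℝ)) (List.ofFn (Fin.partialProd g)) := by
  rw [cod_ofFn, Fin.sum_univ_succ]
  have h1 : List.ofFn (Fin.partialProd g ∘ (0 : Fin (n + 2)).succAbove) =
      (List.ofFn (Fin.partialProd fun i : Fin n => g i.succ)).map (g 0 * ·) := by
    rw [List.map_ofFn]
    congr 1
    funext j
    exact Fin.partialProd_succ' g j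
  rw [h1, hB, inhomogeneousCochains.d_hom_apply]
  simp only [Fin.partialProd_contractNth]
  change ((B _ + ∑ j : Fin (n + 1), (-1 : ℚ) ^ ((j : ℕ) + 1) * B _ : ℚ) : ℝ) = _
  push_cast
  simp

theorem exists_rational {f : List G → ℝ} {x : Ch G} (h : ev f x ≠ 0) :
    ∃ φ : ℝ →ₗ[ℚ] ℚ, ev (fun l => (φ (f l) : ℝ)) x ≠ 0 := by
  by_contra! h0
  let b := Module.Basis.ofVectorSpace ℚ ℝ
  let s := x.support.biUnion fun l => (b.repr (f l)).support
  refine h ?_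
  have h1 : ∀ l ∈ x.support, f l = ∑ i ∈ s, (b.coord i (f l) : ℝ) * b i := fun l hl => by
    conv_lhs => rw [← b.linearCombination_repr (f l), Finsupp.linearCombination_apply,
      Finsupp.sum_of_support_subset _ (Finset.subset_biUnion_of_mem
        (fun l => (b.repr (f l)).support) hl) _ (by simp)]
    simp [Rat.smul_def, s]
  rw [ev, Finsupp.linearCombination_apply, Finsupp.sum, Finset.sum_congr rfl
    fun l hl => by rw [h1 l hl, Finset.smul_sum], Finset.sum_comm]
  refine Finset.sum_eq_zero fun i _ => ?_
  have h2 := h0 (b.coord i)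
  rw [ev, Finsupp.linearCombination_apply, Finsupp.sum] at h2
  simp only [smul_eq_mul, ← mul_assoc] at h2 ⊢
  rw [← Finset.sum_mul, h2, zero_mul]

open CategoryTheory in
theorem nontrivial_groupCohomology {N : ℕ} {f : List G → ℝ} (hf : cod f = 0)
    (hinv : ∀ g l, f (l.map (g * ·)) = f l) {x : Ch G} (hx : x ∈ chn G (N + 2))
    (hbx : bd x ∈ coin (⊤ : Subgroup G)) (hne : ev f x ≠ 0) :
    Nontrivial (groupCohomology (Rep.trivial ℚ G ℚ) (N + 1)) := by
  obtain ⟨φ, hφ⟩ := exists_rational hne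
  by_contra hc
  rw [not_nontrivial_iff_subsingleton] at hc
  have h1 : ((groupCohomology.inhomogeneousCochains (Rep.trivial ℚ G ℚ)).sc' N (N + 1)
      (N + 2)).Exact := by
    rw [← HomologicalComplex.exactAt_iff' _ _ _ _ (by simp) (by simp),
      HomologicalComplex.exactAt_iff_isZero_homology]
    exact @ModuleCat.isZero_of_subsingleton _ _ _ hc
  rw [ShortComplex.moduleCat_exact_iff] at h1
  have hcφ : cod (fun l => (φ (f l) : ℝ)) = 0 := by
    funext l
    obtain ⟨n, v, rfl⟩ : ∃ n, ∃ v : Fin n → G, l = List.ofFn v := ⟨_, _, (List.ofFn_get l).symm⟩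
    rcases n with _ | n
    · simp
    have h2 := congrArg φ (congrFun hf (List.ofFn v))
    rw [cod_ofFn, map_sum, Pi.zero_apply, map_zero] at h2
    rw [cod_ofFn, Pi.zero_apply, ← Rat.cast_zero, ← h2, Rat.cast_sum]
    refine Finset.sum_congr rfl fun i _ => ?_
    rcases neg_one_pow_eq_or ℝ (i : ℕ) with h3 | h3 <;> simp [h3]
  obtain ⟨b, hb⟩ := h1 (fun v : Fin (N + 1) → G => φ (f (List.ofFn (Fin.partialProd v)))) (by
    change (groupCohomology.inhomogeneousCochains _).d (N + 1) (N + 2) _ = 0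
    rw [groupCohomology.inhomogeneousCochains.d_def]
    funext g
    have h2 := d_partialProd (B := fun l => φ (f l)) (fun g l => by rw [hinv]) (N + 1) g
    rw [hcφ] at h2
    exact Rat.cast_eq_zero.1 h2)
  change (groupCohomology.inhomogeneousCochains _).d N (N + 1) b = _ at hb
  rw [groupCohomology.inhomogeneousCochains.d_def] at hb
  let b' : (Fin N → G) → ℚ := b
  classical
  let B : List G → ℚ := fun l => if h : l.length = N + 1 then
    b' fun i => (l.get (Fin.cast h.symm i.castSucc))⁻¹ * l.get (Fin.cast h.symm i.succ) else 0
  have hB : ∀ g l, B (l.map (g * ·)) = B l := fun g l => by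
    by_cases h : l.length = N + 1
    · simp [B, h, mul_assoc]
    · simp [B, h]
  have hBb : (fun v : Fin N → G => B (List.ofFn (Fin.partialProd v))) = b' := by
    funext v
    simp only [B, List.length_ofFn, dite_true]
    congr 1
    funext i
    rw [List.get_ofFn, List.get_ofFn]
    exact Fin.partialProd_right_inv v i
  have h3 : ∀ l ∈ x.support, (φ (f l) : ℝ) = cod (fun l => (B l : ℝ)) l := by
    intro l hl
    have hl' : l.length = N + 2 := (Finsupp.mem_supported ℝ x).1 hx hl
    obtain ⟨n, v, rfl⟩ : ∃ n, ∃ v : Fin n → G, l = List.ofFn v := ⟨_, _, (List.ofFn_get l).symm⟩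
    rw [List.length_ofFn] at hl'
    subst hl'
    rw [ofFn_eq_map_partialProd, hinv]
    refine Eq.trans ?_ (congrFun (cod_comp_map (fun l => (B l : ℝ)) (v 0 * ·)) _)
    simp only [hB]
    rw [← d_partialProd hB N, hBb]
    exact congrArg Rat.cast (congrFun hb _).symm
  rw [ev_congr h3, ← ev_bd, ev_coin (fun g _ l => by rw [hB]) hbx] at hφ
  exact hφ rfl

end Inhomogeneous

namespace IQ

/-! ### Rings of integers -/

open NumberField

theorem exists_int_of_norm_trace {N : ℕ} (hp : (4 * N + 3).Prime) {r s : ℚ} {A B : ℤ}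
    (hA : 2 * r + s = A) (hB : r * r + r * s + (N + 1) * (s * s) = B) :
    ∃ a b : ℤ, r = a ∧ s = b := by
  set d : ℤ := 4 * N + 3 with hd
  have hpd : Prime d := by
    have := Nat.prime_iff_prime_int.1 hp
    exact_mod_cast this
  have h1 : (d * s) * (d * s) = (d * (4 * B - A * A) : ℤ) := by
    push_cast
    rw [← hA, ← hB, hd]
    push_cast
    ring
  obtain ⟨m, hm⟩ : ∃ m : ℤ, (m : ℚ) = d * s := by
    have h2 : IsIntegral ℤ ((d : ℚ) * s) := IsIntegral.of_pow two_pos <| by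
      rw [pow_two, h1]
      exact isIntegral_algebraMap
    exact IsIntegrallyClosed.isIntegral_iff.1 h2
  rw [← hm] at h1
  have h2 : m * m = d * (4 * B - A * A) := by exact_mod_cast h1
  obtain ⟨b, rfl⟩ : d ∣ m := by
    rcases hpd.dvd_or_dvd ⟨_, h2⟩ with h | h <;> exact h
  have hs : s = b := by
    have : (d : ℚ) ≠ 0 := by exact_mod_cast hpd.ne_zero
    push_cast at hm
    exact (mul_left_cancel₀ this hm).symm
  have h3 : d * (b * b) = 4 * B - A * A := mul_left_cancel₀ hpd.ne_zero (by linarith)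
  obtain ⟨a, ha⟩ : (2 : ℤ) ∣ A - b := by
    have h4 : Even (A * A + d * (b * b)) := ⟨2 * B, by linarith⟩
    have h5 : ¬ Even d := by rw [hd, Int.not_even_iff_odd]; exact ⟨2 * N + 1, by ring⟩
    rw [← even_iff_two_dvd]
    simp only [Int.even_add, Int.even_mul, or_self, Int.even_sub, h5, false_or] at h4 ⊢
    exact h4
  refine ⟨a, b, ?_, hs⟩
  have h6 : (A : ℚ) - b = 2 * a := by exact_mod_cast ha
  linarith

/-- The quadratic ring is the ring of integers of the quadratic field. -/
theorem nonempty_ringEquiv {N : ℕ} (hp : (4 * N + 3).Prime) (K : Type) [Field K] [NumberField K]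
    [IsSplittingField ℚ K (X ^ 2 + C ((4 * N + 3 : ℕ) : ℚ))] : Nonempty (IQ N ≃+* 𝓞 K) := by
  obtain ⟨α, hα⟩ : ∃ α : K, α * α = -(4 * N + 3) := by
    obtain ⟨α, hα⟩ := (IsSplittingField.splits K (X ^ 2 + C ((4 * N + 3 : ℕ) : ℚ))).exists_eval_eq_zero
      (by rw [degree_map, degree_X_pow_add_C two_pos]; decide)
    refine ⟨α, ?_⟩
    simp at hα
    linear_combination hα
  set θ : K := (1 + α) / 2 with hθ
  have hθ2 : θ * θ = -(N + 1) + θ := by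
    rw [hθ]
    field_simp
    linear_combination hα
  let Φ : QuadraticAlgebra ℚ (-(N + 1)) 1 →ₐ[ℚ] K := QuadraticAlgebra.lift ⟨θ, by
    rw [hθ2, one_smul, Algebra.smul_def]
    simp⟩
  have hΦ : ∀ x, Φ x = x.re + x.im * θ := fun x => by
    change x.re • 1 + x.im • θ = _
    simp [Algebra.smul_def]
  have hinj : ∀ r s : ℚ, (r + s * θ : K) = 0 → r = 0 ∧ s = 0 := by
    intro r s h
    by_cases hs : s = 0
    · subst hs
      simpa using h
    · have h1 : ((2 * r + s) * (2 * r + s) + (4 * N + 3) * (s * s) : ℚ) = 0 := by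
        have h2 : (s * α : K) = -(2 * r + s) := by
          rw [hθ] at h
          field_simp at h
          linear_combination h
        have h3 : ((2 * r + s) * (2 * r + s) + (4 * N + 3) * (s * s) : K) = 0 := by
          linear_combination -(s * α - (2 * r + s) : K) * h2 + s * s * hα
        exact_mod_cast h3
      have := mul_self_pos.2 hs
      have := mul_self_nonneg (2 * r + s)
      have : (0 : ℚ) ≤ N := by positivity
      nlinarith
  have hΦi : Function.Injective Φ := (injective_iff_map_eq_zero Φ).2 fun x hx => by
    rw [hΦ] at hx
    exact QuadraticAlgebra.ext (hinj _ _ hx).1 (hinj _ _ hx).2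
  have hαΦ : α ∈ Φ.range := ⟨⟨-1, 2⟩, by
    change Φ _ = _
    rw [hΦ, hθ]
    push_cast
    ring⟩
  have hΦs : Function.Surjective Φ := by
    rw [← AlgHom.range_eq_top, eq_top_iff,
      ← IsSplittingField.adjoin_rootSet K (X ^ 2 + C ((4 * N + 3 : ℕ) : ℚ)), Algebra.adjoin_le_iff]
    intro β hβ
    rw [mem_rootSet'] at hβ
    have h1 : (β - α) * (β + α) = 0 := by
      have := hβ.2
      simp at this
      linear_combination this - hα
    rcases mul_eq_zero.1 h1 with h | h
    · rw [sub_eq_zero.1 h]; exact hαΦ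
    · rw [eq_neg_of_add_eq_zero_left h]; exact neg_mem hαΦ
  have hθi : IsIntegral ℤ θ := by
    refine ⟨X ^ 2 - X + C (N + 1 : ℤ), by monicity!, ?_⟩
    simp
    linear_combination hθ2
  obtain ⟨ω, hω⟩ : ∃ ω : 𝓞 K, (ω : K) = θ := ⟨⟨θ, hθi⟩, rfl⟩
  let Ψ : IQ N →ₐ[ℤ] 𝓞 K := QuadraticAlgebra.lift ⟨ω, RingOfIntegers.ext <| by
    simpa [hω] using hθ2⟩
  have hΨ : ∀ x, (Ψ x : K) = x.re + x.im * θ := fun x => by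
    change ((x.re • 1 + x.im • ω : 𝓞 K) : K) = _
    simp [hω]
  refine ⟨RingEquiv.ofBijective Ψ ⟨(injective_iff_map_eq_zero Ψ).2 fun x hx => ?_, fun x => ?_⟩⟩
  · have h1 := hΨ x
    rw [hx] at h1
    have h2 := hinj x.re x.im (by simpa using h1.symm)
    exact QuadraticAlgebra.ext (by exact_mod_cast h2.1) (by exact_mod_cast h2.2)
  · obtain ⟨y, hy⟩ := hΦs (x : K)
    have hyi : IsIntegral ℤ y := by
      refine (isIntegral_algHom_iff (Φ.restrictScalars ℤ) hΦi).1 ?_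
      change IsIntegral ℤ (Φ y)
      rw [hy]
      exact RingOfIntegers.isIntegral_coe x
    have hyi' : IsIntegral ℤ (star y) :=
      hyi.map ((starRingEnd (QuadraticAlgebra ℚ (-(N + 1)) 1) : _ →+* _).toIntAlgHom)
    have hC : ∀ q : ℚ, IsIntegral ℤ (algebraMap ℚ (QuadraticAlgebra ℚ (-(N + 1)) 1) q) →
        ∃ m : ℤ, q = m := fun q hq => by
      obtain ⟨m, hm⟩ := IsIntegrallyClosed.isIntegral_iff.1
        ((isIntegral_algebraMap_iff (algebraMap ℚ (QuadraticAlgebra ℚ (-(N + 1)) 1)).injective).1 hq)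
      exact ⟨m, hm.symm⟩
    obtain ⟨A, hA⟩ := hC (2 * y.re + y.im) (by
      convert hyi.add hyi' using 1
      ext <;> simp
      ring)
    obtain ⟨B, hB⟩ := hC (y.re * y.re + y.re * y.im + (N + 1) * (y.im * y.im)) (by
      convert hyi.mul hyi' using 1
      ext
      · change y.re * y.re + y.re * y.im + (N + 1) * (y.im * y.im) = _
        simp
        ring
      · change 0 = _
        simp
        ring)
    obtain ⟨a, b, ha, hb⟩ := exists_int_of_norm_trace hp hA hB
    refine ⟨⟨a, b⟩, RingOfIntegers.ext ?_⟩
    rw [hΨ, ← hy, hΦ, ha, hb]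
    simp

/-! ### Nonvanishing -/

open NumberField

variable {N : ℕ} {ι : IQ N →+* ℂ}

theorem exists_quadRing (N : ℕ) : ∃ ι : IQ N →+* ℂ, QuadRing ι ⟨0, 1⟩ N := by
  have hs : ((√(4 * N + 3) : ℝ) : ℂ) * (√(4 * N + 3) : ℝ) = 4 * N + 3 := by
    rw [← Complex.ofReal_mul, Real.mul_self_sqrt (by positivity)]
    push_cast
    rfl
  let Φ : IQ N →ₐ[ℤ] ℂ := QuadraticAlgebra.lift ⟨1 / 2 + (√(4 * N + 3) / 2 : ℝ) * Complex.I, by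
    simp
    linear_combination (hs * Complex.I ^ 2) / 4 + (N + 3 / 4) * Complex.I_sq⟩
  have hΦ : Φ ⟨0, 1⟩ = 1 / 2 + (√(4 * N + 3) / 2 : ℝ) * Complex.I := by
    change (0 : ℤ) • (1 : ℂ) + (1 : ℤ) • _ = _
    simp
  refine ⟨Φ, fun x => ⟨x.re, x.im, ?_⟩, ?_, ?_⟩
  · ext <;> simp
  · change (Φ ⟨0, 1⟩).re = _
    rw [hΦ]
    simp
  · change (Φ ⟨0, 1⟩).im = _
    rw [hΦ]
    simp

theorem Conf.exists_good (c : Conf N) (h : QuadRing ι ⟨0, 1⟩ N) (k : ℕ) :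
    ∃ (J : Type) (_ : Fintype J) (_ : DecidableEq J) (D : Datum (IQ N) J),
      Fintype.card J = 2 * (k + 1) ∧ D.N + 2 * (k + 1) = (2 * (k + 1)) ^ 2 ∧
      Good ι (detSign h c.one_le) D := by
  have := h.isDomain
  have : CharZero (IQ N) := ⟨fun a b hab => by simpa using congrArg QuadraticAlgebra.re hab⟩
  induction k with
  | zero => exact ⟨Fin 2, _, _, _, by simp, rfl, (c.base h).good⟩
  | succ k ih =>
    obtain ⟨J, _, _, D, hJ, hDN, hD⟩ := ih
    refine ⟨Fin 2 ⊕ J, inferInstance, inferInstance, D.step c.frame (Fintype.equivFin _),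
      ?_, ?_, (c.base h).good_step h hD ?_ ?_ _⟩
    · rw [Fintype.card_sum, hJ, Fintype.card_fin]
      ring
    · change Fintype.card ((Fin 2 × J) × Fin 2) + (2 + D.N) + 2 * (k + 1 + 1) = _
      rw [Fintype.card_prod, Fintype.card_prod, hJ, Fintype.card_fin]
      linarith
    · ext p
      change unitSign h c.one_le (Matrix.GeneralLinearGroup.det (toG p)) = unitSign h c.one_le _ *
        unitSign h c.one_le _
      rw [det_toG, map_mul]
      rfl
    · rw [Fintype.card_prod, Fintype.card_prod, hJ, Fintype.card_fin]
      omega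

theorem Conf.nontrivial (c : Conf N) (hp : (4 * N + 3).Prime) (K : Type) [Field K] [NumberField K]
    [IsSplittingField ℚ K (X ^ 2 + C ((4 * N + 3 : ℕ) : ℚ))] {n : ℕ} (hn : 2 ≤ n) (he : Even n) :
    Nontrivial (groupCohomology (Rep.trivial ℚ (Matrix.SpecialLinearGroup (Fin n) (𝓞 K)) ℚ)
      (n ^ 2 - n)) := by
  obtain ⟨r⟩ := nonempty_ringEquiv hp K
  obtain ⟨ι, h⟩ := exists_quadRing N
  have := h.isDomain
  have : CharZero (IQ N) := ⟨fun a b hab => by simpa using congrArg QuadraticAlgebra.re hab⟩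
  obtain ⟨k, rfl⟩ : ∃ k, n = 2 * (k + 1) := by
    obtain ⟨m, rfl⟩ := he
    exact ⟨m - 1, by omega⟩
  obtain ⟨J, _, _, D, hJ, hDN, S, hS, z, hz, hbz, hne⟩ := c.exists_good h k
  set χ : Matrix.GeneralLinearGroup J (IQ N) →* ℝ := detSign h c.one_le with hχ
  set f := sm (MonoidHom.id _) χ fun l => tau D.N (l.map (D.pos ι S)) with hf
  have hlf := D.lf_pos h.disc hS
  have hcod : cod f = 0 := by
    rw [hf, cod_sm χ hlf, cod_comp_map, cod_tau]
    funext l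
    simp [sm]
  let e : Fin (2 * (k + 1)) ≃ J := (finCongr hJ.symm).trans (Fintype.equivFin J).symm
  let Θ : Matrix.SpecialLinearGroup (Fin (2 * (k + 1))) (𝓞 K) →* Matrix.GeneralLinearGroup J (IQ N) :=
    (Units.map (Matrix.reindexAlgEquiv (IQ N) (IQ N) e).toMulEquiv.toMonoidHom).comp
      (Matrix.SpecialLinearGroup.toGL.comp (Matrix.SpecialLinearGroup.map r.symm.toRingHom))
  have hΘ : ∀ A, (Θ A).val = (A.val.map r.symm).submatrix e.symm e.symm := fun A => rfl
  have hΘi : Function.Injective Θ := fun A B hAB => by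
    ext i j
    have h1 := congrArg Units.val hAB
    rw [hΘ, hΘ] at h1
    simpa using congrFun (congrFun h1 (e i)) (e j)
  have hΘr : Θ.range = χ.ker := by
    ext g
    obtain ⟨ε, h1, h2, h3⟩ := detSign_spec h c.one_le g
    rw [MonoidHom.mem_ker, hχ, h2]
    constructor
    · rintro ⟨A, rfl⟩
      rw [hΘ, Matrix.det_submatrix_equiv_self, ← RingEquiv.coe_toRingHom, ← RingHom.mapMatrix_apply,
        ← RingHom.map_det, A.2, map_one] at h1
      exact_mod_cast h1.symm
    · intro h4
      have hdet : ((g.val.map r).submatrix e e).det = 1 := by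
        rw [Matrix.det_submatrix_equiv_self, ← RingEquiv.coe_toRingHom, ← RingHom.mapMatrix_apply,
          ← RingHom.map_det, h1, (by exact_mod_cast h4 : ε = 1)]
        simp
      refine ⟨⟨_, hdet⟩, Units.ext ((hΘ _).trans ?_)⟩
      refine Matrix.ext fun i j => ?_
      change r.symm (r (g.val (e (e.symm i)) (e (e.symm j)))) = _
      simp
  rw [← hΘr] at hbz
  have hinv : ∀ g ∈ Θ.range, ∀ l, f (l.map (g * ·)) = f l := fun g hg l => by
    have h1 := sm_translate (σ := MonoidHom.id _) χ (fun l => tau D.N (l.map (D.pos ι S))) g l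
    rw [hΘr] at hg
    rw [χ.mem_ker.1 (inv_mem hg), one_mul] at h1
    exact h1
  obtain ⟨x, hx, hbx, hev⟩ := exists_chain_in_subgroup hcod hinv hz hbz
  let ψ := MonoidHom.ofInjective hΘi
  have hev' : ev (fun l => f (l.map Θ)) (mp ψ.symm x) = ev f z := by
    rw [ev_mp, ← hev]
    refine ev_congr fun l _ => ?_
    rw [List.map_map]
    congr 2
    funext g
    exact congrArg Subtype.val (ψ.apply_symm_apply g)
  obtain ⟨M, hM⟩ : ∃ M, D.N = M + 1 := Nat.exists_eq_succ_of_ne_zero fun h0 => by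
    rw [h0] at hDN
    nlinarith
  rw [show (2 * (k + 1)) ^ 2 - 2 * (k + 1) = M + 1 by omega]
  refine nontrivial_groupCohomology (f := fun l => f (l.map Θ)) (x := mp ψ.symm x) ?_ ?_
    (mp_mem_chn _ (by rwa [hM] at hx)) ?_ (hev' ▸ hne)
  · rw [cod_comp_map, hcod]
    rfl
  · intro g l
    simpa [Function.comp_def] using hinv (Θ g) ⟨g, rfl⟩ (l.map Θ)
  · rw [bd_mp]
    exact mp_mem_coin ψ.symm.toMonoidHom (H' := ⊤) (fun _ _ => trivial) hbx

end IQ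
end ListCx

/-- **Miller–Patzt–Wilson–Yasaki.** Let `d ∈ {43, 67, 163}` and let `K = ℚ(√−d)` be the
imaginary quadratic field obtained by adjoining to `ℚ` a root of `X² + d`. Then for every
even `n ≥ 2`, the rational group cohomology of `SL_n(𝓞_K)` in its virtual cohomological
dimension `n² − n` is nonzero. -/
theorem sln_nonEuclidean_pid_top_cohomology_nonzero
    (d : ℕ) (hd : d = 43 ∨ d = 67 ∨ d = 163)
    (K : Type) [Field K] [NumberField K]
    [IsSplittingField ℚ K (X ^ 2 + C (d : ℚ))]
    (n : ℕ) (hn : 2 ≤ n) (heven : Even n) :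
    Nontrivial
      (groupCohomology
        (Rep.trivial ℚ (Matrix.SpecialLinearGroup (Fin n) (NumberField.RingOfIntegers K)) ℚ)
        (n ^ 2 - n)) := by
  rcases hd with rfl | rfl | rfl
  · exact ListCx.IQ.conf43.nontrivial (by norm_num) K hn heven
  · exact ListCx.IQ.conf67.nontrivial (by norm_num) K hn heven
  · exact ListCx.IQ.conf163.nontrivial (by norm_num) K hn heven
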